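/- Let n ≥ 1 and let K : ℝ^{n+1} → ℝ be an odd Calderón–Zygmund kernel of homogeneity −n: K(x) = Ω(x)/|x|^n with Ω homogeneous of degree 0, K of class C² on ℝ^{n+1}∖{0} and |∇^j K(x)| ≤ C/|x|^{n+j} for j = 0,1,2 and x ≠ 0. Let E ⊂ ℝ^{n+1} be an n-rectifiable set with locally finite n-dimensional Hausdorff measure, let ν be a finite signed Radon measure on ℝ^{n+1}, fix a ∈ (0,1) and b ∈ (0,a), and let x ↦ N_x be an H^n-measurable choice of unit normals to the approximate tangent n-planes of E (defined H^n-a.e. on E). Then for H^n-a.e. x ∈ E the nontangential limits T^+ν(x) = lim_{X_a(x,N_x) ∋ y → x} T_{b|x−y|}ν(y) and T^-ν(x) = lim_{X_a(x,−N_x) ∋ y → x} T_{b|x−y|}ν(y) exist, the principal value pv Tν(x) exists, and ½(T^+ν(x) + T^-ν(x)) = pv Tν(x). -/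

import Mathlib

open MeasureTheory Metric Filter Set
open scoped ENNReal NNReal Topology RealInnerProductSpace

noncomputable section

/-- Integral of a real function with respect to a (finite) signed measure,
defined via the Jordan decomposition. -/
def sintegral {α : Type*} [MeasurableSpace α]
    (ν : MeasureTheory.SignedMeasure α) (f : α → ℝ) : ℝ :=
  ∫ x, f x ∂ν.toJordanDecomposition.posPart - ∫ x, f x ∂ν.toJordanDecomposition.negPart

/-- The one-sided open cone `X_a(x,u)` with vertex `x`, axis `u` and aperture `a`. -/
def cone {n : ℕ} (a : ℝ) (x u : EuclideanSpace ℝ (Fin (n + 1))) :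
    Set (EuclideanSpace ℝ (Fin (n + 1))) :=
  {y | a * ‖y - x‖ < ⟪y - x, u⟫}

/-- The truncated singular integral `T_ε ν (y) = ∫_{|y-z|>ε} K(y-z) dν(z)`. -/
def Teps {n : ℕ} (K : EuclideanSpace ℝ (Fin (n + 1)) → ℝ)
    (ν : MeasureTheory.SignedMeasure (EuclideanSpace ℝ (Fin (n + 1)))) (ε : ℝ)
    (y : EuclideanSpace ℝ (Fin (n + 1))) : ℝ :=
  sintegral ν (fun z => if ε < dist y z then K (y - z) else 0)

/-- `E ⊆ ℝ^{n+1}` is `n`-rectifiable: up to an `H^n`-null set it is covered by countably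
many Lipschitz images of `ℝ^n`. -/
def Rectifiable (n : ℕ) (E : Set (EuclideanSpace ℝ (Fin (n + 1)))) : Prop :=
  ∃ f : ℕ → EuclideanSpace ℝ (Fin n) → EuclideanSpace ℝ (Fin (n + 1)),
    (∀ k, ∃ L : NNReal, LipschitzWith L (f k)) ∧
    μH[n] (E \ ⋃ k, Set.range (f k)) = 0

/-- `E` has an approximate tangent `n`-plane at `x` with unit normal `u`. -/
def HasApproxTangentNormal (n : ℕ) (E : Set (EuclideanSpace ℝ (Fin (n + 1))))
    (x u : EuclideanSpace ℝ (Fin (n + 1))) : Prop :=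
  ‖u‖ = 1 ∧ ∀ a ∈ Set.Ioo (0 : ℝ) 1,
    Tendsto (fun r : ℝ =>
        μH[n] (E ∩ (cone a x u ∪ cone a x (-u)) ∩ ball x r) / ENNReal.ofReal (r ^ n))
      (𝓝[>] 0) (𝓝 0)


set_option linter.unusedSectionVars false

section
/-! ## P1a : dyadic windows, averages, the discrete half-derivative form -/
def Wn (n : ℕ) : Finset ℤ := Finset.Ico (-(2:ℤ)^n) (2^n)

lemma mem_Wn {n : ℕ} {p : ℤ} : p ∈ Wn n ↔ -(2:ℤ)^n ≤ p ∧ p < 2^n := by simp [Wn]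

lemma sum_Wn_succ {M : Type*} [AddCommMonoid M] (n : ℕ) (F : ℤ → M) :
    ∑ p ∈ Wn (n+1), F p = ∑ q ∈ Wn n, (F (2*q) + F (2*q+1)) := by
  have h : ∀ q : ℤ, F (2*q) + F (2*q+1) = ∑ e : Fin 2, F (2*q + (e:ℕ)) := by
    intro q; simp [Fin.sum_univ_two]
  simp_rw [h]
  rw [← Finset.sum_product']
  symm
  refine Finset.sum_nbij' (fun x : ℤ × Fin 2 => 2*x.1 + ((x.2:ℕ):ℤ))
    (fun p : ℤ => (p / 2, ⟨(p % 2).toNat, by omega⟩)) ?_ ?_ ?_ ?_ ?_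
  · rintro ⟨q, e⟩ hq
    simp only [Finset.mem_product, mem_Wn, Finset.mem_univ, and_true] at hq ⊢
    have := e.2
    rw [pow_succ]
    constructor <;> omega
  · intro p hp
    simp only [Finset.mem_product, mem_Wn, Finset.mem_univ, and_true] at hp ⊢
    rw [pow_succ] at hp
    constructor <;> omega
  · rintro ⟨q, e⟩ hq
    have := e.2
    ext
    · simp; omega
    · simp; omega
  · intro p hp
    simp; omega
  · rintro ⟨q, e⟩ hq
    rfl

lemma sum_inv_sq_le (F : Finset ℤ) (P : ℤ) : ∑ Q ∈ F, 1 / ((P - Q : ℤ):ℝ)^2 ≤ 4 := by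
  have key : ∀ G : Finset ℤ, (∀ Q ∈ G, (0:ℤ) < Q) → ∑ Q ∈ G, 1 / ((Q : ℤ):ℝ)^2 ≤ 2 := by
    intro G hG
    obtain ⟨n, hn⟩ : ∃ n : ℕ, ∀ Q ∈ G, Q < n := by
      refine ⟨(∑ Q ∈ G, Q.toNat) + 1, fun Q hQ => ?_⟩
      have := Finset.single_le_sum (f := fun Q : ℤ => Q.toNat) (fun _ _ => Nat.zero_le _) hQ
      omega
    calc ∑ Q ∈ G, 1 / ((Q : ℤ):ℝ)^2 = ∑ i ∈ G.image Int.toNat, ((i:ℝ)^2)⁻¹ := by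
          rw [Finset.sum_image]
          · refine Finset.sum_congr rfl fun Q hQ => ?_
            have : ((Q.toNat : ℕ) : ℝ) = (Q:ℝ) := by
              exact_mod_cast Int.toNat_of_nonneg (hG Q hQ).le
            rw [this, one_div]
          · intro a ha b hb h
            have := hG a ha; have := hG b hb
            omega
      _ ≤ ∑ i ∈ Finset.Ioo 0 n, ((i:ℝ)^2)⁻¹ := by
          refine Finset.sum_le_sum_of_subset_of_nonneg ?_ fun _ _ _ => by positivity
          intro i hi
          obtain ⟨Q, hQ, rfl⟩ := Finset.mem_image.1 hi
          have := hG Q hQ; have := hn Q hQ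
          simp; omega
      _ ≤ 2 := by simpa using sum_Ioo_inv_sq_le (α := ℝ) 0 n
  have h1 : ∑ Q ∈ F, 1 / ((P - Q : ℤ):ℝ)^2
      = ∑ Q ∈ F.filter (fun Q => Q < P), 1 / ((P - Q : ℤ):ℝ)^2
        + ∑ Q ∈ (F.filter (fun Q => ¬ Q < P)).filter (fun Q => P < Q), 1 / ((P - Q : ℤ):ℝ)^2 := by
    rw [← Finset.sum_filter_add_sum_filter_not F (fun Q => Q < P)]
    congr 1
    rw [← Finset.sum_filter_add_sum_filter_not (F.filter (fun Q => ¬ Q < P)) (fun Q => P < Q)]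
    rw [add_eq_left]
    refine Finset.sum_eq_zero fun Q hQ => ?_
    simp only [Finset.mem_filter] at hQ
    have : P - Q = 0 := by omega
    rw [this]; simp
  rw [h1]
  have e1 := key ((F.filter (fun Q => Q < P)).image (fun Q => P - Q)) (by
    intro Q hQ; simp only [Finset.mem_image, Finset.mem_filter] at hQ
    obtain ⟨a, ⟨_, h⟩, rfl⟩ := hQ; omega)
  rw [Finset.sum_image (by intro a _ b _ h; simp only at h; omega)] at e1
  have e2 := key (((F.filter (fun Q => ¬ Q < P)).filter (fun Q => P < Q)).image (fun Q => Q - P)) (by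
    intro Q hQ; simp only [Finset.mem_image, Finset.mem_filter] at hQ
    obtain ⟨a, ⟨_, h⟩, rfl⟩ := hQ; omega)
  rw [Finset.sum_image (by intro a _ b _ h; simp only at h; omega)] at e2
  have e3 : ∀ Q : ℤ, (((Q - P : ℤ):ℝ))^2 = ((P - Q : ℤ):ℝ)^2 := by intro Q; push_cast; ring
  simp_rw [e3] at e2
  linarith

section vec
variable {V : Type*} [NormedAddCommGroup V] [InnerProductSpace ℝ V]

def avg (u : ℤ → V) (q : ℤ) : V := (1/2:ℝ) • (u (2*q) + u (2*q+1))
def hr (u : ℤ → V) (q : ℤ) : V := (1/2:ℝ) • (u (2*q) - u (2*q+1))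

lemma avg_add_hr (u : ℤ → V) (q : ℤ) : avg u q + hr u q = u (2*q) := by
  simp only [avg, hr]; module
lemma avg_sub_hr (u : ℤ → V) (q : ℤ) : avg u q - hr u q = u (2*q+1) := by
  simp only [avg, hr]; module

lemma norm_avg_hr (u : ℤ → V) (q : ℤ) :
    ‖u (2*q)‖^2 + ‖u (2*q+1)‖^2 = 2 * (‖avg u q‖^2 + ‖hr u q‖^2) := by
  rw [← avg_add_hr u q, ← avg_sub_hr u q]; exact parallelogram_law_with_norm ℝ _ _

def En (n : ℕ) (u : ℤ → V) : ℝ := ∑ p ∈ Wn n, ‖u p‖^2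
def Nf (n : ℕ) (u : ℤ → V) : ℝ := ∑ p ∈ Wn n, ∑ q ∈ Wn n, ‖u p - u q‖^2 / ((p - q : ℤ):ℝ)^2

lemma En_nonneg (n : ℕ) (u : ℤ → V) : 0 ≤ En n u := Finset.sum_nonneg fun _ _ => by positivity
lemma Nf_nonneg (n : ℕ) (u : ℤ → V) : 0 ≤ Nf n u :=
  Finset.sum_nonneg fun _ _ => Finset.sum_nonneg fun _ _ => by positivity

lemma En_succ (n : ℕ) (u : ℤ → V) : En (n+1) u = 2 * (En n (avg u) + En n (hr u)) := by
  simp only [En, sum_Wn_succ, norm_avg_hr, ← Finset.mul_sum, Finset.sum_add_distrib]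

lemma nsq_split (a x y : V) : ‖a + (x + y)‖^2 ≤ 15/14 * ‖a‖^2 + 30 * ‖x‖^2 + 30 * ‖y‖^2 := by
  have h1 : ‖a + (x+y)‖ ≤ ‖a‖ + (‖x‖ + ‖y‖) := (norm_add_le _ _).trans (by gcongr; exact norm_add_le _ _)
  have h0 := norm_nonneg (a + (x+y))
  have h2 : ‖a + (x+y)‖^2 ≤ (‖a‖ + (‖x‖ + ‖y‖))^2 := by gcongr
  nlinarith [sq_nonneg (‖a‖ - 14 * (‖x‖+‖y‖)), sq_nonneg (‖x‖ - ‖y‖)]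

lemma Nf_point (u : ℤ → V) (P Q : ℤ) :
    ‖u (2*P) - u (2*Q)‖^2 / ((2*P - 2*Q : ℤ):ℝ)^2 + ‖u (2*P) - u (2*Q+1)‖^2 / ((2*P - (2*Q+1) : ℤ):ℝ)^2
    + (‖u (2*P+1) - u (2*Q)‖^2 / ((2*P+1 - 2*Q : ℤ):ℝ)^2
      + ‖u (2*P+1) - u (2*Q+1)‖^2 / ((2*P+1 - (2*Q+1) : ℤ):ℝ)^2)
    ≤ 15/8 * (‖avg u P - avg u Q‖^2 / ((P-Q:ℤ):ℝ)^2)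
      + 105/2 * (‖hr u P‖^2 * (1/((P-Q:ℤ):ℝ)^2)) + 105/2 * (‖hr u Q‖^2 * (1/((P-Q:ℤ):ℝ)^2))
      + if P = Q then 8 * ‖hr u P‖^2 else 0 := by
  simp only [← avg_add_hr, ← avg_sub_hr]
  set x := hr u P; set y := hr u Q
  by_cases h : P = Q
  · subst h
    have e1 : ‖avg u P + x - (avg u P - x)‖^2 = 4 * ‖x‖^2 := by
      have : avg u P + x - (avg u P - x) = (2:ℝ) • x := by module
      rw [this, norm_smul]; norm_num; ring
    have e2 : ‖avg u P - x - (avg u P + x)‖^2 = 4 * ‖x‖^2 := by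
      have : avg u P - x - (avg u P + x) = (-2:ℝ) • x := by module
      rw [this, norm_smul]; norm_num; ring
    rw [e1, e2]
    simp; linarith
  · rw [if_neg h]
    set j : ℝ := ((P - Q : ℤ):ℝ) with hj
    have hj1 : 1 ≤ j^2 := by
      have : (1:ℤ) ≤ (P-Q)^2 := by
        have : P - Q ≠ 0 := sub_ne_zero.2 h
        have := sq_pos_of_ne_zero this
        omega
      rw [hj]; exact_mod_cast this
    have c1 : ((2*P - 2*Q : ℤ):ℝ) = 2*j := by rw [hj]; push_cast; ring
    have c2 : ((2*P - (2*Q+1) : ℤ):ℝ) = 2*j-1 := by rw [hj]; push_cast; ring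
    have c3 : ((2*P+1 - 2*Q : ℤ):ℝ) = 2*j+1 := by rw [hj]; push_cast; ring
    have c4 : ((2*P+1 - (2*Q+1) : ℤ):ℝ) = 2*j := by rw [hj]; push_cast; ring
    rw [c1, c2, c3, c4]
    set A := avg u P - avg u Q
    set B := 15/14 * ‖A‖^2 + 30 * ‖x‖^2 + 30 * ‖y‖^2 with hB
    have n1 : ‖avg u P + x - (avg u Q + y)‖^2 ≤ B := by
      have := nsq_split A x (-y); rw [norm_neg] at this
      convert this using 3; simp only [A]; abel
    have n2 : ‖avg u P + x - (avg u Q - y)‖^2 ≤ B := by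
      have := nsq_split A x y
      convert this using 3; simp only [A]; abel
    have n3 : ‖avg u P - x - (avg u Q + y)‖^2 ≤ B := by
      have := nsq_split A (-x) (-y); rw [norm_neg, norm_neg] at this
      convert this using 3; simp only [A]; abel
    have n4 : ‖avg u P - x - (avg u Q - y)‖^2 ≤ B := by
      have := nsq_split A (-x) y; rw [norm_neg] at this
      convert this using 3; simp only [A]; abel
    have hB0 : 0 ≤ B := by positivity
    have hm : (2*j-1)^2 * (2*j+1)^2 ≥ 9 * j^4 := by nlinarith [sq_nonneg (j^2-1)]
    have hm1 : 0 < (2*j-1)^2 := by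
      rcases (sq_nonneg (2*j-1)).lt_or_eq with h | h
      · exact h
      · rw [← h] at hm; nlinarith
    have hm2 : 0 < (2*j+1)^2 := by
      rcases (sq_nonneg (2*j+1)).lt_or_eq with h | h
      · exact h
      · rw [← h] at hm; nlinarith
    have hc : 1/(2*j)^2 + 1/(2*j-1)^2 + (1/(2*j+1)^2 + 1/(2*j)^2) ≤ 7/4 * (1/j^2) := by
      have e : 1/(2*j-1)^2 + 1/(2*j+1)^2 = (8*j^2+2)/((2*j-1)^2*(2*j+1)^2) := by
        have := hm1.ne'; have := hm2.ne'
        have a1 : (2*j-1) ≠ 0 := by rintro h; rw [h] at hm1; simp at hm1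
        have a2 : (2*j+1) ≠ 0 := by rintro h; rw [h] at hm2; simp at hm2
        field_simp; ring
      have e' : (8*j^2+2)/((2*j-1)^2*(2*j+1)^2) ≤ (10*j^2)/(9*j^4) := by
        gcongr
        linarith
      have e2 : (10*j^2)/(9*j^4) = 10/9 * (1/j^2) := by
        have : j ≠ 0 := by rintro h; rw [h] at hj1; norm_num at hj1
        field_simp
      have e3 : 1/(2*j)^2 = 1/4 * (1/j^2) := by
        have : j ≠ 0 := by rintro h; rw [h] at hj1; norm_num at hj1
        field_simp; norm_num
      have : 0 ≤ 1/j^2 := by positivity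
      linarith
    calc _ ≤ B / (2*j)^2 + B/(2*j-1)^2 + (B/(2*j+1)^2 + B/(2*j)^2) := by gcongr
      _ = B * (1/(2*j)^2 + 1/(2*j-1)^2 + (1/(2*j+1)^2 + 1/(2*j)^2)) := by ring
      _ ≤ B * (7/4 * (1/j^2)) := by gcongr
      _ = _ := by rw [hB]; ring

lemma Nf_succ (n : ℕ) (u : ℤ → V) : Nf (n+1) u ≤ 428 * En n (hr u) + 15/16 * (2 * Nf n (avg u)) := by
  have h1 : Nf (n+1) u ≤ ∑ P ∈ Wn n, ∑ Q ∈ Wn n,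
     (15/8 * (‖avg u P - avg u Q‖^2 / ((P-Q:ℤ):ℝ)^2)
      + 105/2 * (‖hr u P‖^2 * (1/((P-Q:ℤ):ℝ)^2)) + 105/2 * (‖hr u Q‖^2 * (1/((P-Q:ℤ):ℝ)^2))
      + if P = Q then 8 * ‖hr u P‖^2 else 0) := by
    rw [Nf, sum_Wn_succ]
    refine Finset.sum_le_sum fun P _ => ?_
    rw [sum_Wn_succ, sum_Wn_succ, ← Finset.sum_add_distrib]
    exact Finset.sum_le_sum fun Q _ => Nf_point u P Q
  refine h1.trans ?_
  simp only [Finset.sum_add_distrib, ← Finset.mul_sum]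
  have h2 : ∑ P ∈ Wn n, ‖hr u P‖^2 * ∑ Q ∈ Wn n, (1/((P-Q:ℤ):ℝ)^2) ≤ 4 * En n (hr u) := by
    rw [En, Finset.mul_sum]
    refine Finset.sum_le_sum fun P _ => ?_
    rw [mul_comm]; gcongr; exact sum_inv_sq_le _ _
  have h3 : ∑ P ∈ Wn n, ∑ Q ∈ Wn n, ‖hr u Q‖^2 * (1/((P-Q:ℤ):ℝ)^2) ≤ 4 * En n (hr u) := by
    rw [Finset.sum_comm]
    simp only [← Finset.mul_sum]
    rw [En, Finset.mul_sum]
    refine Finset.sum_le_sum fun P _ => ?_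
    rw [mul_comm]; gcongr
    have := sum_inv_sq_le (Wn n) P
    refine le_trans (Finset.sum_le_sum fun Q _ => le_of_eq ?_) this
    push_cast; ring
  have h4 : ∑ P ∈ Wn n, ∑ Q ∈ Wn n, (if P = Q then 8 * ‖hr u P‖^2 else 0) ≤ 8 * En n (hr u) := by
    rw [En, Finset.mul_sum]
    refine Finset.sum_le_sum fun P hP => ?_
    simp [hP]
  have h5 : ∑ P ∈ Wn n, ∑ Q ∈ Wn n, ‖avg u P - avg u Q‖^2 / ((P-Q:ℤ):ℝ)^2 = Nf n (avg u) := rfl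
  rw [h5]
  linarith

lemma Nf_le (n : ℕ) (u : ℤ → V) : Nf n u ≤ 16 * En n u := by
  have h : Nf n u ≤ ∑ P ∈ Wn n, ∑ Q ∈ Wn n,
      (2 * (‖u P‖^2 * (1/((P-Q:ℤ):ℝ)^2)) + 2 * (‖u Q‖^2 * (1/((Q-P:ℤ):ℝ)^2))) := by
    refine Finset.sum_le_sum fun P _ => Finset.sum_le_sum fun Q _ => ?_
    have e : (((Q - P : ℤ):ℝ))^2 = ((P - Q : ℤ):ℝ)^2 := by push_cast; ring
    have : ‖u P - u Q‖^2 ≤ 2 * ‖u P‖^2 + 2 * ‖u Q‖^2 := by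
      have := parallelogram_law_with_norm ℝ (u P) (u Q)
      nlinarith [sq_nonneg ‖u P + u Q‖]
    rw [e]
    calc _ ≤ (2 * ‖u P‖^2 + 2 * ‖u Q‖^2) / ((P - Q : ℤ):ℝ)^2 := by gcongr
      _ = _ := by ring
  refine h.trans ?_
  simp only [Finset.sum_add_distrib, ← Finset.mul_sum]
  have h2 : ∑ P ∈ Wn n, ‖u P‖^2 * ∑ Q ∈ Wn n, (1/((P-Q:ℤ):ℝ)^2) ≤ 4 * En n u := by
    rw [En, Finset.mul_sum]
    refine Finset.sum_le_sum fun P _ => ?_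
    rw [mul_comm]; gcongr; exact sum_inv_sq_le _ _
  have h3 : ∑ P ∈ Wn n, ∑ Q ∈ Wn n, ‖u Q‖^2 * (1/((Q-P:ℤ):ℝ)^2) ≤ 4 * En n u := by
    rw [Finset.sum_comm]; simpa only [← Finset.mul_sum] using h2
  linarith

/-- averages at level `k` -/
def lev (u : ℤ → V) : ℕ → ℤ → V
  | 0 => u
  | k+1 => avg (lev u k)

lemma lev_avg (u : ℤ → V) (k : ℕ) : lev (avg u) k = lev u (k+1) := by
  induction k with
  | zero => rfl
  | succ k ih => rw [lev, ih]; rfl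

/-- total square function bound. -/
lemma square_fn (m : ℕ) : ∀ u : ℤ → V,
    ∑ k ∈ Finset.range m, (2:ℝ)^k * Nf (m-k) (lev u k) + 15 * Nf m u ≤ 4000 * En m u := by
  induction m with
  | zero => intro u; have := Nf_le 0 u; have := En_nonneg 0 u; simp; linarith
  | succ m ih =>
    intro u
    have := ih (avg u)
    rw [Finset.sum_range_succ']
    have e : ∑ k ∈ Finset.range m, (2:ℝ)^(k+1) * Nf (m+1-(k+1)) (lev u (k+1))
        = 2 * ∑ k ∈ Finset.range m, (2:ℝ)^k * Nf (m-k) (lev (avg u) k) := by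
      rw [Finset.mul_sum]
      refine Finset.sum_congr rfl fun k _ => ?_
      rw [lev_avg, Nat.add_sub_add_right, pow_succ]; ring
    have h1 := Nf_succ m u
    rw [e, En_succ]
    simp only [pow_zero, one_mul, Nat.sub_zero]
    have e3 : Nf (m+1) (lev u 0) = Nf (m+1) u := rfl
    have := En_nonneg m (hr u)
    rw [e3]
    linarith

lemma haar_total (m : ℕ) : ∀ u : ℤ → V,
    ∑ k ∈ Finset.range m, (2:ℝ)^(k+1) * En (m-(k+1)) (hr (lev u k)) ≤ En m u := by
  induction m with
  | zero => intro u; simpa using En_nonneg 0 u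
  | succ m ih =>
    intro u
    rw [Finset.sum_range_succ']
    have e : ∑ k ∈ Finset.range m, (2:ℝ)^(k+1+1) * En (m+1-(k+1+1)) (hr (lev u (k+1)))
        = 2 * ∑ k ∈ Finset.range m, (2:ℝ)^(k+1) * En (m-(k+1)) (hr (lev (avg u) k)) := by
      rw [Finset.mul_sum]
      refine Finset.sum_congr rfl fun k _ => ?_
      rw [lev_avg, Nat.add_sub_add_right, pow_succ _ (k+1)]; ring
    rw [e, En_succ]
    have := ih (avg u)
    have e2 : En m (hr (lev u 0)) = En m (hr u) := rfl
    simp only [zero_add, pow_one, Nat.add_sub_cancel]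
    rw [e2]; linarith

lemma En_lev_le (m k : ℕ) : ∀ u : ℤ → V, k ≤ m → (2:ℝ)^k * En (m-k) (lev u k) ≤ En m u := by
  induction k with
  | zero => intro u _; simp [lev]
  | succ k ih =>
    intro u hk
    refine le_trans ?_ (ih u (by omega))
    have : m - k = (m-(k+1))+1 := by omega
    rw [this, En_succ, pow_succ]
    have e : lev u (k+1) = avg (lev u k) := rfl
    rw [e]
    have := En_nonneg (m-(k+1)) (hr (lev u k))
    have : (0:ℝ) < 2^k := by positivity
    nlinarith
end vec
end

section
/-! ## P1b : Carleson embedding (Bellman) -/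
def AccC (a : ℕ → ℤ → ℝ) : ℕ → ℤ → ℝ
  | 0 => fun _ => 0
  | j+1 => fun q => 1/2 * (AccC a j (2*q) + AccC a j (2*q+1)) + a j q

lemma AccC_nonneg {a : ℕ → ℤ → ℝ} (ha : ∀ j q, 0 ≤ a j q) (j : ℕ) : ∀ q, 0 ≤ AccC a j q := by
  induction j with
  | zero => intro q; simp [AccC]
  | succ j ih => intro q; simp only [AccC]; have := ih (2*q); have := ih (2*q+1); have := ha j q; linarith

lemma sum_Acc (a : ℕ → ℤ → ℝ) (m j : ℕ) (hj : j ≤ m) :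
    ∑ q ∈ Wn (m-j), 2^j * AccC a j q = ∑ i ∈ Finset.range j, ∑ q ∈ Wn (m-(i+1)), 2^(i+1) * a i q := by
  induction j with
  | zero => simp [AccC]
  | succ j ih =>
    rw [Finset.sum_range_succ, ← ih (by omega)]
    have : m - j = (m-(j+1))+1 := by omega
    rw [this, sum_Wn_succ, ← Finset.sum_add_distrib]
    refine Finset.sum_congr rfl fun q _ => ?_
    simp only [AccC]; ring

lemma sum_lev (f : ℤ → ℝ) (m j : ℕ) (hj : j ≤ m) :
    ∑ q ∈ Wn (m-j), 2^j * lev f j q = ∑ q ∈ Wn m, f q := by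
  induction j with
  | zero => simp [lev]
  | succ j ih =>
    rw [← ih (by omega)]
    have : m - j = (m-(j+1))+1 := by omega
    rw [this, sum_Wn_succ]
    refine Finset.sum_congr rfl fun q _ => ?_
    simp only [lev, avg, smul_eq_mul]; ring

lemma bellman_step {u v M N a : ℝ} (hM : 1 ≤ M) (hN : 1 ≤ N) (ha : 0 ≤ a)
    (h2 : 1/2*(M+N) + a ≤ 2) :
    -4 * (1/2*(u^2/M + v^2/N)) + a * (1/2*(u+v))^2 ≤ -4 * ((1/2*(u+v))^2 / (1/2*(M+N)+a)) := by
  have h1 : (u+v)^2/(M+N) ≤ u^2/M + v^2/N := by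
    rw [div_add_div _ _ (by positivity) (by positivity), div_le_div_iff₀ (by positivity) (by positivity)]
    nlinarith [sq_nonneg (u*N - v*M)]
  set w := (1/2*(u+v))^2 with hw
  have hw0 : 0 ≤ w := by positivity
  set P := 1/2*(M+N) with hP
  have hP1 : 1 ≤ P := by rw [hP]; linarith
  have e : 1/2*((u+v)^2/(M+N)) = w / P := by
    rw [hw, hP]; field_simp
  have h3 : w * a + 4 * w/(P+a) ≤ 4 * w / P := by
    have : 4*w/P - 4*w/(P+a) = w * (4*a/(P*(P+a))) := by
      have : P + a ≠ 0 := by positivity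
      field_simp; ring
    have h4 : a ≤ 4*a/(P*(P+a)) := by
      rw [le_div_iff₀ (by positivity)]
      have : P*(P+a) ≤ 4 := by nlinarith
      nlinarith
    nlinarith
  have e2 : 4 * w/(P+a) = 4 * (w/(P+a)) := by ring
  have e3 : 4 * w/P = 4 * (w/P) := by ring
  nlinarith

lemma bellman {a : ℕ → ℤ → ℝ} (ha : ∀ j q, 0 ≤ a j q) {A : ℝ} (hA : 0 < A)
    (hAcc : ∀ j q, AccC a j q ≤ A) (f : ℤ → ℝ) (j : ℕ) : ∀ q,
    AccC (fun j q => a j q * (lev f (j+1) q)^2) j q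
      ≤ 4 * A * (lev (fun s => f s^2) j q - (lev f j q)^2/(1 + AccC a j q / A)) := by
  induction j with
  | zero => intro q; simp [AccC, lev]
  | succ j ih =>
    intro q
    have b := bellman_step (u := lev f j (2*q)) (v := lev f j (2*q+1)) (M := 1 + AccC a j (2*q)/A)
      (N := 1 + AccC a j (2*q+1)/A) (a := a j q / A)
      (by have := div_nonneg (AccC_nonneg ha j (2*q)) hA.le; linarith)
      (by have := div_nonneg (AccC_nonneg ha j (2*q+1)) hA.le; linarith)
      (div_nonneg (ha j q) hA.le) (by
        have := hAcc (j+1) q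
        simp only [AccC] at this
        have h : (1/2 * (AccC a j (2*q) + AccC a j (2*q+1)) + a j q)/A ≤ 1 := by rwa [div_le_one hA]
        have : (1/2 * (AccC a j (2*q) + AccC a j (2*q+1)) + a j q)/A
          = 1/2 * (AccC a j (2*q)/A + AccC a j (2*q+1)/A) + a j q/A := by ring
        linarith)
    have i1 := ih (2*q)
    have i2 := ih (2*q+1)
    have e0 : lev f (j+1) q = 1/2 * (lev f j (2*q) + lev f j (2*q+1)) := by simp [lev, avg]
    have e1 : lev (fun s => f s^2) (j+1) q
      = 1/2 * (lev (fun s => f s^2) j (2*q) + lev (fun s => f s^2) j (2*q+1)) := by simp [lev, avg]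
    have e2 : 1 + AccC a (j+1) q / A = 1/2*((1 + AccC a j (2*q)/A) + (1 + AccC a j (2*q+1)/A)) + a j q/A := by
      simp only [AccC]; ring
    have e3 : AccC (fun j q => a j q * (lev f (j+1) q)^2) (j+1) q
      = 1/2 * (AccC (fun j q => a j q * (lev f (j+1) q)^2) j (2*q)
        + AccC (fun j q => a j q * (lev f (j+1) q)^2) j (2*q+1)) + a j q * (lev f (j+1) q)^2 := by
      simp only [AccC]
    rw [e3, e1, e2, e0]
    have b' := mul_le_mul_of_nonneg_left b hA.le
    have e4 : A * (a j q / A * (1/2 * (lev f j (2*q) + lev f j (2*q+1)))^2)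
       = a j q * (1/2 * (lev f j (2*q) + lev f j (2*q+1)))^2 := by field_simp
    rw [mul_add, e4] at b'
    linarith

lemma carleson_embed {a : ℕ → ℤ → ℝ} (ha : ∀ j q, 0 ≤ a j q) {A : ℝ} (hA : 0 < A)
    (hAcc : ∀ j q, AccC a j q ≤ A) (f : ℤ → ℝ) (m : ℕ) :
    ∑ i ∈ Finset.range m, ∑ q ∈ Wn (m-(i+1)), 2^(i+1) * (a i q * (lev f (i+1) q)^2)
      ≤ 4 * A * En m f := by
  rw [← sum_Acc (fun j q => a j q * (lev f (j+1) q)^2) m m le_rfl]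
  have : En m f = ∑ q ∈ Wn m, (fun s => f s^2) q := by simp [En]
  rw [this, ← sum_lev (fun s => f s^2) m m le_rfl, Finset.mul_sum]
  refine Finset.sum_le_sum fun q _ => ?_
  have h := bellman ha hA hAcc f m q
  have : 0 ≤ (lev f m q)^2/(1 + AccC a m q / A) := by
    have := div_nonneg (AccC_nonneg ha m q) hA.le
    positivity
  have h2 : (0:ℝ) < 2^m := by positivity
  have h3 : AccC (fun j q => a j q * (lev f (j+1) q)^2) m q ≤ 4 * A * lev (fun s => f s^2) m q := by
    nlinarith
  nlinarith
end

section
/-! ## P1c : dyadic T1 step -/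
def Lam (n : ℕ) (b : ℤ → ℤ → ℝ) (u v : ℤ → ℝ) : ℝ := ∑ p ∈ Wn n, ∑ q ∈ Wn n, b p q * u q * v p

def blk (k : ℤ → ℤ → ℝ) (j : ℕ) (p q : ℤ) : ℝ :=
  ∑ i ∈ Finset.range (2^j), ∑ l ∈ Finset.range (2^j), k (p*2^j+i) (q*2^j+l)

lemma sum_cell_succ (F : ℤ → ℝ) (j : ℕ) (p : ℤ) :
    ∑ i ∈ Finset.range (2^(j+1)), F (p*2^(j+1)+i)
      = ∑ i ∈ Finset.range (2^j), F (2*p*2^j+i) + ∑ i ∈ Finset.range (2^j), F ((2*p+1)*2^j+i) := by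
  rw [pow_succ 2 j, mul_two, Finset.sum_range_add]
  congr 1
  · refine Finset.sum_congr rfl fun i _ => ?_
    congr 1; push_cast; ring
  · refine Finset.sum_congr rfl fun i _ => ?_
    congr 1; push_cast; ring

lemma sum_W_cell (F : ℤ → ℝ) (n j : ℕ) :
    ∑ p ∈ Wn n, ∑ i ∈ Finset.range (2^j), F (p*2^j+i) = ∑ t ∈ Wn (n+j), F t := by
  induction j generalizing n with
  | zero => simp
  | succ j ih =>
    simp_rw [sum_cell_succ]
    rw [← sum_Wn_succ n (fun p => ∑ i ∈ Finset.range (2^j), F (p*2^j+i)), ih]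
    congr 2; ring

lemma blk_succ (k : ℤ → ℤ → ℝ) (j : ℕ) (p q : ℤ) : blk k (j+1) p q =
    blk k j (2*p) (2*q) + blk k j (2*p) (2*q+1) + (blk k j (2*p+1) (2*q) + blk k j (2*p+1) (2*q+1)) := by
  simp only [blk]
  rw [sum_cell_succ (fun s => ∑ l ∈ Finset.range (2^(j+1)), k s (q*2^(j+1)+l))]
  simp_rw [fun s => sum_cell_succ (fun t => k s t) j q, Finset.sum_add_distrib]

lemma blk_anti {k : ℤ → ℤ → ℝ} (hA : ∀ s t, k s t = - k t s) (j : ℕ) (p q : ℤ) :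
    blk k j p q = - blk k j q p := by
  simp only [blk]
  rw [Finset.sum_comm, ← Finset.sum_neg_distrib]
  refine Finset.sum_congr rfl fun i _ => ?_
  rw [← Finset.sum_neg_distrib]
  exact Finset.sum_congr rfl fun l _ => hA _ _

lemma blk_far {k : ℤ → ℤ → ℝ} (j : ℕ) (p q : ℤ) {B : ℝ}
    (hB : ∀ s t : ℤ, p*2^j ≤ s → s < (p+1)*2^j → q*2^j ≤ t → t < (q+1)*2^j → |k s t| ≤ B) :
    |blk k j p q| ≤ (2^j)*(2^j) * B := by
  refine (Finset.abs_sum_le_sum_abs _ _).trans ?_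
  have : ∀ i ∈ Finset.range (2^j), |∑ l ∈ Finset.range (2^j), k (p*2^j+i) (q*2^j+l)| ≤ 2^j * B := by
    intro i hi
    refine (Finset.abs_sum_le_sum_abs _ _).trans ?_
    refine (Finset.sum_le_card_nsmul _ _ B ?_).trans (by simp)
    intro l hl
    rw [Finset.mem_range] at hi hl
    have hi' : (i:ℤ) < 2^j := by exact_mod_cast hi
    have hl' : (l:ℤ) < 2^j := by exact_mod_cast hl
    exact hB _ _ (by omega) (by linarith) (by omega) (by linarith)
  refine (Finset.sum_le_card_nsmul _ _ _ this).trans (by simp; ring_nf; rfl)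

lemma dist_cells {j : ℕ} {p q s t : ℤ} (h1 : p*2^j ≤ s) (h2 : s < (p+1)*2^j) (h3 : q*2^j ≤ t)
    (h4 : t < (q+1)*2^j) : ((|p-q|:ℤ)-1:ℝ) * 2^j ≤ |((s:ℝ) - t)| := by
  have hL : (0:ℤ) < 2^j := by positivity
  have : (|p-q|-1) * 2^j ≤ |s-t| := by
    rcases le_total p q with h | h
    · rw [abs_of_nonpos (by omega : p - q ≤ 0)]
      have : -(s-t) ≤ |s-t| := neg_le_abs _
      nlinarith
    · rw [abs_of_nonneg (by omega : 0 ≤ p - q)]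
      have : (s-t) ≤ |s-t| := le_abs_self _
      nlinarith
  exact_mod_cast this

lemma blk_size {k : ℤ → ℤ → ℝ} (hA : ∀ s t, k s t = - k t s)
    (hS : ∀ s t : ℤ, |k s t| ≤ 1/|(s:ℝ)-t|) (j : ℕ) (p q : ℤ) : |blk k j p q| ≤ 3 * 2^j := by
  have far : ∀ j : ℕ, ∀ p q : ℤ, 2 ≤ |p-q| → |blk k j p q| ≤ 2^j := by
    intro j p q h
    have hL : (0:ℝ) < 2^j := by positivity
    refine (blk_far (B := 1/2^j) j p q ?_).trans (by field_simp; rfl)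
    intro s t h1 h2 h3 h4
    refine (hS s t).trans ?_
    have := dist_cells h1 h2 h3 h4
    have h' : (2:ℝ) ≤ ((|p-q|:ℤ):ℝ) := by exact_mod_cast h
    refine one_div_le_one_div_of_le hL ?_
    nlinarith
  have adj : ∀ j : ℕ, ∀ p : ℤ, |blk k j p (p+1)| ≤ 3 * 2^j := by
    intro j
    induction j with
    | zero => intro p; have := hS p (p+1); simp [blk] at this ⊢; linarith
    | succ j ih =>
      intro p
      rw [blk_succ]
      have a1 := far j (2*p) (2*(p+1)) (by rw [abs_of_nonpos] <;> omega)
      have a2 := far j (2*p) (2*(p+1)+1) (by rw [abs_of_nonpos] <;> omega)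
      have a3 := far j (2*p+1) (2*(p+1)+1) (by rw [abs_of_nonpos] <;> omega)
      have a4 := ih (2*p+1)
      rw [show 2*p+1+1 = 2*(p+1) by ring] at a4
      rw [pow_succ]
      rw [abs_le] at *
      constructor <;> linarith
  have hL : (0:ℝ) < 2^j := by positivity
  rcases lt_trichotomy p q with h | h | h
  · rcases eq_or_lt_of_le (Int.add_one_le_iff.2 h) with h' | h'
    · rw [← h']; exact adj j p
    · exact (far j p q (by rw [abs_of_nonpos] <;> omega)).trans (by linarith)
  · subst h
    have := blk_anti hA j p p
    have : blk k j p p = 0 := by linarith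
    rw [this, abs_zero]; positivity
  · rcases eq_or_lt_of_le (Int.add_one_le_iff.2 h) with h' | h'
    · rw [blk_anti hA, abs_neg, ← h']; exact adj j q
    · exact (far j p q (by rw [abs_of_nonneg] <;> omega)).trans (by linarith)

lemma blk_diff {k : ℤ → ℤ → ℝ} (hA : ∀ s t, k s t = - k t s)
    (hS : ∀ s t : ℤ, |k s t| ≤ 1/|(s:ℝ)-t|)
    (hR : ∀ s s' t : ℤ, 2 * |(s:ℝ)-s'| ≤ |(s:ℝ)-t| → |k s t - k s' t| ≤ |(s:ℝ)-s'|/((s:ℝ)-t)^2)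
    (j : ℕ) (P p : ℤ) : |blk k j (2*P) p - blk k j (2*P+1) p| ≤ 54 * 2^j ∧
      |blk k j (2*P) p - blk k j (2*P+1) p| * ((p - 2*P:ℤ):ℝ)^2 ≤ 54 * 2^j ∧
      |blk k j (2*P) p - blk k j (2*P+1) p| * ((p - (2*P+1):ℤ):ℝ)^2 ≤ 54 * 2^j := by
  have hL : (0:ℝ) < 2^j := by positivity
  have h1 := blk_size hA hS j (2*P) p
  have h2 := blk_size hA hS j (2*P+1) p
  have h3 : |blk k j (2*P) p - blk k j (2*P+1) p| ≤ 6 * 2^j := (abs_sub _ _).trans (by linarith)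
  refine ⟨by linarith, ?_⟩
  set r : ℤ := p - 2*P with hr
  have hr' : p - (2*P+1) = r - 1 := by omega
  rw [hr']
  by_cases hb : |r| ≤ 2
  · have hb' := abs_le.1 hb
    have r1 : ((r:ℤ):ℝ)^2 ≤ 9 := by
      have : r^2 ≤ 9 := by nlinarith
      exact_mod_cast this
    have r2 : (((r-1:ℤ)):ℝ)^2 ≤ 9 := by
      have : (r-1)^2 ≤ 9 := by nlinarith
      exact_mod_cast this
    constructor
    · refine (mul_le_mul h3 r1 (by positivity) (by positivity)).trans (le_of_eq (by ring))
    · refine (mul_le_mul h3 r2 (by positivity) (by positivity)).trans (le_of_eq (by ring))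
  · push Not at hb
    have hb2 : (3:ℤ) ≤ |r| := hb
    have hb3 : (3:ℝ) ≤ ((|r|:ℤ):ℝ) := by exact_mod_cast hb2
    set R : ℝ := ((|r|:ℤ):ℝ) with hR'
    have e : blk k j (2*P) p - blk k j (2*P+1) p = blk (fun s t => k s t - k (s + 2^j) t) j (2*P) p := by
      simp only [blk, ← Finset.sum_sub_distrib]
      refine Finset.sum_congr rfl fun i _ => Finset.sum_congr rfl fun l _ => ?_
      congr 2; ring
    have hd : |blk k j (2*P) p - blk k j (2*P+1) p| ≤ 2^j / (R-1)^2 := by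
      rw [e]
      have hR1 : 0 < R - 1 := by linarith
      refine (blk_far (B := 1/((R-1)^2 * 2^j)) j (2*P) p ?_).trans (by field_simp; rfl)
      intro s t a1 a2 a3 a4
      have hdist := dist_cells a1 a2 a3 a4
      have e2 : |2*P - p| = |r| := by rw [hr, abs_sub_comm]
      rw [e2] at hdist
      have e3 : |(s:ℝ) - ((s + 2^j : ℤ):ℝ)| = 2^j := by
        push_cast; rw [sub_add_cancel_left, abs_neg, abs_of_pos hL]
      have := hR s (s+2^j) t (by rw [e3]; nlinarith)
      rw [e3] at this
      refine this.trans ?_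
      rw [← sq_abs ((s:ℝ)-t)]
      calc (2:ℝ)^j/|(s:ℝ)-t|^2 ≤ 2^j/((R-1)*2^j)^2 := by
            gcongr
        _ = _ := by field_simp
    have q1 : ((r:ℤ):ℝ)^2 ≤ 4 * (R-1)^2 := by
      have : ((r:ℤ):ℝ)^2 = R^2 := by rw [hR']; push_cast; rw [sq_abs]
      rw [this]; nlinarith
    have q2 : ((r-1:ℤ):ℝ)^2 ≤ 4 * (R-1)^2 := by
      have : |((r-1:ℤ):ℝ)| ≤ R + 1 := by
        rw [hR']; push_cast
        exact (abs_sub _ _).trans (by simp)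
      rw [← sq_abs]
      nlinarith [abs_nonneg ((r-1:ℤ):ℝ)]
    have hR2 : 0 < (R-1)^2 := by have : 0 < R - 1 := by linarith
                                 positivity
    constructor
    · calc _ ≤ (2^j / (R-1)^2) * (4 * (R-1)^2) := by gcongr
        _ = 4 * 2^j := by
          have hR1 : R - 1 ≠ 0 := by intro h0; linarith
          field_simp
        _ ≤ _ := by linarith
    · calc _ ≤ (2^j / (R-1)^2) * (4 * (R-1)^2) := by gcongr
        _ = 4 * 2^j := by
          have hR1 : R - 1 ≠ 0 := by intro h0; linarith
          field_simp
        _ ≤ _ := by linarith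

lemma est_step (n : ℕ) (Δ : ℤ → ℤ → ℝ) (c : ℝ) (hc : 0 ≤ c)
    (hΔ : ∀ P p, |Δ P p| ≤ c ∧ |Δ P p| * ((p - 2*P:ℤ):ℝ)^2 ≤ c ∧ |Δ P p| * ((p - (2*P+1):ℤ):ℝ)^2 ≤ c)
    (u y : ℤ → ℝ) :
    |∑ P ∈ Wn n, y P * ∑ p ∈ Wn (n+1), Δ P p * u p| ≤ c * (2 * En n y + Nf (n+1) u)
      + |∑ P ∈ Wn n, y P * avg u P * ∑ p ∈ Wn (n+1), Δ P p| := by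
  have e : ∑ P ∈ Wn n, y P * ∑ p ∈ Wn (n+1), Δ P p * u p
      = ∑ P ∈ Wn n, ∑ p ∈ Wn (n+1), y P * (Δ P p * (u p - avg u P))
       + ∑ P ∈ Wn n, y P * avg u P * ∑ p ∈ Wn (n+1), Δ P p := by
    rw [← Finset.sum_add_distrib]
    refine Finset.sum_congr rfl fun P _ => ?_
    rw [Finset.mul_sum, Finset.mul_sum, ← Finset.sum_add_distrib]
    exact Finset.sum_congr rfl fun p _ => by ring
  rw [e]
  refine (abs_add_le _ _).trans (add_le_add_left ?_ _)
  have pt : ∀ P p : ℤ, |y P * (Δ P p * (u p - avg u P))| ≤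
      c/2 * ((y P^2 * (1/((2*P-p:ℤ):ℝ)^2) + ‖u (2*P) - u p‖^2/((2*P-p:ℤ):ℝ)^2)/2
        + (y P^2 * (1/((2*P+1-p:ℤ):ℝ)^2) + ‖u (2*P+1) - u p‖^2/((2*P+1-p:ℤ):ℝ)^2)/2) := by
    intro P p
    obtain ⟨d0, d1, d2⟩ := hΔ P p
    have key : ∀ a : ℤ, |Δ P p| * ((p - a:ℤ):ℝ)^2 ≤ c →
        |y P| * (|Δ P p| * |u p - u a|) ≤ c * ((y P^2 * (1/((a-p:ℤ):ℝ)^2) + ‖u a - u p‖^2/((a-p:ℤ):ℝ)^2)/2) := by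
      intro a ha
      have e1 : ((p-a:ℤ):ℝ)^2 = ((a-p:ℤ):ℝ)^2 := by push_cast; ring
      rw [e1] at ha
      rw [Real.norm_eq_abs, sq_abs]
      by_cases h : p = a
      · subst h; simp
      have hpos : 0 < ((a-p:ℤ):ℝ)^2 := by
        have : ((a-p:ℤ):ℝ) ≠ 0 := by exact_mod_cast sub_ne_zero.2 (Ne.symm h)
        positivity
      have h1 : |Δ P p| ≤ c * (1/((a-p:ℤ):ℝ)^2) := by
        rw [mul_one_div, le_div_iff₀ hpos]; exact ha
      have h2 : |y P| * |u p - u a| ≤ (y P^2 + (u a - u p)^2)/2 := by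
        nlinarith [sq_nonneg (|y P| - |u p - u a|), sq_abs (y P), sq_abs (u p - u a)]
      calc |y P| * (|Δ P p| * |u p - u a|) = |Δ P p| * (|y P| * |u p - u a|) := by ring
        _ ≤ (c * (1/((a-p:ℤ):ℝ)^2)) * ((y P^2 + (u a - u p)^2)/2) := by gcongr
        _ = _ := by ring
    rw [abs_mul, abs_mul]
    have hle : |u p - avg u P| ≤ 1/2 * |u p - u (2*P)| + 1/2 * |u p - u (2*P+1)| := by
      have : u p - avg u P = 1/2 * (u p - u (2*P)) + 1/2 * (u p - u (2*P+1)) := by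
        simp only [avg, smul_eq_mul]; ring
      rw [this]
      refine (abs_add_le _ _).trans ?_
      rw [abs_mul, abs_mul]; norm_num
    have k1 := key (2*P) d1
    have k2 := key (2*P+1) d2
    have : |y P| * (|Δ P p| * |u p - avg u P|) ≤ |y P| * (|Δ P p| * (1/2 * |u p - u (2*P)| + 1/2 * |u p - u (2*P+1)|)) := by
      gcongr
    linarith
  refine (Finset.abs_sum_le_sum_abs _ _).trans ?_
  have h1 : ∑ P ∈ Wn n, |∑ p ∈ Wn (n+1), y P * (Δ P p * (u p - avg u P))| ≤
     ∑ P ∈ Wn n, ∑ p ∈ Wn (n+1), c/2 * ((y P^2 * (1/((2*P-p:ℤ):ℝ)^2) + ‖u (2*P) - u p‖^2/((2*P-p:ℤ):ℝ)^2)/2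
        + (y P^2 * (1/((2*P+1-p:ℤ):ℝ)^2) + ‖u (2*P+1) - u p‖^2/((2*P+1-p:ℤ):ℝ)^2)/2) :=
    Finset.sum_le_sum fun P _ => (Finset.abs_sum_le_sum_abs _ _).trans (Finset.sum_le_sum fun p _ => pt P p)
  refine h1.trans ?_
  have h2 : Nf (n+1) u = ∑ P ∈ Wn n, (∑ p ∈ Wn (n+1), ‖u (2*P) - u p‖^2/((2*P-p:ℤ):ℝ)^2
      + ∑ p ∈ Wn (n+1), ‖u (2*P+1) - u p‖^2/((2*P+1-p:ℤ):ℝ)^2) := by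
    rw [Nf, sum_Wn_succ]
  have h3 : ∑ P ∈ Wn n, ∑ p ∈ Wn (n+1), c/2 * ((y P^2 * (1/((2*P-p:ℤ):ℝ)^2) + ‖u (2*P) - u p‖^2/((2*P-p:ℤ):ℝ)^2)/2
        + (y P^2 * (1/((2*P+1-p:ℤ):ℝ)^2) + ‖u (2*P+1) - u p‖^2/((2*P+1-p:ℤ):ℝ)^2)/2)
      ≤ ∑ P ∈ Wn n, c/2 * ((8 * ‖y P‖^2)/2 + (∑ p ∈ Wn (n+1), ‖u (2*P) - u p‖^2/((2*P-p:ℤ):ℝ)^2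
      + ∑ p ∈ Wn (n+1), ‖u (2*P+1) - u p‖^2/((2*P+1-p:ℤ):ℝ)^2)/2) := by
    refine Finset.sum_le_sum fun P _ => ?_
    rw [← Finset.mul_sum]
    gcongr
    simp only [Finset.sum_add_distrib, ← Finset.mul_sum, ← Finset.sum_div]
    have s1 := sum_inv_sq_le (Wn (n+1)) (2*P)
    have s2 := sum_inv_sq_le (Wn (n+1)) (2*P+1)
    have e4 : ‖y P‖^2 = y P^2 := by simp
    rw [e4]
    have := sq_nonneg (y P)
    nlinarith
  refine h3.trans ?_
  rw [h2, En, ← Finset.mul_sum, Finset.sum_add_distrib, ← Finset.sum_div, ← Finset.mul_sum, ← Finset.sum_div]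
  have : 0 ≤ ∑ P ∈ Wn n, (∑ p ∈ Wn (n+1), ‖u (2*P) - u p‖^2/((2*P-p:ℤ):ℝ)^2
      + ∑ p ∈ Wn (n+1), ‖u (2*P+1) - u p‖^2/((2*P+1-p:ℤ):ℝ)^2) := by positivity
  nlinarith

lemma Lam_step (n : ℕ) (b : ℤ → ℤ → ℝ) (hb : ∀ p q, b p q = - b q p) (u v : ℤ → ℝ) :
    Lam (n+1) b u v - Lam n (fun p q => b (2*p) (2*q) + b (2*p) (2*q+1) + (b (2*p+1) (2*q) + b (2*p+1) (2*q+1)))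
        (avg u) (avg v)
      = ∑ P ∈ Wn n, hr v P * ∑ p ∈ Wn (n+1), (b (2*P) p - b (2*P+1) p) * u p
       - ∑ P ∈ Wn n, hr u P * ∑ p ∈ Wn (n+1), (b (2*P) p - b (2*P+1) p) * avg v (p/2) := by
  have e2 : ∑ P ∈ Wn n, hr u P * ∑ p ∈ Wn (n+1), (b (2*P) p - b (2*P+1) p) * avg v (p/2)
      = ∑ P ∈ Wn n, ∑ Q ∈ Wn n, hr u Q * (((b (2*Q) (2*P) - b (2*Q+1) (2*P)) * avg v P)
         + (b (2*Q) (2*P+1) - b (2*Q+1) (2*P+1)) * avg v P) := by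
    rw [Finset.sum_comm]
    refine Finset.sum_congr rfl fun P _ => ?_
    rw [sum_Wn_succ, Finset.mul_sum]
    refine Finset.sum_congr rfl fun Q _ => ?_
    rw [show (2*Q)/2 = Q by omega, show (2*Q+1)/2 = Q by omega]
  rw [e2]
  simp only [Lam]
  rw [sum_Wn_succ, ← Finset.sum_sub_distrib, ← Finset.sum_sub_distrib]
  refine Finset.sum_congr rfl fun P _ => ?_
  rw [sum_Wn_succ, sum_Wn_succ, sum_Wn_succ, ← Finset.sum_add_distrib, ← Finset.sum_sub_distrib, Finset.mul_sum,
    ← Finset.sum_sub_distrib]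
  refine Finset.sum_congr rfl fun Q _ => ?_
  rw [hb (2*Q) (2*P), hb (2*Q+1) (2*P), hb (2*Q) (2*P+1), hb (2*Q+1) (2*P+1)]
  rw [← avg_add_hr u Q, ← avg_sub_hr u Q, ← avg_add_hr v P, ← avg_sub_hr v P]
  ring

lemma step_bound (n : ℕ) (b : ℤ → ℤ → ℝ) (hb : ∀ p q, b p q = - b q p) (c : ℝ) (hc : 0 ≤ c)
    (hΔ : ∀ P p, |b (2*P) p - b (2*P+1) p| ≤ c ∧ |b (2*P) p - b (2*P+1) p| * ((p - 2*P:ℤ):ℝ)^2 ≤ c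
      ∧ |b (2*P) p - b (2*P+1) p| * ((p - (2*P+1):ℤ):ℝ)^2 ≤ c) (u v : ℤ → ℝ) :
    |Lam (n+1) b u v - Lam n (fun p q => b (2*p) (2*q) + b (2*p) (2*q+1) + (b (2*p+1) (2*q) + b (2*p+1) (2*q+1)))
        (avg u) (avg v)| ≤ c * (2 * En n (hr v) + 2 * En n (hr u) + Nf (n+1) u + 2 * Nf n (avg v))
      + |∑ P ∈ Wn n, hr v P * avg u P * ∑ p ∈ Wn (n+1), (b (2*P) p - b (2*P+1) p)|
      + |∑ P ∈ Wn n, hr u P * avg v P * ∑ p ∈ Wn (n+1), (b (2*P) p - b (2*P+1) p)| := by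
  rw [Lam_step n b hb]
  refine (abs_sub _ _).trans ?_
  have h1 := est_step n (fun P p => b (2*P) p - b (2*P+1) p) c hc hΔ u (hr v)
  have h2 := est_step n (fun P p => b (2*P) p - b (2*P+1) p) c hc hΔ (fun p => avg v (p/2)) (hr u)
  have ea : avg (fun p => avg v (p/2)) = avg v := by
    funext P
    show (1/2:ℝ) • (avg v (2*P/2) + avg v ((2*P+1)/2)) = avg v P
    rw [show (2*P)/2 = P by omega, show (2*P+1)/2 = P by omega]; simp; ring
  have eh : hr (fun p => avg v (p/2)) = fun _ => 0 := by
    funext P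
    show (1/2:ℝ) • (avg v (2*P/2) - avg v ((2*P+1)/2)) = 0
    rw [show (2*P)/2 = P by omega, show (2*P+1)/2 = P by omega]; simp
  have h3 := Nf_succ n (fun p => avg v (p/2))
  rw [ea, eh] at h3
  have h4 : En n (fun _ : ℤ => (0:ℝ)) = 0 := by simp [En]
  rw [h4] at h3
  rw [ea] at h2
  have h5 : Nf (n+1) (fun p => avg v (p/2)) ≤ 2 * Nf n (avg v) := by
    have := Nf_nonneg n (avg v); linarith
  have h6 := mul_le_mul_of_nonneg_left h5 hc
  nlinarith
end

section
/-! ## P1d : Faber–Schauder pieces and pointwise bounds for T1 -/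
section
variable {V : Type*} [NormedAddCommGroup V] [InnerProductSpace ℝ V]

structure KH (γ : ℤ → V) (k : ℤ → ℤ → ℝ) : Prop where
  lip : ∀ s t, ‖γ s - γ t‖ ≤ |(s:ℝ) - t|
  anti : ∀ s t, k s t = - k t s
  size : ∀ s t : ℤ, |k s t| ≤ 1/|(s:ℝ)-t|
  reg : ∀ s s' t : ℤ, 2 * |(s:ℝ)-s'| ≤ |(s:ℝ)-t| → |k s t - k s' t| ≤ |(s:ℝ)-s'|/((s:ℝ)-t)^2
  d1 : ∀ (s s' : ℤ) (h : ℕ), 0 < h → |k s (s+h) - k s' (s'+h)| ≤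
    ‖(γ (s+h) - γ s) - (γ (s'+h) - γ s')‖/(h:ℝ)^2
  d2 : ∀ (s s' : ℤ) (h : ℕ), 0 < h → |(k s (s+h) - k (s-h) s) - (k s' (s'+h) - k (s'-h) s')| ≤
    ‖(γ (s+h) + γ (s-h) - (2:ℝ)•γ s) - (γ (s'+h) + γ (s'-h) - (2:ℝ)•γ s')‖/(h:ℝ)^2
    + (‖γ (s+h) + γ (s-h) - (2:ℝ)•γ s‖ + ‖γ (s'+h) + γ (s'-h) - (2:ℝ)•γ s'‖) * |(s:ℝ)-s'|/(h:ℝ)^3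

def Uf (g : ℤ → V) (k : ℕ) (t : ℤ) : V := lev g k (t / 2^k)
def yf (g : ℤ → V) (i : ℕ) (t : ℤ) : ℝ := ‖hr (lev g i) (t / 2^(i+1))‖
def Gf (g : ℤ → V) (i : ℕ) (t : ℤ) : V :=
  ((min (t % 2^(i+1)) (2^(i+1) - t % 2^(i+1)) : ℤ) : ℝ) • hr (lev g i) (t / 2^(i+1))

lemma yf_nonneg (g : ℤ → V) (i : ℕ) (t : ℤ) : 0 ≤ yf g i t := norm_nonneg _

lemma Gf_step (g : ℤ → V) (i : ℕ) (t : ℤ) : Gf g i (t+1) - Gf g i t = Uf g i t - Uf g (i+1) t := by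
  have hL : (0:ℤ) < 2^i := by positivity
  have e2 : (2:ℤ)^(i+1) = 2 * 2^i := by ring
  unfold Gf Uf
  rw [e2, show lev g (i+1) = avg (lev g i) from rfl]
  set L : ℤ := 2^i
  set q := t / (2*L) with hq
  set r := t % (2*L) with hr'
  have h1 : 2*L*q + r = t := Int.mul_ediv_add_emod t (2*L)
  have h2 : 0 ≤ r := Int.emod_nonneg _ (by omega)
  have h3 : r < 2*L := Int.emod_lt_of_pos _ (by omega)
  have eA := avg_add_hr (lev g i) q
  have eB := avg_sub_hr (lev g i) q
  have hlev : lev g i (t / L) - avg (lev g i) q = (if r < L then (1:ℝ) else -1) • hr (lev g i) q := by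
    split_ifs with h
    · have : t / L = 2*q := by
        rw [Int.ediv_eq_iff_of_pos hL]
        constructor <;> nlinarith
      rw [this, ← eA]; simp
    · have : t / L = 2*q+1 := by
        rw [Int.ediv_eq_iff_of_pos hL]
        constructor <;> nlinarith
      rw [this, ← eB]; simp
  rw [hlev]
  by_cases hlast : r + 1 < 2*L
  · have a1 : (t+1) / (2*L) = q := by
      rw [Int.ediv_eq_iff_of_pos (by omega)]
      constructor <;> nlinarith
    have a2 : (t+1) % (2*L) = r+1 := by
      have := Int.mul_ediv_add_emod (t+1) (2*L)
      rw [a1] at this; linarith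
    rw [a1, a2, ← sub_smul]
    congr 1
    split_ifs with h
    · rw [min_eq_left (by omega), min_eq_left (by omega)]; push_cast; ring
    · rw [min_eq_right (by omega), min_eq_right (by omega)]; push_cast; ring
  · have hr1 : r = 2*L - 1 := by omega
    have a1 : (t+1) / (2*L) = q+1 := by
      rw [Int.ediv_eq_iff_of_pos (by omega)]
      constructor <;> nlinarith
    have a2 : (t+1) % (2*L) = 0 := by
      have := Int.mul_ediv_add_emod (t+1) (2*L)
      rw [a1] at this; linarith
    rw [a2, hr1, if_neg (by omega)]
    rw [min_eq_left (by omega), min_eq_right (by omega)]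
    simp

lemma Gf_le (g : ℤ → V) (i : ℕ) (t : ℤ) : ‖Gf g i t‖ ≤ 2^i * yf g i t := by
  have hL : (0:ℤ) < 2^i := by positivity
  have e2 : (2:ℤ)^(i+1) = 2 * 2^i := by ring
  have h2 : 0 ≤ t % 2^(i+1) := Int.emod_nonneg _ (by positivity)
  have h3 : t % 2^(i+1) < 2^(i+1) := Int.emod_lt_of_pos _ (by positivity)
  unfold Gf yf
  rw [norm_smul, Real.norm_eq_abs, ← Int.cast_abs]
  refine mul_le_mul_of_nonneg_right ?_ (norm_nonneg _)
  rw [abs_of_nonneg (by omega)]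
  have : min (t % 2^(i+1)) (2^(i+1) - t % 2^(i+1)) ≤ 2^i := by omega
  exact_mod_cast this

lemma Gf_le' (g : ℤ → V) (i : ℕ) (c t : ℤ) (hc : (2^(i+1):ℤ) ∣ c) :
    ‖Gf g i t‖ ≤ |(t:ℝ) - c| * yf g i t := by
  obtain ⟨d, rfl⟩ := hc
  have hL : (0:ℤ) < 2^(i+1) := by positivity
  have h1 := Int.mul_ediv_add_emod t (2^(i+1))
  have h2 : 0 ≤ t % 2^(i+1) := Int.emod_nonneg _ (by positivity)
  have h3 : t % 2^(i+1) < 2^(i+1) := Int.emod_lt_of_pos _ (by positivity)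
  unfold Gf yf
  rw [norm_smul, Real.norm_eq_abs, ← Int.cast_abs]
  refine mul_le_mul_of_nonneg_right ?_ (norm_nonneg _)
  rw [abs_of_nonneg (by omega)]
  set M : ℤ := 2^(i+1)
  set q := t / M
  set r := t % M
  have : min r (M - r) ≤ |t - M*d| := by
    rw [← h1]
    rcases le_or_gt d q with h | h
    · have : M * d ≤ M * q := by nlinarith
      have := le_abs_self (M*q + r - M*d)
      omega
    · have : M * (q+1) ≤ M * d := by nlinarith [Int.add_one_le_iff.2 h]
      have := neg_le_abs (M*q + r - M*d)
      have : M*(q+1) = M*q+M := by ring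
      omega
  exact_mod_cast this

/-- smooth part of the path -/
def gk (γ : ℤ → V) (k : ℕ) (t : ℤ) : V :=
  γ t - ∑ i ∈ Finset.range k, Gf (fun t => γ (t+1) - γ t) i t

lemma gk_step (γ : ℤ → V) (k : ℕ) (t : ℤ) :
    gk γ k (t+1) - gk γ k t = Uf (fun t => γ (t+1) - γ t) k t := by
  unfold gk
  set g : ℤ → V := fun t => γ (t+1) - γ t
  have h : ∑ i ∈ Finset.range k, (Gf g i (t+1) - Gf g i t) = Uf g 0 t - Uf g k t := by
    simp_rw [Gf_step]
    exact Finset.sum_range_sub' (fun i => Uf g i t) k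
  rw [Finset.sum_sub_distrib] at h
  have h0 : Uf g 0 t = γ (t+1) - γ t := by simp [Uf, lev, g]
  rw [h0] at h
  have : Uf g k t = (γ (t+1) - γ t) - (∑ i ∈ Finset.range k, Gf g i (t+1) - ∑ i ∈ Finset.range k, Gf g i t) := by
    rw [h]; abel
  rw [this]; abel

lemma gk_sum (γ : ℤ → V) (k : ℕ) (t : ℤ) (h : ℕ) :
    gk γ k (t+h) - gk γ k t = ∑ l ∈ Finset.range h, Uf (fun t => γ (t+1) - γ t) k (t+l) := by
  induction h with
  | zero => simp
  | succ h ih =>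
    rw [Finset.sum_range_succ, ← ih, ← gk_step]
    push_cast; rw [← add_assoc]; abel

lemma tel_shift {M : Type*} [AddCommGroup M] (F : ℤ → M) (a : ℤ) (L h : ℕ) :
    ∑ i ∈ Finset.range L, (F (a+i) - F (a+i-h)) =
      ∑ i ∈ Finset.range h, (F (a+L-h+i) - F (a-h+i)) := by
  induction L with
  | zero => simp
  | succ L ih =>
    rw [Finset.sum_range_succ, ih]
    have := Finset.sum_range_sub (fun i : ℕ => F (a+L-h+i)) h
    have e : ∀ i : ℕ, F (a+(L+1:ℕ)-h+i) - F (a-h+i) =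
      (F (a+L-h+(i+1:ℕ)) - F (a+L-h+i)) + (F (a+L-h+i) - F (a-h+i)) := by
      intro i; rw [show a+(L+1:ℕ)-h+(i:ℤ) = a+L-h+(i+1:ℕ) by push_cast; ring]; abel
    simp_rw [e]
    rw [Finset.sum_add_distrib, this, add_comm]
    congr 2
    · congr 1; ring
    · congr 1; simp

end
end

section
/-! ## P1e : near part of T1 -/
lemma sum_inj_le {ι : Type*} {A : Finset ι} {S : Finset ℤ} {f : ℤ → ℝ} (hf : ∀ t, 0 ≤ f t) (e : ι → ℤ)
    (he : Set.InjOn e A) (hS : ∀ r ∈ A, e r ∈ S) : ∑ r ∈ A, f (e r) ≤ ∑ t ∈ S, f t := by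
  rw [← Finset.sum_image (f := f) he]
  refine Finset.sum_le_sum_of_subset_of_nonneg ?_ fun _ _ _ => hf _
  intro t ht
  obtain ⟨r, hr, rfl⟩ := Finset.mem_image.1 ht
  exact hS r hr

lemma csw {ι : Type*} (A : Finset ι) (c x : ι → ℝ) (hc : ∀ i ∈ A, 0 ≤ c i) :
    (∑ i ∈ A, c i * x i)^2 ≤ (∑ i ∈ A, c i) * ∑ i ∈ A, c i * x i^2 :=
  Finset.sum_sq_le_sum_mul_sum_of_sq_le_mul A hc (fun i hi => mul_nonneg (hc i hi) (sq_nonneg _))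
    (fun i _ => le_of_eq (by ring))

lemma sum_inv_sq_Ico (r L : ℕ) (hr : 0 < r) : ∑ h ∈ Finset.Ico r L, 1/(h:ℝ)^2 ≤ 2/(r:ℝ) := by
  have := sum_Ioo_inv_sq_le (α := ℝ) (r-1) L
  have e : Finset.Ioo (r-1) L = Finset.Ico r L := by ext; simp; omega
  rw [e] at this
  have e2 : ((r-1:ℕ):ℝ) + 1 = r := by
    have : ((r-1:ℕ):ℝ) = r - 1 := by push_cast [Nat.cast_sub hr]; ring
    rw [this]; ring
  rw [e2] at this
  simpa [one_div] using this

lemma swap_bound (L i : ℕ) (f y : ℕ → ℝ) (hf : ∀ r, 0 ≤ f r) (hy : ∀ r, 0 ≤ y r)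
    (h1 : ∀ r, f r ≤ r * y r) (h2 : ∀ r, f r ≤ 2^i * y r) :
    (∑ h ∈ Finset.Ico 1 L, (∑ r ∈ Finset.range (h+1), f r)/(h:ℝ)^2)^2 ≤
      12 * 2^i * ∑ r ∈ Finset.range L, y r^2 := by
  have hI : (0:ℝ) < 2^i := by positivity
  have e1 : ∑ h ∈ Finset.Ico 1 L, (∑ r ∈ Finset.range (h+1), f r)/(h:ℝ)^2 =
      ∑ r ∈ Finset.range L, f r * ∑ h ∈ Finset.Ico (max 1 r) L, 1/(h:ℝ)^2 := by
    simp_rw [Finset.sum_div, Finset.mul_sum, mul_one_div]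
    refine Finset.sum_comm' ?_
    intro h r; simp; omega
  set w : ℕ → ℝ := fun r => if r < 2^i then 2 else 2 * 2^i / r with hw
  have e2 : ∑ r ∈ Finset.range L, f r * ∑ h ∈ Finset.Ico (max 1 r) L, 1/(h:ℝ)^2 ≤
      ∑ r ∈ Finset.range L, w r * y r := by
    refine Finset.sum_le_sum fun r _ => ?_
    rcases Nat.eq_zero_or_pos r with h0 | h0
    · subst h0
      have : f 0 = 0 := le_antisymm (by simpa using h1 0) (hf 0)
      rw [this, zero_mul]
      simp only [hw]; split_ifs <;> simp [hy]
    · have hr : (0:ℝ) < r := by exact_mod_cast h0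
      rw [max_eq_right h0]
      refine (mul_le_mul_of_nonneg_left (sum_inv_sq_Ico r L h0) (hf r)).trans ?_
      simp only [hw]; split_ifs
      · calc f r * (2/r) ≤ (r * y r) * (2/r) := by gcongr; exact h1 r
          _ = _ := by field_simp
      · calc f r * (2/r) ≤ (2^i * y r) * (2/r) := by gcongr; exact h2 r
          _ = _ := by field_simp
  have e3 : 0 ≤ ∑ h ∈ Finset.Ico 1 L, (∑ r ∈ Finset.range (h+1), f r)/(h:ℝ)^2 :=
    Finset.sum_nonneg fun h _ => div_nonneg (Finset.sum_nonneg fun r _ => hf r) (by positivity)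
  have e4 : ∑ r ∈ Finset.range L, w r^2 ≤ 12 * 2^i := by
    have : ∀ r, w r^2 = if r < 2^i then 4 else 4 * 4^i * (1/(r:ℝ)^2) := by
      intro r; simp only [hw]; split_ifs
      · norm_num
      · rw [div_pow, mul_pow, ← pow_mul, mul_comm i 2, pow_mul]; norm_num; ring
    simp_rw [this]
    rw [Finset.sum_ite, Finset.sum_const, ← Finset.mul_sum]
    have c1 : ((Finset.range L).filter (· < 2^i)).card ≤ 2^i := by
      calc _ ≤ (Finset.range (2^i)).card := Finset.card_le_card (by intro r; simp)
        _ = _ := by simp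
    have c2 : ∑ r ∈ (Finset.range L).filter (fun r => ¬ r < 2^i), 1/(r:ℝ)^2 ≤ 2/2^i := by
      have := sum_inv_sq_Ico (2^i) L (by positivity)
      push_cast at this
      refine le_trans (le_of_eq ?_) this
      congr 1; ext; simp; omega
    have c1' : (((Finset.range L).filter (· < 2^i)).card : ℝ) ≤ 2^i := by exact_mod_cast c1
    have e4i : (4:ℝ)^i = 2^i*2^i := by rw [← mul_pow]; norm_num
    rw [nsmul_eq_mul]
    refine (add_le_add (mul_le_mul_of_nonneg_right c1' (by norm_num))
      (mul_le_mul_of_nonneg_left c2 (by positivity))).trans (le_of_eq ?_)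
    rw [e4i]; field_simp; ring
  calc _ ≤ (∑ r ∈ Finset.range L, w r * y r)^2 := by
        rw [e1] at e3 ⊢; gcongr
    _ ≤ (∑ r ∈ Finset.range L, w r^2) * ∑ r ∈ Finset.range L, y r^2 := Finset.sum_mul_sq_le_sq_mul_sq _ _ _
    _ ≤ _ := mul_le_mul_of_nonneg_right e4 (Finset.sum_nonneg fun _ _ => sq_nonneg _)

section
variable {V : Type*} [NormedAddCommGroup V] [InnerProductSpace ℝ V]

def dh (k : ℤ → ℤ → ℝ) (a : ℤ) (L h : ℕ) : ℝ := ∑ i ∈ Finset.range L,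
  ((k (a+i) (a+i+h) - k (a+i-h) (a+i)) - (k (a+L+i) (a+L+i+h) - k (a+L+i-h) (a+L+i)))

def mh (γ : ℤ → V) (L h : ℕ) (s : ℤ) : ℝ := ‖(γ (s+h) - γ s) - (γ (s+L+h) - γ (s+L))‖

lemma near_h {γ : ℤ → V} {k : ℤ → ℤ → ℝ} (H : KH γ k) (a : ℤ) (L h : ℕ) (hh : 0 < h) :
    |dh k a L h| ≤ (∑ i ∈ Finset.range h, (mh γ L h (a-h+i)))/(h:ℝ)^2
      + (∑ i ∈ Finset.range h, (mh γ L h (a+L-h+i)))/(h:ℝ)^2 := by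
  set F : ℤ → ℝ := fun s => k s (s+h) with hF
  have e1 := tel_shift F a L h
  have e2 := tel_shift F (a+L) L h
  have e : dh k a L h = ∑ i ∈ Finset.range h, (F (a-h+i+L) - F (a-h+i))
      - ∑ i ∈ Finset.range h, (F (a+L-h+i+L) - F (a+L-h+i)) := by
    unfold dh
    rw [Finset.sum_sub_distrib]
    congr 1
    · simp_rw [show ∀ i : ℕ, a-h+(i:ℤ)+L = a+L-h+i from fun i => by ring]
      rw [← e1]
      exact Finset.sum_congr rfl fun i _ => by simp [hF]
    · simp_rw [show ∀ i : ℕ, a+L-h+(i:ℤ)+L = a+L+L-h+i from fun i => by ring]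
      rw [← e2]
      exact Finset.sum_congr rfl fun i _ => by simp [hF]
  rw [e]
  refine (abs_sub _ _).trans (add_le_add ?_ ?_)
  all_goals
    refine (Finset.abs_sum_le_sum_abs _ _).trans ?_
    rw [Finset.sum_div]
    refine Finset.sum_le_sum fun i _ => ?_
    rw [abs_sub_comm]
    exact H.d1 _ _ h hh

lemma near_m (γ : ℤ → V) (k L h : ℕ) (hhL : h < L) (c : ℤ) (B : ℝ)
    (hB : ∀ t, c - L ≤ t → t < c + L →
      ‖Uf (fun t => γ (t+1) - γ t) k (t+L) - Uf (fun t => γ (t+1) - γ t) k t‖ ≤ B)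
    (j : ℕ) (hj : j < h) : mh γ L h (c-h+j) ≤ h * B + ∑ i ∈ Finset.range k,
      (‖Gf (fun t => γ (t+1) - γ t) i (c+j)‖ + ‖Gf (fun t => γ (t+1) - γ t) i (c-(h-j:ℕ))‖
      + (‖Gf (fun t => γ (t+1) - γ t) i (c+L+j)‖ + ‖Gf (fun t => γ (t+1) - γ t) i (c+L-(h-j:ℕ))‖)) := by
  set g : ℤ → V := fun t => γ (t+1) - γ t
  have hγ : ∀ t, γ t = gk γ k t + ∑ i ∈ Finset.range k, Gf g i t := fun t => by
    unfold gk; abel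
  have e : ((h-j:ℕ):ℤ) = h - j := by omega
  unfold mh
  rw [hγ (c-h+j+h), hγ (c-h+j), hγ (c-h+j+L+h), hγ (c-h+j+L)]
  rw [show c-h+(j:ℤ)+h = c+j by ring, show c-h+(j:ℤ)+L+h = c+L+j by ring,
    show c-h+(j:ℤ)+L = c+L-(h-j:ℕ) by rw [e]; ring, show c-h+(j:ℤ) = c-(h-j:ℕ) by rw [e]; ring]
  have s1 := gk_sum γ k (c-(h-j:ℕ)) h
  have s2 := gk_sum γ k (c+L-(h-j:ℕ)) h
  rw [show c-((h-j:ℕ):ℤ)+h = c+j by rw [e]; ring] at s1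
  rw [show c+L-((h-j:ℕ):ℤ)+h = c+L+j by rw [e]; ring] at s2
  have b1 : ‖(gk γ k (c+j) - gk γ k (c-(h-j:ℕ))) - (gk γ k (c+L+j) - gk γ k (c+L-(h-j:ℕ)))‖ ≤ h * B := by
    rw [s1, s2, ← Finset.sum_sub_distrib]
    refine (norm_sum_le _ _).trans ?_
    refine (Finset.sum_le_card_nsmul _ _ B ?_).trans (by simp)
    intro l hl
    rw [Finset.mem_range] at hl
    rw [norm_sub_rev, show c+L-((h-j:ℕ):ℤ)+l = c-((h-j:ℕ):ℤ)+l+L by ring]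
    exact hB _ (by omega) (by omega)
  have b2 : ‖(∑ i ∈ Finset.range k, Gf g i (c+j) - ∑ i ∈ Finset.range k, Gf g i (c-(h-j:ℕ)))
      - (∑ i ∈ Finset.range k, Gf g i (c+L+j) - ∑ i ∈ Finset.range k, Gf g i (c+L-(h-j:ℕ)))‖ ≤
      ∑ i ∈ Finset.range k, (‖Gf g i (c+j)‖ + ‖Gf g i (c-(h-j:ℕ))‖
      + (‖Gf g i (c+L+j)‖ + ‖Gf g i (c+L-(h-j:ℕ))‖)) := by
    simp_rw [← Finset.sum_sub_distrib]
    refine (norm_sum_le _ _).trans (Finset.sum_le_sum fun i _ => ?_)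
    refine (norm_sub_le _ _).trans (add_le_add (norm_sub_le _ _) (norm_sub_le _ _))
  refine le_trans (le_of_eq ?_) ((norm_add_le _ _).trans (add_le_add b1 b2))
  congr 1; abel

def Mp (g : ℤ → V) (i L : ℕ) (c : ℤ) : ℝ := ∑ h ∈ Finset.Ico 1 L, (∑ r ∈ Finset.range (h+1), ‖Gf g i (c+r)‖)/(h:ℝ)^2
def Mm (g : ℤ → V) (i L : ℕ) (c : ℤ) : ℝ := ∑ h ∈ Finset.Ico 1 L, (∑ r ∈ Finset.range (h+1), ‖Gf g i (c-r)‖)/(h:ℝ)^2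

lemma near_N (γ : ℤ → V) (k L : ℕ) (c : ℤ) (B : ℝ) (hB0 : 0 ≤ B)
    (hB : ∀ t, c - L ≤ t → t < c + L →
      ‖Uf (fun t => γ (t+1) - γ t) k (t+L) - Uf (fun t => γ (t+1) - γ t) k t‖ ≤ B) :
    ∑ h ∈ Finset.Ico 1 L, (∑ j ∈ Finset.range h, (mh γ L h (c-h+j)))/(h:ℝ)^2 ≤
      L * B + ∑ i ∈ Finset.range k, (Mp (fun t => γ (t+1) - γ t) i L c + Mm (fun t => γ (t+1) - γ t) i L c +
        (Mp (fun t => γ (t+1) - γ t) i L (c+L) + Mm (fun t => γ (t+1) - γ t) i L (c+L))) := by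
  set g : ℤ → V := fun t => γ (t+1) - γ t
  have hp : ∀ (i : ℕ) (h : ℕ) (c : ℤ), ∑ j ∈ Finset.range h, ‖Gf g i (c+j)‖ ≤
      ∑ r ∈ Finset.range (h+1), ‖Gf g i (c+r)‖ := fun i h c => by
    rw [Finset.sum_range_succ]; simp
  have hm : ∀ (i : ℕ) (h : ℕ) (c : ℤ), ∑ j ∈ Finset.range h, ‖Gf g i (c-(h-j:ℕ))‖ ≤
      ∑ r ∈ Finset.range (h+1), ‖Gf g i (c-r)‖ := fun i h c => by
    rw [← Finset.sum_range_reflect (fun r => ‖Gf g i (c-(r:ℕ))‖) (h+1), Finset.sum_range_succ]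
    simp
  have key : ∀ h ∈ Finset.Ico 1 L, (∑ j ∈ Finset.range h, (mh γ L h (c-h+j)))/(h:ℝ)^2 ≤
      B + ∑ i ∈ Finset.range k, ((∑ r ∈ Finset.range (h+1), ‖Gf g i (c+r)‖)/(h:ℝ)^2 +
        (∑ r ∈ Finset.range (h+1), ‖Gf g i (c-r)‖)/(h:ℝ)^2
        + ((∑ r ∈ Finset.range (h+1), ‖Gf g i (c+L+r)‖)/(h:ℝ)^2 +
          (∑ r ∈ Finset.range (h+1), ‖Gf g i (c+L-r)‖)/(h:ℝ)^2)) := by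
    intro h hh
    rw [Finset.mem_Ico] at hh
    have hh0 : (0:ℝ) < h := by exact_mod_cast hh.1
    have := Finset.sum_le_sum (fun j hj => near_m γ k L h hh.2 c B hB j (Finset.mem_range.1 hj))
    rw [div_le_iff₀ (by positivity)]
    refine this.trans ?_
    rw [Finset.sum_add_distrib, Finset.sum_comm, add_mul]
    refine add_le_add (le_of_eq (by simp; ring)) ?_
    rw [Finset.sum_mul]
    refine Finset.sum_le_sum fun i _ => ?_
    simp_rw [Finset.sum_add_distrib]
    have := hp i h c; have := hp i h (c+L); have := hm i h c; have := hm i h (c+L)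
    have e : ∀ x y z w : ℝ, (x/(h:ℝ)^2 + y/(h:ℝ)^2 + (z/(h:ℝ)^2 + w/(h:ℝ)^2)) * (h:ℝ)^2 = x + y + (z + w) := by
      intro x y z w; field_simp
    rw [e]; linarith
  refine (Finset.sum_le_sum key).trans ?_
  rw [Finset.sum_add_distrib, Finset.sum_comm]
  refine add_le_add ?_ (le_of_eq ?_)
  · simp only [Finset.sum_const, Nat.card_Ico, nsmul_eq_mul]
    have : ((L-1:ℕ):ℝ) ≤ L := by exact_mod_cast Nat.sub_le _ _
    gcongr
  · refine Finset.sum_congr rfl fun i _ => ?_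
    simp only [Finset.sum_add_distrib, Mp, Mm]

lemma Mp_sq (g : ℤ → V) (i L : ℕ) (c : ℤ) (hc : (2^(i+1):ℤ) ∣ c) (S : Finset ℤ)
    (hS : Finset.Ico c (c+L) ⊆ S) : Mp g i L c ≤ √(12 * 2^i * ∑ t ∈ S, yf g i t^2) := by
  refine Real.le_sqrt_of_sq_le ?_
  have := swap_bound L i (fun r => ‖Gf g i (c+r)‖) (fun r => yf g i (c+r)) (fun _ => norm_nonneg _)
    (fun _ => yf_nonneg _ _ _) (fun r => by simpa using Gf_le' g i c (c+r) hc) (fun r => Gf_le _ _ _)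
  refine this.trans ?_
  gcongr
  exact sum_inj_le (f := fun t => yf g i t^2) (fun _ => sq_nonneg _) (fun r : ℕ => c + r)
    (fun x _ y _ h => by simpa using h) (fun r hr => hS (by simp at hr ⊢; omega))

lemma Mm_sq (g : ℤ → V) (i L : ℕ) (c : ℤ) (hc : (2^(i+1):ℤ) ∣ c) (S : Finset ℤ)
    (hS : Finset.Ioc (c-L) c ⊆ S) : Mm g i L c ≤ √(12 * 2^i * ∑ t ∈ S, yf g i t^2) := by
  refine Real.le_sqrt_of_sq_le ?_
  have := swap_bound L i (fun r => ‖Gf g i (c-r)‖) (fun r => yf g i (c-r)) (fun _ => norm_nonneg _)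
    (fun _ => yf_nonneg _ _ _) (fun r => by simpa using Gf_le' g i c (c-r) hc) (fun r => Gf_le _ _ _)
  refine this.trans ?_
  gcongr
  exact sum_inj_le (f := fun t => yf g i t^2) (fun _ => sq_nonneg _) (fun r : ℕ => c - r)
    (fun x _ y _ h => by simpa using h) (fun r hr => hS (by simp at hr ⊢; omega))

lemma near_final {γ : ℤ → V} {κ : ℤ → ℤ → ℝ} (H : KH γ κ) (k L : ℕ) (hL : L = 2^k) (a : ℤ) (ha : (L:ℤ) ∣ a)
    (B : ℝ) (hB0 : 0 ≤ B) (hB : ∀ t, a - L ≤ t → t < a + 2*L →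
      ‖Uf (fun t => γ (t+1) - γ t) k (t+L) - Uf (fun t => γ (t+1) - γ t) k t‖ ≤ B) :
    (∑ h ∈ Finset.Ico 1 L, |dh κ a L h|)^2 ≤ 8*L^2*B^2 + 4608 * ∑ i ∈ Finset.range k, (4/3)^(k-i) *
      (2^i * ∑ t ∈ Finset.Ico (a-L) (a+3*L), yf (fun t => γ (t+1) - γ t) i t^2) := by
  have h0 := Finset.sum_le_sum (fun h (hh : h ∈ Finset.Ico 1 L) => near_h H a L h (Finset.mem_Ico.1 hh).1)
  rw [Finset.sum_add_distrib] at h0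
  have h1 := near_N γ k L a B hB0 (fun t h1 h2 => hB t h1 (by omega))
  have h2 := near_N γ k L (a+L) B hB0 (fun t h1 h2 => hB t (by omega) (by omega))
  set g : ℤ → V := fun t => γ (t+1) - γ t
  set Z : ℕ → ℝ := fun i => 2^i * ∑ t ∈ Finset.Ico (a-L) (a+3*L), yf g i t^2 with hZ
  have hZ0 : ∀ i, 0 ≤ Z i := fun i => mul_nonneg (by positivity) (Finset.sum_nonneg fun _ _ => sq_nonneg _)
  have bp : ∀ i < k, ∀ c : ℤ, (c = a ∨ c = a + L ∨ c = a+L+L) → Mp g i L c ≤ √(12 * Z i) ∧ Mm g i L c ≤ √(12 * Z i) := by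
    intro i hi c hc
    have hL0 : 0 < L := by rw [hL]; positivity
    have hd : (2^(i+1):ℤ) ∣ L := by
      rw [hL]; push_cast; exact pow_dvd_pow _ hi
    have hda : (2^(i+1):ℤ) ∣ a := hd.trans ha
    have hdc : (2^(i+1):ℤ) ∣ c := by
      rcases hc with rfl | rfl | rfl
      · exact hda
      · exact dvd_add hda hd
      · exact dvd_add (dvd_add hda hd) hd
    rw [hZ]; simp only [← mul_assoc]
    refine ⟨Mp_sq g i L c hdc _ ?_, Mm_sq g i L c hdc _ ?_⟩
    · intro t ht; simp at ht ⊢; omega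
    · intro t ht; simp at ht ⊢; omega
  have h3 : ∑ h ∈ Finset.Ico 1 L, |dh κ a L h| ≤ 2*L*B + ∑ i ∈ Finset.range k, 8 * √(12 * Z i) := by
    refine h0.trans ((add_le_add h1 h2).trans ?_)
    have : ∀ x y z w : ℝ, x + y + (z + w) = (x + z) + (y + w) := by intros; ring
    rw [this, ← Finset.sum_add_distrib]
    refine add_le_add (le_of_eq (by ring)) (Finset.sum_le_sum fun i hi => ?_)
    have hi := Finset.mem_range.1 hi
    have a1 := bp i hi a (by simp); have a2 := bp i hi (a+L) (by simp); have a3 := bp i hi (a+L+L) (by simp)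
    linarith [a1.1, a1.2, a2.1, a2.2, a3.1, a3.2]
  have h4 : 0 ≤ ∑ h ∈ Finset.Ico 1 L, |dh κ a L h| := Finset.sum_nonneg fun _ _ => abs_nonneg _
  have h5 : (∑ i ∈ Finset.range k, 8 * √(12 * Z i))^2 ≤ 3 * ∑ i ∈ Finset.range k, (4/3)^(k-i) * (768 * Z i) := by
    have := csw (Finset.range k) (fun i => (3/4:ℝ)^(k-i)) (fun i => (4/3:ℝ)^(k-i) * (8 * √(12 * Z i)))
      (fun i _ => by positivity)
    have e1 : ∀ i, (3/4:ℝ)^(k-i) * ((4/3:ℝ)^(k-i) * (8 * √(12 * Z i))) = 8 * √(12 * Z i) := by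
      intro i; rw [← mul_assoc, ← mul_pow]; norm_num
    have e2 : ∀ i, (3/4:ℝ)^(k-i) * ((4/3:ℝ)^(k-i) * (8 * √(12 * Z i)))^2 = (4/3)^(k-i) * (768 * Z i) := by
      intro i
      have : (8 * √(12 * Z i))^2 = 768 * Z i := by
        rw [mul_pow, Real.sq_sqrt (mul_nonneg (by norm_num) (hZ0 i))]; ring
      have e : (3/4:ℝ)^(k-i) * (4/3)^(k-i) = 1 := by rw [← mul_pow]; norm_num
      rw [mul_pow, this]
      linear_combination (4/3)^(k-i) * (768 * Z i) * e
    simp_rw [e1, e2] at this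
    refine this.trans ?_
    have e3 : ∑ i ∈ Finset.range k, (3/4:ℝ)^(k-i) ≤ 3 := by
      rw [← Finset.sum_range_reflect]
      have : ∀ j ∈ Finset.range k, (3/4:ℝ)^(k-(k-1-j)) = (3/4) * (3/4)^j := by
        intro j hj; rw [Finset.mem_range] at hj
        rw [show k-(k-1-j) = j+1 by omega, pow_succ]; ring
      rw [Finset.sum_congr rfl this, ← Finset.mul_sum, geom_sum_eq (by norm_num)]
      have : (0:ℝ) ≤ (3/4)^k := by positivity
      rw [mul_div_assoc', div_le_iff_of_neg (by norm_num)]; linarith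
    refine mul_le_mul_of_nonneg_right e3 (Finset.sum_nonneg fun i _ => ?_)
    have := hZ0 i; positivity
  have h6 : ∑ i ∈ Finset.range k, (4/3:ℝ)^(k-i) * (768 * Z i) = 768 * ∑ i ∈ Finset.range k, (4/3)^(k-i) * Z i := by
    rw [Finset.mul_sum]; exact Finset.sum_congr rfl fun i _ => by ring
  have h7 := pow_le_pow_left₀ h4 h3 2
  rw [h6] at h5
  have : ∀ x y : ℝ, (x+y)^2 ≤ 2*x^2+2*y^2 := fun x y => by nlinarith [sq_nonneg (x-y)]
  have := this (2*L*B) (∑ i ∈ Finset.range k, 8 * √(12 * Z i))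
  nlinarith
end
end

section
/-! ## P1f : mid part of T1 -/
lemma sum_blocks_le (n m : ℕ) {f : ℤ → ℝ} (hf : ∀ t, 0 ≤ f t) (σ : ℤ) (S : Finset ℤ)
    (hS : ∀ t : ℤ, 0 ≤ t → t < n*m → t+σ ∈ S) :
    ∑ q ∈ Finset.range n, ∑ i ∈ Finset.range m, f ((q:ℤ)*m+i+σ) ≤ ∑ t ∈ S, f t := by
  rw [← Finset.sum_product' (Finset.range n) (Finset.range m) (fun q i => f ((q:ℤ)*m+i+σ))]
  refine sum_inj_le hf (fun x : ℕ × ℕ => (x.1:ℤ)*m+x.2+σ) ?_ ?_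
  · rintro ⟨q, i⟩ h1 ⟨q', i'⟩ h2 h
    simp only [Finset.coe_product, Finset.coe_range, Set.mem_prod, Set.mem_Iio] at h1 h2
    have h' : q*m+i = q'*m+i' := by
      have : (q:ℤ)*m+i = q'*m+i' := by simpa using h
      exact_mod_cast this
    have hm : 0 < m := by omega
    have e1 : (q*m+i)/m = q := by
      rw [mul_comm, Nat.mul_add_div hm, Nat.div_eq_of_lt h1.2, add_zero]
    have e2 : (q'*m+i')/m = q' := by
      rw [mul_comm, Nat.mul_add_div hm, Nat.div_eq_of_lt h2.2, add_zero]
    have : q = q' := by rw [← e1, h', e2]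
    subst this
    simp; omega
  · rintro ⟨q, i⟩ h
    simp only [Finset.mem_product, Finset.mem_range] at h
    apply hS
    · positivity
    · have h1 : (q:ℤ)+1 ≤ n := by exact_mod_cast h.1
      have h2 : (i:ℤ)+1 ≤ m := by exact_mod_cast h.2
      nlinarith [Int.natCast_nonneg m]

lemma mid_gen (n m : ℕ) (H : Finset ℕ) (c : ℕ → ℝ) (hc : ∀ h, 0 ≤ c h) (f : ℕ → ℤ → ℝ) (B : ℕ → ℝ)
    (hB : ∀ h ∈ H, ∑ q ∈ Finset.range n, ∑ i ∈ Finset.range m, f h ((q:ℤ)*m+i)^2 ≤ B h) :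
    ∑ q ∈ Finset.range n, (∑ h ∈ H, ∑ i ∈ Finset.range m, c h * f h ((q:ℤ)*m+i))^2 ≤
      (∑ h ∈ H, c h) * m * ∑ h ∈ H, c h * B h := by
  have key : ∀ q ∈ Finset.range n, (∑ h ∈ H, ∑ i ∈ Finset.range m, c h * f h ((q:ℤ)*m+i))^2 ≤
      ((∑ h ∈ H, c h) * m) * ∑ h ∈ H, c h * ∑ i ∈ Finset.range m, f h ((q:ℤ)*m+i)^2 := by
    intro q _
    have := csw (H ×ˢ Finset.range m) (fun x => c x.1) (fun x => f x.1 ((q:ℤ)*m+x.2)) (fun x _ => hc _)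
    rw [Finset.sum_product, Finset.sum_product, Finset.sum_product] at this
    refine this.trans (le_of_eq ?_)
    simp only [Finset.sum_const, Finset.card_range, nsmul_eq_mul, Finset.mul_sum, Finset.sum_mul]
    congr 1; ext h; simp only [mul_comm, mul_assoc, mul_left_comm]
  refine (Finset.sum_le_sum key).trans ?_
  rw [← Finset.mul_sum, Finset.sum_comm]
  refine mul_le_mul_of_nonneg_left (Finset.sum_le_sum fun h hh => ?_)
    (mul_nonneg (Finset.sum_nonneg fun h _ => hc h) (by positivity))
  rw [← Finset.mul_sum]
  exact mul_le_mul_of_nonneg_left (hB h hh) (hc h)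

section
variable {V : Type*} [NormedAddCommGroup V] [InnerProductSpace ℝ V]

def xf (g : ℤ → V) (k h : ℕ) (t : ℤ) : ℝ := ‖Uf g k (t+h) - Uf g k t‖
def Xf (g : ℤ → V) (k m h : ℕ) : ℝ := ∑ t ∈ (Wn m).filter (fun t : ℤ => t + (h:ℤ) ∈ Wn m), xf g k h t^2

lemma Uf_cell (g : ℤ → V) (k : ℕ) (p : ℤ) (i : ℕ) (hi : i < 2^k) : Uf g k (p*2^k+i) = lev g k p := by
  unfold Uf
  congr 1
  have : (i:ℤ) < 2^k := by exact_mod_cast hi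
  rw [Int.ediv_eq_iff_of_pos (by positivity)]
  constructor <;> nlinarith [Int.natCast_nonneg i]

lemma sum_Xf_le (g : ℤ → V) (k m T : ℕ) (hk : k ≤ m) :
    ∑ h ∈ Finset.Ico (2^k) T, Xf g k m h / (h:ℝ)^2 ≤ 4 * Nf (m-k) (lev g k) := by
  set F : ℤ → ℤ → ℝ := fun t t' => if 2^k ≤ t' - t then ‖Uf g k t' - Uf g k t‖^2/((t'-t:ℤ):ℝ)^2 else 0 with hF
  have hF0 : ∀ t t', 0 ≤ F t t' := fun t t' => by
    simp only [hF]; split_ifs <;> positivity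
  have s1 : ∑ h ∈ Finset.Ico (2^k) T, Xf g k m h / (h:ℝ)^2 ≤ ∑ t ∈ Wn m, ∑ t' ∈ Wn m, F t t' := by
    have e : ∀ h ∈ Finset.Ico (2^k) T, Xf g k m h / (h:ℝ)^2 =
        ∑ t ∈ Wn m, if t + h ∈ Wn m then F t (t+h) else 0 := by
      intro h hh
      rw [Xf, Finset.sum_filter, Finset.sum_div]
      refine Finset.sum_congr rfl fun t _ => ?_
      have h1 : (2^k:ℤ) ≤ h := by exact_mod_cast (Finset.mem_Ico.1 hh).1
      split_ifs
      · simp only [hF]; rw [if_pos (by linarith)]; simp [xf]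
      · simp
    rw [Finset.sum_congr rfl e, Finset.sum_comm]
    refine Finset.sum_le_sum fun t _ => ?_
    rw [← Finset.sum_filter]
    exact sum_inj_le (hF0 t) (fun h : ℕ => t + h) (fun x _ y _ h => by simpa using h)
      (fun h hh => (Finset.mem_filter.1 hh).2)
  refine s1.trans ?_
  obtain ⟨d, rfl⟩ : ∃ d, m = d + k := ⟨m-k, by omega⟩
  rw [Nat.add_sub_cancel]
  rw [← sum_W_cell (fun t => ∑ t' ∈ Wn (d+k), F t t') d k]
  simp_rw [fun t => (sum_W_cell (F t) d k).symm]
  unfold Nf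
  rw [Finset.mul_sum]
  refine Finset.sum_le_sum fun p _ => ?_
  rw [Finset.sum_comm, Finset.mul_sum]
  refine Finset.sum_le_sum fun q _ => ?_
  have hL : (0:ℝ) < 2^k := by positivity
  have pt : ∀ i ∈ Finset.range (2^k), ∀ l ∈ Finset.range (2^k), F (p*2^k+i) (q*2^k+l) ≤
      4 * (‖lev g k p - lev g k q‖^2/((p-q:ℤ):ℝ)^2)/(2^k*2^k) := by
    intro i hi l hl
    rw [Finset.mem_range] at hi hl
    simp only [hF]
    split_ifs with hc
    · rw [Uf_cell g k p i hi, Uf_cell g k q l hl, norm_sub_rev]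
      have hi' : (i:ℝ) < 2^k := by exact_mod_cast hi
      have hl' : (l:ℝ) < 2^k := by exact_mod_cast hl
      have hc' : (2^k:ℝ) ≤ ((q*2^k+l - (p*2^k+i):ℤ):ℝ) := by exact_mod_cast hc
      set D : ℝ := ((q*2^k+l - (p*2^k+i):ℤ):ℝ) with hD
      have hD' : D = (q-p:ℝ)*2^k + l - i := by rw [hD]; push_cast; ring
      have hDpos : 0 < D := by linarith
      have i0 : (0:ℝ) ≤ i := by positivity
      have l0 : (0:ℝ) ≤ l := by positivity
      have hqp : 0 < (q-p:ℝ) := by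
        by_contra hcon
        push Not at hcon
        nlinarith
      have hb : (q-p:ℝ)*2^k ≤ 2*D := by linarith
      have e : ((p-q:ℤ):ℝ)^2 = (q-p:ℝ)^2 := by push_cast; ring
      rw [e]
      have : (q-p:ℝ)^2*(2^k*2^k) ≤ 4*D^2 := by
        have h0 : 0 ≤ (q-p:ℝ)*2^k := by positivity
        nlinarith
      have h0 := sq_nonneg ‖lev g k p - lev g k q‖
      rw [mul_div_assoc', div_div, div_le_div_iff₀ (by positivity) (by positivity)]
      nlinarith
    · positivity
  refine (Finset.sum_le_sum fun i hi => Finset.sum_le_sum fun l hl => pt i hi l hl).trans (le_of_eq ?_)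
  simp only [Finset.sum_const, Finset.card_range, nsmul_eq_mul]
  push_cast
  field_simp

def Ef (g : ℤ → V) (k h : ℕ) (s : ℤ) : ℝ :=
  ∑ i ∈ Finset.range k, (2:ℝ)^i * (yf g i (s+h) + yf g i (s-h) + 2 * yf g i s)
def Pf (g : ℤ → V) (k L h : ℕ) (s : ℤ) : ℝ := ∑ j ∈ Finset.range L, (xf g k h (s+j) + xf g k h (s+j-h))
def Qf (g : ℤ → V) (k h : ℕ) (s : ℤ) : ℝ := ∑ j ∈ Finset.range h, xf g k h (s+j-h)

lemma Ef_nonneg (g : ℤ → V) (k h : ℕ) (s : ℤ) : 0 ≤ Ef g k h s :=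
  Finset.sum_nonneg fun i _ => mul_nonneg (by positivity)
    (by have := yf_nonneg g i (s+h); have := yf_nonneg g i (s-h); have := yf_nonneg g i s; positivity)

lemma Dh_le (γ : ℤ → V) (k h : ℕ) (s : ℤ) : ‖γ (s+h) + γ (s-h) - (2:ℝ)•γ s‖ ≤
    Qf (fun t => γ (t+1) - γ t) k h s + Ef (fun t => γ (t+1) - γ t) k h s := by
  set g : ℤ → V := fun t => γ (t+1) - γ t
  have hγ : ∀ t, γ t = gk γ k t + ∑ i ∈ Finset.range k, Gf g i t := fun t => by
    unfold gk; abel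
  have s1 := gk_sum γ k s h
  have s2 := gk_sum γ k (s-h) h
  rw [sub_add_cancel] at s2
  have e : γ (s+h) + γ (s-h) - (2:ℝ)•γ s = ((gk γ k (s+h) - gk γ k s) - (gk γ k s - gk γ k (s-h)))
      + ∑ i ∈ Finset.range k, (Gf g i (s+h) + Gf g i (s-h) - (2:ℝ) • Gf g i s) := by
    rw [hγ (s+h), hγ (s-h), hγ s, Finset.sum_sub_distrib, Finset.sum_add_distrib, ← Finset.smul_sum]
    module
  rw [e]
  refine (norm_add_le _ _).trans (add_le_add ?_ ?_)
  · rw [s1, s2, ← Finset.sum_sub_distrib]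
    refine (norm_sum_le _ _).trans (Finset.sum_le_sum fun j _ => le_of_eq ?_)
    unfold xf
    rw [show s+(j:ℤ)-h+h = s+j by ring, show s+(j:ℤ)-h = s-h+j by ring]
  · refine (norm_sum_le _ _).trans (Finset.sum_le_sum fun i _ => ?_)
    refine (norm_sub_le _ _).trans ?_
    have h1 := norm_add_le (Gf g i (s+h)) (Gf g i (s-h))
    have h2 : ‖(2:ℝ) • Gf g i s‖ = 2 * ‖Gf g i s‖ := by rw [norm_smul]; simp
    have := Gf_le g i (s+h); have := Gf_le g i (s-h); have := Gf_le g i s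
    linarith

lemma DDh_le (γ : ℤ → V) (k L h : ℕ) (s : ℤ) :
    ‖(γ (s+h) + γ (s-h) - (2:ℝ)•γ s) - (γ (s+L+h) + γ (s+L-h) - (2:ℝ)•γ (s+L))‖ ≤
    Pf (fun t => γ (t+1) - γ t) k L h s + (Ef (fun t => γ (t+1) - γ t) k h s
      + Ef (fun t => γ (t+1) - γ t) k h (s+L)) := by
  set g : ℤ → V := fun t => γ (t+1) - γ t
  have hγ : ∀ t, γ t = gk γ k t + ∑ i ∈ Finset.range k, Gf g i t := fun t => by
    unfold gk; abel
  have s1 := gk_sum γ k (s+h) L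
  have s2 := gk_sum γ k (s-h) L
  have s3 := gk_sum γ k s L
  rw [show s+(h:ℤ)+L = s+L+h by ring] at s1
  rw [show s-(h:ℤ)+L = s+L-h by ring] at s2
  have e : (γ (s+h) + γ (s-h) - (2:ℝ)•γ s) - (γ (s+L+h) + γ (s+L-h) - (2:ℝ)•γ (s+L)) =
      (((gk γ k (s+L) - gk γ k s) - (gk γ k (s+L-h) - gk γ k (s-h)))
        - ((gk γ k (s+L+h) - gk γ k (s+h)) - (gk γ k (s+L) - gk γ k s)))
      + (∑ i ∈ Finset.range k, (Gf g i (s+h) + Gf g i (s-h) - (2:ℝ) • Gf g i s)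
        - ∑ i ∈ Finset.range k, (Gf g i (s+L+h) + Gf g i (s+L-h) - (2:ℝ) • Gf g i (s+L))) := by
    rw [hγ (s+h), hγ (s-h), hγ s, hγ (s+L+h), hγ (s+L-h), hγ (s+L)]
    simp only [Finset.sum_sub_distrib, Finset.sum_add_distrib, ← Finset.smul_sum]
    module
  have hE : ∀ s, ‖∑ i ∈ Finset.range k, (Gf g i (s+h) + Gf g i (s-h) - (2:ℝ) • Gf g i s)‖ ≤ Ef g k h s := by
    intro s
    refine (norm_sum_le _ _).trans (Finset.sum_le_sum fun i _ => ?_)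
    refine (norm_sub_le _ _).trans ?_
    have h1 := norm_add_le (Gf g i (s+h)) (Gf g i (s-h))
    have h2 : ‖(2:ℝ) • Gf g i s‖ = 2 * ‖Gf g i s‖ := by rw [norm_smul]; simp
    have := Gf_le g i (s+h); have := Gf_le g i (s-h); have := Gf_le g i s
    linarith
  rw [e]
  refine (norm_add_le _ _).trans (add_le_add ?_ ((norm_sub_le _ _).trans (add_le_add (hE s) (hE (s+L)))))
  rw [s1, s2, s3]
  simp only [← Finset.sum_sub_distrib]
  refine (norm_sum_le _ _).trans (Finset.sum_le_sum fun j _ => ?_)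
  rw [add_comm (xf g k h (s+j))]
  refine (norm_sub_le _ _).trans (le_of_eq ?_)
  unfold xf
  rw [show s+(j:ℤ)-h+h = s+j by ring, show s+(j:ℤ)-h = s-h+j by ring, show s+(h:ℤ)+j = s+j+h by ring]

lemma mid_h {γ : ℤ → V} {κ : ℤ → ℤ → ℝ} (H : KH γ κ) (k L h : ℕ) (hL : 0 < L) (hh : L ≤ h) (a : ℤ) :
    |dh κ a L h| ≤ ∑ i ∈ Finset.range (2*L), (1/(h:ℝ)^2 * Pf (fun t => γ (t+1) - γ t) k L h (a+i)) +
      ∑ i ∈ Finset.range (2*L), ((L:ℝ)/(h:ℝ)^2 * (Qf (fun t => γ (t+1) - γ t) k h (a+i)/h)) +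
      ∑ i ∈ Finset.range (2*L), (1/(h:ℝ)^2 * (2 * Ef (fun t => γ (t+1) - γ t) k h (a+i))) := by
  have hh0 : (0:ℝ) < h := by exact_mod_cast lt_of_lt_of_le hL hh
  have hLh : (L:ℝ) ≤ h := by exact_mod_cast hh
  unfold dh
  refine (Finset.abs_sum_le_sum_abs _ _).trans ?_
  set g : ℤ → V := fun t => γ (t+1) - γ t
  have pt : ∀ i ∈ Finset.range L, |(κ (a+i) (a+i+h) - κ (a+i-h) (a+i)) - (κ (a+L+i) (a+L+i+h) - κ (a+L+i-h) (a+L+i))|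
     ≤ 1/(h:ℝ)^2 * Pf g k L h (a+i) + ((L:ℝ)/(h:ℝ)^2 * (Qf g k h (a+i)/h) + (L:ℝ)/(h:ℝ)^2 * (Qf g k h (a+(L+i:ℕ))/h))
      + (1/(h:ℝ)^2 * (2 * Ef g k h (a+i)) + 1/(h:ℝ)^2 * (2 * Ef g k h (a+(L+i:ℕ)))) := by
    intro i _
    have e : a+((L+i:ℕ):ℤ) = a+i+L := by push_cast; ring
    have e' : a+(L:ℤ)+i = a+i+L := by ring
    rw [e, e']
    refine (H.d2 (a+i) (a+i+L) h (by omega)).trans ?_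
    have e2 : |((a+i:ℤ):ℝ) - ((a+i+L:ℤ):ℝ)| = L := by
      push_cast; rw [sub_add_cancel_left, abs_neg, abs_of_nonneg (by positivity)]
    rw [e2]
    have h1 := DDh_le γ k L h (a+i)
    have h2 := Dh_le γ k h (a+i)
    have h3 := Dh_le γ k h (a+i+L)
    have E1 := Ef_nonneg g k h (a+i)
    have E2 := Ef_nonneg g k h (a+i+L)
    refine (add_le_add (div_le_div_of_nonneg_right h1 (by positivity))
      (div_le_div_of_nonneg_right (mul_le_mul_of_nonneg_right (add_le_add h2 h3) (by positivity))
        (by positivity))).trans ?_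
    have : (L:ℝ)/h^3 ≤ 1/h^2 := by
      rw [div_le_div_iff₀ (by positivity) (by positivity)]
      nlinarith [pow_pos hh0 2]
    have e3 : ∀ q q' e e' : ℝ, (q + e + (q' + e')) * L / (h:ℝ)^3 = (L:ℝ)/(h:ℝ)^2 * (q/h) + (L:ℝ)/(h:ℝ)^2 * (q'/h) + (L:ℝ)/h^3 * (e+e') := by
      intro q q' e e'; field_simp; ring
    rw [e3, add_div]
    have := mul_le_mul_of_nonneg_right this (add_nonneg E1 E2)
    have e4 : ∀ x y : ℝ, x/(h:ℝ)^2 + y = 1/(h:ℝ)^2 * x + y := by intros; ring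
    rw [div_eq_inv_mul, div_eq_inv_mul (_ + _)]
    rw [one_div] at *
    linarith
  refine (Finset.sum_le_sum pt).trans ?_
  have nnP : ∀ s, 0 ≤ 1/(h:ℝ)^2 * Pf g k L h s := fun s => mul_nonneg (by positivity)
    (Finset.sum_nonneg fun j _ => add_nonneg (norm_nonneg _) (norm_nonneg _))
  rw [Finset.sum_add_distrib, Finset.sum_add_distrib, Finset.sum_add_distrib, Finset.sum_add_distrib, two_mul]
  simp only [Finset.sum_range_add]
  have := Finset.sum_nonneg (s := Finset.range L) fun i _ => nnP (a + ((L+i:ℕ):ℤ))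
  linarith
end
end

section
section
variable {V : Type*} [NormedAddCommGroup V] [InnerProductSpace ℝ V]

def om (g : ℤ → V) (m i : ℕ) : ℝ := ∑ t ∈ Wn m, yf g i t^2

lemma om_nonneg (g : ℤ → V) (m i : ℕ) : 0 ≤ om g m i := Finset.sum_nonneg fun _ _ => sq_nonneg _

lemma om_eq (g : ℤ → V) (m i : ℕ) (hi : i < m) : om g m i = 2^(i+1) * En (m-(i+1)) (hr (lev g i)) := by
  obtain ⟨d, rfl⟩ : ∃ d, m = d + (i+1) := ⟨m-(i+1), by omega⟩
  rw [om, ← sum_W_cell, Nat.add_sub_cancel, En, Finset.mul_sum]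
  refine Finset.sum_congr rfl fun p _ => ?_
  rw [Finset.sum_congr rfl (g := fun _ => ‖hr (lev g i) p‖^2)]
  · simp
  · intro j hj
    rw [Finset.mem_range] at hj
    unfold yf
    congr 4
    have : (j:ℤ) < 2^(i+1) := by exact_mod_cast hj
    rw [Int.ediv_eq_iff_of_pos (by positivity)]
    constructor <;> nlinarith [Int.natCast_nonneg j]

lemma om_total (g : ℤ → V) (m K : ℕ) (hK : K ≤ m) : ∑ i ∈ Finset.range K, om g m i ≤ En m g := by
  refine (Finset.sum_le_sum_of_subset_of_nonneg (Finset.range_mono hK) fun i _ _ => om_nonneg g m i).trans ?_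
  refine le_trans (le_of_eq ?_) (haar_total m g)
  exact Finset.sum_congr rfl fun i hi => om_eq g m i (Finset.mem_range.1 hi)

lemma sq_sum_range_le (n : ℕ) (x : ℕ → ℝ) : (∑ i ∈ Finset.range n, x i)^2 ≤ n * ∑ i ∈ Finset.range n, x i^2 := by
  have := sq_sum_le_card_mul_sum_sq (s := Finset.range n) (f := x)
  simpa using this

lemma mem_Wn2 (K : ℕ) (t : ℤ) (h1 : -4*2^K ≤ t) (h2 : t < 4*2^K) : t ∈ Wn (K+2) := by
  rw [mem_Wn, pow_add]; constructor <;> linarith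

variable (g : ℤ → V) (K k L n h : ℕ)

lemma Pf_B (hn : n*(2*L) = 2^K) (hLh : L ≤ h) (hh : h < 2^K) :
    ∑ q ∈ Finset.range n, ∑ i ∈ Finset.range (2*L), Pf g k L h ((q:ℤ)*(2*L:ℕ)+i)^2 ≤ 4*(L:ℝ)^2*Xf g k (K+2) h := by
  have hnz : ((n:ℤ)*(2*L:ℕ)) = 2^K := by exact_mod_cast hn
  have hhz : (h:ℤ) < 2^K := by exact_mod_cast hh
  have hLz : (L:ℤ) ≤ h := by exact_mod_cast hLh
  have p1 : ∀ s, Pf g k L h s^2 ≤ 2*L*∑ j ∈ Finset.range L, (xf g k h (s+j)^2 + xf g k h (s+j-h)^2) := by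
    intro s
    refine (sq_sum_range_le L _).trans ?_
    rw [mul_comm 2 (L:ℝ), mul_assoc, Finset.mul_sum (Finset.range L) _ (2:ℝ)]
    refine mul_le_mul_of_nonneg_left (Finset.sum_le_sum fun j _ => ?_) (by positivity)
    nlinarith [sq_nonneg (xf g k h (s+j) - xf g k h (s+j-h))]
  refine (Finset.sum_le_sum fun q _ => Finset.sum_le_sum fun i _ => p1 _).trans ?_
  simp_rw [← Finset.mul_sum]
  have e : ∀ q : ℕ, ∑ i ∈ Finset.range (2*L), ∑ j ∈ Finset.range L, (xf g k h ((q:ℤ)*(2*L:ℕ)+i+j)^2 + xf g k h ((q:ℤ)*(2*L:ℕ)+i+j-h)^2)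
     = ∑ j ∈ Finset.range L, (∑ i ∈ Finset.range (2*L), xf g k h ((q:ℤ)*(2*L:ℕ)+i+(j:ℤ))^2 + ∑ i ∈ Finset.range (2*L), xf g k h ((q:ℤ)*(2*L:ℕ)+i+((j:ℤ)-h))^2) := by
    intro q
    rw [Finset.sum_comm]
    refine Finset.sum_congr rfl fun j _ => ?_
    rw [Finset.sum_add_distrib]
    simp only [add_sub_assoc]
  simp_rw [e]
  rw [Finset.sum_comm]
  have : ∀ j ∈ Finset.range L, ∑ q ∈ Finset.range n, (∑ i ∈ Finset.range (2*L), xf g k h ((q:ℤ)*(2*L:ℕ)+i+(j:ℤ))^2 + ∑ i ∈ Finset.range (2*L), xf g k h ((q:ℤ)*(2*L:ℕ)+i+((j:ℤ)-h))^2) ≤ 2*Xf g k (K+2) h := by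
    intro j hj
    have hj' : (j:ℤ) < L := by exact_mod_cast Finset.mem_range.1 hj
    have hj0 := Int.natCast_nonneg j
    have hh0 := Int.natCast_nonneg h
    rw [Finset.sum_add_distrib, two_mul (Xf g k (K+2) h)]
    refine add_le_add ?_ ?_ <;>
    · refine sum_blocks_le n (2*L) (f := fun t => xf g k h t^2) (fun t => sq_nonneg _) _ _ ?_
      intro t h0 h1
      rw [hnz] at h1
      rw [Finset.mem_filter]
      constructor <;> apply mem_Wn2 <;> linarith
  refine (mul_le_mul_of_nonneg_left (Finset.sum_le_sum this) (by positivity)).trans (le_of_eq ?_)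
  simp; ring

lemma Qf_B (hn : n*(2*L) = 2^K) (h0 : 0 < h) (hh : h < 2^K) :
    ∑ q ∈ Finset.range n, ∑ i ∈ Finset.range (2*L), (Qf g k h ((q:ℤ)*(2*L:ℕ)+i)/h)^2 ≤ Xf g k (K+2) h := by
  have hnz : ((n:ℤ)*(2*L:ℕ)) = 2^K := by exact_mod_cast hn
  have hhz : (h:ℤ) < 2^K := by exact_mod_cast hh
  have hp : (0:ℝ) < h := by exact_mod_cast h0
  have p1 : ∀ s, (Qf g k h s/h)^2 ≤ 1/h*∑ j ∈ Finset.range h, xf g k h (s+j-h)^2 := by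
    intro s
    have := sq_sum_range_le h (fun j => xf g k h (s+j-h))
    rw [div_pow, div_le_iff₀ (by positivity)]
    refine this.trans (le_of_eq ?_)
    field_simp
  refine (Finset.sum_le_sum fun q _ => Finset.sum_le_sum fun i _ => p1 _).trans ?_
  simp_rw [← Finset.mul_sum]
  have e : ∀ q : ℕ, ∑ i ∈ Finset.range (2*L), ∑ j ∈ Finset.range h, (xf g k h ((q:ℤ)*(2*L:ℕ)+i+j-h)^2)
     = ∑ j ∈ Finset.range h, (∑ i ∈ Finset.range (2*L), xf g k h ((q:ℤ)*(2*L:ℕ)+i+((j:ℤ)-h))^2) := by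
    intro q
    rw [Finset.sum_comm]
    simp only [add_sub_assoc]
  simp_rw [e]
  rw [Finset.sum_comm]
  have : ∀ j ∈ Finset.range h, ∑ q ∈ Finset.range n, (∑ i ∈ Finset.range (2*L), xf g k h ((q:ℤ)*(2*L:ℕ)+i+((j:ℤ)-h))^2) ≤ Xf g k (K+2) h := by
    intro j hj
    have hj' : (j:ℤ) < h := by exact_mod_cast Finset.mem_range.1 hj
    have hj0 := Int.natCast_nonneg j
    have hh0 := Int.natCast_nonneg h
    refine sum_blocks_le n (2*L) (f := fun t => xf g k h t^2) (fun t => sq_nonneg _) _ _ ?_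
    intro t h0 h1
    rw [hnz] at h1
    rw [Finset.mem_filter]
    constructor <;> apply mem_Wn2 <;> linarith
  refine (mul_le_mul_of_nonneg_left (Finset.sum_le_sum this) (by positivity)).trans (le_of_eq ?_)
  simp
  field_simp

lemma Ef_B (hL : L = 2^k) (hn : n*(2*L) = 2^K) (hh : h < 2^K) :
    ∑ q ∈ Finset.range n, ∑ i ∈ Finset.range (2*L), (2 * Ef g k h ((q:ℤ)*(2*L:ℕ)+i))^2 ≤
      64*L*∑ i ∈ Finset.range k, 2^i * om g (K+2) i := by
  have hnz : ((n:ℤ)*(2*L:ℕ)) = 2^K := by exact_mod_cast hn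
  have hhz : (h:ℤ) < 2^K := by exact_mod_cast hh
  have hh0 := Int.natCast_nonneg h
  have p1 : ∀ s, (2*Ef g k h s)^2 ≤ 16*L*∑ j ∈ Finset.range k, 2^j*(yf g j (s+h)^2 + yf g j (s+(-h))^2 + 2*yf g j (s+0)^2) := by
    intro s
    have := csw (Finset.range k) (fun i => (2:ℝ)^i) (fun i => (yf g i (s+h) + yf g i (s-h) + 2 * yf g i s)) (fun i _ => by positivity)
    have gs : ∑ i ∈ Finset.range k, (2:ℝ)^i ≤ L := by
      rw [geom_sum_eq (by norm_num), hL]; push_cast; linarith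
    rw [mul_pow]
    have h2 : Ef g k h s^2 ≤ L * ∑ j ∈ Finset.range k, 2^j*(4*(yf g j (s+h)^2 + yf g j (s+(-h))^2 + 2*yf g j (s+0)^2)) := by
      refine this.trans (mul_le_mul gs (Finset.sum_le_sum fun j _ => ?_) (Finset.sum_nonneg fun j _ => by positivity) (by positivity))
      refine mul_le_mul_of_nonneg_left ?_ (by positivity)
      rw [add_zero, ← sub_eq_add_neg]
      nlinarith [sq_nonneg (yf g j (s+h) - yf g j (s-h)), sq_nonneg (yf g j (s+h) - yf g j s), sq_nonneg (yf g j s - yf g j (s-h))]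
    have e : ∑ j ∈ Finset.range k, (2:ℝ)^j*(4*(yf g j (s+h)^2 + yf g j (s+(-h))^2 + 2*yf g j (s+0)^2)) = 4 * ∑ j ∈ Finset.range k, 2^j*(yf g j (s+h)^2 + yf g j (s+(-h))^2 + 2*yf g j (s+0)^2) := by
      rw [Finset.mul_sum]; refine Finset.sum_congr rfl fun j _ => by ring
    rw [e] at h2
    linarith
  refine (Finset.sum_le_sum fun q _ => Finset.sum_le_sum fun i _ => p1 _).trans ?_
  simp_rw [← Finset.mul_sum]
  have e : ∀ q : ℕ, ∑ i ∈ Finset.range (2*L), ∑ j ∈ Finset.range k, (2:ℝ)^j*(yf g j ((q:ℤ)*(2*L:ℕ)+i+h)^2 + yf g j ((q:ℤ)*(2*L:ℕ)+i+(-h))^2 + 2*yf g j ((q:ℤ)*(2*L:ℕ)+i+0)^2)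
     = ∑ j ∈ Finset.range k, 2^j*(∑ i ∈ Finset.range (2*L), yf g j ((q:ℤ)*(2*L:ℕ)+i+h)^2 + ∑ i ∈ Finset.range (2*L), yf g j ((q:ℤ)*(2*L:ℕ)+i+(-h))^2 + 2*∑ i ∈ Finset.range (2*L), yf g j ((q:ℤ)*(2*L:ℕ)+i+0)^2) := by
    intro q
    rw [Finset.sum_comm]
    refine Finset.sum_congr rfl fun j _ => ?_
    rw [← Finset.mul_sum, Finset.sum_add_distrib, Finset.sum_add_distrib, Finset.mul_sum]
  simp_rw [e]
  rw [Finset.sum_comm]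
  have : ∀ j ∈ Finset.range k, ∑ q ∈ Finset.range n, (2:ℝ)^j*(∑ i ∈ Finset.range (2*L), yf g j ((q:ℤ)*(2*L:ℕ)+i+h)^2 + ∑ i ∈ Finset.range (2*L), yf g j ((q:ℤ)*(2*L:ℕ)+i+(-h))^2 + 2*∑ i ∈ Finset.range (2*L), yf g j ((q:ℤ)*(2*L:ℕ)+i+0)^2) ≤ 4*(2^j*om g (K+2) j) := by
    intro j hj
    have : ∀ σ : ℤ, -2^K ≤ σ → σ ≤ 2^K → ∑ q ∈ Finset.range n, ∑ i ∈ Finset.range (2*L), yf g j ((q:ℤ)*(2*L:ℕ)+i+σ)^2 ≤ om g (K+2) j := by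
      intro σ h1 h2
      refine sum_blocks_le n (2*L) (f := fun t => yf g j t^2) (fun t => sq_nonneg _) _ _ ?_
      intro t h0 h1
      rw [hnz] at h1
      apply mem_Wn2 <;> linarith
    rw [← Finset.mul_sum, Finset.sum_add_distrib, Finset.sum_add_distrib, ← Finset.mul_sum, mul_left_comm]
    refine mul_le_mul_of_nonneg_left ?_ (by positivity)
    have a1 := this h (by linarith) (by linarith)
    have a2 := this (-h) (by linarith) (by linarith)
    have a3 := this 0 (by linarith) (by linarith)
    linarith
  refine (mul_le_mul_of_nonneg_left (Finset.sum_le_sum this) (by positivity)).trans (le_of_eq ?_)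
  rw [← Finset.mul_sum]; ring

end
end

section
section
variable {V : Type*} [NormedAddCommGroup V] [InnerProductSpace ℝ V]
variable {γ : ℤ → V} {κ : ℤ → ℤ → ℝ} (H : KH γ κ) (K k L n M : ℕ)
include H

lemma mid_sum (hL : L = 2^k) (hk : k < K) (hn : n*(2*L) = 2^K) :
    ∑ q ∈ Finset.range n, (∑ h ∈ Finset.Ico L (2^K), |dh κ ((q:ℤ)*(2*L:ℕ)) L h|)^2 ≤
      240*(L:ℝ)^2*Nf (K+2-k) (lev (fun t => γ (t+1) - γ t) k) +
      1536 * ∑ i ∈ Finset.range k, 2^i * om (fun t => γ (t+1) - γ t) (K+2) i := by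
  set g : ℤ → V := fun t => γ (t+1) - γ t with hg
  have L0 : 0 < L := by rw [hL]; positivity
  have Lp : (0:ℝ) < L := by exact_mod_cast L0
  set Hs := Finset.Ico L (2^K) with hHs
  have m1 := mid_gen n (2*L) Hs (fun h => 1/(h:ℝ)^2) (fun h => by positivity) (fun h => Pf g k L h) _
    (fun h hh => Pf_B g K k L n h hn (Finset.mem_Ico.1 hh).1 (Finset.mem_Ico.1 hh).2)
  have m2 := mid_gen n (2*L) Hs (fun h => (L:ℝ)/(h:ℝ)^2) (fun h => by positivity) (fun h s => Qf g k h s/h) _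
    (fun h hh => Qf_B g K k L n h hn (lt_of_lt_of_le L0 (Finset.mem_Ico.1 hh).1) (Finset.mem_Ico.1 hh).2)
  have m3 := mid_gen n (2*L) Hs (fun h => 1/(h:ℝ)^2) (fun h => by positivity) (fun h s => 2*Ef g k h s) _
    (fun h hh => Ef_B g K k L n h hL hn (Finset.mem_Ico.1 hh).2)
  set c0 := ∑ h ∈ Hs, 1/(h:ℝ)^2 with hc0
  have c0n : 0 ≤ c0 := Finset.sum_nonneg fun _ _ => by positivity
  have c0b : c0*L ≤ 2 := by
    have := sum_inv_sq_Ico L (2^K) L0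
    rwa [le_div_iff₀ Lp] at this
  set X := Nf (K+2-k) (lev g k)
  set S := ∑ i ∈ Finset.range k, 2^i * om g (K+2) i with hS
  have S0 : 0 ≤ S := Finset.sum_nonneg fun i _ => mul_nonneg (by positivity) (om_nonneg _ _ _)
  set Y := ∑ h ∈ Hs, Xf g k (K+2) h/(h:ℝ)^2 with hY
  have Y0 : 0 ≤ Y := Finset.sum_nonneg fun i _ => div_nonneg (Finset.sum_nonneg fun _ _ => sq_nonneg _) (by positivity)
  have Yb : Y ≤ 4*X := by
    have := sum_Xf_le g k (K+2) (2^K) (by omega)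
    rwa [← hL] at this
  have e1 : ∑ h ∈ Hs, 1/(h:ℝ)^2*(4*(L:ℝ)^2*Xf g k (K+2) h) = 4*(L:ℝ)^2*Y := by
    rw [hY, Finset.mul_sum]; exact Finset.sum_congr rfl fun _ _ => by ring
  have e2 : ∑ h ∈ Hs, (L:ℝ)/(h:ℝ)^2*(Xf g k (K+2) h) = L*Y := by
    rw [hY, Finset.mul_sum]; exact Finset.sum_congr rfl fun _ _ => by ring
  have e2' : ∑ h ∈ Hs, (L:ℝ)/(h:ℝ)^2 = L*c0 := by
    rw [hc0, Finset.mul_sum]; exact Finset.sum_congr rfl fun _ _ => by ring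
  have e3 : ∑ h ∈ Hs, 1/(h:ℝ)^2*(64*L*S) = 64*L*S*c0 := by
    rw [← Finset.sum_mul, mul_comm]
  rw [e1] at m1; rw [e2, e2'] at m2; rw [e3] at m3
  push_cast at m1 m2 m3
  have b1 : c0*(2*L)*(4*(L:ℝ)^2*Y) ≤ 64*L^2*X := by
    have : (c0*L)*Y ≤ 2*(4*X) := mul_le_mul c0b Yb Y0 (by norm_num)
    nlinarith [mul_le_mul_of_nonneg_left this (show 0 ≤ 8*(L:ℝ)^2 by positivity)]
  have b2 : L*c0*(2*L)*((L:ℝ)*Y) ≤ 16*L^2*X := by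
    have : (c0*L)*Y ≤ 2*(4*X) := mul_le_mul c0b Yb Y0 (by norm_num)
    nlinarith [mul_le_mul_of_nonneg_left this (show 0 ≤ 2*(L:ℝ)^2 by positivity)]
  have b3 : c0*(2*L)*(64*(L:ℝ)*S*c0) ≤ 512*S := by
    have : (c0*L)*(c0*L) ≤ 2*2 := mul_le_mul c0b c0b (by positivity) (by norm_num)
    nlinarith [mul_le_mul_of_nonneg_left this (show 0 ≤ 128*S by positivity)]
  have key : ∀ q ∈ Finset.range n, (∑ h ∈ Hs, |dh κ ((q:ℤ)*(2*L:ℕ)) L h|)^2 ≤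
     3*((∑ h ∈ Hs, ∑ i ∈ Finset.range (2*L), 1/(h:ℝ)^2 * Pf g k L h ((q:ℤ)*(2*L:ℕ)+i))^2 +
       (∑ h ∈ Hs, ∑ i ∈ Finset.range (2*L), (L:ℝ)/(h:ℝ)^2 * (Qf g k h ((q:ℤ)*(2*L:ℕ)+i)/h))^2 +
       (∑ h ∈ Hs, ∑ i ∈ Finset.range (2*L), 1/(h:ℝ)^2 * (2*Ef g k h ((q:ℤ)*(2*L:ℕ)+i)))^2) := by
    intro q _
    have := Finset.sum_le_sum fun h (hh : h ∈ Hs) => mid_h H k L h L0 (Finset.mem_Ico.1 hh).1 ((q:ℤ)*(2*L:ℕ))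
    rw [Finset.sum_add_distrib, Finset.sum_add_distrib] at this
    have h0 : 0 ≤ ∑ h ∈ Hs, |dh κ ((q:ℤ)*(2*L:ℕ)) L h| := Finset.sum_nonneg fun _ _ => abs_nonneg _
    refine (pow_le_pow_left₀ h0 this 2).trans ?_
    generalize (∑ h ∈ Hs, ∑ i ∈ Finset.range (2*L), 1/(h:ℝ)^2 * Pf g k L h ((q:ℤ)*(2*L:ℕ)+i)) = x
    generalize (∑ h ∈ Hs, ∑ i ∈ Finset.range (2*L), (L:ℝ)/(h:ℝ)^2 * (Qf g k h ((q:ℤ)*(2*L:ℕ)+i)/h)) = y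
    generalize (∑ h ∈ Hs, ∑ i ∈ Finset.range (2*L), 1/(h:ℝ)^2 * (2*Ef g k h ((q:ℤ)*(2*L:ℕ)+i))) = z
    nlinarith [sq_nonneg (x-y), sq_nonneg (x-z), sq_nonneg (y-z)]
  refine (Finset.sum_le_sum key).trans ?_
  rw [← Finset.mul_sum, Finset.sum_add_distrib, Finset.sum_add_distrib]
  push_cast
  linarith

lemma near_sum (hL : L = 2^k) (hk : k < K) (hn : n*(2*L) = 2^K) :
    ∑ q ∈ Finset.range n, (∑ h ∈ Finset.Ico 1 L, |dh κ ((q:ℤ)*(2*L:ℕ)) L h|)^2 ≤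
      72*(L:ℝ)^2*Nf (K+2-k) (lev (fun t => γ (t+1) - γ t) k) +
      9216 * ∑ i ∈ Finset.range k, (4/3)^(k-i)*(2^i * om (fun t => γ (t+1) - γ t) (K+2) i) := by
  set g : ℤ → V := fun t => γ (t+1) - γ t with hg
  have L0 : 0 < L := by rw [hL]; positivity
  have Lz : (0:ℤ) < L := by exact_mod_cast L0
  have hnz : ((n:ℤ)*(2*L:ℕ)) = 2^K := by exact_mod_cast hn
  set d : ℤ → ℝ := fun p => ‖lev g k (p+1) - lev g k p‖ with hd
  have d0 : ∀ p, 0 ≤ d p := fun p => norm_nonneg _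
  set Bq : ℕ → ℝ := fun q => d (2*q-1) + d (2*q) + d (2*q+1) with hBq
  have UL : ∀ t, Uf g k (t+L) = lev g k (t/2^k+1) := by
    intro t; unfold Uf
    congr 1
    rw [hL]; push_cast
    rw [Int.add_ediv_of_dvd_right (dvd_refl _), Int.ediv_self (by positivity)]
  have key : ∀ q ∈ Finset.range n, (∑ h ∈ Finset.Ico 1 L, |dh κ ((q:ℤ)*(2*L:ℕ)) L h|)^2 ≤
      8*L^2*Bq q^2 + 4608 * ∑ i ∈ Finset.range k, (4/3)^(k-i) *
      (2^i * ∑ t ∈ Finset.Ico ((q:ℤ)*(2*L:ℕ)-L) ((q:ℤ)*(2*L:ℕ)+3*L), yf g i t^2) := by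
    intro q _
    refine near_final H k L hL _ ⟨2*q, by push_cast; ring⟩ (Bq q) (by have := d0 (2*q-1); have := d0 (2*q); have := d0 (2*q+1); positivity) ?_
    intro t h1 h2
    rw [UL, Uf]
    push_cast at h1 h2
    have hLz : (2:ℤ)^k = L := by rw [hL]; push_cast; rfl
    rw [hLz]
    have c1 : 2*(q:ℤ)-1 ≤ t/L := by rw [Int.le_ediv_iff_mul_le Lz]; linarith
    have c2 : t/L < 2*(q:ℤ)+2 := by rw [Int.ediv_lt_iff_lt_mul Lz]; linarith
    have : t/L = 2*q-1 ∨ t/L = 2*q ∨ t/L = 2*q+1 := by omega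
    have x1 := d0 (2*q-1); have x2 := d0 (2*q); have x3 := d0 (2*q+1)
    change d (t/L) ≤ _
    rcases this with h | h | h <;> rw [h] <;> simp only [hBq] <;> linarith
  refine (Finset.sum_le_sum key).trans ?_
  rw [Finset.sum_add_distrib, ← Finset.mul_sum, ← Finset.mul_sum]
  have nb : n*2 = 2^(K-k) := by
    have : n*2*2^k = 2^(K-k)*2^k := by rw [← pow_add, Nat.sub_add_cancel hk.le, ← hn, hL]; ring
    exact Nat.eq_of_mul_eq_mul_right (by positivity) this
  have nbz : (n:ℤ)*2 = 2^(K-k) := by exact_mod_cast nb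
  refine add_le_add ?_ ?_
  · have dsum : ∀ σ : ℤ, -1 ≤ σ → σ ≤ 1 → ∑ q ∈ Finset.range n, d (2*q+σ)^2 ≤ Nf (K+2-k) (lev g k) := by
      intro σ h1 h2
      have := sum_inj_le (A := Finset.range n) (S := (Wn (K+2-k)).filter (fun p : ℤ => p+1 ∈ Wn (K+2-k))) (f := fun p => d p^2)
        (fun t => sq_nonneg _) (fun q : ℕ => 2*(q:ℤ)+σ) (fun x _ y _ h => by simp at h; exact_mod_cast h) (by
          intro r hr
          have hr' : (r:ℤ) + 1 ≤ n := by exact_mod_cast Finset.mem_range.1 hr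
          have hr0 := Int.natCast_nonneg r
          have e : K+2-k = (K-k)+2 := by omega
          rw [Finset.mem_filter, e]
          constructor <;> apply mem_Wn2 <;> linarith)
      refine this.trans ?_
      rw [Finset.sum_filter]
      unfold Nf
      refine Finset.sum_le_sum fun p _ => ?_
      split_ifs with hp
      · refine le_trans (le_of_eq ?_) (Finset.single_le_sum (f := fun q => ‖lev g k p - lev g k q‖^2/((p-q:ℤ):ℝ)^2) (fun _ _ => by positivity) hp)
        simp [hd, norm_sub_rev]
      · exact Finset.sum_nonneg fun _ _ => by positivity
    have a1 := dsum (-1) (by norm_num) (by norm_num)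
    have a2 := dsum 0 (by norm_num) (by norm_num)
    have a3 := dsum 1 (by norm_num) (by norm_num)
    have : ∑ q ∈ Finset.range n, Bq q^2 ≤ 3*(∑ q ∈ Finset.range n, d (2*q+(-1))^2 + ∑ q ∈ Finset.range n, d (2*q+0)^2 + ∑ q ∈ Finset.range n, d (2*q+1)^2) := by
      rw [← Finset.sum_add_distrib, ← Finset.sum_add_distrib, Finset.mul_sum]
      refine Finset.sum_le_sum fun q _ => ?_
      simp only [hBq, add_zero, ← sub_eq_add_neg]
      nlinarith [sq_nonneg (d (2*q-1) - d (2*q)), sq_nonneg (d (2*q-1) - d (2*q+1)), sq_nonneg (d (2*q) - d (2*q+1))]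
    have h9 : ∑ q ∈ Finset.range n, Bq q^2 ≤ 9*Nf (K+2-k) (lev g k) := by linarith
    nlinarith [mul_le_mul_of_nonneg_left h9 (show 0 ≤ 8*(L:ℝ)^2 by positivity)]
  · have : (9216:ℝ) = 4608*2 := by norm_num
    rw [this, mul_assoc]
    refine mul_le_mul_of_nonneg_left ?_ (by norm_num)
    rw [Finset.sum_comm, Finset.mul_sum]
    refine Finset.sum_le_sum fun i _ => ?_
    rw [← Finset.mul_sum, ← Finset.mul_sum, mul_left_comm 2, mul_left_comm 2]
    refine mul_le_mul_of_nonneg_left (mul_le_mul_of_nonneg_left ?_ (by positivity)) (by positivity)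
    have sp : ∀ q : ℕ, ∑ t ∈ Finset.Ico ((q:ℤ)*(2*L:ℕ)-L) ((q:ℤ)*(2*L:ℕ)+3*L), yf g i t^2 ≤
       ∑ j ∈ Finset.range (2*L), yf g i ((q:ℤ)*(2*L:ℕ)+j+(-L:ℤ))^2 + ∑ j ∈ Finset.range (2*L), yf g i ((q:ℤ)*(2*L:ℕ)+j+(L:ℤ))^2 := by
      intro q
      have sub : Finset.Ico ((q:ℤ)*(2*L:ℕ)-L) ((q:ℤ)*(2*L:ℕ)+3*L) ⊆ (Finset.range (2*L)).image (fun j : ℕ => (q:ℤ)*(2*L:ℕ)+j+(-L:ℤ)) ∪ (Finset.range (2*L)).image (fun j : ℕ => (q:ℤ)*(2*L:ℕ)+j+(L:ℤ)) := by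
        intro t ht
        rw [Finset.mem_Ico] at ht
        simp only [Finset.mem_union, Finset.mem_image, Finset.mem_range]
        generalize (q:ℤ)*(2*L:ℕ) = A at ht ⊢
        by_cases hc : t < A + L
        · left; exact ⟨(t-A+L).toNat, by omega, by omega⟩
        · right; exact ⟨(t-A-L).toNat, by omega, by omega⟩
      refine (Finset.sum_le_sum_of_subset_of_nonneg sub fun _ _ _ => sq_nonneg _).trans ?_
      refine (Finset.sum_union_inter (f := fun t => yf g i t^2) ▸ le_add_of_nonneg_right (Finset.sum_nonneg fun _ _ => sq_nonneg _) : _ ≤ _).trans ?_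
      rw [Finset.sum_image (fun x _ y _ h => by simpa using h), Finset.sum_image (fun x _ y _ h => by simpa using h)]
    refine (Finset.sum_le_sum fun q _ => sp q).trans ?_
    rw [Finset.sum_add_distrib, two_mul (om _ _ _)]
    have hLK : (L:ℤ) ≤ 2^K := by
      rw [hL]; push_cast; exact pow_le_pow_right₀ (by norm_num) hk.le
    refine add_le_add ?_ ?_ <;>
    · refine sum_blocks_le n (2*L) (f := fun t => yf g i t^2) (fun t => sq_nonneg _) _ _ ?_
      intro t h0 h1
      rw [hnz] at h1
      apply mem_Wn2 <;> linarith

lemma tail_h (h : ℕ) (h0 : 0 < h) (a : ℤ) : |dh κ a L h| ≤ 8*L^2*(1/(h:ℝ)^2) := by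
  have hp : (0:ℝ) < h := by exact_mod_cast h0
  have lip := H.lip
  have D : ∀ s : ℤ, ‖γ (s+h) + γ (s-h) - (2:ℝ)•γ s‖ ≤ 2*h := by
    intro s
    have e : γ (s+h) + γ (s-h) - (2:ℝ)•γ s = (γ (s+h) - γ s) + (γ (s-h) - γ s) := by rw [two_smul]; abel
    rw [e]
    have a1 := lip (s+h) s
    have a2 := lip (s-h) s
    push_cast at a1 a2
    rw [show (s:ℝ)+h-s = h by ring, abs_of_pos hp] at a1
    rw [show (s:ℝ)-h-s = -h by ring, abs_neg, abs_of_pos hp] at a2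
    linarith [norm_add_le (γ (s+h) - γ s) (γ (s-h) - γ s)]
  have DD : ∀ s : ℤ, ‖(γ (s+h) + γ (s-h) - (2:ℝ)•γ s) - (γ (s+L+h) + γ (s+L-h) - (2:ℝ)•γ (s+L))‖ ≤ 4*L := by
    intro s
    have e : (γ (s+h) + γ (s-h) - (2:ℝ)•γ s) - (γ (s+L+h) + γ (s+L-h) - (2:ℝ)•γ (s+L)) =
      (γ (s+h) - γ (s+L+h)) + (γ (s-h) - γ (s+L-h)) + (γ (s+L) - γ s) + (γ (s+L) - γ s) := by rw [two_smul, two_smul]; abel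
    rw [e]
    have a1 := lip (s+h) (s+L+h)
    have a2 := lip (s-h) (s+L-h)
    have a3 := lip (s+L) s
    push_cast at a1 a2 a3
    rw [show (s:ℝ)+h-(s+L+h) = -L by ring, abs_neg, Nat.abs_cast] at a1
    rw [show (s:ℝ)-h-(s+L-h) = -L by ring, abs_neg, Nat.abs_cast] at a2
    rw [show (s:ℝ)+L-s = L by ring, Nat.abs_cast] at a3
    refine norm_add₄_le.trans ?_
    linarith
  have t1 : ∀ i ∈ Finset.range L, |(κ (a+i) (a+i+h) - κ (a+i-h) (a+i)) - (κ (a+L+i) (a+L+i+h) - κ (a+L+i-h) (a+L+i))| ≤ 8*L*(1/(h:ℝ)^2) := by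
    intro i _
    have := H.d2 (a+i) (a+i+L) h h0
    rw [show a+L+i = a+i+L by ring]
    refine this.trans ?_
    have e : |((a+i:ℤ):ℝ) - ((a+i+L:ℤ):ℝ)| = L := by push_cast; rw [show (a:ℝ)+i-(a+i+L) = -L by ring, abs_neg, Nat.abs_cast]
    rw [e]
    have b1 := DD (a+i); have b2 := D (a+i); have b3 := D (a+i+L)
    have c1 := div_le_div_of_nonneg_right b1 (show 0 ≤ (h:ℝ)^2 by positivity)
    have c2 := div_le_div_of_nonneg_right (mul_le_mul_of_nonneg_right (add_le_add b2 b3) (show (0:ℝ) ≤ L by positivity)) (show 0 ≤ (h:ℝ)^3 by positivity)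
    refine (add_le_add c1 c2).trans (le_of_eq ?_)
    field_simp; ring
  refine (Finset.abs_sum_le_sum_abs _ _).trans ((Finset.sum_le_sum t1).trans (le_of_eq ?_))
  simp; ring

lemma tail_sum (a : ℤ) : (∑ h ∈ Finset.Ico (2^K) M, |dh κ a L h|) ≤ 16*L^2/2^K := by
  refine (Finset.sum_le_sum fun h hh => tail_h H L h (lt_of_lt_of_le (by positivity) (Finset.mem_Ico.1 hh).1) a).trans ?_
  rw [← Finset.mul_sum]
  refine (mul_le_mul_of_nonneg_left (sum_inv_sq_Ico (2^K) M (by positivity)) (by positivity)).trans (le_of_eq ?_)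
  push_cast; ring

lemma level_bound (hL : L = 2^k) (hk : k < K) (hn : n*(2*L) = 2^K) (hM : 2^K ≤ M) :
    ∑ q ∈ Finset.range n, (∑ h ∈ Finset.Ico 1 M, dh κ ((q:ℤ)*(2*L:ℕ)) L h)^2 ≤
      936*(L:ℝ)^2*Nf (K+2-k) (lev (fun t => γ (t+1) - γ t) k) +
      32256 * ∑ i ∈ Finset.range k, (4/3)^(k-i)*(2^i * om (fun t => γ (t+1) - γ t) (K+2) i) + 384*L^3/2^K := by
  have h1 := near_sum H K k L n hL hk hn
  have h2 := mid_sum H K k L n hL hk hn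
  have L0 : 0 < L := by rw [hL]; positivity
  have hLK : L ≤ 2^K := by rw [hL]; exact pow_le_pow_right₀ (by norm_num) hk.le
  have h3 : ∑ i ∈ Finset.range k, 2^i * om (fun t => γ (t+1) - γ t) (K+2) i ≤ ∑ i ∈ Finset.range k, (4/3:ℝ)^(k-i)*(2^i * om (fun t => γ (t+1) - γ t) (K+2) i) :=
    Finset.sum_le_sum fun i _ => le_mul_of_one_le_left (mul_nonneg (by positivity) (om_nonneg _ _ _)) (one_le_pow₀ (by norm_num))
  have key : ∀ q ∈ Finset.range n, (∑ h ∈ Finset.Ico 1 M, dh κ ((q:ℤ)*(2*L:ℕ)) L h)^2 ≤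
     3*((∑ h ∈ Finset.Ico 1 L, |dh κ ((q:ℤ)*(2*L:ℕ)) L h|)^2 + (∑ h ∈ Finset.Ico L (2^K), |dh κ ((q:ℤ)*(2*L:ℕ)) L h|)^2 + (16*L^2/2^K)^2) := by
    intro q _
    have ht := tail_sum H K L M ((q:ℤ)*(2*L:ℕ))
    have e := Finset.sum_Ico_consecutive (fun h => |dh κ ((q:ℤ)*(2*L:ℕ)) L h|) L0 hLK
    have e' := Finset.sum_Ico_consecutive (fun h => |dh κ ((q:ℤ)*(2*L:ℕ)) L h|) (show 1 ≤ 2^K by omega) hM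
    rw [← e] at e'
    have hab := Finset.abs_sum_le_sum_abs (fun h => dh κ ((q:ℤ)*(2*L:ℕ)) L h) (Finset.Ico 1 M)
    rw [← e'] at hab
    set x := ∑ h ∈ Finset.Ico 1 L, |dh κ ((q:ℤ)*(2*L:ℕ)) L h| with hx
    set y := ∑ h ∈ Finset.Ico L (2^K), |dh κ ((q:ℤ)*(2*L:ℕ)) L h| with hy
    have hle := hab.trans (add_le_add_right ht (x+y))
    rw [← sq_abs]
    refine (pow_le_pow_left₀ (abs_nonneg _) hle 2).trans ?_
    generalize (16*(L:ℝ)^2/2^K) = z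
    nlinarith [sq_nonneg (x-y), sq_nonneg (x-z), sq_nonneg (y-z)]
  refine (Finset.sum_le_sum key).trans ?_
  rw [← Finset.mul_sum, Finset.sum_add_distrib, Finset.sum_add_distrib]
  simp only [Finset.sum_const, Finset.card_range, nsmul_eq_mul]
  have hnr : (n:ℝ)*(2*L) = 2^K := by exact_mod_cast hn
  have e4 : (n:ℝ)*(16*L^2/2^K)^2 = 128*L^3/2^K := by
    rw [← hnr]
    have : (L:ℝ) ≠ 0 := by exact_mod_cast L0.ne'
    have : (n:ℝ) ≠ 0 := by rintro h; rw [h, zero_mul] at hnr; exact absurd hnr.symm (by positivity)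
    field_simp; norm_num
  rw [e4]
  have e5 : 384*(L:ℝ)^3/2^K = 3*(128*L^3/2^K) := by ring
  rw [e5]
  linarith

end
end

section
def tht (κ : ℤ → ℤ → ℝ) (M : ℕ) (s : ℤ) : ℝ := ∑ h ∈ Finset.Ico 1 M, (κ s (s+h) + κ s (s-h))
def rhf (κ : ℤ → ℤ → ℝ) (M j : ℕ) (q : ℤ) : ℝ :=
  (∑ i ∈ Finset.range (2^j), (tht κ M (2*q*2^j+i) - tht κ M ((2*q+1)*2^j+i)))/2^(j+1)

lemma tht_ext (κ : ℤ → ℤ → ℝ) (M M' : ℕ) (h : M ≤ M') (hz : ∀ s t : ℤ, (M:ℤ) ≤ |s-t| → κ s t = 0) :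
    tht κ M' = tht κ M := by
  ext s
  unfold tht
  symm
  refine Finset.sum_subset (Finset.Ico_subset_Ico_right h) fun x hx hx' => ?_
  simp only [Finset.mem_Ico, not_and, not_lt] at hx hx'
  have := hx' hx.1
  have h1 : (M:ℤ) ≤ x := by exact_mod_cast this
  rw [hz, hz, add_zero]
  · rw [sub_sub_cancel]; exact h1.trans (le_abs_self _)
  · rw [show s-(s+x) = -x by ring, abs_neg]; exact h1.trans (le_abs_self _)

lemma AccC_expand (a : ℕ → ℤ → ℝ) (K : ℕ) (Q : ℤ) : 2^K * AccC a K Q =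
    ∑ j ∈ Finset.range K, 2^(j+1) * ∑ i ∈ Finset.range (2^(K-1-j)), a j (Q*2^(K-1-j)+i) := by
  induction K generalizing Q with
  | zero => simp [AccC]
  | succ K ih =>
    rw [AccC, Finset.sum_range_succ]
    have e : (2:ℝ)^(K+1)*(1/2*(AccC a K (2*Q) + AccC a K (2*Q+1)) + a K Q) =
       2^K*AccC a K (2*Q) + 2^K*AccC a K (2*Q+1) + 2^(K+1)*a K Q := by ring
    rw [e, ih, ih, ← Finset.sum_add_distrib]
    congr 1
    · refine Finset.sum_congr rfl fun j hj => ?_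
      rw [Finset.mem_range] at hj
      rw [← mul_add]
      congr 1
      have e1 : K+1-1-j = (K-1-j)+1 := by omega
      rw [e1, pow_succ 2 (K-1-j), mul_two, Finset.sum_range_add]
      congr 1
      · refine Finset.sum_congr rfl fun i _ => ?_
        congr 1; ring
      · refine Finset.sum_congr rfl fun i _ => ?_
        congr 1; push_cast; ring
    · simp

section
variable {V : Type*} [NormedAddCommGroup V] [InnerProductSpace ℝ V]
variable {γ : ℤ → V} {κ : ℤ → ℤ → ℝ}

lemma sum_dh (ha : ∀ s t, κ s t = - κ t s) (a : ℤ) (L M : ℕ) : ∑ h ∈ Finset.Ico 1 M, dh κ a L h =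
    ∑ i ∈ Finset.range L, (tht κ M (a+i) - tht κ M (a+L+i)) := by
  unfold dh tht
  rw [Finset.sum_comm]
  refine Finset.sum_congr rfl fun i _ => ?_
  rw [← Finset.sum_sub_distrib]
  refine Finset.sum_congr rfl fun h _ => ?_
  rw [ha (a+i) (a+i-h), ha (a+L+i) (a+L+i-h)]; ring

lemma pack0 (H : KH γ κ) (K M : ℕ) (hM : 2^K ≤ M) :
    ∑ j ∈ Finset.range K, 2^(j+1) * ∑ i ∈ Finset.range (2^(K-1-j)), rhf κ M j i^2 ≤ 20000000 * 2^K := by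
  set g : ℤ → V := fun t => γ (t+1) - γ t with hg
  have lv : ∀ j ∈ Finset.range K, (2:ℝ)^(j+1) * ∑ i ∈ Finset.range (2^(K-1-j)), rhf κ M j i^2 ≤
      468*(2^j*Nf (K+2-j) (lev g j)) + 16128 * ∑ i ∈ Finset.range j, (2/3)^(j-i)*om g (K+2) i + 192*4^j/2^K := by
    intro j hj
    rw [Finset.mem_range] at hj
    have hn : 2^(K-1-j)*(2*2^j) = 2^K := by
      rw [← pow_succ', ← pow_add]; congr 1; omega
    have := level_bound H K j (2^j) (2^(K-1-j)) M rfl hj hn hM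
    rw [← hg] at this
    have e : ∀ i : ℕ, rhf κ M j i = (∑ h ∈ Finset.Ico 1 M, dh κ ((i:ℤ)*(2*2^j:ℕ)) (2^j) h)/2^(j+1) := by
      intro i
      rw [sum_dh H.anti, rhf]
      congr 1
      refine Finset.sum_congr rfl fun l _ => ?_
      congr 2 <;> push_cast <;> ring
    have e' : ∀ i : ℕ, rhf κ M j i^2 = (∑ h ∈ Finset.Ico 1 M, dh κ ((i:ℤ)*(2*2^j:ℕ)) (2^j) h)^2/(2^(j+1))^2 := by
      intro i; rw [e, div_pow]
    simp_rw [e']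
    rw [← Finset.sum_div]
    have e2 : (2:ℝ)^(j+1) * ((∑ i ∈ Finset.range (2^(K-1-j)), (∑ h ∈ Finset.Ico 1 M, dh κ ((i:ℤ)*(2*2^j:ℕ)) (2^j) h)^2)/(2^(j+1))^2) =
      (∑ i ∈ Finset.range (2^(K-1-j)), (∑ h ∈ Finset.Ico 1 M, dh κ ((i:ℤ)*(2*2^j:ℕ)) (2^j) h)^2)/2^(j+1) := by field_simp
    rw [e2, div_le_iff₀ (by positivity)]
    refine this.trans (le_of_eq ?_)
    have e3 : ∑ i ∈ Finset.range j, (4/3:ℝ)^(j-i)*(2^i * om g (K+2) i) = 2^j*∑ i ∈ Finset.range j, (2/3)^(j-i)*om g (K+2) i := by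
      rw [Finset.mul_sum]
      refine Finset.sum_congr rfl fun i hi => ?_
      rw [Finset.mem_range] at hi
      obtain ⟨d, rfl⟩ : ∃ d, j = i + d := ⟨j-i, by omega⟩
      rw [Nat.add_sub_cancel_left, pow_add, show (4/3:ℝ) = 2/3*2 by norm_num, mul_pow]; ring
    rw [e3]
    have e4 : (4:ℝ)^j = (2^j)^2 := by rw [← pow_mul, mul_comm, pow_mul]; norm_num
    rw [e4]
    generalize ∑ i ∈ Finset.range j, (2/3:ℝ)^(j-i)*om g (K+2) i = S
    generalize Nf (K+2-j) (lev g j) = N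
    push_cast; ring
  refine (Finset.sum_le_sum lv).trans ?_
  rw [Finset.sum_add_distrib, Finset.sum_add_distrib, ← Finset.mul_sum, ← Finset.mul_sum, ← Finset.sum_div, ← Finset.mul_sum]
  have hEn : En (K+2) g ≤ 8*2^K := by
    unfold En
    have : ∀ p ∈ Wn (K+2), ‖g p‖^2 ≤ 1 := by
      intro p _
      have := H.lip (p+1) p
      rw [show ((p+1:ℤ):ℝ) - p = 1 by push_cast; ring, abs_one] at this
      exact pow_le_one₀ (norm_nonneg _) this
    refine (Finset.sum_le_sum this).trans ?_
    simp only [Finset.sum_const, nsmul_eq_mul, mul_one, Wn, Int.card_Ico]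
    have : ((2:ℤ)^(K+2) - -2^(K+2)).toNat = 8*2^K := by
      rw [show (2:ℤ)^(K+2) - -2^(K+2) = ((8*2^K:ℕ):ℤ) by push_cast; ring]; exact Int.toNat_natCast _
    rw [this]; push_cast; exact le_refl _
  have s1 : ∑ j ∈ Finset.range K, 2^j*Nf (K+2-j) (lev g j) ≤ 4000*En (K+2) g := by
    have := square_fn (K+2) g
    have h2 : ∑ j ∈ Finset.range K, 2^j*Nf (K+2-j) (lev g j) ≤ ∑ j ∈ Finset.range (K+2), 2^j*Nf (K+2-j) (lev g j) :=
      Finset.sum_le_sum_of_subset_of_nonneg (Finset.range_mono (by omega)) fun i _ _ => mul_nonneg (by positivity) (Nf_nonneg _ _)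
    have := Nf_nonneg (K+2) g
    linarith
  have s2 : ∑ j ∈ Finset.range K, ∑ i ∈ Finset.range j, (2/3:ℝ)^(j-i)*om g (K+2) i ≤ 2*En (K+2) g := by
    have e : ∑ j ∈ Finset.range K, ∑ i ∈ Finset.range j, (2/3:ℝ)^(j-i)*om g (K+2) i =
       ∑ i ∈ Finset.range K, ∑ j ∈ Finset.Ico (i+1) K, (2/3:ℝ)^(j-i)*om g (K+2) i :=
      Finset.sum_comm' (by intro x y; simp; omega)
    rw [e]
    refine le_trans ?_ (mul_le_mul_of_nonneg_left (om_total g (K+2) K (by omega)) (by norm_num))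
    rw [Finset.mul_sum]
    refine Finset.sum_le_sum fun i _ => ?_
    rw [← Finset.sum_mul]
    refine mul_le_mul_of_nonneg_right ?_ (om_nonneg _ _ _)
    rw [Finset.sum_Ico_eq_sum_range]
    have : ∀ l, i+1+l-i = l+1 := fun l => by omega
    simp_rw [this, pow_succ]
    rw [← Finset.sum_mul, geom_sum_eq (by norm_num)]
    have : (0:ℝ) < (2/3)^(K-(i+1)) := by positivity
    generalize (2/3:ℝ)^(K-(i+1)) = x at this ⊢
    have e : (x-1)/(2/3-1)*(2/3) = 2*(1-x) := by norm_num; ring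
    rw [e]; linarith
  have s3 : (∑ j ∈ Finset.range K, (4:ℝ)^j) ≤ 2^K*2^K := by
    rw [geom_sum_eq (by norm_num), ← mul_pow]; norm_num
    have : (0:ℝ) < 4^K := by positivity
    linarith
  have s4 : 192*(∑ j ∈ Finset.range K, (4:ℝ)^j)/2^K ≤ 192*2^K := by
    rw [div_le_iff₀ (by positivity)]; linarith
  have t0 : (0:ℝ) < 2^K := by positivity
  refine (add_le_add (add_le_add (mul_le_mul_of_nonneg_left s1 (by norm_num)) (mul_le_mul_of_nonneg_left s2 (by norm_num))) s4).trans ?_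
  generalize En (K+2) g = E at hEn
  generalize (2:ℝ)^K = T at *
  linarith

lemma KH.shift (H : KH γ κ) (c : ℤ) : KH (fun s => γ (s+c)) (fun s t => κ (s+c) (t+c)) where
  lip s t := by have := H.lip (s+c) (t+c); push_cast at this; rwa [add_sub_add_right_eq_sub] at this
  anti s t := H.anti _ _
  size s t := by have := H.size (s+c) (t+c); push_cast at this; rwa [add_sub_add_right_eq_sub] at this
  reg s s' t h := by
    have := H.reg (s+c) (s'+c) (t+c) (by push_cast; simpa only [add_sub_add_right_eq_sub] using h)
    push_cast at this; simpa only [add_sub_add_right_eq_sub] using this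
  d1 s s' h h0 := by
    have := H.d1 (s+c) (s'+c) h h0
    simpa only [add_right_comm _ c] using this
  d2 s s' h h0 := by
    have := H.d2 (s+c) (s'+c) h h0
    push_cast at this
    simpa only [add_right_comm _ c, sub_add_eq_add_sub, add_sub_add_right_eq_sub] using this

lemma carl (H : KH γ κ) (M : ℕ) (hz : ∀ s t : ℤ, (M:ℤ) ≤ |s-t| → κ s t = 0) (K : ℕ) (Q : ℤ) :
    AccC (fun j q => rhf κ M j q^2) K Q ≤ 20000000 := by
  have hM : 2^K ≤ M + 2^K := Nat.le_add_left _ _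
  have e1 : rhf κ M = rhf κ (M+2^K) := by
    ext j q; unfold rhf; rw [tht_ext κ M (M+2^K) (Nat.le_add_right _ _) hz]
  rw [e1]
  have := pack0 (H.shift (Q*2^K)) K (M+2^K) hM
  rw [mul_comm (20000000:ℝ)] at this
  refine le_of_mul_le_mul_left (le_trans (le_of_eq ?_) this) (show (0:ℝ) < 2^K by positivity)
  rw [AccC_expand]
  refine Finset.sum_congr rfl fun j hj => ?_
  rw [Finset.mem_range] at hj
  congr 1
  refine Finset.sum_congr rfl fun i _ => ?_
  congr 1
  unfold rhf
  congr 1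
  refine Finset.sum_congr rfl fun l _ => ?_
  have et : ∀ s, tht (fun s t => κ (s+Q*2^K) (t+Q*2^K)) (M+2^K) s = tht κ (M+2^K) (s+Q*2^K) := by
    intro s; unfold tht
    refine Finset.sum_congr rfl fun h _ => ?_
    rw [add_right_comm, ← sub_add_eq_add_sub]
  rw [et, et]
  have e2 : (2:ℤ)^K = 2^(K-1-j)*(2*2^j) := by
    rw [← pow_succ', ← pow_add]; congr 1; omega
  congr 2 <;> rw [e2] <;> ring

end
end

section
lemma lev_supp (f : ℤ → ℝ) (m j : ℕ) (hj : j ≤ m) (hf : ∀ t, t ∉ Wn m → f t = 0) (p : ℤ) (hp : p ∉ Wn (m-j)) :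
    lev f j p = 0 := by
  induction j generalizing p with
  | zero => exact hf p hp
  | succ j ih =>
    have e : m-j = (m-(j+1))+1 := by omega
    have h1 : ∀ x : ℤ, (x = 2*p ∨ x = 2*p+1) → x ∉ Wn (m-j) := by
      intro x hx
      rw [e]; rw [mem_Wn] at hp ⊢
      rw [pow_succ]
      generalize (2:ℤ)^(m-(j+1)) = T at *
      omega
    rw [lev, avg, ih (by omega) _ (h1 _ (Or.inl rfl)), ih (by omega) _ (h1 _ (Or.inr rfl))]; simp

lemma sum_tht (κ : ℤ → ℤ → ℝ) (M m : ℕ) (hM : M ≤ 2^m) (ha : ∀ s t, κ s t = - κ t s)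
    (hz : ∀ s t : ℤ, (M:ℤ) ≤ |s-t| → κ s t = 0) (s : ℤ) (hs : s ∈ Wn m) :
    ∑ t ∈ Wn (m+1), κ s t = tht κ M s := by
  have hMz : (M:ℤ) ≤ 2^m := by exact_mod_cast hM
  rw [mem_Wn] at hs
  unfold tht
  rw [Finset.sum_add_distrib]
  rw [← Finset.sum_image (f := fun t => κ s t) (g := fun h : ℕ => s+h) (fun x _ y _ h => by simpa using h)]
  rw [← Finset.sum_image (f := fun t => κ s t) (g := fun h : ℕ => s-h) (fun x _ y _ h => by simpa using h)]
  rw [← Finset.sum_union]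
  · symm
    refine Finset.sum_subset ?_ ?_
    · intro t ht
      simp only [Finset.mem_union, Finset.mem_image, Finset.mem_Ico] at ht
      rw [mem_Wn, pow_succ]
      rcases ht with ⟨h, h1, rfl⟩ | ⟨h, h1, rfl⟩ <;> constructor <;> omega
    · intro t _ ht
      simp only [Finset.mem_union, Finset.mem_image, Finset.mem_Ico, not_or, not_exists, not_and] at ht
      by_cases h0 : t = s
      · subst h0; linarith [ha t t]
      · apply hz
        by_contra hc
        push Not at hc
        rw [abs_lt] at hc
        rcases lt_or_gt_of_ne h0 with h | h
        · exact ht.2 (s-t).toNat (by omega) (by omega)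
        · exact ht.1 (t-s).toNat (by omega) (by omega)
  · rw [Finset.disjoint_left]
    intro t h1 h2
    simp only [Finset.mem_image, Finset.mem_Ico] at h1 h2
    obtain ⟨x, hx, rfl⟩ := h1
    obtain ⟨y, hy, h⟩ := h2
    omega

lemma tau_eq (κ : ℤ → ℤ → ℝ) (M m : ℕ) (hM : M ≤ 2^m) (ha : ∀ s t, κ s t = - κ t s)
    (hz : ∀ s t : ℤ, (M:ℤ) ≤ |s-t| → κ s t = 0) (j : ℕ) (hj : j < m) (P : ℤ) (hP : P ∈ Wn (m-1-j)) :
    ∑ p ∈ Wn (m+1-j), (blk κ j (2*P) p - blk κ j (2*P+1) p) = 2^(j+1) * rhf κ M j P := by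
  have key : ∀ Q : ℤ, Q = 2*P ∨ Q = 2*P+1 → ∑ p ∈ Wn (m+1-j), blk κ j Q p = ∑ i ∈ Finset.range (2^j), tht κ M (Q*2^j+i) := by
    intro Q hQ
    unfold blk
    rw [Finset.sum_comm]
    refine Finset.sum_congr rfl fun i hi => ?_
    rw [sum_W_cell (fun t => κ (Q*2^j+i) t) (m+1-j) j, Nat.sub_add_cancel (by omega)]
    refine sum_tht κ M m hM ha hz _ ?_
    have e : m = (m-1-j)+1+j := by omega
    have hi' : (i:ℤ)+1 ≤ 2^j := by exact_mod_cast Finset.mem_range.1 hi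
    have hi0 := Int.natCast_nonneg i
    rw [mem_Wn] at hP ⊢
    have e' : (2:ℤ)^m = 2*2^(m-1-j)*2^j := by
      conv_lhs => rw [e, pow_add, pow_add]
      ring
    rw [e']
    have hL : (0:ℤ) < 2^j := by positivity
    constructor <;> rcases hQ with rfl | rfl <;> nlinarith
  rw [Finset.sum_sub_distrib, key _ (Or.inl rfl), key _ (Or.inr rfl), rhf, Finset.sum_sub_distrib]
  field_simp

lemma par_bound (n j : ℕ) (y u τ r : ℤ → ℝ) (h : ∀ P ∈ Wn n, y P * τ P = y P * (2^(j+1) * r P)) :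
    |∑ P ∈ Wn n, y P * u P * τ P| ≤ 1/2*(2^(j+1) * En n y) + 1/2 * ∑ P ∈ Wn n, 2^(j+1)*(r P^2 * u P^2) := by
  refine (Finset.abs_sum_le_sum_abs _ _).trans ?_
  rw [En, Finset.mul_sum, Finset.mul_sum, Finset.mul_sum, ← Finset.sum_add_distrib]
  refine Finset.sum_le_sum fun P hP => ?_
  have e : y P * u P * τ P = 2^(j+1) * (y P * (r P * u P)) := by
    rw [mul_right_comm, h P hP]; ring
  have hp : (0:ℝ) < 2^(j+1) := by positivity
  rw [e, abs_mul, abs_of_pos hp, Real.norm_eq_abs, sq_abs]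
  have : |y P * (r P * u P)| ≤ 1/2*(y P^2 + (r P*u P)^2) := by
    rw [abs_le]; constructor <;> nlinarith [sq_nonneg (y P - r P*u P), sq_nonneg (y P + r P*u P)]
  nlinarith

section
variable {V : Type*} [NormedAddCommGroup V] [InnerProductSpace ℝ V]
variable {γ : ℤ → V} {κ : ℤ → ℤ → ℝ}

lemma T1_main (H : KH γ κ) (M m : ℕ) (hM : M ≤ 2^m) (hz : ∀ s t : ℤ, (M:ℤ) ≤ |s-t| → κ s t = 0)
    (f φ : ℤ → ℝ) (hf : ∀ t, t ∉ Wn m → f t = 0) (hφ : ∀ t, t ∉ Wn m → φ t = 0) :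
    |Lam (m+1) κ f φ| ≤ 50000000 * (En (m+1) f + En (m+1) φ) := by
  set a : ℕ → ℤ → ℝ := fun j q => rhf κ M j q^2 with ha
  have emb := fun f => carleson_embed (a := a) (fun _ _ => sq_nonneg _) (by norm_num) (carl H M hz) f (m+1)
  set L : ℕ → ℝ := fun j => Lam (m+1-j) (blk κ j) (lev f j) (lev φ j) with hL
  set C : (ℤ → ℝ) → ℕ → ℝ := fun f j => ∑ q ∈ Wn (m+1-(j+1)), 2^(j+1) * (a j q * (lev f (j+1) q)^2) with hC
  set W : (ℤ → ℝ) → ℕ → ℝ := fun f j => 2^(j+1)*En (m+1-(j+1)) (hr (lev f j)) with hW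
  set N : (ℤ → ℝ) → ℕ → ℝ := fun f j => 2^j*Nf (m+1-j) (lev f j) with hN
  have zy : ∀ u : ℤ → ℝ, (∀ t, t ∉ Wn m → u t = 0) → ∀ j < m, ∀ P ∈ Wn (m-j),
      hr (lev u j) P * ∑ p ∈ Wn (m+1-j), (blk κ j (2*P) p - blk κ j (2*P+1) p) = hr (lev u j) P * (2^(j+1) * rhf κ M j P) := by
    intro u hu j hj P _
    by_cases hP : P ∈ Wn (m-1-j)
    · rw [tau_eq κ M m hM H.anti hz j hj P hP]
    · have h1 : ∀ x : ℤ, (x = 2*P ∨ x = 2*P+1) → x ∉ Wn (m-j) := by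
        intro x hx
        have e : m-j = (m-1-j)+1 := by omega
        rw [e]; rw [mem_Wn] at hP ⊢
        rw [pow_succ]
        generalize (2:ℤ)^(m-1-j) = T at *
        omega
      have : hr (lev u j) P = 0 := by
        rw [hr, lev_supp u m j hj.le hu _ (h1 _ (Or.inl rfl)), lev_supp u m j hj.le hu _ (h1 _ (Or.inr rfl))]; simp
      rw [this]; simp
  have step : ∀ j ∈ Finset.range m, |L j - L (j+1)| ≤ 55*W φ j + 55*W f j + 54*N f j + 54*N φ (j+1) + 1/2*C f j + 1/2*C φ j := by
    intro j hj
    rw [Finset.mem_range] at hj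
    have e1 : m+1-j = (m-j)+1 := by omega
    have e2 : m+1-(j+1) = m-j := by omega
    have sb := step_bound (m-j) (blk κ j) (blk_anti H.anti j) (54*2^j) (by positivity)
      (blk_diff H.anti H.size H.reg j) (lev f j) (lev φ j)
    have eb : blk κ (j+1) = (fun p q => blk κ j (2*p) (2*q) + blk κ j (2*p) (2*q+1) + (blk κ j (2*p+1) (2*q) + blk κ j (2*p+1) (2*q+1))) := by
      ext p q; exact blk_succ κ j p q
    simp only [hL, hC, hW, hN]
    rw [e1, e2, eb]
    have zf := zy f hf j hj
    have zφ := zy φ hφ j hj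
    rw [e1] at zf zφ
    have p1 := par_bound (m-j) j (hr (lev φ j)) (avg (lev f j)) _ _ zφ
    have p2 := par_bound (m-j) j (hr (lev f j)) (avg (lev φ j)) _ _ zf
    have q1 := En_nonneg (m-j) (hr (lev φ j))
    have q2 := En_nonneg (m-j) (hr (lev f j))
    have h2 : (2:ℝ)^(j+1) = 2*2^j := by ring
    have h0 : (0:ℝ) < 2^j := by positivity
    refine (sb.trans (add_le_add (add_le_add le_rfl p1) p2)).trans ?_
    have ef : lev f (j+1) = avg (lev f j) := rfl
    have eφ : lev φ (j+1) = avg (lev φ j) := rfl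
    rw [ef, eφ]
    simp only [ha]
    generalize ∑ P ∈ Wn (m-j), (2:ℝ)^(j+1)*(rhf κ M j P^2 * avg (lev f j) P^2) = s1
    generalize ∑ P ∈ Wn (m-j), (2:ℝ)^(j+1)*(rhf κ M j P^2 * avg (lev φ j) P^2) = s2
    rw [h2]
    generalize (2:ℝ)^j = T at *
    generalize En (m-j) (hr (lev φ j)) = x1 at *
    generalize En (m-j) (hr (lev f j)) = x2 at *
    generalize Nf (m-j) (avg (lev φ j)) = x3 at *
    generalize Nf (m-j+1) (lev f j) = x4 at *
    nlinarith [mul_nonneg h0.le q1, mul_nonneg h0.le q2]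
  have tel : L 0 = L m + ∑ j ∈ Finset.range m, (L j - L (j+1)) := by
    rw [Finset.sum_range_sub']; ring
  have top : |L m| ≤ 6*(En (m+1) f + En (m+1) φ) := by
    simp only [hL]
    rw [Nat.add_sub_cancel_left]
    have h1 := En_lev_le (m+1) m f (by omega)
    have h2 := En_lev_le (m+1) m φ (by omega)
    rw [Nat.add_sub_cancel_left] at h1 h2
    have : |Lam 1 (blk κ m) (lev f m) (lev φ m)| ≤ ∑ p ∈ Wn 1, ∑ q ∈ Wn 1, 3*2^m*(1/2*(‖lev f m q‖^2 + ‖lev φ m p‖^2)) := by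
      refine (Finset.abs_sum_le_sum_abs _ _).trans (Finset.sum_le_sum fun p _ => ?_)
      refine (Finset.abs_sum_le_sum_abs _ _).trans (Finset.sum_le_sum fun q _ => ?_)
      rw [mul_assoc, abs_mul]
      refine mul_le_mul (blk_size H.anti H.size m p q) ?_ (abs_nonneg _) (by positivity)
      rw [Real.norm_eq_abs, Real.norm_eq_abs, sq_abs, sq_abs, abs_le]
      constructor <;> nlinarith [sq_nonneg (lev f m q + lev φ m p), sq_nonneg (lev f m q - lev φ m p)]
    refine this.trans ?_
    have ec : (Wn 1).card = 4 := by simp [Wn]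
    have e : ∑ p ∈ Wn 1, ∑ q ∈ Wn 1, 3*2^m*(1/2*(‖lev f m q‖^2 + ‖lev φ m p‖^2)) = 6*(2^m*En 1 (lev f m) + 2^m*En 1 (lev φ m)) := by
      simp_rw [← Finset.mul_sum, Finset.sum_add_distrib]
      simp only [Finset.sum_const, ec, En, nsmul_eq_mul, ← Finset.mul_sum]
      push_cast; ring
    rw [e]; linarith
  have sW : ∀ u, ∑ j ∈ Finset.range m, W u j ≤ En (m+1) u := by
    intro u
    refine le_trans ?_ (haar_total (m+1) u)
    exact Finset.sum_le_sum_of_subset_of_nonneg (Finset.range_mono (by omega)) fun i _ _ => mul_nonneg (by positivity) (En_nonneg _ _)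
  have N0 : ∀ u j, 0 ≤ N u j := fun u j => mul_nonneg (by positivity) (Nf_nonneg _ _)
  have sN' : ∀ u, ∑ j ∈ Finset.range (m+1), N u j ≤ 4000*En (m+1) u := by
    intro u
    have := square_fn (m+1) u
    have := Nf_nonneg (m+1) u
    linarith
  have sN : ∀ u, ∑ j ∈ Finset.range m, N u j ≤ 4000*En (m+1) u := fun u => by
    have := sN' u
    rw [Finset.sum_range_succ] at this
    linarith [N0 u m]
  have sN1 : ∀ u, ∑ j ∈ Finset.range m, N u (j+1) ≤ 4000*En (m+1) u := fun u => by
    have := sN' u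
    rw [Finset.sum_range_succ'] at this
    linarith [N0 u 0]
  have sC : ∀ u, ∑ j ∈ Finset.range m, C u j ≤ 4*20000000*En (m+1) u := by
    intro u
    refine le_trans ?_ (emb u)
    exact Finset.sum_le_sum_of_subset_of_nonneg (Finset.range_mono (by omega)) fun i _ _ =>
      Finset.sum_nonneg fun q _ => mul_nonneg (by positivity) (mul_nonneg (sq_nonneg _) (sq_nonneg _))
  have L0 : Lam (m+1) κ f φ = L 0 := by
    simp only [hL, Nat.sub_zero, lev]
    congr 1; ext p q; simp [blk]
  rw [L0, tel]
  refine (abs_add_le _ _).trans ((add_le_add top ((Finset.abs_sum_le_sum_abs _ _).trans (Finset.sum_le_sum step))).trans ?_)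
  simp only [Finset.sum_add_distrib, ← Finset.mul_sum]
  have b1 := sW f; have b2 := sW φ; have b3 := sN f; have b4 := sN1 φ; have b5 := sC f; have b6 := sC φ
  have b7 := En_nonneg (m+1) f; have b8 := En_nonneg (m+1) φ
  generalize En (m+1) f = x1 at *
  generalize En (m+1) φ = x2 at *
  generalize ∑ j ∈ Finset.range m, W f j = y1 at *
  generalize ∑ j ∈ Finset.range m, W φ j = y2 at *
  generalize ∑ j ∈ Finset.range m, N f j = y3 at *
  generalize ∑ j ∈ Finset.range m, N φ (j+1) = y4 at *
  generalize ∑ j ∈ Finset.range m, C f j = y5 at *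
  generalize ∑ j ∈ Finset.range m, C φ j = y6 at *
  linarith

/-- discrete one-dimensional `L²` bound -/
theorem T1_final (H : KH γ κ) (M : ℕ) (hz : ∀ s t : ℤ, (M:ℤ) ≤ |s-t| → κ s t = 0)
    (S : Finset ℤ) (f φ : ℤ → ℝ) :
    |∑ s ∈ S, ∑ t ∈ S, κ s t * f t * φ s| ≤ 50000000 * (∑ s ∈ S, f s^2 + ∑ s ∈ S, φ s^2) := by
  obtain ⟨m, hM, hS⟩ : ∃ m : ℕ, M ≤ 2^m ∧ S ⊆ Wn m := by
    refine ⟨M + ∑ s ∈ S, s.natAbs, (Nat.le_add_right _ _).trans Nat.lt_two_pow_self.le, fun s hs => ?_⟩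
    have h1 : s.natAbs ≤ ∑ s ∈ S, s.natAbs := Finset.single_le_sum (f := Int.natAbs) (fun _ _ => Nat.zero_le _) hs
    have h2 := Nat.lt_two_pow_self (n := M + ∑ s ∈ S, s.natAbs)
    rw [mem_Wn]
    have h3 : (s.natAbs:ℤ) < 2^(M + ∑ s ∈ S, s.natAbs) := by exact_mod_cast (by omega : s.natAbs < 2^(M + ∑ s ∈ S, s.natAbs))
    generalize (2:ℤ)^(M + ∑ s ∈ S, s.natAbs) = T at *
    omega
  have hS1 : S ⊆ Wn (m+1) := hS.trans fun x hx => by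
    rw [mem_Wn] at hx ⊢; rw [pow_succ]; omega
  set c : (ℤ → ℝ) → ℤ → ℝ := fun f t => if t ∈ S then f t else 0 with hc
  have c0 : ∀ u t, t ∉ Wn m → c u t = 0 := fun u t ht => if_neg fun h => ht (hS h)
  have := T1_main H M m hM hz (c f) (c φ) (c0 f) (c0 φ)
  have eE : ∀ u, En (m+1) (c u) = ∑ s ∈ S, u s^2 := by
    intro u
    rw [En, ← Finset.sum_subset hS1]
    · exact Finset.sum_congr rfl fun s hs => by simp [hc, hs]
    · intro s _ hs; simp [hc, hs]
  rw [eE, eE] at this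
  refine le_trans (le_of_eq ?_) this
  congr 1
  rw [Lam, ← Finset.sum_subset hS1]
  · refine Finset.sum_congr rfl fun s hs => ?_
    rw [← Finset.sum_subset hS1]
    · exact Finset.sum_congr rfl fun t ht => by simp [hc, hs, ht]
    · intro t _ ht; simp [hc, ht]
  · intro s _ hs; simp [hc, hs]
end
end

section
structure RB {V : Type*} [NormedAddCommGroup V] (m : ℕ) (C : ℝ) (f : V → ℝ) : Prop where
  nn : 0 ≤ C
  b0 : ∀ ρ > 0, ∀ x, ρ ≤ ‖x‖ → |f x| ≤ C / ρ ^ m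
  b1 : ∀ ρ > 0, ∀ x y, ρ ≤ ‖x‖ → ρ ≤ ‖y‖ → |f x - f y| ≤ C * ‖x - y‖ / ρ ^ (m + 1)
  b2 : ∀ ρ > 0, ∀ a b a' b', ρ ≤ ‖a‖ → ρ ≤ ‖b‖ → ρ ≤ ‖a'‖ → ρ ≤ ‖b'‖ →
    |(f a - f b) - (f a' - f b')| ≤ C * (‖(a - b) - (a' - b')‖ / ρ ^ (m + 1)
      + (‖a - b‖ + ‖a' - b'‖) * (‖a - a'‖ + ‖b - b'‖) / ρ ^ (m + 2))

theorem RB.mul {V : Type*} [NormedAddCommGroup V] {m : ℕ} {C B : ℝ} {f w : V → ℝ}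
    (hf : RB m C f) (hw : RB 0 B w) : RB m (4 * C * B) (fun x => f x * w x) := by
  have hC := hf.nn
  have hB := hw.nn
  have m2 : ∀ {x y X Y : ℝ}, |x| ≤ X → |y| ≤ Y → |x * y| ≤ X * Y := by
    intro x y X Y h1 h2
    rw [abs_mul]; exact mul_le_mul h1 h2 (abs_nonneg _) ((abs_nonneg _).trans h1)
  refine ⟨by positivity, ?_, ?_, ?_⟩
  · intro ρ hρ x hx
    refine (m2 (hf.b0 ρ hρ x hx) (hw.b0 ρ hρ x hx)).trans ?_
    have : 0 ≤ C * B / ρ ^ m := by positivity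
    calc C / ρ ^ m * (B / ρ ^ 0) = C * B / ρ ^ m := by rw [pow_zero]; ring
      _ ≤ 4 * (C * B / ρ ^ m) := by linarith
      _ = _ := by ring
  · intro ρ hρ x y hx hy
    have h1 := m2 (hf.b1 ρ hρ x y hx hy) (hw.b0 ρ hρ x hx)
    have h2 := m2 (hf.b0 ρ hρ y hy) (hw.b1 ρ hρ x y hx hy)
    have e : f x * w x - f y * w y = (f x - f y) * w x + f y * (w x - w y) := by ring
    have h3 : 0 ≤ C * B * ‖x - y‖ / ρ ^ (m + 1) := by positivity
    rw [e]
    refine (abs_add_le _ _).trans ((add_le_add h1 h2).trans ?_)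
    calc C * ‖x - y‖ / ρ ^ (m + 1) * (B / ρ ^ 0) + C / ρ ^ m * (B * ‖x - y‖ / ρ ^ (0 + 1))
        = 2 * (C * B * ‖x - y‖ / ρ ^ (m + 1)) := by field_simp; ring
      _ ≤ 4 * (C * B * ‖x - y‖ / ρ ^ (m + 1)) := by linarith
      _ = _ := by ring
  · intro ρ hρ a b a' b' ha hb ha' hb'
    have h1 := m2 (hf.b2 ρ hρ a b a' b' ha hb ha' hb') (hw.b0 ρ hρ a ha)
    have h2 := m2 (hf.b1 ρ hρ a' b' ha' hb') (hw.b1 ρ hρ a a' ha ha')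
    have h3 := m2 (hf.b0 ρ hρ b hb) (hw.b2 ρ hρ a b a' b' ha hb ha' hb')
    have h4 := m2 (hf.b1 ρ hρ b b' hb hb') (hw.b1 ρ hρ a' b' ha' hb')
    have e : (f a * w a - f b * w b) - (f a' * w a' - f b' * w b') =
        ((f a - f b) - (f a' - f b')) * w a + (f a' - f b') * (w a - w a') +
        f b * ((w a - w b) - (w a' - w b')) + (f b - f b') * (w a' - w b') := by ring
    rw [e]
    refine (abs_add_le _ _).trans ((add_le_add ((abs_add_le _ _).trans (add_le_add
      ((abs_add_le _ _).trans (add_le_add h1 h2)) h3)) h4).trans ?_)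
    have hD := norm_nonneg ((a - b) - (a' - b'))
    generalize ‖(a - b) - (a' - b')‖ = D at *
    have hp := norm_nonneg (a - b)
    have hp' := norm_nonneg (a' - b')
    have hq := norm_nonneg (a - a')
    have hq' := norm_nonneg (b - b')
    generalize ‖a - b‖ = p at *
    generalize ‖a' - b'‖ = p' at *
    generalize ‖a - a'‖ = q at *
    generalize ‖b - b'‖ = q' at *
    have hM : 0 ≤ C * B / ρ ^ (m + 2) := by positivity
    have k : 0 ≤ C * B / ρ ^ (m + 2) * (2 * D * ρ + 2 * (p * q) + 2 * (p * q') + p' * q + p' * q') :=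
      by positivity
    have e1 : C / ρ ^ m = C / ρ ^ (m + 2) * ρ ^ 2 := by field_simp; ring
    have e2 : ∀ z, z / ρ ^ (m + 1) = z / ρ ^ (m + 2) * ρ := by intro z; field_simp; ring
    refine sub_nonneg.1 (k.trans (le_of_eq ?_))
    rw [e1, e2 D, e2 (C * p'), e2 (C * q')]
    field_simp
    ring


theorem RB.scale {V : Type*} [NormedAddCommGroup V] [NormedSpace ℝ V] {B : ℝ} {w : V → ℝ}
    (hw : RB 0 B w) {η : ℝ} (hη : 0 < η) : RB 0 B (fun x => w (η⁻¹ • x)) := by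
  have hi : 0 < η⁻¹ := inv_pos.2 hη
  have hn : ∀ x : V, ‖η⁻¹ • x‖ = η⁻¹ * ‖x‖ := fun x => by
    rw [norm_smul, Real.norm_of_nonneg hi.le]
  have hs : ∀ {ρ : ℝ} {x : V}, ρ ≤ ‖x‖ → η⁻¹ * ρ ≤ ‖η⁻¹ • x‖ := fun h => by
    rw [hn]; exact mul_le_mul_of_nonneg_left h hi.le
  refine ⟨hw.nn, ?_, ?_, ?_⟩
  · intro ρ hρ x hx
    simpa using hw.b0 (η⁻¹ * ρ) (by positivity) _ (hs hx)
  · intro ρ hρ x y hx hy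
    refine (hw.b1 (η⁻¹ * ρ) (by positivity) _ _ (hs hx) (hs hy)).trans (le_of_eq ?_)
    rw [← smul_sub, hn, zero_add, pow_one, pow_one]; field_simp
  · intro ρ hρ a b a' b' ha hb ha' hb'
    refine (hw.b2 (η⁻¹ * ρ) (by positivity) _ _ _ _ (hs ha) (hs hb) (hs ha') (hs hb')).trans
      (le_of_eq ?_)
    simp only [← smul_sub, hn, zero_add, pow_one]; field_simp

theorem RB.mono {V : Type*} [NormedAddCommGroup V] {m : ℕ} {C C' : ℝ} {f : V → ℝ}
    (hf : RB m C f) (h : C ≤ C') : RB m C' f := by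
  refine ⟨hf.nn.trans h, fun ρ hρ x hx => (hf.b0 ρ hρ x hx).trans (by gcongr),
    fun ρ hρ x y hx hy => (hf.b1 ρ hρ x y hx hy).trans (by gcongr),
    fun ρ hρ a b a' b' ha hb ha' hb' => (hf.b2 ρ hρ a b a' b' ha hb ha' hb').trans (by gcongr)⟩

theorem RB.of_smooth {V : Type*} [NormedAddCommGroup V] [NormedSpace ℝ V] {m : ℕ} {C : ℝ}
    (hC : 0 ≤ C) {f : V → ℝ} (h0 : ∀ x ≠ 0, |f x| ≤ C / ‖x‖ ^ m)
    (hd : ∀ x ≠ 0, DifferentiableAt ℝ f x)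
    (h1 : ∀ x ≠ 0, ‖fderiv ℝ f x‖ ≤ C / ‖x‖ ^ (m + 1))
    (hd2 : ∀ x ≠ 0, DifferentiableAt ℝ (fderiv ℝ f) x)
    (h2 : ∀ x ≠ 0, ‖fderiv ℝ (fderiv ℝ f) x‖ ≤ C / ‖x‖ ^ (m + 2)) :
    RB m (32 * 2 ^ (m + 2) * C) f := by
  have p1 : (1:ℝ) ≤ 2 ^ m := one_le_pow₀ (by norm_num)
  have nz : ∀ {ρ : ℝ} {x : V}, 0 < ρ → ρ ≤ ‖x‖ → x ≠ 0 := fun hρ h =>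
    norm_pos_iff.1 (hρ.trans_le h)
  have a0 : ∀ ρ > 0, ∀ x, ρ ≤ ‖x‖ → |f x| ≤ C / ρ ^ m := fun ρ hρ x hx =>
    (h0 x (nz hρ hx)).trans (by gcongr)
  have nb : ∀ {ρ : ℝ} {x z : V}, ρ ≤ ‖x‖ → z ∈ closedBall x (ρ / 2) → ρ / 2 ≤ ‖z‖ := by
    intro ρ x z hx hz
    rw [mem_closedBall, dist_eq_norm] at hz
    have := norm_sub_norm_le x z
    rw [norm_sub_rev] at this
    linarith
  have B1 : ∀ ρ > 0, ∀ z, ρ / 2 ≤ ‖z‖ → ‖fderiv ℝ f z‖ ≤ 2 ^ (m + 1) * C / ρ ^ (m + 1) := by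
    intro ρ hρ z hz
    refine (h1 z (nz (half_pos hρ) hz)).trans ?_
    calc C / ‖z‖ ^ (m + 1) ≤ C / (ρ / 2) ^ (m + 1) := by gcongr
      _ = _ := by rw [div_pow]; field_simp
  have B2 : ∀ ρ > 0, ∀ z, ρ / 2 ≤ ‖z‖ →
      ‖fderiv ℝ (fderiv ℝ f) z‖ ≤ 2 ^ (m + 2) * C / ρ ^ (m + 2) := by
    intro ρ hρ z hz
    refine (h2 z (nz (half_pos hρ) hz)).trans ?_
    calc C / ‖z‖ ^ (m + 2) ≤ C / (ρ / 2) ^ (m + 2) := by gcongr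
      _ = _ := by rw [div_pow]; field_simp
  have a1 : ∀ ρ > 0, ∀ x y, ρ ≤ ‖x‖ → ρ ≤ ‖y‖ →
      |f x - f y| ≤ 2 ^ (m + 2) * C * ‖x - y‖ / ρ ^ (m + 1) := by
    intro ρ hρ x y hx hy
    by_cases hxy : ‖x - y‖ ≤ ρ / 2
    · have := (convex_closedBall x (ρ / 2)).norm_image_sub_le_of_norm_fderiv_le
        (𝕜 := ℝ) (f := f) (fun z hz => hd z (nz (half_pos hρ) (nb hx hz)))
        (fun z hz => B1 ρ hρ z (nb hx hz)) (x := y) (y := x)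
        (by rw [mem_closedBall, dist_comm, dist_eq_norm]; exact hxy)
        (mem_closedBall_self (by positivity))
      rw [Real.norm_eq_abs] at this
      refine this.trans ?_
      have : 0 ≤ 2 ^ (m + 1) * C / ρ ^ (m + 1) * ‖x - y‖ := by positivity
      calc 2 ^ (m + 1) * C / ρ ^ (m + 1) * ‖x - y‖
          ≤ 2 * (2 ^ (m + 1) * C / ρ ^ (m + 1) * ‖x - y‖) := by linarith
        _ = _ := by rw [pow_succ 2 (m + 1)]; ring
    · push Not at hxy
      have := (abs_sub (f x) (f y)).trans (add_le_add (a0 ρ hρ x hx) (a0 ρ hρ y hy))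
      refine this.trans ?_
      calc C / ρ ^ m + C / ρ ^ m = 4 * 1 * C * (ρ / 2) / ρ ^ (m + 1) := by
            rw [pow_succ]; field_simp; ring
        _ ≤ 4 * 2 ^ m * C * ‖x - y‖ / ρ ^ (m + 1) := by gcongr
        _ = _ := by rw [pow_add 2 m 2]; ring
  refine ⟨by positivity, fun ρ hρ x hx => (a0 ρ hρ x hx).trans ?_,
    fun ρ hρ x y hx hy => (a1 ρ hρ x y hx hy).trans ?_, ?_⟩
  · gcongr
    have : (1:ℝ) ≤ 2 ^ (m + 2) := one_le_pow₀ (by norm_num)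
    nlinarith
  · gcongr
    have : (0:ℝ) ≤ 2 ^ (m + 2) := by positivity
    linarith
  intro ρ hρ a b a' b' ha hb ha' hb'
  set D := ‖(a - b) - (a' - b')‖
  by_cases hbig : ρ / 8 < ‖a - b‖ + ‖a' - b'‖
  · have e : |(f a - f b) - (f a' - f b')| ≤ |f a - f a'| + |f b - f b'| := by
      rw [show (f a - f b) - (f a' - f b') = (f a - f a') - (f b - f b') by ring]
      exact abs_sub _ _
    refine (e.trans (add_le_add (a1 ρ hρ _ _ ha ha') (a1 ρ hρ _ _ hb hb'))).trans ?_
    calc 2 ^ (m + 2) * C * ‖a - a'‖ / ρ ^ (m + 1) + 2 ^ (m + 2) * C * ‖b - b'‖ / ρ ^ (m + 1)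
        = 8 * 2 ^ (m + 2) * C * (0 / ρ ^ (m + 1) +
          (ρ / 8) * (‖a - a'‖ + ‖b - b'‖) / ρ ^ (m + 2)) := by
            rw [pow_succ ρ (m + 1)]; field_simp; ring
      _ ≤ 32 * 2 ^ (m + 2) * C * (D / ρ ^ (m + 1) +
          (‖a - b‖ + ‖a' - b'‖) * (‖a - a'‖ + ‖b - b'‖) / ρ ^ (m + 2)) := by
            gcongr
            · norm_num
            · positivity
  by_cases hbig2 : ρ / 8 < ‖a - a'‖ + ‖b - b'‖
  · refine ((abs_sub _ _).trans (add_le_add (a1 ρ hρ _ _ ha hb) (a1 ρ hρ _ _ ha' hb'))).trans ?_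
    calc 2 ^ (m + 2) * C * ‖a - b‖ / ρ ^ (m + 1) + 2 ^ (m + 2) * C * ‖a' - b'‖ / ρ ^ (m + 1)
        = 8 * 2 ^ (m + 2) * C * (0 / ρ ^ (m + 1) +
          (‖a - b‖ + ‖a' - b'‖) * (ρ / 8) / ρ ^ (m + 2)) := by
            rw [pow_succ ρ (m + 1)]; field_simp; ring
      _ ≤ 32 * 2 ^ (m + 2) * C * (D / ρ ^ (m + 1) +
          (‖a - b‖ + ‖a' - b'‖) * (‖a - a'‖ + ‖b - b'‖) / ρ ^ (m + 2)) := by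
            gcongr
            · norm_num
            · positivity
  push Not at hbig hbig2
  have n1 := norm_nonneg (a - b)
  have n2 := norm_nonneg (a' - b')
  have n3 := norm_nonneg (a - a')
  have n4 := norm_nonneg (b - b')
  have i1 : ∀ t ∈ Icc (0:ℝ) 1, b + t • (a - b) ∈ closedBall b (ρ / 2) := by
    intro t ht
    rw [mem_closedBall, dist_eq_norm, add_sub_cancel_left, norm_smul, Real.norm_of_nonneg ht.1]
    nlinarith [ht.2]
  have i2 : ∀ t ∈ Icc (0:ℝ) 1, b' + t • (a' - b') ∈ closedBall b (ρ / 2) := by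
    intro t ht
    rw [mem_closedBall, dist_eq_norm, show b' + t • (a' - b') - b = t • (a' - b') - (b - b') by abel]
    refine (norm_sub_le _ _).trans ?_
    rw [norm_smul, Real.norm_of_nonneg ht.1]
    nlinarith [ht.2]
  have hD : ∀ z ∈ closedBall b (ρ / 2), z ≠ 0 := fun z hz => nz (half_pos hρ) (nb hb hz)
  set h : ℝ → ℝ := fun t => f (b + t • (a - b)) - f (b' + t • (a' - b')) with hh
  set h' : ℝ → ℝ := fun t => fderiv ℝ f (b + t • (a - b)) (a - b)
    - fderiv ℝ f (b' + t • (a' - b')) (a' - b') with hh'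
  have dl : ∀ (p q : V) (t : ℝ), HasDerivAt (fun t : ℝ => p + t • q) q t := fun p q t => by
    simpa using ((hasDerivAt_id t).smul_const q).const_add p
  have hder : ∀ t ∈ Icc (0:ℝ) 1, HasDerivWithinAt h (h' t) (Icc 0 1) t := by
    intro t ht
    exact (((hd _ (hD _ (i1 t ht))).hasFDerivAt.comp_hasDerivAt t (dl b (a - b) t)).sub
      ((hd _ (hD _ (i2 t ht))).hasFDerivAt.comp_hasDerivAt t (dl b' (a' - b') t))).hasDerivWithinAt
  have hbd : ∀ t ∈ Ico (0:ℝ) 1, ‖h' t‖ ≤ 2 ^ (m + 2) * C * (D / ρ ^ (m + 1)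
      + (‖a - b‖ + ‖a' - b'‖) * (‖a - a'‖ + ‖b - b'‖) / ρ ^ (m + 2)) := by
    intro t ht
    have ht' := Ico_subset_Icc_self ht
    have e : h' t = fderiv ℝ f (b + t • (a - b)) ((a - b) - (a' - b')) +
        (fderiv ℝ f (b + t • (a - b)) - fderiv ℝ f (b' + t • (a' - b'))) (a' - b') := by
      simp only [hh', map_sub, sub_apply]; ring
    have l1 : ‖fderiv ℝ f (b + t • (a - b)) ((a - b) - (a' - b'))‖ ≤
        2 ^ (m + 1) * C / ρ ^ (m + 1) * D := (ContinuousLinearMap.le_opNorm _ _).trans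
      (mul_le_mul_of_nonneg_right (B1 ρ hρ _ (nb hb (i1 t ht'))) (norm_nonneg _))
    have l2 := (convex_closedBall b (ρ / 2)).norm_image_sub_le_of_norm_fderiv_le
        (𝕜 := ℝ) (f := fderiv ℝ f) (fun z hz => hd2 z (hD z hz))
        (fun z hz => B2 ρ hρ z (nb hb hz)) (i2 t ht') (i1 t ht')
    have l3 : ‖b + t • (a - b) - (b' + t • (a' - b'))‖ ≤ ‖a - a'‖ + ‖b - b'‖ := by
      rw [show b + t • (a - b) - (b' + t • (a' - b')) = (1 - t) • (b - b') + t • (a - a') by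
        module]
      refine (norm_add_le _ _).trans ?_
      rw [norm_smul, norm_smul, Real.norm_of_nonneg ht.1, Real.norm_of_nonneg (by linarith [ht.2])]
      nlinarith [ht.1, ht.2]
    have l4 : ‖(fderiv ℝ f (b + t • (a - b)) - fderiv ℝ f (b' + t • (a' - b'))) (a' - b')‖ ≤
        2 ^ (m + 2) * C / ρ ^ (m + 2) * (‖a - a'‖ + ‖b - b'‖) * (‖a - b‖ + ‖a' - b'‖) := by
      refine (ContinuousLinearMap.le_opNorm _ _).trans ?_
      gcongr
      · exact l2.trans (by gcongr)
      · linarith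
    rw [e]
    refine (norm_add_le _ _).trans ((add_le_add l1 l4).trans ?_)
    have : 0 ≤ 2 ^ (m + 1) * C / ρ ^ (m + 1) * D := by positivity
    have e2 : (2:ℝ) ^ (m + 2) * C * (D / ρ ^ (m + 1)) =
      2 * (2 ^ (m + 1) * C / ρ ^ (m + 1) * D) := by rw [pow_succ 2 (m + 1)]; ring
    rw [mul_add (2 ^ (m + 2) * C), e2]
    refine add_le_add (by linarith) (le_of_eq (by ring))
  have key := norm_image_sub_le_of_norm_deriv_le_segment_01' hder hbd
  rw [Real.norm_eq_abs] at key
  have e3 : h 1 - h 0 = (f a - f b) - (f a' - f b') := by simp [hh]; ring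
  rw [e3] at key
  refine key.trans ?_
  gcongr
  have : (0:ℝ) ≤ 2 ^ (m + 2) := by positivity
  linarith


theorem RB.one_sub {V : Type*} [NormedAddCommGroup V] {B : ℝ} {u : V → ℝ} (hu : RB 0 B u)
    (h0 : ∀ x, 0 ≤ u x) (h1 : ∀ x, u x ≤ 1) : RB 0 (B + 1) (fun x => 1 - u x) := by
  have H := hu.mono (show B ≤ B + 1 by linarith)
  refine ⟨H.nn, fun ρ hρ x hx => ?_, fun ρ hρ x y hx hy => ?_,
    fun ρ hρ a b a' b' ha hb ha' hb' => ?_⟩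
  · rw [pow_zero, div_one, abs_le]; constructor <;> linarith [h0 x, h1 x, hu.nn]
  · rw [show 1 - u x - (1 - u y) = -(u x - u y) by ring, abs_neg]; exact H.b1 ρ hρ x y hx hy
  · rw [show (1 - u a - (1 - u b)) - (1 - u a' - (1 - u b')) =
      -((u a - u b) - (u a' - u b')) by ring, abs_neg]
    exact H.b2 ρ hρ a b a' b' ha hb ha' hb'

abbrev EV (n : ℕ) := EuclideanSpace ℝ (Fin n)

def ubp (n : ℕ) : ContDiffBump (0 : EV n) := ⟨1/2, 1, by norm_num, by norm_num⟩

/-- smooth cutoff: 1 on `‖v‖ ≤ 1/2`, 0 for `‖v‖ ≥ 1` -/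
def uc (n : ℕ) (v : EV n) : ℝ := ubp n v

theorem uc_nonneg {n} (v : EV n) : 0 ≤ uc n v := (ubp n).nonneg
theorem uc_le_one {n} (v : EV n) : uc n v ≤ 1 := (ubp n).le_one
theorem uc_neg {n} (v : EV n) : uc n (-v) = uc n v := (ubp n).neg v
theorem uc_one {n} {v : EV n} (h : ‖v‖ ≤ 1 / 2) : uc n v = 1 :=
  (ubp n).one_of_mem_closedBall (by simpa [ubp] using h)
theorem uc_zero {n} {v : EV n} (h : 1 ≤ ‖v‖) : uc n v = 0 :=
  (ubp n).zero_of_le_dist (by simpa [ubp] using h)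
theorem uc_cont {n} : Continuous (uc n) := (ubp n).continuous

theorem fderiv_bdd {V W : Type*} [NormedAddCommGroup V] [NormedSpace ℝ V] [NormedAddCommGroup W]
    [NormedSpace ℝ W] {u : V → W} (hc : HasCompactSupport u) (hs : Continuous (fderiv ℝ u)) :
    ∃ M, ∀ x, ‖fderiv ℝ u x‖ ≤ M := hs.bounded_above_of_compact_support (hc.fderiv ℝ)

theorem bump_RB {V : Type*} [NormedAddCommGroup V] [NormedSpace ℝ V] {u : V → ℝ}
    (hs : ContDiff ℝ 2 u) (hc : HasCompactSupport u) (hts : tsupport u = closedBall 0 1)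
    (h0 : ∀ x, 0 ≤ u x) (h1 : ∀ x, u x ≤ 1) : ∃ B, RB 0 B u := by
  have d1 : ContDiff ℝ 1 (fderiv ℝ u) := hs.fderiv_right (m := 1) (by norm_num)
  have d2 : Continuous (fderiv ℝ (fderiv ℝ u)) := d1.continuous_fderiv (by norm_num)
  obtain ⟨M1, hM1⟩ : ∃ M, ∀ x, ‖fderiv ℝ u x‖ ≤ M := fderiv_bdd hc d1.continuous
  obtain ⟨M2, hM2⟩ : ∃ M, ∀ x, ‖fderiv ℝ (fderiv ℝ u) x‖ ≤ M := 
    fderiv_bdd (hc.fderiv ℝ) d2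
  obtain ⟨C, hC1, hC2, hC3⟩ : ∃ C : ℝ, 1 ≤ C ∧ M1 ≤ C ∧ M2 ≤ C :=
    ⟨max 1 (max M1 M2), le_max_left _ _, (le_max_left _ _).trans (le_max_right _ _),
      (le_max_right _ _).trans (le_max_right _ _)⟩
  have hC : (0:ℝ) ≤ C := zero_le_one.trans hC1
  have far : ∀ x : V, 1 < ‖x‖ → fderiv ℝ u x = 0 ∧ fderiv ℝ (fderiv ℝ u) x = 0 := by
    intro x hx
    have h : x ∉ tsupport u := by rw [hts]; simpa using hx
    have h' : x ∉ tsupport (fderiv ℝ u) := fun hh => h (tsupport_fderiv_subset ℝ hh)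
    exact ⟨image_eq_zero_of_notMem_tsupport h',
      image_eq_zero_of_notMem_tsupport fun hh => h' (tsupport_fderiv_subset ℝ hh)⟩
  have key : ∀ (x : V) (j : ℕ), x ≠ 0 → ‖x‖ ≤ 1 → C ≤ C / ‖x‖ ^ j := fun x j h0 h1 => by
    rw [le_div_iff₀ (pow_pos (norm_pos_iff.2 h0) _)]
    exact mul_le_of_le_one_right hC (pow_le_one₀ (norm_nonneg _) h1)
  refine ⟨32 * 2 ^ (0 + 2) * C, RB.of_smooth hC (fun x _ => ?_) (fun x _ => hs.differentiable (by norm_num) x)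
    (fun x hx => ?_) (fun x _ => d1.differentiable (by norm_num) x) (fun x hx => ?_)⟩
  · rw [pow_zero, div_one, abs_of_nonneg (h0 x)]
    exact (h1 x).trans hC1
  · rcases le_or_gt ‖x‖ 1 with h | h
    · exact ((hM1 x).trans hC2).trans (key x _ hx h)
    · rw [(far x h).1, norm_zero]; positivity
  · rcases le_or_gt ‖x‖ 1 with h | h
    · exact ((hM2 x).trans hC3).trans (key x _ hx h)
    · rw [(far x h).2]; exact (norm_zero (E := V →L[ℝ] V →L[ℝ] ℝ)).le.trans (by positivity)

theorem uc_RB (n : ℕ) : ∃ B, RB 0 B (uc n) := by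
  have e : uc n = ⇑(ubp n) := rfl
  refine bump_RB ?_ ?_ ?_ uc_nonneg uc_le_one <;> rw [e]
  · exact (ubp n).contDiff
  · exact (ubp n).hasCompactSupport
  · exact (ubp n).tsupport_eq

/-- doubly truncated kernel -/
def Kt {n : ℕ} (K : EV n → ℝ) (η R : ℝ) (v : EV n) : ℝ :=
  K v * (1 - uc n (η⁻¹ • v)) * uc n (R⁻¹ • v)

theorem K_RB {n : ℕ} {K : EV (n+1) → ℝ} {C : ℝ}
    (hs : ContDiffOn ℝ 2 K {(0 : EV (n+1))}ᶜ)
    (hb : ∀ j ≤ 2, ∀ x : EV (n+1), x ≠ 0 →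
      ‖iteratedFDerivWithin ℝ j K {(0 : EV (n+1))}ᶜ x‖ ≤ C / ‖x‖ ^ (n + j)) :
    ∃ C', RB n C' K := by
  have ho : IsOpen ({(0 : EV (n+1))}ᶜ) := isOpen_compl_singleton
  have hb' : ∀ j ≤ 2, ∀ x : EV (n+1), x ≠ 0 →
      ‖iteratedFDeriv ℝ j K x‖ ≤ (max C 0) / ‖x‖ ^ (n + j) := fun j hj x hx => by
    rw [← iteratedFDerivWithin_of_isOpen j ho hx]
    exact (hb j hj x hx).trans (by gcongr; exact le_max_left _ _)
  have hat : ∀ x : EV (n+1), x ≠ 0 → ContDiffAt ℝ 2 K x := fun x hx =>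
    hs.contDiffAt (ho.mem_nhds hx)
  refine ⟨_, RB.of_smooth (le_max_right C 0) (fun x hx => ?_)
    (fun x hx => (hat x hx).differentiableAt (by norm_num)) (fun x hx => ?_)
    (fun x hx => ((hat x hx).fderiv_right (m := 1) (by norm_num)).differentiableAt (by norm_num))
    (fun x hx => ?_)⟩
  · simpa using hb' 0 (by norm_num) x hx
  · rw [← norm_iteratedFDeriv_one]; exact hb' 1 (by norm_num) x hx
  · rw [← norm_iteratedFDeriv_one, norm_iteratedFDeriv_fderiv]; exact hb' 2 le_rfl x hx

theorem Kt_RB {n : ℕ} {K : EV (n+1) → ℝ} {C : ℝ} (hK : RB n C K) :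
    ∃ C', ∀ η > 0, ∀ R > 0, RB n C' (Kt K η R) := by
  obtain ⟨B, hB⟩ := uc_RB (n+1)
  exact ⟨_, fun η hη R hR => (hK.mul ((hB.scale hη).one_sub (fun x => uc_nonneg _)
    (fun x => uc_le_one _))).mul (hB.scale hR)⟩

theorem Kt_neg {n : ℕ} {K : EV n → ℝ} (h : ∀ x, K (-x) = -K x) (η R : ℝ) (x : EV n) :
    Kt K η R (-x) = -Kt K η R x := by
  simp only [Kt, h, smul_neg, uc_neg]; ring

theorem Kt_near {n : ℕ} {K : EV n → ℝ} {η R : ℝ} (hη : 0 < η) {v : EV n} (h : ‖v‖ ≤ η / 2) :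
    Kt K η R v = 0 := by
  rw [Kt, uc_one (v := η⁻¹ • v)]; · ring
  rw [norm_smul, Real.norm_of_nonneg (inv_nonneg.2 hη.le), inv_mul_le_iff₀ hη]; linarith

theorem Kt_far {n : ℕ} {K : EV n → ℝ} {η R : ℝ} (hR : 0 < R) {v : EV n} (h : R ≤ ‖v‖) :
    Kt K η R v = 0 := by
  rw [Kt, uc_zero (v := R⁻¹ • v)]; · ring
  rw [norm_smul, Real.norm_of_nonneg (inv_nonneg.2 hR.le), le_inv_mul_iff₀ hR]; linarith

theorem Kt_cont {n : ℕ} {K : EV n → ℝ} (hK : ContinuousOn K {(0 : EV n)}ᶜ) {η R : ℝ}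
    (hη : 0 < η) : Continuous (Kt K η R) := by
  rw [continuous_iff_continuousAt]
  intro x
  by_cases hx : x = 0
  · have : Kt K η R =ᶠ[𝓝 x] fun _ => 0 := by
      filter_upwards [closedBall_mem_nhds x (half_pos hη)] with v hv
      exact Kt_near hη (by simpa [hx] using hv)
    exact continuousAt_const.congr this.symm
  · have h1 : ContinuousAt K x := hK.continuousAt (isOpen_compl_singleton.mem_nhds hx)
    have h2 := uc_cont (n := n)
    unfold Kt
    fun_prop
end

section
theorem abs_pow_sub_le (m : ℕ) {d d' : ℝ} (hd : 0 < d) (h0 : 0 ≤ d') (h : d' ≤ 2 * d) :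
    |d ^ m - d' ^ m| ≤ m * 2 ^ m * d ^ m * |d - d'| / d := by
  rcases m with _ | m
  · simp
  refine (abs_pow_sub_pow_le d d' (m+1)).trans ?_
  have hm : max |d| |d'| ≤ 2 * d := by
    rw [abs_of_pos hd, abs_of_nonneg h0]; exact max_le (by linarith) h
  have h1 : max |d| |d'| ^ m ≤ (2 * d) ^ m := by
    gcongr
  have h2 : (0:ℝ) ≤ |d - d'| * (m+1:ℕ) := by positivity
  calc |d - d'| * ((m+1:ℕ):ℝ) * max |d| |d'| ^ (m + 1 - 1)
      ≤ |d - d'| * ((m+1:ℕ):ℝ) * (2 * d) ^ m := by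
        rw [Nat.add_sub_cancel]; exact mul_le_mul_of_nonneg_left h1 h2
    _ ≤ 2 * (|d - d'| * ((m+1:ℕ):ℝ) * (2 * d) ^ m) := by
        have : 0 ≤ |d - d'| * ((m+1:ℕ):ℝ) * (2 * d) ^ m := by positivity
        linarith
    _ = _ := by rw [pow_succ, pow_succ d m, mul_pow]; field_simp

theorem KH_of {V : Type*} [NormedAddCommGroup V] [InnerProductSpace ℝ V] {m : ℕ} {C c Λ A : ℝ}
    {k : V → ℝ} (hk : RB (m+1) C k) (ko : ∀ x, k (-x) = - k x) (hc : 0 < c) (hΛ : 0 < Λ) (hA : 0 < A)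
    (h1 : C / c ^ (m+1) ≤ A) (h2 : C * Λ / c ^ (m+2) ≤ A) (h3 : 4 * C * Λ ^ 2 / c ^ (m+3) ≤ A)
    (h4 : m * 2 ^ m * C / c ^ (m+1) + 4 ^ (m+1) * C * Λ / c ^ (m+2) ≤ A)
    {γ : ℤ → V} {r : ℝ} (hr : 0 < r) (hl : ∀ i j : ℤ, c * r * |(i:ℝ) - j| ≤ ‖γ i - γ j‖)
    (hu : ∀ i j : ℤ, ‖γ i - γ j‖ ≤ Λ * r * |(i:ℝ) - j|) :
    KH (fun i => (Λ * r)⁻¹ • γ i)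
      (fun i j => A⁻¹ * (r ^ (m+1) * |(i:ℝ) - j| ^ m * k (γ i - γ j))) := by
  have hC := hk.nn
  have hLr : 0 < Λ * r := by positivity
  have hn : ∀ v : V, ‖(Λ * r)⁻¹ • v‖ = (Λ * r)⁻¹ * ‖v‖ := fun v => by
    rw [norm_smul, Real.norm_of_nonneg (by positivity)]
  have hAi : ∀ {x y : ℝ}, 0 ≤ y → |x| ≤ A * y → |A⁻¹ * x| ≤ y := by
    intro x y hy h
    rw [abs_mul, abs_of_pos (inv_pos.2 hA), inv_mul_le_iff₀ hA]; exact h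
  refine ⟨?_, ?_, ?_, ?_, ?_, ?_⟩
  · intro s t
    rw [← smul_sub, hn, inv_mul_le_iff₀ hLr]; exact hu s t
  · intro s t
    rw [show γ s - γ t = -(γ t - γ s) by abel, ko, abs_sub_comm]; ring
  · intro s t
    by_cases hst : s = t
    · subst hst
      have : k 0 = 0 := by have := ko 0; rw [neg_zero] at this; linarith
      simp [this]
    have hd : 0 < |(s:ℝ) - t| := abs_pos.2 (sub_ne_zero.2 (by exact_mod_cast hst))
    refine hAi (by positivity) ?_
    have := hk.b0 (c * r * |(s:ℝ) - t|) (by positivity) _ (hl s t)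
    rw [abs_mul, abs_of_nonneg (by positivity)]
    generalize |(s:ℝ) - t| = d at *
    calc r ^ (m+1) * d ^ m * |k (γ s - γ t)| ≤ r ^ (m+1) * d ^ m * (C / (c * r * d) ^ (m+1)) := by
          gcongr
      _ = C / c ^ (m+1) * (1 / d) := by rw [mul_pow, mul_pow, pow_succ d m]; field_simp
      _ ≤ A * (1 / d) := by gcongr
  · intro s s' t h
    by_cases hst : s = t
    · subst hst
      have : (s:ℝ) = s' := by
        rw [sub_self, abs_zero] at h
        have := abs_nonneg ((s:ℝ) - s')
        exact sub_eq_zero.1 (abs_eq_zero.1 (by linarith))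
      have : s = s' := by exact_mod_cast this
      subst this; simp
    have hd : 0 < |(s:ℝ) - t| := abs_pos.2 (sub_ne_zero.2 (by exact_mod_cast hst))
    have l1 : |(s:ℝ) - t| ≤ |(s:ℝ) - s'| + |(s':ℝ) - t| := abs_sub_le _ _ _
    have l2 : |(s':ℝ) - t| ≤ |(s:ℝ) - s'| + |(s:ℝ) - t| := by
      rw [abs_sub_comm (s:ℝ) s']; exact abs_sub_le _ _ _
    have l3 : |(|(s:ℝ) - t| - |(s':ℝ) - t|)| ≤ |(s:ℝ) - s'| := by
      refine (abs_abs_sub_abs_le _ _).trans (le_of_eq ?_); congr 1; ring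
    have n1 := hl s t
    have n2 := hl s' t
    have n3 := hu s s'
    have h0 := abs_nonneg ((s':ℝ) - t)
    have h00 := abs_nonneg ((s:ℝ) - s')
    rw [← mul_sub, ← sq_abs]
    generalize |(s:ℝ) - t| = d at *
    generalize |(s':ℝ) - t| = d' at *
    generalize |(s:ℝ) - s'| = δ at *
    refine hAi (by positivity) ?_
    have hρ : c * r * (d / 2) ≤ c * r * d' := by gcongr; linarith
    have hρ' : c * r * (d / 2) ≤ c * r * d := by gcongr; linarith
    have q0 := hk.b0 (c * r * d) (by positivity) _ n1
    have q1 := hk.b1 (c * r * (d / 2)) (by positivity) _ _ (hρ'.trans n1) (hρ.trans n2)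
    rw [sub_sub_sub_cancel_right] at q1
    have q2 := abs_pow_sub_le m hd h0 (by linarith)
    have e : r ^ (m+1) * d ^ m * k (γ s - γ t) - r ^ (m+1) * d' ^ m * k (γ s' - γ t) =
      r ^ (m+1) * ((d ^ m - d' ^ m) * k (γ s - γ t)) +
      r ^ (m+1) * (d' ^ m * (k (γ s - γ t) - k (γ s' - γ t))) := by ring
    rw [e]
    refine (abs_add_le _ _).trans ?_
    rw [abs_mul, abs_mul, abs_mul, abs_mul, abs_of_pos (pow_pos hr (m+1)), abs_of_nonneg (pow_nonneg h0 m)]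
    calc r ^ (m+1) * (|d ^ m - d' ^ m| * |k (γ s - γ t)|) +
          r ^ (m+1) * (d' ^ m * |k (γ s - γ t) - k (γ s' - γ t)|)
        ≤ r ^ (m+1) * ((m * 2 ^ m * d ^ m * δ / d) * (C / (c * r * d) ^ (m+1))) +
          r ^ (m+1) * ((2 * d) ^ m * (C * (Λ * r * δ) / (c * r * (d / 2)) ^ (m+1+1))) := by
          gcongr
          · exact q2.trans (by gcongr)
          · linarith
          · exact q1.trans (by gcongr)
      _ = (m * 2 ^ m * C / c ^ (m+1) + 4 ^ (m+1) * C * Λ / c ^ (m+2)) * (δ / d ^ 2) := by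
          rw [show (4:ℝ) ^ (m+1) = 2 ^ m * 2 ^ (m+2) by
            rw [← pow_add, show m + (m+2) = 2 * (m+1) by ring, pow_mul]; norm_num]
          simp only [mul_pow, div_pow, pow_succ]
          field_simp
      _ ≤ A * (δ / d ^ 2) := by gcongr
  all_goals
    intro s s' h hh
    have hh' : (0:ℝ) < h := by exact_mod_cast hh
    have ea : ∀ s : ℤ, |(s:ℝ) - ((s + (h:ℤ) : ℤ):ℝ)| = h := fun s => by
      push_cast; rw [sub_add_cancel_left, abs_neg, abs_of_pos hh']
    have eb : ∀ s : ℤ, |((s - (h:ℤ) : ℤ):ℝ) - (s:ℝ)| = h := fun s => by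
      push_cast; rw [sub_sub_cancel_left, abs_neg, abs_of_pos hh']
    have na : ∀ s : ℤ, c * r * h ≤ ‖γ s - γ (s + h)‖ := fun s => by
      have := hl s (s + h); rwa [ea] at this
    have nb : ∀ s : ℤ, c * r * h ≤ ‖γ (s - h) - γ s‖ := fun s => by
      have := hl (s - h) s; rwa [eb] at this
  · rw [ea, ea, ← mul_sub]
    refine hAi (by positivity) ?_
    rw [← mul_sub, abs_mul, abs_of_nonneg (by positivity)]
    have := hk.b1 (c * r * h) (by positivity) _ _ (na s) (na s')
    rw [← smul_sub, ← smul_sub, ← smul_sub, hn]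
    rw [show γ s - γ (s + h) - (γ s' - γ (s' + h)) =
      -((γ (s + h) - γ s) - (γ (s' + h) - γ s')) by abel, norm_neg] at this
    have hD := norm_nonneg ((γ (s + h) - γ s) - (γ (s' + h) - γ s'))
    generalize ‖(γ (s + h) - γ s) - (γ (s' + h) - γ s')‖ = D at *
    calc r ^ (m+1) * (h:ℝ) ^ m * |k (γ s - γ (s + h)) - k (γ s' - γ (s' + h))|
        ≤ r ^ (m+1) * (h:ℝ) ^ m * (C * D / (c * r * h) ^ (m+1+1)) := by gcongr
      _ = C * Λ / c ^ (m+2) * ((Λ * r)⁻¹ * D / (h:ℝ) ^ 2) := by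
          simp only [mul_pow, pow_succ]; field_simp
      _ ≤ A * ((Λ * r)⁻¹ * D / (h:ℝ) ^ 2) := by
          gcongr
  · rw [ea, ea, eb, eb]
    have := hk.b2 (c * r * h) (by positivity) _ _ _ _ (na s) (nb s) (na s') (nb s')
    have e2 : ∀ s : ℤ, γ s - γ (s + h) - (γ (s - h) - γ s) =
        -(γ (s + h) + γ (s - h) - (2:ℝ) • γ s) := fun s => by rw [two_smul]; abel
    have e3 : ∀ s : ℤ, (Λ * r)⁻¹ • γ (s + h) + (Λ * r)⁻¹ • γ (s - h) - (2:ℝ) • (Λ * r)⁻¹ • γ s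
        = (Λ * r)⁻¹ • (γ (s + h) + γ (s - h) - (2:ℝ) • γ s) := fun s => by
      rw [smul_sub, smul_add, smul_comm (2:ℝ)]
    have u1 : ‖γ s - γ (s + h) - (γ s' - γ (s' + h))‖ ≤ 2 * (Λ * r * |(s:ℝ) - s'|) := by
      rw [show γ s - γ (s + h) - (γ s' - γ (s' + h)) = (γ s - γ s') - (γ (s + h) - γ (s' + h)) by abel]
      have a1 := hu s s'
      have a2 := hu (s + h) (s' + h)
      push_cast at a2
      rw [add_sub_add_right_eq_sub] at a2
      linarith [norm_sub_le (γ s - γ s') (γ (s + h) - γ (s' + h))]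
    have u2 : ‖γ (s - h) - γ s - (γ (s' - h) - γ s')‖ ≤ 2 * (Λ * r * |(s:ℝ) - s'|) := by
      rw [show γ (s - h) - γ s - (γ (s' - h) - γ s') = (γ (s - h) - γ (s' - h)) - (γ s - γ s') by abel]
      have a1 := hu s s'
      have a2 := hu (s - h) (s' - h)
      push_cast at a2
      rw [sub_sub_sub_cancel_right] at a2
      linarith [norm_sub_le (γ (s - h) - γ (s' - h)) (γ s - γ s')]
    rw [e2, e2, ← neg_sub', norm_neg, norm_neg, norm_neg] at this
    rw [← mul_sub, ← mul_sub, ← mul_sub, ← mul_sub, ← mul_sub, ← mul_sub]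
    simp only [e3, ← smul_sub, hn]
    refine hAi (by positivity) ?_
    rw [abs_mul, abs_of_nonneg (by positivity)]
    generalize hX : γ (s + h) + γ (s - h) - (2:ℝ) • γ s = X at *
    generalize hY : γ (s' + h) + γ (s' - h) - (2:ℝ) • γ s' = Y at *
    have hXY := norm_nonneg (X - Y)
    have hx := norm_nonneg X
    have hy := norm_nonneg Y
    have hδ := abs_nonneg ((s:ℝ) - s')
    generalize ‖X - Y‖ = D at *
    generalize ‖X‖ = x at *
    generalize ‖Y‖ = y at *
    generalize |(s:ℝ) - s'| = δ at *
    refine (mul_le_mul_of_nonneg_left this (by positivity)).trans ?_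
    calc r ^ (m+1) * (h:ℝ) ^ m * (C * (D / (c * r * h) ^ (m+1+1) + (x + y) *
          (‖γ s - γ (s + h) - (γ s' - γ (s' + h))‖ + ‖γ (s - h) - γ s - (γ (s' - h) - γ s')‖)
            / (c * r * h) ^ (m+1+2)))
        ≤ r ^ (m+1) * (h:ℝ) ^ m * (C * (D / (c * r * h) ^ (m+1+1) + (x + y) *
          (2 * (Λ * r * δ) + 2 * (Λ * r * δ)) / (c * r * h) ^ (m+1+2))) := by gcongr
      _ = C * Λ / c ^ (m+2) * ((Λ * r)⁻¹ * D / (h:ℝ) ^ 2) + 4 * C * Λ ^ 2 / c ^ (m+3) *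
          (((Λ * r)⁻¹ * x + (Λ * r)⁻¹ * y) * δ / (h:ℝ) ^ 3) := by
          simp only [mul_pow, pow_succ]; field_simp; ring
      _ ≤ A * ((Λ * r)⁻¹ * D / (h:ℝ) ^ 2) + A *
          (((Λ * r)⁻¹ * x + (Λ * r)⁻¹ * y) * δ / (h:ℝ) ^ 3) := by gcongr
      _ = _ := by ring
end

section
structure BLip {X V : Type*} [NormedAddCommGroup X] [NormedAddCommGroup V] (c Λ : ℝ) (g : X → V) : Prop where
  cpos : 0 < c
  Lpos : 0 < Λ
  lo : ∀ s t, c * ‖s - t‖ ≤ ‖g s - g t‖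
  hi : ∀ s t, ‖g s - g t‖ ≤ Λ * ‖s - t‖

theorem BLip.cont {X V : Type*} [NormedAddCommGroup X] [NormedAddCommGroup V] {c Λ : ℝ} {g : X → V}
    (h : BLip c Λ g) : Continuous g :=
  (LipschitzWith.of_dist_le_mul (K := Λ.toNNReal) fun x y => by
    rw [dist_eq_norm, dist_eq_norm, Real.coe_toNNReal _ h.Lpos.le]; exact h.hi x y).continuous

/-- bounded kernels admissible for the `L²` bound -/
structure Ker {V : Type*} [NormedAddCommGroup V] (m : ℕ) (C R : ℝ) (k : V → ℝ) : Prop where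
  rb : RB (m+1) C k
  odd : ∀ x, k (-x) = -k x
  cont : Continuous k
  bdd : ∃ M, ∀ x, |k x| ≤ M
  far : ∀ x, R ≤ ‖x‖ → k x = 0

theorem Ker.zero {V : Type*} [NormedAddCommGroup V] {m : ℕ} {C R : ℝ} {k : V → ℝ}
    (h : Ker m C R k) : k 0 = 0 := by have := h.odd 0; rw [neg_zero] at this; linarith

/-- integrable and square integrable -/
structure L12 {X : Type*} [MeasurableSpace X] (μ : Measure X) (f : X → ℝ) : Prop where
  i1 : Integrable f μ
  i2 : Integrable (fun x => f x ^ 2) μ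

section
variable {m : ℕ} {V : Type*} [NormedAddCommGroup V] [InnerProductSpace ℝ V]
  {C R c Λ A : ℝ} {k : V → ℝ} {g : EV (m+1) → V} {f φ : EV (m+1) → ℝ}

theorem bdd_int {α : Type*} [MeasurableSpace α] {μ : Measure α} {F q : α → ℝ} {M : ℝ}
    (hF : Integrable F μ) (hq : AEStronglyMeasurable q μ) (hM : ∀ x, |q x| ≤ M) :
    Integrable (fun x => q x * F x) μ :=
  hF.bdd_mul hq (Eventually.of_forall hM)

theorem P_slice (hk : Ker m C R k) (hg : BLip c Λ g) (hf : L12 volume f) (hφ : L12 volume φ)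
    (h : EV (m+1)) : Integrable (fun s => k (g s - g (s + h)) * (f (s + h) * φ s)) := by
  obtain ⟨M, hM⟩ := hk.bdd
  have hk' := hk.cont
  have hg' := hg.cont
  refine bdd_int ?_ (by fun_prop) (fun s => hM _)
  have a1 : Integrable (fun s => f (s + h) ^ 2) := hf.i2.comp_add_right h
  refine ((a1.add hφ.i2)).mono' ((hf.i1.comp_add_right h).1.mul hφ.i1.1) (Eventually.of_forall fun s => ?_)
  simp only [Pi.add_apply, Real.norm_eq_abs, abs_mul]
  nlinarith [sq_nonneg (|f (s+h)| - |φ s|), sq_abs (f (s+h)), sq_abs (φ s), sq_nonneg (f (s+h)), sq_nonneg (φ s)]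

def Pfn (k : V → ℝ) (g : EV (m+1) → V) (f φ : EV (m+1) → ℝ) (h : EV (m+1)) : ℝ :=
  ∫ s, k (g s - g (s + h)) * (f (s + h) * φ s)

theorem Pf_far (hk : Ker m C R k) (hg : BLip c Λ g) {h : EV (m+1)} (hh : R ≤ c * ‖h‖) :
    Pfn k g f φ h = 0 := by
  unfold Pfn
  refine integral_eq_zero_of_ae (Eventually.of_forall fun s => ?_)
  have := hg.lo s (s + h)
  rw [sub_add_cancel_left, norm_neg] at this
  simp [hk.far _ (hh.trans this)]

theorem P_step1 (hk : Ker m C R k) (hg : BLip c Λ g) (hf : L12 volume f) (hφ : L12 volume φ)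
    (hA : 0 < A) (h1 : C / c ^ (m+1) ≤ A) (h2 : C * Λ / c ^ (m+2) ≤ A)
    (h3 : 4 * C * Λ ^ 2 / c ^ (m+3) ≤ A)
    (h4 : m * 2 ^ m * C / c ^ (m+1) + 4 ^ (m+1) * C * Λ / c ^ (m+2) ≤ A)
    {θ : EV (m+1)} (hθ : θ ≠ 0) (J : ℕ) (hJ : R ≤ c * (‖θ‖ * J)) :
    |∑ l ∈ Finset.Ioo (-(J:ℤ)) J, |(l:ℝ)| ^ m * Pfn k g f φ ((l:ℝ) • θ)| ≤
      100000000 * A * ‖θ‖⁻¹ ^ (m+1) * ((∫ x, f x ^ 2) + ∫ x, φ x ^ 2) := by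
  have hr : 0 < ‖θ‖ := norm_pos_iff.2 hθ
  obtain ⟨N, hN⟩ : ∃ N : ℕ, N = 2 * J + 1 := ⟨_, rfl⟩
  set S := Finset.Ico (-(J:ℤ)) (N + J) with hS
  set S0 := Finset.Ico (0:ℤ) N with hS0
  have hsub : S0 ⊆ S := Finset.Ico_subset_Ico (by omega) (by omega)
  set W : ℤ → ℝ := fun l => |(l:ℝ)| ^ m * Pfn k g f φ ((l:ℝ) • θ) with hW
  obtain ⟨cc, hcc⟩ : ∃ cc, cc = A⁻¹ * ‖θ‖ ^ (m+1) := ⟨_, rfl⟩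
  have hcc0 : 0 < cc := by rw [hcc]; positivity
  have pt : ∀ x, |∑ i ∈ S0, ∑ j ∈ S, (cc * |(i:ℝ) - j| ^ m) *
      (k (g (x + (i:ℝ) • θ) - g (x + (j:ℝ) • θ)) * (f (x + (j:ℝ) • θ) * φ (x + (i:ℝ) • θ)))| ≤
      50000000 * (∑ i ∈ S, f (x + (i:ℝ) • θ) ^ 2 + ∑ i ∈ S0, φ (x + (i:ℝ) • θ) ^ 2) := by
    intro x
    have ed : ∀ i j : ℤ, ‖x + (i:ℝ) • θ - (x + (j:ℝ) • θ)‖ = ‖θ‖ * |(i:ℝ) - j| := fun i j => by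
      rw [add_sub_add_left_eq_sub, ← sub_smul, norm_smul, Real.norm_eq_abs, mul_comm]
    have H := KH_of hk.rb hk.odd hg.cpos hg.Lpos hA h1 h2 h3 h4 (γ := fun i : ℤ => g (x + (i:ℝ) • θ))
      hr (fun i j => by rw [mul_assoc, ← ed]; exact hg.lo _ _)
      (fun i j => by rw [mul_assoc, ← ed]; exact hg.hi _ _)
    have T := T1_final H J (fun i j hij => by
      have : (J:ℝ) ≤ |(i:ℝ) - j| := by exact_mod_cast hij
      rw [hk.far _ ((hJ.trans ?_).trans (hg.lo _ _)), mul_zero, mul_zero]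
      rw [ed]
      exact mul_le_mul_of_nonneg_left (mul_le_mul_of_nonneg_left this hr.le) hg.cpos.le)
      S (fun i => f (x + (i:ℝ) • θ)) (fun i => if i ∈ S0 then φ (x + (i:ℝ) • θ) else 0)
    have e1 : ∑ i ∈ S, (if i ∈ S0 then φ (x + (i:ℝ) • θ) else 0) ^ 2 =
        ∑ i ∈ S0, φ (x + (i:ℝ) • θ) ^ 2 := by
      rw [← Finset.sum_subset hsub]
      · exact Finset.sum_congr rfl fun i hi => by rw [if_pos hi]
      · intro i _ hi; rw [if_neg hi]; norm_num
    rw [e1] at T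
    refine le_trans (le_of_eq ?_) T
    congr 1
    rw [← Finset.sum_subset hsub]
    · refine Finset.sum_congr rfl fun i hi => Finset.sum_congr rfl fun j _ => ?_
      rw [if_pos hi, hcc]; ring
    · intro i _ hi; simp [hi]
  have tr : ∀ i j : ℤ, ∫ x, k (g (x + (i:ℝ) • θ) - g (x + (j:ℝ) • θ)) *
      (f (x + (j:ℝ) • θ) * φ (x + (i:ℝ) • θ)) = Pfn k g f φ (((j - i : ℤ):ℝ) • θ) := by
    intro i j
    have e : ∀ x, x + (i:ℝ) • θ + ((j - i : ℤ):ℝ) • θ = x + (j:ℝ) • θ := fun x => by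
      push_cast; module
    have := integral_add_right_eq_self (μ := volume) (fun s => k (g s - g (s + ((j - i : ℤ):ℝ) • θ)) *
      (f (s + ((j - i : ℤ):ℝ) • θ) * φ s)) ((i:ℝ) • θ)
    simp only [e] at this
    exact this
  have ti : ∀ i j : ℤ, Integrable (fun x => k (g (x + (i:ℝ) • θ) - g (x + (j:ℝ) • θ)) *
      (f (x + (j:ℝ) • θ) * φ (x + (i:ℝ) • θ))) := by
    intro i j
    have := (P_slice hk hg hf hφ (((j - i : ℤ):ℝ) • θ)).comp_add_right ((i:ℝ) • θ)
    have e : ∀ x, x + (i:ℝ) • θ + ((j - i : ℤ):ℝ) • θ = x + (j:ℝ) • θ := fun x => by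
      push_cast; module
    simpa only [e] using this
  have hWz : ∀ l : ℤ, (J:ℤ) ≤ |l| → W l = 0 := by
    intro l hl
    have hl' : (J:ℝ) ≤ |(l:ℝ)| := by exact_mod_cast hl
    simp only [hW]
    rw [Pf_far hk hg, mul_zero]
    rw [norm_smul, Real.norm_eq_abs, mul_comm |(l:ℝ)|]
    exact hJ.trans (mul_le_mul_of_nonneg_left (mul_le_mul_of_nonneg_left hl' hr.le) hg.cpos.le)
  have inner : ∀ i ∈ S0, ∑ j ∈ S, W (j - i) = ∑ l ∈ Finset.Ioo (-(J:ℤ)) J, W l := by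
    intro i hi
    rw [hS0, Finset.mem_Ico] at hi
    symm
    rw [← Finset.sum_subset (s₁ := Finset.Ioo (i - J) (i + J)) (s₂ := S)]
    · refine Finset.sum_bij (fun l _ => l + i) ?_ ?_ ?_ ?_
      · intro l hl; rw [Finset.mem_Ioo] at *; omega
      · intro a _ b _ h; simpa using h
      · intro b hb; rw [Finset.mem_Ioo] at hb
        exact ⟨b - i, by rw [Finset.mem_Ioo]; omega, by ring⟩
      · intro l _; simp
    · intro j hj; rw [hS, Finset.mem_Ico]; rw [Finset.mem_Ioo] at hj; omega
    · intro j _ hj; rw [Finset.mem_Ioo] at hj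
      refine hWz _ (le_abs.2 ?_); omega
  have I1 : ∫ x, ∑ i ∈ S0, ∑ j ∈ S, (cc * |(i:ℝ) - j| ^ m) *
      (k (g (x + (i:ℝ) • θ) - g (x + (j:ℝ) • θ)) * (f (x + (j:ℝ) • θ) * φ (x + (i:ℝ) • θ))) =
      cc * (N * ∑ l ∈ Finset.Ioo (-(J:ℤ)) J, W l) := by
    rw [integral_finsetSum _ fun i _ => integrable_finsetSum _ fun j _ => (ti i j).const_mul _]
    have : ∀ i ∈ S0, ∫ x, ∑ j ∈ S, (cc * |(i:ℝ) - j| ^ m) *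
      (k (g (x + (i:ℝ) • θ) - g (x + (j:ℝ) • θ)) * (f (x + (j:ℝ) • θ) * φ (x + (i:ℝ) • θ))) =
      cc * ∑ l ∈ Finset.Ioo (-(J:ℤ)) J, W l := by
      intro i hi
      rw [integral_finsetSum _ fun j _ => (ti i j).const_mul _, ← inner i hi, Finset.mul_sum]
      refine Finset.sum_congr rfl fun j _ => ?_
      rw [integral_const_mul, tr, mul_assoc, abs_sub_comm]
      simp only [hW]; push_cast; rfl
    rw [Finset.sum_congr rfl this, Finset.sum_const, hS0, Int.card_Ico, nsmul_eq_mul]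
    simp only [sub_zero, Int.toNat_natCast]; ring
  have sq : ∀ (q : EV (m+1) → ℝ) (T : Finset ℤ), Integrable (fun x => q x ^ 2) →
      Integrable (fun x => ∑ i ∈ T, q (x + (i:ℝ) • θ) ^ 2) ∧
      ∫ x, ∑ i ∈ T, q (x + (i:ℝ) • θ) ^ 2 = T.card * ∫ x, q x ^ 2 := by
    intro q T hq
    have hi : ∀ i ∈ T, Integrable (fun x => q (x + (i:ℝ) • θ) ^ 2) := fun i _ =>
      hq.comp_add_right _
    refine ⟨integrable_finsetSum _ hi, ?_⟩
    have hj : ∀ i ∈ T, ∫ x, q (x + (i:ℝ) • θ) ^ 2 = ∫ x, q x ^ 2 := fun i _ =>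
      integral_add_right_eq_self (fun x => q x ^ 2) ((i:ℝ) • θ)
    rw [integral_finsetSum _ hi, Finset.sum_congr rfl hj, Finset.sum_const, nsmul_eq_mul]
  have q1 := sq f S hf.i2
  have q2 := sq φ S0 hφ.i2
  have I2 := norm_integral_le_of_norm_le (μ := volume) (f := fun x => ∑ i ∈ S0, ∑ j ∈ S,
      (cc * |(i:ℝ) - j| ^ m) *
      (k (g (x + (i:ℝ) • θ) - g (x + (j:ℝ) • θ)) * (f (x + (j:ℝ) • θ) * φ (x + (i:ℝ) • θ))))
    (g := fun x => 50000000 * (∑ i ∈ S, f (x + (i:ℝ) • θ) ^ 2 + ∑ i ∈ S0, φ (x + (i:ℝ) • θ) ^ 2))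
    ((q1.1.add q2.1).const_mul 50000000) (Eventually.of_forall pt)
  rw [I1, integral_const_mul, integral_add q1.1 q2.1, q1.2, q2.2, Real.norm_eq_abs, abs_mul, abs_mul,
    abs_of_nonneg hcc0.le, abs_of_nonneg (Nat.cast_nonneg N), hS, hS0,
    Int.card_Ico, Int.card_Ico] at I2
  have c1 : ((((N:ℤ) + J - -J).toNat : ℕ):ℝ) ≤ 2 * N := by
    have : ((N:ℤ) + J - -J).toNat ≤ 2 * N := by omega
    exact_mod_cast this
  have c2 : ((((N:ℤ) - 0).toNat : ℕ):ℝ) ≤ 2 * N := by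
    have : ((N:ℤ) - 0).toNat ≤ 2 * N := by omega
    exact_mod_cast this
  have f0 : 0 ≤ ∫ x, f x ^ 2 := integral_nonneg fun x => sq_nonneg _
  have φ0 : 0 ≤ ∫ x, φ x ^ 2 := integral_nonneg fun x => sq_nonneg _
  have hN0 : (0:ℝ) < N := by rw [hN]; positivity
  have I3 : cc * (N * |∑ l ∈ Finset.Ioo (-(J:ℤ)) J, W l|) ≤
      50000000 * (2 * N * (∫ x, f x ^ 2) + 2 * N * ∫ x, φ x ^ 2) :=
    I2.trans (by gcongr)
  generalize |∑ l ∈ Finset.Ioo (-(J:ℤ)) J, W l| = Z at *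
  have I4 : cc * Z ≤ 100000000 * ((∫ x, f x ^ 2) + ∫ x, φ x ^ 2) := by
    refine le_of_mul_le_mul_left (a := (N:ℝ)) ?_ hN0
    linarith
  have I5 : Z ≤ cc⁻¹ * (100000000 * ((∫ x, f x ^ 2) + ∫ x, φ x ^ 2)) := by
    rw [le_inv_mul_iff₀ (by positivity)]; exact I4
  refine I5.trans (le_of_eq ?_)
  rw [hcc, mul_inv, inv_inv, inv_pow]; ring

end
end

section
section
variable {m : ℕ} {V : Type*} [NormedAddCommGroup V] [InnerProductSpace ℝ V]
  {C R c Λ A : ℝ} {k : V → ℝ} {g : EV (m+1) → V} {f φ : EV (m+1) → ℝ}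

theorem G_int (hk : Continuous k) (hb : ∃ M, ∀ x, |k x| ≤ M) (hg : Continuous g)
    (hf : Integrable f) (hφ : Integrable φ) :
    Integrable (fun p : EV (m+1) × EV (m+1) => k (g p.1 - g p.2) * (f p.2 * φ p.1)) := by
  obtain ⟨M, hM⟩ := hb
  refine bdd_int ?_ (Continuous.aestronglyMeasurable (by fun_prop)) (fun s => hM _)
  exact (hφ.mul_prod hf).congr (Eventually.of_forall fun p => mul_comm _ _)

theorem P_int (hk : Ker m C R k) (hg : BLip c Λ g) (hf : L12 volume f) (hφ : L12 volume φ) :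
    Integrable (Pfn k g f φ) ∧
    ∫ h, Pfn k g f φ h = ∫ s, ∫ t, k (g s - g t) * (f t * φ s) := by
  have hG := G_int hk.cont hk.bdd hg.cont hf.i1 hφ.i1
  have hF : Integrable (fun p : EV (m+1) × EV (m+1) =>
      k (g p.1 - g (p.1 + p.2)) * (f (p.1 + p.2) * φ p.1)) :=
    (measurePreserving_prod_add (volume : Measure (EV (m+1))) volume).integrable_comp_of_integrable hG
  refine ⟨hF.integral_prod_right, ?_⟩
  unfold Pfn
  rw [← integral_integral_swap hF]
  refine integral_congr_ae (Eventually.of_forall fun s => ?_)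
  exact integral_add_left_eq_self (μ := volume) (fun t => k (g s - g t) * (f t * φ s)) s

def Qm (m : ℕ) (u : EV (m+1)) : ℝ := if 1 ≤ ‖u‖ then ‖u‖⁻¹ ^ (m+2) else 0

theorem Qm_int (m : ℕ) : Integrable (Qm m) := by
  have h : Integrable (fun u : EV (m+1) => (2:ℝ) ^ (m+2) * (1 + ‖u‖) ^ (-((m+2 : ℕ):ℝ))) :=
    (integrable_one_add_norm (by rw [finrank_euclideanSpace_fin]; push_cast; linarith)).const_mul _
  refine h.mono' (Measurable.aestronglyMeasurable ?_) (Eventually.of_forall fun u => ?_)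
  · exact Measurable.ite (measurableSet_le measurable_const measurable_norm) (by fun_prop) (by fun_prop)
  · rw [Real.rpow_neg (by positivity), Real.rpow_natCast]
    unfold Qm
    split_ifs with h1
    · have : 0 < ‖u‖ := by linarith
      rw [Real.norm_eq_abs, abs_of_nonneg (by positivity), ← inv_pow, ← mul_pow]
      refine pow_le_pow_left₀ (by positivity) ?_ _
      rw [← div_eq_mul_inv, inv_le_iff_one_le_mul₀ this, div_mul_eq_mul_div, le_div_iff₀ (by positivity)]
      linarith
    · rw [norm_zero]; positivity

theorem cnt (J : ℕ) {x : ℝ} (hx : 0 ≤ x) (hJ : x < J) (y : ℝ) :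
    ∑ l ∈ (Finset.Ioo (-(J:ℤ)) J).erase 0, (if |(l:ℝ)| ≤ x then y else 0) = 2 * ⌊x⌋₊ * y := by
  rw [← Finset.sum_filter]
  have e : ((Finset.Ioo (-(J:ℤ)) J).erase 0).filter (fun l : ℤ => |(l:ℝ)| ≤ x) =
      (Finset.Icc (-(⌊x⌋₊:ℤ)) ⌊x⌋₊).erase 0 := by
    have hfl : ⌊x⌋₊ < J := (Nat.floor_lt hx).2 hJ
    ext l
    simp only [Finset.mem_filter, Finset.mem_erase, Finset.mem_Ioo, Finset.mem_Icc]
    have : |(l:ℝ)| ≤ x ↔ l.natAbs ≤ ⌊x⌋₊ := by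
      rw [Nat.le_floor_iff hx, ← Int.cast_abs, Int.abs_eq_natAbs, Int.cast_natCast]
    rw [this]; omega
  rw [e, Finset.sum_const, Finset.card_erase_of_mem (by simp), Int.card_Icc, nsmul_eq_mul]
  have : (((⌊x⌋₊:ℤ) + 1 - -⌊x⌋₊).toNat - 1) = 2 * ⌊x⌋₊ := by omega
  rw [this]; push_cast; ring

theorem avg_eps {P : EV (m+1) → ℝ} (hP : Integrable P) (h0 : P 0 = 0) {ρ B : ℝ}
    (hfar : ∀ h, ρ ≤ ‖h‖ → P h = 0)
    (hB : ∀ θ : EV (m+1), θ ≠ 0 → ∀ J : ℕ, ρ ≤ ‖θ‖ * J →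
      |∑ l ∈ Finset.Ioo (-(J:ℤ)) J, |(l:ℝ)| ^ m * P ((l:ℝ) • θ)| ≤ B * ‖θ‖⁻¹ ^ (m+1))
    {ε : ℝ} (hε : 0 < ε) :
    |∫ h, 2 * ⌊‖h‖ / ε⌋₊ * (ε / ‖h‖) * P h| ≤ B * ∫ u, Qm m u := by
  obtain ⟨J, hJ⟩ := exists_nat_ge (ρ / ε)
  rw [div_le_iff₀ hε, mul_comm] at hJ
  set ψ : EV (m+1) → ℝ := fun θ => if ε ≤ ‖θ‖ then ε / ‖θ‖ else 0 with hψ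
  have ψm : Measurable ψ :=
    Measurable.ite (measurableSet_le measurable_const measurable_norm) (by fun_prop) (by fun_prop)
  have ψb : ∀ θ, |ψ θ| ≤ 1 := fun θ => by
    simp only [hψ]; split_ifs with h
    · rw [abs_of_nonneg (by positivity)]; exact (div_le_one (hε.trans_le h)).2 h
    · simp
  set S := (Finset.Ioo (-(J:ℤ)) J).erase 0 with hS
  have li : ∀ l ∈ S, Integrable (fun θ => ψ θ * (|(l:ℝ)| ^ m * P ((l:ℝ) • θ))) := by
    intro l hl
    have hl0 : (l:ℝ) ≠ 0 := by exact_mod_cast (Finset.mem_erase.1 hl).1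
    exact bdd_int ((hP.comp_smul hl0).const_mul _) ψm.aestronglyMeasurable ψb
  have lv : ∀ l ∈ S, ∫ θ, ψ θ * (|(l:ℝ)| ^ m * P ((l:ℝ) • θ)) =
      ∫ h, (if |(l:ℝ)| ≤ ‖h‖ / ε then ε / ‖h‖ else 0) * P h := by
    intro l hl
    have hl0 : (l:ℝ) ≠ 0 := by exact_mod_cast (Finset.mem_erase.1 hl).1
    have hl1 : 0 < |(l:ℝ)| := abs_pos.2 hl0
    have := Measure.integral_comp_smul (volume : Measure (EV (m+1)))
      (fun h => |(l:ℝ)| ^ (m+1) * ((if |(l:ℝ)| ≤ ‖h‖ / ε then ε / ‖h‖ else 0) * P h)) (l:ℝ)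
    rw [integral_const_mul, integral_const_mul, smul_eq_mul, finrank_euclideanSpace_fin, abs_inv, abs_pow,
      inv_mul_cancel_left₀ (by positivity)] at this
    rw [← this, ← integral_const_mul]
    refine integral_congr_ae (Eventually.of_forall fun θ => ?_)
    simp only [hψ, norm_smul, Real.norm_eq_abs]
    have : |(l:ℝ)| ≤ |(l:ℝ)| * ‖θ‖ / ε ↔ ε ≤ ‖θ‖ := by
      rw [le_div_iff₀ hε]; exact mul_le_mul_iff_right₀ hl1
    rw [if_congr this rfl rfl]
    split_ifs with h
    · have : 0 < ‖θ‖ := hε.trans_le h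
      generalize |(l:ℝ)| = L at *
      field_simp
      ring
    · simp
  have li' : ∀ l ∈ S, Integrable (fun h => (if |(l:ℝ)| ≤ ‖h‖ / ε then ε / ‖h‖ else 0) * P h) := by
    intro l hl
    have hl0 : (l:ℝ) ≠ 0 := by exact_mod_cast (Finset.mem_erase.1 hl).1
    have hl1 : 1 ≤ |(l:ℝ)| := by
      exact_mod_cast Int.one_le_abs (Finset.mem_erase.1 hl).1
    refine bdd_int (M := 1) hP (Measurable.aestronglyMeasurable (Measurable.ite
      (measurableSet_le measurable_const (by fun_prop)) (by fun_prop) (by fun_prop))) (fun h => ?_)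
    split_ifs with hh
    · rw [abs_of_nonneg (by positivity)]
      have := hl1.trans hh
      rw [one_le_div hε] at this
      exact (div_le_one (hε.trans_le this)).2 this
    · simp
  have key : ∫ h, 2 * ⌊‖h‖ / ε⌋₊ * (ε / ‖h‖) * P h =
      ∫ θ, ψ θ * ∑ l ∈ Finset.Ioo (-(J:ℤ)) J, |(l:ℝ)| ^ m * P ((l:ℝ) • θ) := by
    have e1 : ∀ θ, ψ θ * ∑ l ∈ Finset.Ioo (-(J:ℤ)) J, |(l:ℝ)| ^ m * P ((l:ℝ) • θ) =
        ∑ l ∈ S, ψ θ * (|(l:ℝ)| ^ m * P ((l:ℝ) • θ)) := by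
      intro θ
      rw [hS, ← Finset.mul_sum, Finset.sum_erase]
      simp [h0]
    simp only [e1]
    rw [integral_finsetSum _ li, Finset.sum_congr rfl lv, ← integral_finsetSum _ li']
    refine integral_congr_ae (Eventually.of_forall fun h => ?_)
    simp only
    rw [← Finset.sum_mul]
    by_cases hh : ρ ≤ ‖h‖
    · rw [hfar h hh]; simp
    · rw [cnt J (by positivity) (by rw [div_lt_iff₀ hε, mul_comm]; linarith)]
  have hF : ∀ θ : EV (m+1), (if ε ≤ ‖θ‖ then ε / ‖θ‖ * (B * ‖θ‖⁻¹ ^ (m+1)) else 0) =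
      B * ((ε⁻¹) ^ (m+1) * Qm m (ε⁻¹ • θ)) := by
    intro θ
    unfold Qm
    rw [norm_smul, Real.norm_eq_abs, abs_of_pos (inv_pos.2 hε)]
    have : 1 ≤ ε⁻¹ * ‖θ‖ ↔ ε ≤ ‖θ‖ := by
      rw [inv_mul_eq_div, one_le_div hε]
    rw [if_congr this rfl rfl]
    split_ifs with h
    · have : 0 < ‖θ‖ := hε.trans_le h
      generalize ‖θ‖ = L at *
      rw [mul_inv, inv_inv, mul_pow, pow_succ _ (m+1), pow_succ L⁻¹ (m+1), inv_pow ε]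
      field_simp
    · simp
  have hFi : Integrable (fun θ : EV (m+1) => B * ((ε⁻¹) ^ (m+1) * Qm m (ε⁻¹ • θ))) :=
    (((Qm_int m).comp_smul (inv_ne_zero hε.ne')).const_mul _).const_mul _
  rw [key, ← Real.norm_eq_abs]
  refine (norm_integral_le_of_norm_le hFi (Eventually.of_forall fun θ => ?_)).trans (le_of_eq ?_)
  · rw [← hF, norm_mul, Real.norm_eq_abs, Real.norm_eq_abs]
    simp only [hψ]
    split_ifs with h
    · have h' : 0 < ‖θ‖ := hε.trans_le h
      rw [abs_of_nonneg (by positivity)]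
      refine mul_le_mul_of_nonneg_left (hB θ (norm_pos_iff.1 h') J (hJ.trans ?_)) (by positivity)
      gcongr
    · simp
  · rw [integral_const_mul, integral_const_mul, Measure.integral_comp_smul, finrank_euclideanSpace_fin,
      smul_eq_mul, abs_inv, abs_pow, abs_of_pos (inv_pos.2 hε), mul_inv_cancel_left₀ (by positivity)]

theorem avg_lim {P : EV (m+1) → ℝ} (hP : Integrable P) (h0 : P 0 = 0) {ρ B : ℝ}
    (hfar : ∀ h, ρ ≤ ‖h‖ → P h = 0)
    (hB : ∀ θ : EV (m+1), θ ≠ 0 → ∀ J : ℕ, ρ ≤ ‖θ‖ * J →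
      |∑ l ∈ Finset.Ioo (-(J:ℤ)) J, |(l:ℝ)| ^ m * P ((l:ℝ) • θ)| ≤ B * ‖θ‖⁻¹ ^ (m+1)) :
    |∫ h, P h| ≤ B * ∫ u, Qm m u := by
  have hB0 : 0 ≤ B * ∫ u, Qm m u := by
    have := avg_eps hP h0 hfar hB one_pos
    exact (abs_nonneg _).trans this
  have lim : Tendsto (fun N : ℕ => ∫ h, 2 * ⌊‖h‖ / (1 / ((N:ℝ) + 1))⌋₊ * (1 / ((N:ℝ) + 1) / ‖h‖) * P h)
      atTop (𝓝 (∫ h, 2 * P h)) := by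
    have hw : ∀ (h : EV (m+1)) (ε : ℝ), 0 < ε → |2 * ⌊‖h‖ / ε⌋₊ * (ε / ‖h‖)| ≤ 2 := by
      intro h ε hε
      rw [abs_of_nonneg (by positivity)]
      rcases eq_or_ne ‖h‖ 0 with h0 | h0
      · simp [h0]
      · have hp : 0 < ‖h‖ := lt_of_le_of_ne (norm_nonneg _) (Ne.symm h0)
        have := Nat.floor_le (show 0 ≤ ‖h‖ / ε by positivity)
        calc 2 * (⌊‖h‖ / ε⌋₊:ℝ) * (ε / ‖h‖) ≤ 2 * (‖h‖ / ε) * (ε / ‖h‖) := by gcongr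
          _ = 2 := by field_simp
    refine tendsto_integral_of_dominated_convergence (fun h => 2 * ‖P h‖) (fun N => ?_)
      (hP.norm.const_mul 2) (fun N => Eventually.of_forall fun h => ?_) ?_
    · refine AEStronglyMeasurable.mul (Measurable.aestronglyMeasurable ?_) hP.1
      exact ((measurable_const.mul ((measurable_from_nat (f := fun n : ℕ => (n:ℝ))).comp
        (Nat.measurable_floor.comp (by fun_prop)))).mul (by fun_prop))
    · rw [norm_mul]
      exact mul_le_mul_of_nonneg_right (hw h _ (by positivity)) (norm_nonneg _)
    · refine Eventually.of_forall fun h => ?_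
      rcases eq_or_ne h 0 with rfl | hh
      · simp [h0]
      have hp : 0 < ‖h‖ := norm_pos_iff.2 hh
      refine Tendsto.mul_const _ ?_
      have t1 : Tendsto (fun N : ℕ => ‖h‖ * ((N:ℝ) + 1)) atTop atTop :=
        (tendsto_natCast_atTop_atTop.atTop_add tendsto_const_nhds).const_mul_atTop hp
      have t2 := ((tendsto_nat_floor_div_atTop (R := ℝ)).comp t1).const_mul 2
      rw [mul_one] at t2
      refine t2.congr fun N => ?_
      simp only [Function.comp]
      rw [div_div_eq_mul_div, div_one]
      field_simp
  have := le_of_tendsto lim.abs (Eventually.of_forall fun N : ℕ =>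
    avg_eps hP h0 hfar hB (ε := 1 / ((N:ℝ) + 1)) (by positivity))
  rw [integral_const_mul, abs_mul, abs_two] at this
  have := abs_nonneg (∫ h, P h)
  linarith

end

theorem P3 (m : ℕ) (V : Type*) [NormedAddCommGroup V] [InnerProductSpace ℝ V] (C c Λ : ℝ) :
    ∃ A : ℝ, 0 ≤ A ∧ ∀ (R : ℝ) (k : V → ℝ) (g : EV (m+1) → V) (f φ : EV (m+1) → ℝ),
      Ker m C R k → BLip c Λ g → L12 volume f → L12 volume φ →
      |∫ s, ∫ t, k (g s - g t) * (f t * φ s)| ≤ A * ((∫ x, f x ^ 2) + ∫ x, φ x ^ 2) := by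
  obtain ⟨A, hA⟩ : ∃ A : ℝ, A = 1 + |C / c ^ (m+1)| + |C * Λ / c ^ (m+2)| +
    |4 * C * Λ ^ 2 / c ^ (m+3)| + |m * 2 ^ m * C / c ^ (m+1) + 4 ^ (m+1) * C * Λ / c ^ (m+2)| := ⟨_, rfl⟩
  have a1 := le_abs_self (C / c ^ (m+1))
  have a2 := le_abs_self (C * Λ / c ^ (m+2))
  have a3 := le_abs_self (4 * C * Λ ^ 2 / c ^ (m+3))
  have a4 := le_abs_self (m * 2 ^ m * C / c ^ (m+1) + 4 ^ (m+1) * C * Λ / c ^ (m+2))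
  have b1 := abs_nonneg (C / c ^ (m+1))
  have b2 := abs_nonneg (C * Λ / c ^ (m+2))
  have b3 := abs_nonneg (4 * C * Λ ^ 2 / c ^ (m+3))
  have b4 := abs_nonneg (m * 2 ^ m * C / c ^ (m+1) + 4 ^ (m+1) * C * Λ / c ^ (m+2))
  have hQ : 0 ≤ ∫ u, Qm m u := integral_nonneg fun u => by unfold Qm; positivity
  refine ⟨100000000 * A * ∫ u, Qm m u, mul_nonneg (by linarith) hQ, fun R k g f φ hk hg hf hφ => ?_⟩
  obtain ⟨p1, p2⟩ := P_int hk hg hf hφ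
  rw [← p2]
  have hc := hg.cpos
  have := avg_lim (B := 100000000 * A * ((∫ x, f x ^ 2) + ∫ x, φ x ^ 2)) (ρ := R / c) p1 ?_ ?_ ?_
  · refine this.trans (le_of_eq (by ring))
  · unfold Pfn; simp [hk.zero]
  · intro h hh; rw [div_le_iff₀ hc, mul_comm] at hh; exact Pf_far hk hg hh
  · intro θ hθ J hJ
    rw [div_le_iff₀ hc, mul_comm] at hJ
    refine (P_step1 hk hg hf hφ (A := A) (by linarith) (by linarith) (by linarith) (by linarith)
      (by linarith) hθ J hJ).trans (le_of_eq (by ring))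
end

section
/-- Poisson-type kernel -/
def pk (n : ℕ) (ρ d : ℝ) : ℝ := ρ / (ρ + d) ^ (n+1)

theorem pk_nonneg {n : ℕ} {ρ d : ℝ} (hρ : 0 ≤ ρ) (hd : 0 ≤ d) : 0 ≤ pk n ρ d := by
  unfold pk; positivity

theorem pk_le {n : ℕ} {ρ d η : ℝ} (hη : 0 < η) (hρ : η ≤ ρ) (hd : 0 ≤ d) : pk n ρ d ≤ (η ^ n)⁻¹ := by
  have h0 : 0 < ρ := hη.trans_le hρ
  have h1 : ρ ^ n * ρ ≤ (ρ + d) ^ (n+1) := by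
    rw [← pow_succ]; gcongr; linarith
  calc pk n ρ d ≤ ρ / (ρ ^ n * ρ) := by unfold pk; gcongr
    _ = (ρ ^ n)⁻¹ := by field_simp
    _ ≤ _ := by gcongr

theorem pk_ge {n : ℕ} {ρ d : ℝ} (M : ℝ) (hρ : 0 < ρ) (hd : 0 ≤ d) (hM : d ≤ M * ρ) :
    (ρ ^ n)⁻¹ ≤ (1 + M) ^ (n+1) * pk n ρ d := by
  unfold pk
  rw [mul_div_assoc', le_div_iff₀ (by positivity)]
  have : (ρ + d) ^ (n+1) ≤ ((1 + M) * ρ) ^ (n+1) := by gcongr; linarith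
  calc (ρ ^ n)⁻¹ * (ρ + d) ^ (n+1) ≤ (ρ ^ n)⁻¹ * ((1 + M) * ρ) ^ (n+1) := by gcongr
    _ = (1 + M) ^ (n+1) * ρ := by rw [mul_pow, pow_succ ρ]; field_simp

theorem pk_split {n : ℕ} {d η D : ℝ} (hd : 0 ≤ d) (hη : 0 < η) (hD : 0 ≤ D) :
    pk n (d + η) D ≤ pk n d D + pk n η D := by
  unfold pk
  rw [add_div]
  rcases hd.eq_or_lt with rfl | hd
  · simp
  · gcongr <;> linarith

section
variable {Y : Type*} [MeasurableSpace Y]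

theorem growth {ν : Measure Y} {D : Y → ℝ} (hD : Measurable D) (hD0 : ∀ y, 0 ≤ D y) {n : ℕ} {l : ℝ}
    (hl : 0 ≤ l) (h : ∀ r > 0, ν {y | D y < r} ≤ ENNReal.ofReal (l * r ^ n)) {ρ : ℝ} (hρ : 0 < ρ) :
    ∫⁻ y, ENNReal.ofReal (pk n ρ (D y)) ∂ν ≤ ENNReal.ofReal (2 ^ (n+2) * l) := by
  set c : ℕ → ℝ := fun k => 2 ^ (n+1) * (1/2) ^ k * ((2 ^ k * ρ) ^ n)⁻¹ with hc
  have c0 : ∀ k, 0 ≤ c k := fun k => by simp only [hc]; positivity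
  have pt : ∀ y, ENNReal.ofReal (pk n ρ (D y)) ≤
      ∑' k, {y | D y < 2 ^ k * ρ}.indicator (fun _ => ENNReal.ofReal (c k)) y := by
    intro y
    have ex : ∃ k : ℕ, D y < 2 ^ k * ρ := by
      obtain ⟨k, hk⟩ := pow_unbounded_of_one_lt (D y / ρ) one_lt_two
      exact ⟨k, by rwa [div_lt_iff₀ hρ] at hk⟩
    classical
    obtain ⟨k, hk, hmin⟩ : ∃ k : ℕ, D y < 2 ^ k * ρ ∧ ∀ j < k, 2 ^ j * ρ ≤ D y :=
      ⟨Nat.find ex, Nat.find_spec ex, fun j hj => not_lt.1 (Nat.find_min ex hj)⟩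
    refine le_trans ?_ (ENNReal.le_tsum k)
    rw [indicator_of_mem (show y ∈ {y | D y < 2 ^ k * ρ} from hk)]
    refine ENNReal.ofReal_le_ofReal ?_
    have hb : 2 ^ k * ρ ≤ 2 * (ρ + D y) := by
      rcases k with _ | k
      · have := hD0 y; simp only [pow_zero]; linarith
      · have := hmin k (Nat.lt_succ_self k); rw [pow_succ]; linarith
    have hp : 0 < 2 ^ k * ρ := by positivity
    have e : c k = ρ / ((2 ^ k * ρ) / 2) ^ (n+1) := by
      simp only [hc]; rw [div_pow, div_pow, pow_succ (2 ^ k * ρ)]; field_simp; simp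
    rw [e]; unfold pk
    gcongr
    linarith
  have hm : ∀ r, MeasurableSet {y | D y < r} := fun r => measurableSet_lt hD measurable_const
  calc ∫⁻ y, ENNReal.ofReal (pk n ρ (D y)) ∂ν
      ≤ ∫⁻ y, ∑' k, {y | D y < 2 ^ k * ρ}.indicator (fun _ => ENNReal.ofReal (c k)) y ∂ν := lintegral_mono pt
    _ = ∑' k, ENNReal.ofReal (c k) * ν {y | D y < 2 ^ k * ρ} := by
      rw [lintegral_tsum fun k => (measurable_const.indicator (hm _)).aemeasurable]
      exact tsum_congr fun k => by rw [lintegral_indicator (hm _), setLIntegral_const]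
    _ ≤ ∑' k : ℕ, ENNReal.ofReal (2 ^ (n+1) * l * (1/2) ^ k) := by
      refine ENNReal.tsum_le_tsum fun k => ?_
      have hp : 0 < 2 ^ k * ρ := by positivity
      refine (mul_le_mul_right (h _ hp) _).trans (le_of_eq ?_)
      rw [← ENNReal.ofReal_mul (c0 k)]
      congr 1
      simp only [hc]
      field_simp
    _ = ENNReal.ofReal (2 ^ (n+2) * l) := by
      rw [← ENNReal.ofReal_tsum_of_nonneg (fun k => by positivity) (summable_geometric_two.mul_left _),
        tsum_mul_left, tsum_geometric_two]
      congr 1; ring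

end

section
variable {m : ℕ} {c Λ : ℝ} {g : EV (m+1) → EV (m+2)}

def vb (m : ℕ) : ℝ := (volume (ball (0 : EV (m+1)) 1)).toReal

theorem vb_pos (m : ℕ) : 0 < vb m :=
  ENNReal.toReal_pos (measure_ball_pos _ _ one_pos).ne' measure_ball_lt_top.ne

theorem vol_ball (s : EV (m+1)) {r : ℝ} (hr : 0 ≤ r) :
    volume (ball s r) = ENNReal.ofReal (vb m * r ^ (m+1)) := by
  rw [Measure.addHaar_ball _ _ hr, finrank_euclideanSpace_fin, mul_comm, ENNReal.ofReal_mul (vb_pos m).le,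
    vb, ENNReal.ofReal_toReal measure_ball_lt_top.ne]

theorem mu_growth (hg : BLip c Λ g) (z : EV (m+2)) {r : ℝ} (hr : 0 < r) :
    volume {s | ‖g s - z‖ < r} ≤ ENNReal.ofReal (vb m * (3 / c) ^ (m+1) * r ^ (m+1)) := by
  have hc := hg.cpos
  rcases Set.eq_empty_or_nonempty {s | ‖g s - z‖ < r} with h | ⟨s, hs⟩
  · rw [h]; simp
  · refine (measure_mono (t := ball s (3 * r / c)) fun t ht => ?_).trans (le_of_eq ?_)
    · have h1 := hg.lo t s
      have h2 : ‖g t - g s‖ ≤ ‖g t - z‖ + ‖g s - z‖ := by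
        have := norm_sub_le (g t - z) (g s - z); rwa [sub_sub_sub_cancel_right] at this
      simp only [mem_setOf_eq] at hs ht
      rw [mem_ball, dist_eq_norm, lt_div_iff₀ hc]
      linarith
    · rw [vol_ball _ (by positivity), mul_div_right_comm, mul_pow, mul_assoc]

theorem mu_pk (hg : BLip c Λ g) (z : EV (m+2)) {ρ : ℝ} (hρ : 0 < ρ) :
    ∫⁻ s, ENNReal.ofReal (pk (m+1) ρ ‖g s - z‖) ≤ ENNReal.ofReal (2 ^ (m+3) * (vb m * (3 / c) ^ (m+1))) := by
  have hc := hg.cpos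
  have := vb_pos m
  have := hg.cont
  exact growth (Continuous.measurable (by fun_prop)) (fun _ => norm_nonneg _) (by positivity)
    (fun r hr => mu_growth hg z hr) hρ

end
end

section
theorem smear_sq {Y T : Type*} [MeasurableSpace Y] [MeasurableSpace T] {ω : Measure Y} [SFinite ω]
    {μ : Measure T} [SFinite μ] {s : Y → T → ℝ≥0∞} {a : Y → Y → ℝ≥0∞} {l : ℝ≥0∞}
    (hm : Measurable (fun p : Y × T => s p.1 p.2)) (am : Measurable (fun p : Y × Y => a p.1 p.2))
    (R : Y → ℝ) (pt : ∀ z w t, R w ≤ R z → s z t * s w t ≤ a z w * s w t)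
    (one : ∀ z, ∫⁻ t, s z t ∂μ = 1) (aI : ∀ z, ∫⁻ w, a z w ∂ω ≤ l) :
    ∫⁻ t, (∫⁻ z, s z t ∂ω) ^ 2 ∂μ ≤ 2 * l * ω univ := by
  have mu : ∀ t, Measurable (fun z => s z t) := fun t => hm.comp measurable_prodMk_right
  have pt2 : ∀ z w t, s z t * s w t ≤ a z w * s w t + a w z * s z t := by
    intro z w t
    rcases le_total (R w) (R z) with h | h
    · exact (pt z w t h).trans le_self_add
    · rw [mul_comm]; exact (pt w z t h).trans le_add_self
  have m3 : Measurable (fun p : T × (Y × Y) => a p.2.1 p.2.2 * s p.2.2 p.1) :=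
    (am.comp measurable_snd).mul (hm.comp ((measurable_snd.comp measurable_snd).prodMk measurable_fst))
  have T1 : ∫⁻ t, ∫⁻ p : Y × Y, a p.1 p.2 * s p.2 t ∂(ω.prod ω) ∂μ ≤ l * ω univ := by
    rw [lintegral_lintegral_swap m3.aemeasurable]
    have : ∀ p : Y × Y, ∫⁻ t, a p.1 p.2 * s p.2 t ∂μ = a p.1 p.2 := fun p => by
      rw [lintegral_const_mul _ (show Measurable (s p.2) from hm.comp measurable_prodMk_left), one, mul_one]
    simp only [this]
    rw [lintegral_prod _ am.aemeasurable]
    exact (lintegral_mono aI).trans (by rw [lintegral_const])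
  calc ∫⁻ t, (∫⁻ z, s z t ∂ω) ^ 2 ∂μ
      = ∫⁻ t, ∫⁻ p : Y × Y, s p.1 t * s p.2 t ∂(ω.prod ω) ∂μ := by
        refine lintegral_congr fun t => ?_
        rw [lintegral_prod_mul (mu t).aemeasurable (mu t).aemeasurable, sq]
    _ ≤ ∫⁻ t, ((∫⁻ p : Y × Y, a p.1 p.2 * s p.2 t ∂(ω.prod ω)) +
        ∫⁻ p : Y × Y, a p.2 p.1 * s p.1 t ∂(ω.prod ω)) ∂μ := by
        refine lintegral_mono fun t => ?_
        rw [← lintegral_add_left (show Measurable (fun p : Y × Y => a p.1 p.2 * s p.2 t) from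
          m3.comp measurable_prodMk_left)]
        exact lintegral_mono fun p => pt2 _ _ _
    _ = 2 * ∫⁻ t, ∫⁻ p : Y × Y, a p.1 p.2 * s p.2 t ∂(ω.prod ω) ∂μ := by
        have e : ∀ t, ∫⁻ p : Y × Y, a p.2 p.1 * s p.1 t ∂(ω.prod ω) =
            ∫⁻ p : Y × Y, a p.1 p.2 * s p.2 t ∂(ω.prod ω) := fun t =>
          lintegral_prod_swap (fun p : Y × Y => a p.1 p.2 * s p.2 t)
        simp only [e]
        rw [← lintegral_const_mul _ m3.lintegral_prod_right']
        exact lintegral_congr fun t => (two_mul _).symm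
    _ ≤ _ := by
        rw [mul_assoc]
        gcongr

section
variable {m : ℕ} {c Λ : ℝ} {g : EV (m+1) → EV (m+2)} {R : EV (m+2) → ℝ}

def Vz (g : EV (m+1) → EV (m+2)) (R : EV (m+2) → ℝ) (z : EV (m+2)) : ℝ :=
  (volume {t | ‖g t - z‖ < 2 * R z}).toReal

def sg (g : EV (m+1) → EV (m+2)) (R : EV (m+2) → ℝ) (z : EV (m+2)) (t : EV (m+1)) : ℝ :=
  if ‖g t - z‖ < 2 * R z then (Vz g R z)⁻¹ else 0

theorem sg_nonneg (z : EV (m+2)) (t : EV (m+1)) : 0 ≤ sg g R z t := by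
  unfold sg Vz; split_ifs <;> positivity

theorem sg_meas (hg : BLip c Λ g) (hR : Continuous R) :
    Measurable (fun p : EV (m+2) × EV (m+1) => sg g R p.1 p.2) := by
  have := hg.cont
  have hS : MeasurableSet {p : EV (m+2) × EV (m+1) | ‖g p.2 - p.1‖ < 2 * R p.1} :=
    (isOpen_lt (by fun_prop) (by fun_prop)).measurableSet
  have hV : Measurable (Vz g R) := (measurable_measure_prodMk_left hS).ennreal_toReal
  exact Measurable.ite hS (hV.comp measurable_fst).inv measurable_const

structure SH (c Λ : ℝ) (g : EV (m+1) → EV (m+2)) (R : EV (m+2) → ℝ) (v η : ℝ) : Prop where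
  bl : BLip c Λ g
  Rc : Continuous R
  vp : 0 < v
  ηp : 0 < η
  Rη : ∀ z, η ≤ R z
  lo : ∀ z, v * R z ^ (m+1) ≤ Vz g R z

variable {v η : ℝ}

theorem SH.Rp (H : SH c Λ g R v η) (z) : 0 < R z := H.ηp.trans_le (H.Rη z)

theorem SH.Vp (H : SH c Λ g R v η) (z) : 0 < Vz g R z :=
  (mul_pos H.vp (pow_pos (H.Rp z) _)).trans_le (H.lo z)

theorem SH.one (H : SH c Λ g R v η) (z) : ∫⁻ t, ENNReal.ofReal (sg g R z t) = 1 := by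
  have hm : MeasurableSet {t | ‖g t - z‖ < 2 * R z} :=
    (isOpen_lt (by have := H.bl.cont; fun_prop) continuous_const).measurableSet
  have e : (fun t => ENNReal.ofReal (sg g R z t)) =
      {t | ‖g t - z‖ < 2 * R z}.indicator (fun _ => ENNReal.ofReal (Vz g R z)⁻¹) := by
    ext t; unfold sg; simp only [indicator, mem_ofPred_eq]; split_ifs <;> simp
  rw [e, lintegral_indicator hm, setLIntegral_const]
  have hf : volume {t | ‖g t - z‖ < 2 * R z} ≠ ∞ :=
    ((mu_growth H.bl z (mul_pos two_pos (H.Rp z))).trans_lt ENNReal.ofReal_lt_top).ne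
  have hp := H.Vp z
  rw [← ENNReal.ofReal_toReal hf]
  change ENNReal.ofReal (Vz g R z)⁻¹ * ENNReal.ofReal (Vz g R z) = 1
  rw [← ENNReal.ofReal_mul (by positivity), inv_mul_cancel₀ hp.ne', ENNReal.ofReal_one]

theorem SH.bd (H : SH c Λ g R v η) (z t) : sg g R z t ≤ (v * R z ^ (m+1))⁻¹ := by
  have h1 := H.lo z
  have h2 := mul_pos H.vp (pow_pos (H.Rp z) (m+1))
  unfold sg; split_ifs
  · gcongr
  · positivity

theorem SH.sint (H : SH c Λ g R v η) (z) : Integrable (sg g R z) := by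
  refine ⟨((sg_meas H.bl H.Rc).comp measurable_prodMk_left).aestronglyMeasurable, ?_⟩
  rw [hasFiniteIntegral_iff_ofReal (Eventually.of_forall (sg_nonneg z)), H.one z]
  exact ENNReal.one_lt_top

variable {ω : Measure (EV (m+2))} [IsFiniteMeasure ω]

theorem SH.pint (H : SH c Λ g R v η) :
    Integrable (fun p : EV (m+2) × EV (m+1) => sg g R p.1 p.2) (ω.prod volume) := by
  have hm := sg_meas H.bl H.Rc
  refine ⟨hm.aestronglyMeasurable, ?_⟩
  rw [hasFiniteIntegral_iff_ofReal (Eventually.of_forall fun p => sg_nonneg _ _),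
    lintegral_prod _ hm.ennreal_ofReal.aemeasurable]
  simp only [H.one, lintegral_one]
  exact measure_lt_top _ _

theorem SH.hsq (H : SH c Λ g R v η) {l : ℝ}
    (hω : ∀ z, ω {w | ‖w - z‖ < 4 * R z} ≤ ENNReal.ofReal (l * R z ^ (m+1))) :
    ∫⁻ t, (∫⁻ z, ENNReal.ofReal (sg g R z t) ∂ω) ^ 2 ≤ ENNReal.ofReal (2 * (l / v)) * ω univ := by
  have hRc := H.Rc
  rw [ENNReal.ofReal_mul two_pos.le, ENNReal.ofReal_ofNat]
  have hS : ∀ z, MeasurableSet {w | ‖w - z‖ < 4 * R z} := fun z =>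
    (isOpen_lt (by fun_prop) continuous_const).measurableSet
  refine smear_sq (a := fun z w => {w | ‖w - z‖ < 4 * R z}.indicator
    (fun _ => ENNReal.ofReal (v * R z ^ (m+1))⁻¹) w) (sg_meas H.bl H.Rc).ennreal_ofReal ?_ R ?_ H.one ?_
  · have hO : MeasurableSet {p : EV (m+2) × EV (m+2) | ‖p.2 - p.1‖ < 4 * R p.1} :=
      (isOpen_lt (by fun_prop) (by fun_prop)).measurableSet
    refine Measurable.indicator (s := {p : EV (m+2) × EV (m+2) | ‖p.2 - p.1‖ < 4 * R p.1})
      (f := fun p : EV (m+2) × EV (m+2) => ENNReal.ofReal (v * R p.1 ^ (m+1))⁻¹) ?_ hO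
    exact Measurable.ennreal_ofReal (by fun_prop)
  · intro z w t hR
    by_cases h1 : ‖g t - z‖ < 2 * R z
    · by_cases h2 : ‖g t - w‖ < 2 * R w
      · have : ‖w - z‖ < 4 * R z := by
          have := norm_sub_le (g t - z) (g t - w)
          rw [sub_sub_sub_cancel_left] at this; linarith
        rw [indicator_of_mem (show w ∈ {w | ‖w - z‖ < 4 * R z} from this)]
        gcongr
        exact H.bd z t
      · simp [sg, h2]
    · simp [sg, h1]
  · intro z
    rw [lintegral_indicator (hS z), setLIntegral_const]
    have h2 := mul_pos H.vp (pow_pos (H.Rp z) (m+1))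
    have h3 := pow_pos (H.Rp z) (m+1)
    have h4 := H.vp
    refine (mul_le_mul_right (hω z) _).trans (le_of_eq ?_)
    rw [← ENNReal.ofReal_mul (by positivity)]
    congr 1
    field_simp

theorem SH.hL12 (H : SH c Λ g R v η) {l : ℝ} (hl : 0 ≤ l)
    (hω : ∀ z, ω {w | ‖w - z‖ < 4 * R z} ≤ ENNReal.ofReal (l * R z ^ (m+1))) :
    L12 volume (fun t => ∫ z, sg g R z t ∂ω) ∧
    ∫ t, (∫ z, sg g R z t ∂ω) ^ 2 ≤ 2 * (l / v) * ω.real univ := by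
  have hv := H.vp
  have i1 : Integrable (fun t => ∫ z, sg g R z t ∂ω) := H.pint.integral_prod_right
  have e : ∀ t, ENNReal.ofReal ((∫ z, sg g R z t ∂ω) ^ 2) = (∫⁻ z, ENNReal.ofReal (sg g R z t) ∂ω) ^ 2 := by
    intro t
    have hi : Integrable (fun z => sg g R z t) ω := by
      refine Integrable.mono' (integrable_const (v * η ^ (m+1))⁻¹)
        ((sg_meas H.bl H.Rc).comp measurable_prodMk_right).aestronglyMeasurable (Eventually.of_forall fun z => ?_)
      rw [Real.norm_eq_abs, abs_of_nonneg (sg_nonneg _ _)]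
      refine (H.bd z t).trans ?_
      have := H.ηp; have := H.Rη z
      gcongr
    rw [ENNReal.ofReal_pow (integral_nonneg fun z => sg_nonneg _ _),
      ofReal_integral_eq_lintegral_ofReal hi (Eventually.of_forall fun z => sg_nonneg _ _)]
  have h := H.hsq hω
  have ht : ENNReal.ofReal (2 * (l / v)) * ω univ < ∞ :=
    ENNReal.mul_lt_top ENNReal.ofReal_lt_top (measure_lt_top _ _)
  simp only [← e] at h
  have i2 : Integrable (fun t => (∫ z, sg g R z t ∂ω) ^ 2) := by
    refine ⟨i1.1.pow 2, ?_⟩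
    rw [hasFiniteIntegral_iff_ofReal (Eventually.of_forall fun t => sq_nonneg _)]
    exact h.trans_lt ht
  refine ⟨⟨i1, i2⟩, ?_⟩
  rw [integral_eq_lintegral_of_nonneg_ae (Eventually.of_forall fun t => sq_nonneg _) i2.1]
  refine (ENNReal.toReal_mono ht.ne h).trans (le_of_eq ?_)
  rw [ENNReal.toReal_mul, ENNReal.toReal_ofReal (by positivity)]; rfl

end
end

section
section
variable {m : ℕ} {C R0 c Λ v η : ℝ} {g : EV (m+1) → EV (m+2)} {k : EV (m+2) → ℝ} {f φ : EV (m+1) → ℝ}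
  {R : EV (m+2) → ℝ}

/-- potential of an integrable function along `g` -/
def pot (k : EV (m+2) → ℝ) (g : EV (m+1) → EV (m+2)) (f : EV (m+1) → ℝ) (s : EV (m+1)) : ℝ :=
  ∫ t, k (g s - g t) * f t

theorem pot_meas (hk : Ker m C R0 k) (hg : BLip c Λ g) (hf : Integrable f) :
    AEStronglyMeasurable (pot k g f) := by
  have h1 := hk.cont; have h2 := hg.cont
  refine AEStronglyMeasurable.integral_prod_right'
    (f := fun p : EV (m+1) × EV (m+1) => k (g p.1 - g p.2) * f p.2) ?_
  exact (Continuous.aestronglyMeasurable (by fun_prop)).mul hf.1.comp_snd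

theorem pot_bdd (hk : Ker m C R0 k) (hf : Integrable f) : ∃ M, ∀ s, |pot k g f s| ≤ M := by
  obtain ⟨M, hM⟩ := hk.bdd
  refine ⟨∫ t, M * ‖f t‖, fun s => ?_⟩
  unfold pot; rw [← Real.norm_eq_abs]
  refine norm_integral_le_of_norm_le (hf.norm.const_mul M) (Eventually.of_forall fun t => ?_)
  rw [norm_mul]; exact mul_le_mul_of_nonneg_right (hM _) (norm_nonneg _)

theorem pot_int (hk : Ker m C R0 k) (hg : BLip c Λ g) (hf : Integrable f) (hφ : Integrable φ) :
    Integrable (fun s => pot k g f s * φ s) := by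
  obtain ⟨M, hM⟩ := pot_bdd (g := g) hk hf
  exact bdd_int hφ (pot_meas hk hg hf) hM

theorem pot_eq : ∫ s, ∫ t, k (g s - g t) * (f t * φ s) = ∫ s, pot k g f s * φ s := by
  unfold pot
  simp only [← mul_assoc, integral_mul_const]

theorem pot_swap (hk : Ker m C R0 k) (hg : BLip c Λ g) (hf : Integrable f) (hφ : Integrable φ) :
    ∫ s, pot k g f s * φ s = -∫ t, pot k g φ t * f t := by
  rw [← pot_eq, ← pot_eq, integral_integral_swap (G_int hk.cont hk.bdd hg.cont hf hφ), ← integral_neg]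
  refine integral_congr_ae (Eventually.of_forall fun t => ?_)
  simp only
  rw [← integral_neg]
  refine integral_congr_ae (Eventually.of_forall fun s => ?_)
  simp only
  rw [← neg_sub, hk.odd]; ring

theorem SH.sint1 (H : SH c Λ g R v η) (z) : ∫ t, sg g R z t = 1 := by
  rw [integral_eq_lintegral_of_nonneg_ae (Eventually.of_forall (sg_nonneg z)) (H.sint z).1, H.one,
    ENNReal.toReal_one]

theorem SH.L12 (H : SH c Λ g R v η) (z) : L12 volume (sg g R z) ∧
    ∫ t, sg g R z t ^ 2 ≤ (v * R z ^ (m+1))⁻¹ := by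
  have h := H.sint z
  have hb : ∀ t, |sg g R z t| ≤ (v * R z ^ (m+1))⁻¹ := fun t => by
    rw [abs_of_nonneg (sg_nonneg _ _)]; exact H.bd z t
  have i2 : Integrable (fun t => sg g R z t ^ 2) := by
    simpa only [sq] using bdd_int h h.1 hb
  refine ⟨⟨h, i2⟩, ?_⟩
  have := integral_mono i2 (h.const_mul (v * R z ^ (m+1))⁻¹) fun t => by
    simp only; rw [sq]; exact mul_le_mul_of_nonneg_right (H.bd z t) (sg_nonneg _ _)
  rwa [integral_const_mul, H.sint1, mul_one] at this

theorem pkint (H : SH c Λ g R v η) (z) {q : EV (m+1) → ℝ} (hq : Integrable q) :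
    Integrable (fun s => pk (m+1) (R z) ‖g s - z‖ * q s) := by
  have h2 := H.bl.cont
  refine bdd_int (M := (η ^ (m+1))⁻¹) hq (Measurable.aestronglyMeasurable (by unfold pk; fun_prop)) fun s => ?_
  rw [abs_of_nonneg (pk_nonneg (H.Rp z).le (norm_nonneg _))]
  exact pk_le H.ηp (H.Rη z) (norm_nonneg _)

/-- pointwise error on the good set -/
theorem ker_err (H : SH c Λ g R v η) (hk : Ker m C R0 k) (hη : ∀ x, |k x| ≤ C / η ^ (m+1)) {z : EV (m+2)}
    {s : EV (m+1)} (hs : R z ≤ ‖g s - z‖ + η) :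
    |k (g s - z) - (if ‖g s - z‖ < 4 * R z then 0 else pot k g (sg g R z) s)| ≤
      (C * 2 ^ (m+1) * 5 ^ (m+2) + C * 4 ^ (m+3)) * pk (m+1) (R z) ‖g s - z‖ := by
  have hR := H.Rp z
  have hC := hk.rb.nn
  have hp := pk_nonneg (n := m+1) hR.le (norm_nonneg (g s - z))
  obtain ⟨D, hD⟩ : ∃ D, D = ‖g s - z‖ := ⟨_, rfl⟩
  have hD0 : 0 ≤ D := hD ▸ norm_nonneg _
  rw [← hD] at hs hp ⊢
  rw [add_mul]
  split_ifs with h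
  · rw [sub_zero]
    have h1 : |k (g s - z)| ≤ C / (R z / 2) ^ (m+1) := by
      rcases le_total D η with h2 | h2
      · refine (hη _).trans ?_
        have := H.ηp
        gcongr; linarith
      · exact hk.rb.b0 _ (by positivity) _ (by rw [← hD]; linarith)
    have h2 := pk_ge (n := m+1) 4 hR hD0 h.le
    norm_num1 at h2
    calc |k (g s - z)| ≤ C * 2 ^ (m+1) * (R z ^ (m+1))⁻¹ := by
          refine h1.trans (le_of_eq ?_); rw [div_pow]; field_simp
      _ ≤ C * 2 ^ (m+1) * (5 ^ (m+2) * pk (m+1) (R z) D) := by gcongr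
      _ ≤ _ := by rw [← mul_assoc]; exact le_add_of_nonneg_right (by positivity)
  · push Not at h
    have e : k (g s - z) - pot k g (sg g R z) s = ∫ t, (k (g s - z) - k (g s - g t)) * sg g R z t := by
      obtain ⟨M, hM⟩ := hk.bdd
      have h1 := hk.cont; have h2 := H.bl.cont
      simp only [sub_mul]
      rw [integral_sub ((H.sint z).const_mul _) (bdd_int (H.sint z) (Continuous.aestronglyMeasurable
        (by fun_prop)) fun t => hM _), integral_const_mul, H.sint1, mul_one]; rfl
    have hb : ∀ t, ‖(k (g s - z) - k (g s - g t)) * sg g R z t‖ ≤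
        (C * (2 * R z) / (D / 2) ^ (m+2)) * sg g R z t := by
      intro t
      rw [norm_mul, Real.norm_eq_abs, Real.norm_eq_abs, abs_of_nonneg (sg_nonneg _ _)]
      by_cases ht : ‖g t - z‖ < 2 * R z
      · refine mul_le_mul_of_nonneg_right ?_ (sg_nonneg _ _)
        have h3 : ‖g s - z‖ ≤ ‖g s - g t‖ + ‖g t - z‖ := norm_sub_le_norm_sub_add_norm_sub _ _ _
        have h4 := hk.rb.b1 (D / 2) (by linarith) (g s - z) (g s - g t) (by linarith) (by linarith)
        refine h4.trans ?_
        rw [sub_sub_sub_cancel_left]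
        have : 0 < D := by linarith
        gcongr
      · simp [sg, ht]
    rw [e, ← Real.norm_eq_abs]
    refine (norm_integral_le_of_norm_le ((H.sint z).const_mul _) (Eventually.of_forall hb)).trans ?_
    rw [integral_const_mul, H.sint1, mul_one]
    refine le_trans ?_ (le_add_of_nonneg_left (by positivity))
    have hDp : 0 < D := by linarith
    unfold pk
    rw [mul_div_assoc', div_le_div_iff₀ (by positivity) (by positivity)]
    have : (R z + D) ^ (m+1+1) ≤ (4 * (D / 2)) ^ (m+2) := by gcongr; linarith
    calc C * (2 * R z) * (R z + D) ^ (m+1+1) ≤ C * (2 * R z) * (4 * (D / 2)) ^ (m+2) := by gcongr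
      _ ≤ C * 4 ^ (m+3) * R z * (D / 2) ^ (m+2) := by
        rw [mul_pow, pow_succ (4:ℝ) (m+2)]
        have : 0 ≤ C * R z * 4 ^ (m+2) * (D / 2) ^ (m+2) := by positivity
        linarith

theorem z_err (H : SH c Λ g R v η) (hk : Ker m C R0 k) (hη : ∀ x, |k x| ≤ C / η ^ (m+1)) {A : ℝ} (hA : 0 ≤ A)
    (hP : ∀ f φ : EV (m+1) → ℝ, L12 volume f → L12 volume φ →
      |∫ s, ∫ t, k (g s - g t) * (f t * φ s)| ≤ A * ((∫ x, f x ^ 2) + ∫ x, φ x ^ 2))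
    (hφ : L12 volume φ) (z : EV (m+2)) (hs : ∀ s, φ s ≠ 0 → R z ≤ ‖g s - z‖ + η) {B : ℝ}
    (hB : B = C * 2 ^ (m+1) * 5 ^ (m+2) + C * 4 ^ (m+3)) :
    |(∫ s, k (g s - z) * φ s) - ∫ s, pot k g (sg g R z) s * φ s| ≤
      (B + A * 5 ^ (m+2)) * (∫ s, pk (m+1) (R z) ‖g s - z‖ * φ s ^ 2) +
      (B * (2 ^ (m+3) * (vb m * (3 / c) ^ (m+1))) + A * v⁻¹) := by
  have hR := H.Rp z
  have hC := hk.rb.nn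
  have hv := H.vp
  have hB0 : 0 ≤ B := by rw [hB]; positivity
  have h1 := hk.cont; have h2 := H.bl.cont
  obtain ⟨M, hM⟩ := hk.bdd
  set b : Set (EV (m+1)) := {s | ‖g s - z‖ < 4 * R z} with hb
  have bm : MeasurableSet b := (isOpen_lt (by fun_prop) continuous_const).measurableSet
  have i1 : Integrable (fun s => k (g s - z) * φ s) :=
    bdd_int hφ.i1 (Continuous.aestronglyMeasurable (by fun_prop)) fun t => hM _
  have i2 := pot_int hk H.bl (H.sint z) hφ.i1
  have i3 := pot_int hk H.bl (H.sint z) (hφ.i1.indicator bm)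
  have e : (∫ s, k (g s - z) * φ s) - ∫ s, pot k g (sg g R z) s * φ s =
      (∫ s, (k (g s - z) - (if ‖g s - z‖ < 4 * R z then 0 else pot k g (sg g R z) s)) * φ s) -
      ∫ s, pot k g (sg g R z) s * b.indicator φ s := by
    have : ∀ s, (k (g s - z) - (if ‖g s - z‖ < 4 * R z then 0 else pot k g (sg g R z) s)) * φ s =
        k (g s - z) * φ s - pot k g (sg g R z) s * φ s + pot k g (sg g R z) s * b.indicator φ s := by
      intro s
      by_cases h : ‖g s - z‖ < 4 * R z
      · rw [if_pos h, indicator_of_mem (show s ∈ b from h)]; ring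
      · rw [if_neg h, indicator_of_notMem (show s ∉ b from h)]; ring
    simp only [this]
    have e3 := integral_add (i1.sub i2) i3
    have e4 := integral_sub i1 i2
    simp only [Pi.sub_apply] at e3
    linarith
  have hpk : Integrable (fun s => pk (m+1) (R z) ‖g s - z‖) := by
    refine ⟨Measurable.aestronglyMeasurable (by unfold pk; fun_prop), ?_⟩
    rw [hasFiniteIntegral_iff_ofReal (Eventually.of_forall fun s => pk_nonneg hR.le (norm_nonneg _))]
    exact (mu_pk H.bl z hR).trans_lt ENNReal.ofReal_lt_top
  have hpk' : ∫ s, pk (m+1) (R z) ‖g s - z‖ ≤ 2 ^ (m+3) * (vb m * (3 / c) ^ (m+1)) := by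
    rw [integral_eq_lintegral_of_nonneg_ae (Eventually.of_forall fun s => pk_nonneg hR.le (norm_nonneg _)) hpk.1]
    have := vb_pos m; have := H.bl.cpos
    exact ENNReal.toReal_le_of_le_ofReal (by positivity) (mu_pk H.bl z hR)
  have hq := pkint H z hφ.i2
  have t1 : |∫ s, (k (g s - z) - (if ‖g s - z‖ < 4 * R z then 0 else pot k g (sg g R z) s)) * φ s| ≤
      B * ((∫ s, pk (m+1) (R z) ‖g s - z‖ * φ s ^ 2) + ∫ s, pk (m+1) (R z) ‖g s - z‖) := by
    rw [← integral_add hq hpk, ← integral_const_mul, ← Real.norm_eq_abs]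
    refine norm_integral_le_of_norm_le ((hq.add hpk).const_mul B) (Eventually.of_forall fun s => ?_)
    by_cases h : φ s = 0
    · simp only [h, mul_zero, norm_zero]
      have := pk_nonneg (n := m+1) hR.le (norm_nonneg (g s - z)); simp; positivity
    · have h3 := ker_err H hk hη (hs s h)
      rw [← hB] at h3
      have h4 := pk_nonneg (n := m+1) hR.le (norm_nonneg (g s - z))
      rw [norm_mul, Real.norm_eq_abs, Real.norm_eq_abs]
      generalize pk (m+1) (R z) ‖g s - z‖ = p at *
      calc _ ≤ B * p * |φ s| := mul_le_mul_of_nonneg_right h3 (abs_nonneg _)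
        _ ≤ B * p * (φ s ^ 2 + 1) := by
          gcongr; nlinarith [sq_abs (φ s), sq_nonneg (|φ s| - 1)]
        _ = _ := by ring
  have t2 : |∫ s, pot k g (sg g R z) s * b.indicator φ s| ≤
      A * (v⁻¹ + 5 ^ (m+2) * ∫ s, pk (m+1) (R z) ‖g s - z‖ * φ s ^ 2) := by
    obtain ⟨β, hβ⟩ : ∃ β, β = √(R z ^ (m+1)) := ⟨_, rfl⟩
    have hp : 0 < R z ^ (m+1) := by positivity
    have hβ0 : 0 < β := hβ ▸ Real.sqrt_pos.2 hp
    have hβ2 : β ^ 2 = R z ^ (m+1) := by rw [hβ, Real.sq_sqrt hp.le]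
    obtain ⟨s1, s2⟩ := H.L12 z
    have e2 : ∀ s, (β⁻¹ * b.indicator φ s) ^ 2 = (R z ^ (m+1))⁻¹ * b.indicator (fun s => φ s ^ 2) s := by
      intro s
      rw [mul_pow, inv_pow, hβ2]
      by_cases h : s ∈ b
      · simp [h]
      · simp [h]
    have l1 : L12 volume (fun t => β * sg g R z t) :=
      ⟨s1.i1.const_mul β, by simp only [mul_pow]; exact s1.i2.const_mul _⟩
    have l2 : L12 volume (fun s => β⁻¹ * b.indicator φ s) :=
      ⟨(hφ.i1.indicator bm).const_mul _, by simp only [e2]; exact (hφ.i2.indicator bm).const_mul _⟩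
    have := hP _ _ l1 l2
    have e1 : ∀ s t, k (g s - g t) * (β * sg g R z t * (β⁻¹ * b.indicator φ s)) =
        k (g s - g t) * (sg g R z t * b.indicator φ s) := fun s t => by field_simp
    simp only [e1, e2, mul_pow] at this
    rw [pot_eq] at this
    refine this.trans ?_
    gcongr
    · rw [integral_const_mul, hβ2]
      calc R z ^ (m+1) * ∫ x, sg g R z x ^ 2 ≤ R z ^ (m+1) * (v * R z ^ (m+1))⁻¹ := by gcongr
        _ = v⁻¹ := by field_simp
    · rw [← integral_const_mul]
      refine integral_mono ((hφ.i2.indicator bm).const_mul _) (hq.const_mul _) fun s => ?_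
      simp only
      by_cases h : s ∈ b
      · rw [indicator_of_mem h, ← mul_assoc]
        refine mul_le_mul_of_nonneg_right ?_ (sq_nonneg _)
        have := pk_ge (n := m+1) 4 hR (norm_nonneg _) (le_of_lt h)
        norm_num1 at this; exact this
      · rw [indicator_of_notMem h]
        have := pk_nonneg (n := m+1) hR.le (norm_nonneg (g s - z)); simp; positivity
  rw [e]
  refine (abs_sub _ _).trans ?_
  have := mul_le_mul_of_nonneg_left hpk' hB0
  linarith

end
end

section
section
variable {m : ℕ} {C R0 c Λ v η : ℝ} {g : EV (m+1) → EV (m+2)} {k : EV (m+2) → ℝ} {f φ : EV (m+1) → ℝ}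
  {R : EV (m+2) → ℝ} {ω : Measure (EV (m+2))} [IsFiniteMeasure ω]

theorem P4core (H : SH c Λ g R v η) (hk : Ker m C R0 k) (hη : ∀ x, |k x| ≤ C / η ^ (m+1)) {A : ℝ} (hA : 0 ≤ A)
    (hP : ∀ f φ : EV (m+1) → ℝ, L12 volume f → L12 volume φ →
      |∫ s, ∫ t, k (g s - g t) * (f t * φ s)| ≤ A * ((∫ x, f x ^ 2) + ∫ x, φ x ^ 2))
    (hφ : L12 volume φ) (hs : ∀ z s, φ s ≠ 0 → R z ≤ ‖g s - z‖ + η) {B : ℝ}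
    (hB : B = C * 2 ^ (m+1) * 5 ^ (m+2) + C * 4 ^ (m+3)) {l L : ℝ} (hl : 0 ≤ l) (hL : 0 ≤ L)
    (hω : ∀ z, ω {w | ‖w - z‖ < 4 * R z} ≤ ENNReal.ofReal (l * R z ^ (m+1)))
    (hpk : ∀ s, φ s ≠ 0 → ∫⁻ z, ENNReal.ofReal (pk (m+1) (R z) ‖g s - z‖) ∂ω ≤ ENNReal.ofReal L) :
    |∫ s, φ s * ∫ z, k (g s - z) ∂ω| ≤ (B + A * 5 ^ (m+2)) * (L * ∫ s, φ s ^ 2) +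
      (B * (2 ^ (m+3) * (vb m * (3 / c) ^ (m+1))) + A * v⁻¹) * ω.real univ +
      A * (2 * (l / v) * ω.real univ + ∫ s, φ s ^ 2) := by
  have hC := hk.rb.nn
  have h1 := hk.cont; have h2 := H.bl.cont; have hRc := H.Rc
  have hB0 : 0 ≤ B := by rw [hB]; positivity
  obtain ⟨M, hM⟩ := hk.bdd
  have J1 : Integrable (fun p : EV (m+2) × EV (m+1) => k (g p.2 - p.1) * φ p.2) (ω.prod volume) :=
    bdd_int (hφ.i1.comp_snd ω) (Continuous.aestronglyMeasurable (by fun_prop)) fun t => hM _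
  have J2 : Integrable (fun p : EV (m+2) × EV (m+1) => pot k g φ p.2 * sg g R p.1 p.2) (ω.prod volume) := by
    obtain ⟨M, hM⟩ := pot_bdd (g := g) hk hφ.i1
    exact bdd_int H.pint (pot_meas hk H.bl hφ.i1).comp_snd fun t => hM _
  have J3 : Integrable (fun p : EV (m+2) × EV (m+1) => pk (m+1) (R p.1) ‖g p.2 - p.1‖ * φ p.2 ^ 2)
      (ω.prod volume) := by
    refine bdd_int (M := (η ^ (m+1))⁻¹) (hφ.i2.comp_snd ω)
      (Measurable.aestronglyMeasurable (by unfold pk; fun_prop)) fun s => ?_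
    rw [abs_of_nonneg (pk_nonneg (H.Rp _).le (norm_nonneg _))]
    exact pk_le H.ηp (H.Rη _) (norm_nonneg _)
  obtain ⟨hh, hh2⟩ := H.hL12 hl hω
  have e1 : ∫ s, φ s * ∫ z, k (g s - z) ∂ω = ∫ z, (∫ s, k (g s - z) * φ s) ∂ω := by
    rw [integral_integral_swap J1]
    simp only [integral_mul_const]; simp only [mul_comm]
  have e2 : ∀ z, ∫ s, pot k g (sg g R z) s * φ s = -∫ t, pot k g φ t * sg g R z t := fun z =>
    pot_swap hk H.bl (H.sint z) hφ.i1
  have e3 : ∫ z, (∫ s, pot k g (sg g R z) s * φ s) ∂ω =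
      ∫ s, ∫ t, k (g s - g t) * ((∫ z, sg g R z t ∂ω) * φ s) := by
    rw [pot_eq, pot_swap hk H.bl hh.i1 hφ.i1]
    simp only [e2]
    rw [integral_neg, integral_integral_swap J2]
    simp only [integral_const_mul]
  have I2 : Integrable (fun z => ∫ s, pot k g (sg g R z) s * φ s) ω := by
    simp only [e2]; exact J2.integral_prod_left.neg
  have I1 := J1.integral_prod_left
  have I3 := J3.integral_prod_left
  simp only at I1 I3
  have e4 : ∫ z, (∫ s, pk (m+1) (R z) ‖g s - z‖ * φ s ^ 2) ∂ω ≤ L * ∫ s, φ s ^ 2 := by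
    rw [integral_integral_swap J3, ← integral_const_mul]
    refine integral_mono J3.integral_prod_right (hφ.i2.const_mul L) fun s => ?_
    simp only [integral_mul_const]
    by_cases h : φ s = 0
    · simp [h]
    · refine mul_le_mul_of_nonneg_right ?_ (sq_nonneg _)
      rw [integral_eq_lintegral_of_nonneg_ae
        (Eventually.of_forall fun z => pk_nonneg (H.Rp z).le (norm_nonneg _))
        (Measurable.aestronglyMeasurable (by unfold pk; fun_prop))]
      exact ENNReal.toReal_le_of_le_ofReal hL (hpk s h)
  have e5 : |(∫ z, (∫ s, k (g s - z) * φ s) ∂ω) - ∫ z, (∫ s, pot k g (sg g R z) s * φ s) ∂ω| ≤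
      (B + A * 5 ^ (m+2)) * (L * ∫ s, φ s ^ 2) +
      (B * (2 ^ (m+3) * (vb m * (3 / c) ^ (m+1))) + A * v⁻¹) * ω.real univ := by
    rw [← integral_sub I1 I2, ← Real.norm_eq_abs]
    refine (norm_integral_le_of_norm_le ((I3.const_mul (B + A * 5 ^ (m+2))).add (integrable_const
      (B * (2 ^ (m+3) * (vb m * (3 / c) ^ (m+1))) + A * v⁻¹))) (Eventually.of_forall fun z =>
      z_err H hk hη hA hP hφ z (hs z) hB)).trans ?_
    simp only [Pi.add_apply]
    rw [integral_add (I3.const_mul _) (integrable_const _), integral_const_mul, integral_const, smul_eq_mul,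
      mul_comm (ω.real univ)]
    gcongr
  have e6 := hP _ _ hh hφ
  rw [← e3] at e6
  rw [e1]
  have e7 := mul_le_mul_of_nonneg_left hh2 hA
  rw [abs_le] at *
  constructor <;> linarith [e5.1, e5.2, e6.1, e6.2]

theorem P4 (m : ℕ) (C c Λ l l' : ℝ) (hl : 0 ≤ l) (hl' : 0 ≤ l') : ∃ A : ℝ, 0 < A ∧
    ∀ (R0 η : ℝ) (k : EV (m+2) → ℝ) (g : EV (m+1) → EV (m+2)) (G G' : Set (EV (m+1)))
      (ω : Measure (EV (m+2))) [IsFiniteMeasure ω] (φ : EV (m+1) → ℝ), Ker m C R0 k → 0 < η →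
      (∀ x, |k x| ≤ C / η ^ (m+1)) → BLip c Λ g → G.Nonempty → G' ⊆ G →
      (∀ s ∈ G, ∀ r > 0, ω (ball (g s) r) ≤ ENNReal.ofReal (l * r ^ (m+1))) →
      (∀ s ∈ G', ∫⁻ z, ENNReal.ofReal (pk (m+1) (infDist z (g '' G)) ‖g s - z‖) ∂ω ≤ ENNReal.ofReal l') →
      L12 volume φ → (∀ s, s ∉ G' → φ s = 0) →
      |∫ s, φ s * ∫ z, k (g s - z) ∂ω| ≤ A * ((∫ s, φ s ^ 2) + ω.real univ) := by
  obtain ⟨A, hA, hP⟩ := P3 m (EV (m+2)) C c Λ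
  obtain ⟨B, hB⟩ : ∃ B, B = C * 2 ^ (m+1) * 5 ^ (m+2) + C * 4 ^ (m+3) := ⟨_, rfl⟩
  obtain ⟨v, hv⟩ : ∃ v, v = vb m * (1 / Λ) ^ (m+1) := ⟨_, rfl⟩
  obtain ⟨L, hL⟩ : ∃ L, L = l' + 2 ^ (m+3) * l := ⟨_, rfl⟩
  obtain ⟨A1, hA1⟩ : ∃ A1, A1 = (B + A * 5 ^ (m+2)) * L + A := ⟨_, rfl⟩
  obtain ⟨A2, hA2⟩ : ∃ A2, A2 = (B * (2 ^ (m+3) * (vb m * (3 / c) ^ (m+1))) + A * v⁻¹) +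
    A * (2 * (l * 5 ^ (m+1) / v)) := ⟨_, rfl⟩
  refine ⟨|A1| + |A2| + 1, by positivity, ?_⟩
  intro R0 η k g G G' ω _ φ hk hη hkη hg hG hGG hω hp hφ hφ0
  have hΛ := hg.Lpos
  have hvb := vb_pos m
  have hvp : 0 < v := by rw [hv]; positivity
  have near : ∀ z, ∃ s0 ∈ G, ‖z - g s0‖ < infDist z (g '' G) + η := by
    intro z
    obtain ⟨y, ⟨s0, hs0, rfl⟩, h⟩ := (infDist_lt_iff (hG.image g)).1
      (show infDist z (g '' G) < infDist z (g '' G) + η by linarith)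
    exact ⟨s0, hs0, by rwa [← dist_eq_norm]⟩
  have H : SH c Λ g (fun z => infDist z (g '' G) + η) v η := by
    refine ⟨hg, (continuous_infDist_pt _).add continuous_const, hvp, hη, fun z => ?_, fun z => ?_⟩
    · have : 0 ≤ infDist z (g '' G) := infDist_nonneg; linarith
    · obtain ⟨s0, h0, hd⟩ := near z
      obtain ⟨ρ, hρ⟩ : ∃ ρ, ρ = infDist z (g '' G) + η := ⟨_, rfl⟩
      simp only [Vz, ← hρ] at hd ⊢
      have hρ0 : 0 < ρ := (norm_nonneg _).trans_lt hd
      have hsub : ball s0 (ρ / Λ) ⊆ {t | ‖g t - z‖ < 2 * ρ} := by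
        intro t ht
        rw [mem_ball, dist_eq_norm, lt_div_iff₀ hΛ] at ht
        have h1 := hg.hi t s0
        have h2 := norm_sub_le_norm_sub_add_norm_sub (g t) (g s0) z
        rw [norm_sub_rev (g s0) z] at h2
        rw [mem_ofPred_eq]; linarith
      have h3 := measure_mono (μ := volume) hsub
      rw [vol_ball _ (by positivity)] at h3
      have h4 := (ENNReal.ofReal_le_iff_le_toReal
        ((mu_growth hg z (by positivity : 0 < 2 * ρ)).trans_lt ENNReal.ofReal_lt_top).ne).1 h3
      refine le_trans (le_of_eq ?_) h4
      rw [hv, div_pow, div_pow, one_pow]; ring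
  have hgc := hg.cont
  have := P4core H hk hkη hA (fun f φ => hP R0 k g f φ hk hg) hφ (fun z s h => by
      have hsG : s ∈ G := hGG (by by_contra h'; exact h (hφ0 s h'))
      have := infDist_le_dist_of_mem (x := z) (mem_image_of_mem g hsG)
      rw [dist_eq_norm, norm_sub_rev] at this
      linarith) hB (l := l * 5 ^ (m+1)) (L := L) (by positivity) (by rw [hL]; positivity) (fun z => by
      obtain ⟨s0, h0, hd⟩ := near z
      obtain ⟨ρ, hρ⟩ : ∃ ρ, ρ = infDist z (g '' G) + η := ⟨_, rfl⟩
      simp only [← hρ] at hd ⊢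
      have hρ0 : 0 < ρ := (norm_nonneg _).trans_lt hd
      refine (measure_mono (t := ball (g s0) (5 * ρ)) fun w hw => ?_).trans
        ((hω s0 h0 (5 * ρ) (by positivity)).trans (le_of_eq (by rw [mul_pow, mul_assoc])))
      rw [mem_ofPred_eq] at hw
      have h2 := norm_sub_le_norm_sub_add_norm_sub w z (g s0)
      rw [mem_ball, dist_eq_norm]; linarith) (fun s h => by
      have hs : s ∈ G' := by by_contra h'; exact h (hφ0 s h')
      have hgr := growth (ν := ω) (D := fun z => ‖g s - z‖) (n := m+1) (l := l) (by fun_prop)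
        (fun _ => norm_nonneg _) hl (fun r hr => by
          refine le_trans (measure_mono fun z hz => ?_) (hω s (hGG hs) r hr)
          rw [mem_ball', dist_eq_norm]; exact hz) hη
      rw [hL, ENNReal.ofReal_add hl' (by positivity)]
      refine le_trans ?_ (add_le_add (hp s hs) hgr)
      rw [← lintegral_add_right _ (by unfold pk; fun_prop)]
      refine lintegral_mono fun z => ?_
      rw [← ENNReal.ofReal_add (pk_nonneg infDist_nonneg (norm_nonneg _)) (pk_nonneg hη.le (norm_nonneg _))]
      exact ENNReal.ofReal_le_ofReal (pk_split infDist_nonneg hη (norm_nonneg _)))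
  have q0 : 0 ≤ ∫ s, φ s ^ 2 := integral_nonneg fun s => sq_nonneg _
  have w0 : 0 ≤ ω.real univ := measureReal_nonneg
  generalize ∫ s, φ s ^ 2 = q at *
  generalize ω.real univ = w at *
  have b1 := mul_le_mul_of_nonneg_right (le_abs_self A1) q0
  have b2 := mul_le_mul_of_nonneg_right (le_abs_self A2) w0
  have b3 := mul_nonneg (abs_nonneg A1) w0
  have b4 := mul_nonneg (abs_nonneg A2) q0
  have e : (B + A * 5 ^ (m+2)) * (L * q) +
      (B * (2 ^ (m+3) * (vb m * (3 / c) ^ (m+1))) + A * v⁻¹) * w +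
      A * (2 * (l * 5 ^ (m+1) / v) * w + q) = A1 * q + A2 * w := by rw [hA1, hA2]; ring
  rw [e] at this
  linarith

end
end

section
theorem decomp {d : ℕ} (μ ν : Measure (EV d)) [IsLocallyFiniteMeasure μ] [IsFiniteMeasure ν] :
    ∀ᵐ x ∂μ, ∃ (θ : ℝ≥0) (ωp ωm : Measure (EV d)), ωp ≤ ν ∧ ωm ≤ θ • μ ∧ ν + ωm = θ • μ + ωp ∧
      Tendsto (fun r => (ωp + ωm) (closedBall x r) / μ (closedBall x r)) (𝓝[>] 0) (𝓝 0) := by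
  set f := ν.rnDeriv μ with hf
  have fm : Measurable f := Measure.measurable_rnDeriv ν μ
  have fin : ∀ᵐ y ∂μ, f y < ∞ := Measure.rnDeriv_lt_top ν μ
  have hi : Integrable (fun y => (f y).toReal) μ := Measure.integrable_toReal_rnDeriv
  have sing : ∀ᵐ x ∂μ, (ν.singularPart μ).rnDeriv μ x = 0 :=
    (Measure.rnDeriv_eq_zero _ _).2 (Measure.mutuallySingular_singularPart ν μ)
  filter_upwards [Besicovitch.ae_tendsto_rnDeriv (ν.singularPart μ) μ, sing, fin,
    (Besicovitch.vitaliFamily μ).ae_tendsto_lintegral_enorm_sub_div hi.locallyIntegrable] with x h1 h2 h3 h4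
  rw [h2] at h1
  have h4 := h4.comp (Besicovitch.tendsto_filterAt μ x)
  obtain ⟨θ, hθ⟩ : ∃ θ : ℝ≥0, (θ : ℝ≥0∞) = f x := ⟨(f x).toNNReal, ENNReal.coe_toNNReal h3.ne⟩
  have hν := ν.haveLebesgueDecomposition_add μ
  have hc : θ • μ = μ.withDensity (fun _ => (θ : ℝ≥0∞)) := by rw [withDensity_const]; rfl
  refine ⟨θ, μ.withDensity (fun y => f y - θ) + ν.singularPart μ, μ.withDensity (fun y => θ - f y), ?_, ?_, ?_, ?_⟩
  · conv_rhs => rw [hν, add_comm]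
    exact add_le_add (withDensity_mono (Eventually.of_forall fun y => tsub_le_self)) le_rfl
  · rw [hc]; exact withDensity_mono (Eventually.of_forall fun y => tsub_le_self)
  · rw [hc]; conv_lhs => rw [hν]
    rw [← hf, add_assoc, ← withDensity_add_left fm, add_comm, ← add_assoc, ← withDensity_add_left measurable_const]
    congr 2
    ext y
    simp only [Pi.add_apply, add_tsub_eq_max, max_comm]
  · have h5 := h1.add h4
    rw [add_zero] at h5
    refine tendsto_of_tendsto_of_tendsto_of_le_of_le tendsto_const_nhds h5 (fun _ => zero_le) fun r => ?_
    simp only [Function.comp_apply]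
    rw [← ENNReal.add_div]
    refine ENNReal.div_le_div_right ?_ _
    simp only [Measure.add_apply]
    rw [withDensity_apply _ measurableSet_closedBall, withDensity_apply _ measurableSet_closedBall,
      add_comm (lintegral _ _), add_assoc, ← lintegral_add_left (by fun_prop)]
    refine add_le_add le_rfl ?_
    refine lintegral_mono_ae (ae_restrict_of_ae ?_)
    filter_upwards [fin] with y hy
    rw [← hθ]
    obtain ⟨q, hq⟩ : ∃ q : ℝ≥0, (q : ℝ≥0∞) = f y := ⟨(f y).toNNReal, ENNReal.coe_toNNReal hy.ne⟩
    rw [← hq, ENNReal.coe_toReal, ENNReal.coe_toReal]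
    have e : ‖(q:ℝ) - θ‖ₑ = edist q θ := by
      rw [← edist_eq_enorm_sub]; rfl
    rw [e]
    rcases le_total q θ with h | h
    · rw [tsub_eq_zero_of_le (ENNReal.coe_le_coe.2 h), zero_add, edist_comm, edist_nndist,
        NNReal.nndist_eq, tsub_eq_zero_of_le h, max_eq_left zero_le, ENNReal.coe_sub]
    · rw [tsub_eq_zero_of_le (ENNReal.coe_le_coe.2 h), add_zero, edist_nndist,
        NNReal.nndist_eq, tsub_eq_zero_of_le h, max_eq_left zero_le, ENNReal.coe_sub]

theorem pk_tail {n : ℕ} {ρ r d : ℝ} (hρ : 0 ≤ ρ) (hr : 0 < r) (hd : r ≤ d) :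
    pk n ρ d ≤ ρ / r * 2 ^ (n+1) * pk n r d := by
  unfold pk
  have h0 : 0 < d := hr.trans_le hd
  have : ρ / r * 2 ^ (n+1) * (r / (r + d) ^ (n+1)) = ρ / ((r + d) / 2) ^ (n+1) := by
    rw [div_pow]; field_simp
  rw [this]
  gcongr; linarith

section
variable {m : ℕ} {c Λ : ℝ} {g : EV (m+1) → EV (m+2)}

def pm (g : EV (m+1) → EV (m+2)) : Measure (EV (m+2)) := volume.map g

def gl (m : ℕ) (c : ℝ) : ℝ := vb m * (3 / c) ^ (m+1)

theorem gl_nn (hg : BLip c Λ g) : 0 ≤ gl m c := by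
  have := hg.cpos; have := vb_pos m; unfold gl; positivity

theorem pm_growth (hg : BLip c Λ g) (z : EV (m+2)) {r : ℝ} (hr : 0 < r) :
    pm g {y | ‖y - z‖ < r} ≤ ENNReal.ofReal (gl m c * r ^ (m+1)) := by
  unfold pm
  rw [Measure.map_apply hg.cont.measurable (isOpen_lt (by fun_prop) continuous_const).measurableSet]
  exact mu_growth hg z hr

theorem pm_lf (hg : BLip c Λ g) : IsLocallyFiniteMeasure (pm g) := by
  refine ⟨fun z => ⟨ball z 1, ball_mem_nhds _ one_pos, ?_⟩⟩
  refine (measure_mono fun y hy => ?_).trans_lt ((pm_growth hg z one_pos).trans_lt ENNReal.ofReal_lt_top)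
  rw [mem_ofPred_eq, ← dist_eq_norm]; exact hy

/-- decomposition of `ν` at `x` w.r.t. `pm g` -/
structure Dec (g : EV (m+1) → EV (m+2)) (ν : Measure (EV (m+2))) (x : EV (m+2)) (θ : ℝ≥0)
    (ωp ωm : Measure (EV (m+2))) : Prop where
  hp : ωp ≤ ν
  hm : ωm ≤ θ • pm g
  eq : ν + ωm = θ • pm g + ωp
  o : ∀ κ > 0, ∃ r0 > 0, ∀ r ∈ Ioc 0 r0, (ωp + ωm) (closedBall x r) ≤ ENNReal.ofReal (κ * r ^ (m+1))

theorem dec_ae (hg : BLip c Λ g) (ν : Measure (EV (m+2))) [IsFiniteMeasure ν] :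
    ∀ᵐ s, ∃ θ ωp ωm, Dec g ν (g s) θ ωp ωm := by
  have := pm_lf hg
  have h := ae_of_ae_map hg.cont.measurable.aemeasurable (decomp (pm g) ν)
  filter_upwards [h] with s ⟨θ, ωp, ωm, h1, h2, h3, h4⟩
  refine ⟨θ, ωp, ωm, h1, h2, h3, fun κ hκ => ?_⟩
  obtain ⟨A, hA⟩ : ∃ A, A = gl m c * 2 ^ (m+1) + 1 := ⟨_, rfl⟩
  have hA0 : 0 < A := by have := gl_nn hg; rw [hA]; positivity
  have h5 : ∀ᶠ r in 𝓝[>] (0:ℝ), (ωp + ωm) (closedBall (g s) r) / pm g (closedBall (g s) r) < ENNReal.ofReal (κ / A) :=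
    h4.eventually_lt_const (ENNReal.ofReal_pos.2 (by positivity))
  rw [eventually_nhdsWithin_iff, Metric.eventually_nhds_iff] at h5
  obtain ⟨r0, hr0, h5⟩ := h5
  refine ⟨r0 / 2, by positivity, fun r hr => ?_⟩
  have h6 := h5 (y := r) (by rw [Real.dist_eq, sub_zero, abs_of_pos hr.1]; linarith [hr.2]) hr.1
  have h7 : pm g (closedBall (g s) r) ≤ ENNReal.ofReal (gl m c * (2 * r) ^ (m+1)) :=
    (measure_mono fun y hy => by
      rw [mem_closedBall, dist_eq_norm] at hy
      rw [mem_ofPred_eq]; linarith [hr.1]).trans (pm_growth hg (g s) (r := 2 * r) (by linarith [hr.1]))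
  have h8 := (ENNReal.div_le_iff_le_mul (Or.inr ENNReal.ofReal_ne_top)
    (Or.inl (h7.trans_lt ENNReal.ofReal_lt_top).ne)).1 h6.le
  refine h8.trans ((mul_le_mul_right h7 _).trans ?_)
  rw [← ENNReal.ofReal_mul (by positivity)]
  refine ENNReal.ofReal_le_ofReal ?_
  have := hr.1
  rw [mul_pow, ← mul_assoc (gl m c), ← mul_assoc]
  gcongr
  rw [div_mul_eq_mul_div, div_le_iff₀ hA0]
  gcongr; linarith

/-- integrals of the Poisson kernel against `o(r^n)` measures -/
theorem o_growth {τ : Measure (EV (m+2))} {x : EV (m+2)} {l : ℝ} (hl : 0 ≤ l)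
    (h : ∀ r > 0, τ {y | ‖x - y‖ < r} ≤ ENNReal.ofReal (l * r ^ (m+1)))
    (o : ∀ κ > 0, ∃ r0 > 0, ∀ r ∈ Ioc 0 r0, τ (closedBall x r) ≤ ENNReal.ofReal (κ * r ^ (m+1))) {κ : ℝ} (hκ : 0 < κ) :
    ∃ ρ0 > 0, ∀ ρ ∈ Ioc 0 ρ0, ∫⁻ y, ENNReal.ofReal (pk (m+1) ρ ‖x - y‖) ∂τ ≤ ENNReal.ofReal κ := by
  obtain ⟨κ', hκ', e⟩ : ∃ κ' > 0, 2 ^ (m+3) * κ' = κ / 2 := ⟨κ / 2 / 2 ^ (m+3), by positivity, by field_simp⟩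
  obtain ⟨r0, hr0, h1⟩ := o κ' hκ'
  refine ⟨κ / 2 / (2 ^ (m+2) * (2 ^ (m+3) * l) + 1) * r0, by positivity, fun ρ hρ => ?_⟩
  have hpm : ∀ a, Measurable fun y => ENNReal.ofReal (pk (m+1) a ‖x - y‖) := fun a => by unfold pk; fun_prop
  have g1 := growth (ν := τ.restrict (closedBall x r0)) (D := fun y => ‖x - y‖) (n := m+1) (by fun_prop)
    (fun _ => norm_nonneg _) hκ'.le (fun r hr => by
      have hm : MeasurableSet {y | ‖x - y‖ < r} := (isOpen_lt (by fun_prop) continuous_const).measurableSet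
      rw [Measure.restrict_apply hm]
      rcases le_total r r0 with h2 | h2
      · refine (measure_mono fun y hy => ?_).trans (h1 r ⟨hr, h2⟩)
        rw [mem_closedBall, dist_comm, dist_eq_norm]; exact le_of_lt hy.1
      · refine (measure_mono inter_subset_right).trans ((h1 r0 ⟨hr0, le_rfl⟩).trans ?_)
        exact ENNReal.ofReal_le_ofReal (by gcongr)) hρ.1
  have g2 := growth (ν := τ) (D := fun y => ‖x - y‖) (n := m+1) (by fun_prop) (fun _ => norm_nonneg _) hl h hr0
  rw [← lintegral_add_compl _ (measurableSet_closedBall (x := x) (ε := r0)), ← add_halves κ,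
    ENNReal.ofReal_add (by positivity) (by positivity)]
  refine add_le_add (g1.trans (ENNReal.ofReal_le_ofReal e.le)) ?_
  have hρ1 := hρ.1
  calc ∫⁻ y in (closedBall x r0)ᶜ, ENNReal.ofReal (pk (m+1) ρ ‖x - y‖) ∂τ
      ≤ ∫⁻ y in (closedBall x r0)ᶜ, ENNReal.ofReal (ρ / r0 * 2 ^ (m+2)) * ENNReal.ofReal (pk (m+1) r0 ‖x - y‖) ∂τ := by
        refine setLIntegral_mono' measurableSet_closedBall.compl fun y hy => ?_
        rw [← ENNReal.ofReal_mul (by positivity)]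
        refine ENNReal.ofReal_le_ofReal (pk_tail hρ1.le hr0 ?_)
        rw [mem_compl_iff, mem_closedBall, dist_comm, dist_eq_norm] at hy; linarith
    _ ≤ ∫⁻ y, ENNReal.ofReal (ρ / r0 * 2 ^ (m+2)) * ENNReal.ofReal (pk (m+1) r0 ‖x - y‖) ∂τ := setLIntegral_le_lintegral _ _
    _ ≤ ENNReal.ofReal (ρ / r0 * 2 ^ (m+2)) * ENNReal.ofReal (2 ^ (m+3) * l) := by
        rw [lintegral_const_mul _ (hpm _)]; gcongr
    _ ≤ _ := by
        rw [← ENNReal.ofReal_mul (by positivity)]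
        refine ENNReal.ofReal_le_ofReal ?_
        have h2 : ρ / r0 ≤ κ / 2 / (2 ^ (m+2) * (2 ^ (m+3) * l) + 1) := (div_le_iff₀ hr0).2 hρ.2
        rw [mul_assoc]
        rw [le_div_iff₀ (by positivity)] at h2
        have : 0 ≤ ρ / r0 := by positivity
        linarith

theorem Dec.lp {ν : Measure (EV (m+2))} [IsFiniteMeasure ν] {x θ ωp ωm} (D : Dec g ν x θ ωp ωm) (hg : BLip c Λ g) :
    ∃ l, 0 ≤ l ∧ ∀ r > 0, (ωp + ωm) {y | ‖x - y‖ < r} ≤ ENNReal.ofReal (l * r ^ (m+1)) := by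
  have h0 := gl_nn hg
  obtain ⟨r0, hr0, h1⟩ := D.o 1 one_pos
  refine ⟨1 + ν.real univ / r0 ^ (m+1) + θ * gl m c, by positivity, fun r hr => ?_⟩
  rcases le_total r r0 with h2 | h2
  · refine (measure_mono fun y hy => ?_).trans ((h1 r ⟨hr, h2⟩).trans (ENNReal.ofReal_le_ofReal ?_))
    · rw [mem_closedBall, dist_comm, dist_eq_norm]; exact le_of_lt hy
    · gcongr
      have : 0 ≤ ν.real univ / r0 ^ (m+1) + θ * gl m c := by positivity
      linarith
  · rw [Measure.add_apply]
    have e1 : ωp {y | ‖x - y‖ < r} ≤ ENNReal.ofReal (ν.real univ) := by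
      rw [ofReal_measureReal]; exact (D.hp _).trans (measure_mono (subset_univ _))
    have e2 : ωm {y | ‖x - y‖ < r} ≤ ENNReal.ofReal (θ * (gl m c * r ^ (m+1))) := by
      refine (D.hm _).trans ?_
      rw [ENNReal.ofReal_mul (NNReal.coe_nonneg θ), ENNReal.ofReal_coe_nnreal]
      simp only [norm_sub_rev x]
      exact mul_le_mul_right (pm_growth hg x hr) _
    refine (add_le_add e1 e2).trans ?_
    rw [← ENNReal.ofReal_add (by positivity) (by positivity)]
    refine ENNReal.ofReal_le_ofReal ?_
    have : ν.real univ ≤ ν.real univ / r0 ^ (m+1) * r ^ (m+1) := by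
      rw [div_mul_eq_mul_div, le_div_iff₀ (by positivity)]; gcongr
    have : 0 ≤ r ^ (m+1) := by positivity
    linarith

/-- reduction to the measure `pm g` -/
theorem reduce_mu {ν : Measure (EV (m+2))} [IsFiniteMeasure ν] {x θ ωp ωm} (D : Dec g ν x θ ωp ωm)
    (hg : BLip c Λ g) {B κ : ℝ} (hB : 0 ≤ B) (hκ : 0 < κ) : ∃ ρ0 > 0, ∀ ρ ∈ Ioc 0 ρ0, ∀ F : EV (m+2) → ℝ, Measurable F →
      (∀ z, |F z| ≤ B * pk (m+1) ρ ‖x - z‖) → |(∫ z, F z ∂ν) - θ * ∫ t, F (g t)| ≤ κ := by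
  obtain ⟨l, hl, h1⟩ := D.lp hg
  obtain ⟨ρ0, h0, h2⟩ := o_growth hl h1 D.o (κ := κ / (B + 1)) (by positivity)
  refine ⟨ρ0, h0, fun ρ hρ F hF hb => ?_⟩
  have hρ0 := hρ.1
  have h3 : ∫⁻ z, ‖F z‖ₑ ∂(ωp + ωm) ≤ ENNReal.ofReal κ := by
    calc ∫⁻ z, ‖F z‖ₑ ∂(ωp + ωm) ≤ ∫⁻ z, ENNReal.ofReal B * ENNReal.ofReal (pk (m+1) ρ ‖x - z‖) ∂(ωp + ωm) :=
          lintegral_mono fun z => by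
            rw [← ENNReal.ofReal_mul hB, Real.enorm_eq_ofReal_abs]; exact ENNReal.ofReal_le_ofReal (hb z)
      _ ≤ ENNReal.ofReal B * ENNReal.ofReal (κ / (B + 1)) := by
          rw [lintegral_const_mul _ (by unfold pk; fun_prop)]; gcongr; exact h2 ρ hρ
      _ ≤ _ := by
          rw [← ENNReal.ofReal_mul hB]
          refine ENNReal.ofReal_le_ofReal ?_
          rw [mul_div_assoc', div_le_iff₀ (by positivity)]; linarith
  have i0 : Integrable F (ωp + ωm) := ⟨hF.aestronglyMeasurable, h3.trans_lt ENNReal.ofReal_lt_top⟩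
  have i1 : Integrable (fun t => F (g t)) := by
    refine Integrable.mono' (g := fun t => B * pk (m+1) ρ ‖g t - x‖) (Integrable.const_mul ⟨?_, ?_⟩ B) ?_
      (Eventually.of_forall fun t => ?_)
    · have := hg.cont; exact Measurable.aestronglyMeasurable (by unfold pk; fun_prop)
    · rw [hasFiniteIntegral_iff_ofReal (Eventually.of_forall fun s => pk_nonneg hρ0.le (norm_nonneg _))]
      exact (mu_pk hg x hρ0).trans_lt ENNReal.ofReal_lt_top
    · exact (hF.comp hg.cont.measurable).aestronglyMeasurable
    · rw [norm_sub_rev]; exact hb _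
  have i2 : Integrable F (θ • pm g) :=
    Integrable.smul_measure_nnreal ((integrable_map_measure hF.aestronglyMeasurable hg.cont.measurable.aemeasurable).2 i1)
  have ip : Integrable F ωp := i0.mono_measure (Measure.le_add_right le_rfl)
  have im : Integrable F ωm := i0.mono_measure (Measure.le_add_left le_rfl)
  have i3 : Integrable F ν := (i2.add_measure ip).mono_measure (D.eq ▸ Measure.le_add_right le_rfl)
  have e1 := congrArg (fun M => ∫ z, F z ∂M) D.eq
  rw [integral_add_measure i3 im, integral_add_measure i2 ip, integral_smul_nnreal_measure, pm,
    integral_map hg.cont.measurable.aemeasurable hF.aestronglyMeasurable, NNReal.smul_def, smul_eq_mul] at e1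
  have e2 : |(∫ z, F z ∂ωp) - ∫ z, F z ∂ωm| ≤ ∫ z, ‖F z‖ ∂(ωp + ωm) := by
    rw [integral_add_measure ip.norm im.norm]
    exact (abs_sub _ _).trans (add_le_add abs_integral_le_integral_abs abs_integral_le_integral_abs)
  rw [integral_norm_eq_lintegral_enorm hF.aestronglyMeasurable] at e2
  have e3 := ENNReal.toReal_le_of_le_ofReal hκ.le h3
  rw [show (∫ z, F z ∂ν) - θ * ∫ t, F (g t) = (∫ z, F z ∂ωp) - ∫ z, F z ∂ωm by linarith]
  exact e2.trans e3

end
end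

section
structure CZ (m : ℕ) (C : ℝ) (K : EV (m+2) → ℝ) : Prop where
  rb : RB (m+1) C K
  rbt : ∀ η > 0, ∀ R > 0, RB (m+1) C (Kt K η R)
  odd : ∀ x, K (-x) = -K x
  co : ContinuousOn K {(0 : EV (m+2))}ᶜ
  hom : ∀ x, ∀ t : ℝ, 0 < t → K (t • x) = (t ^ (m+1))⁻¹ * K x

section
variable {m : ℕ} {C c Λ : ℝ} {K : EV (m+2) → ℝ} {g : EV (m+1) → EV (m+2)}

theorem CZ.bd (h : CZ m C K) {η R : ℝ} (hη : 0 < η) (hR : 0 < R) (v : EV (m+2)) :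
    |Kt K η R v| ≤ C * 2 ^ (m+1) / η ^ (m+1) := by
  rcases le_total ‖v‖ (η / 2) with h1 | h1
  · rw [Kt_near hη h1, abs_zero]; have := h.rb.nn; positivity
  · refine ((h.rbt η hη R hR).b0 _ (by positivity) v h1).trans (le_of_eq ?_)
    rw [div_pow]; field_simp

theorem CZ.ker (h : CZ m C K) {η R : ℝ} (hη : 0 < η) (hR : 0 < R) : Ker m (C * 2 ^ (m+1)) R (Kt K η R) :=
  ⟨(h.rbt η hη R hR).mono (le_mul_of_one_le_right h.rb.nn (one_le_pow₀ one_le_two)), Kt_neg h.odd η R,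
    Kt_cont h.co hη, ⟨_, h.bd hη hR⟩, fun x hx => Kt_far hR hx⟩

theorem CZ.pk (h : CZ m C K) {η R : ℝ} (hη : 0 < η) (hR : 0 < R) {a b : EV (m+2)} (hab : ‖a - b‖ ≤ η / 8) :
    |Kt K η R a - Kt K η R b| ≤ C * 10 ^ (m+2) * ‖a - b‖ / (η + ‖a‖) ^ (m+2) := by
  have hC := h.rb.nn
  have h3 := norm_sub_norm_le a b
  have h4 := norm_sub_norm_le b a
  rw [norm_sub_rev b a] at h4
  rcases le_total ‖a‖ (η / 4) with h1 | h1
  · rw [Kt_near hη (by linarith), Kt_near hη (by linarith), sub_zero, abs_zero]; positivity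
  · have h0 : 0 < ‖a‖ := by linarith
    refine ((h.rbt η hη R hR).b1 (‖a‖ / 2) (by positivity) a b (by linarith) (by linarith)).trans ?_
    rw [show C * 10 ^ (m+2) * ‖a - b‖ / (η + ‖a‖) ^ (m+2) = C * ‖a - b‖ / ((η + ‖a‖) / 10) ^ (m+2) by
      rw [div_pow]; field_simp]
    exact div_le_div_of_nonneg_left (by positivity) (by positivity) (pow_le_pow_left₀ (by positivity) (by linarith) _)

/-- measurable functions and products -/
theorem near_term (m : ℕ) (C c Λ : ℝ) : ∃ A : ℝ, 0 ≤ A ∧ ∀ (R : ℝ) (k : EV (m+2) → ℝ) (g : EV (m+1) → EV (m+2))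
    (S T : Set (EV (m+1))), Ker m C R k → BLip c Λ g → MeasurableSet S → MeasurableSet T → volume S < ∞ → volume T < ∞ →
    ∀ t > 0, |∫ p in S ×ˢ T, k (g p.1 - g p.2) ∂(volume.prod volume)| ≤ A * (t * volume.real S + volume.real T / t) := by
  obtain ⟨A, hA, hP⟩ := P3 m (EV (m+2)) C c Λ
  refine ⟨A, hA, fun R k g S T hk hg hS hT hS' hT' t ht => ?_⟩
  obtain ⟨q, hq⟩ : ∃ q, q = √t := ⟨_, rfl⟩
  have hq0 : 0 < q := hq ▸ Real.sqrt_pos.2 ht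
  have hq2 : q ^ 2 = t := by rw [hq, Real.sq_sqrt ht.le]
  have key : ∀ (S : Set (EV (m+1))) (a : ℝ), MeasurableSet S → volume S < ∞ →
      L12 volume (S.indicator fun _ => a) ∧ ∫ x, (S.indicator (fun _ => a) x) ^ 2 = a ^ 2 * volume.real S := by
    intro S a hS hf
    have e : ∀ x, (S.indicator (fun _ => a) x) ^ 2 = S.indicator (fun _ => a ^ 2) x := fun x => by
      by_cases h : x ∈ S <;> simp [h]
    refine ⟨⟨(integrable_indicator_iff hS).2 (integrableOn_const hf.ne), ?_⟩, ?_⟩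
    · simp only [e]; exact (integrable_indicator_iff hS).2 (integrableOn_const hf.ne)
    · simp only [e]; rw [integral_indicator hS, setIntegral_const, smul_eq_mul, mul_comm]
  obtain ⟨l1, e1⟩ := key T q⁻¹ hT hT'
  obtain ⟨l2, e2⟩ := key S q hS hS'
  have := hP R k g _ _ hk hg l1 l2
  rw [e1, e2, inv_pow, hq2] at this
  have hi := G_int hk.cont hk.bdd hg.cont l1.i1 l2.i1
  rw [integral_integral hi] at this
  have e : (∫ p in S ×ˢ T, k (g p.1 - g p.2) ∂(volume.prod volume)) = ∫ p, k (g p.1 - g p.2) *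
      (T.indicator (fun _ => q⁻¹) p.2 * S.indicator (fun _ => q) p.1) ∂(volume.prod volume) := by
    rw [← integral_indicator (hS.prod hT)]
    refine integral_congr_ae (Eventually.of_forall fun p => ?_)
    simp only [indicator, mem_prod]
    by_cases h1 : p.1 ∈ S <;> by_cases h2 : p.2 ∈ T <;> simp [h1, h2, hq0.ne']
  rw [e]
  refine this.trans (le_of_eq ?_)
  ring

theorem sing_term (m : ℕ) (C c Λ l l' : ℝ) (hl : 0 ≤ l) (hl' : 0 ≤ l') : ∃ A : ℝ, 0 < A ∧
    ∀ (R0 η : ℝ) (k : EV (m+2) → ℝ) (g : EV (m+1) → EV (m+2)) (G G' : Set (EV (m+1)))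
      (ω : Measure (EV (m+2))) [IsFiniteMeasure ω], Ker m C R0 k → 0 < η →
      (∀ x, |k x| ≤ C / η ^ (m+1)) → BLip c Λ g → G.Nonempty → G' ⊆ G → MeasurableSet G' → volume G' < ∞ →
      (∀ s ∈ G, ∀ r > 0, ω (ball (g s) r) ≤ ENNReal.ofReal (l * r ^ (m+1))) →
      (∀ s ∈ G', ∫⁻ z, ENNReal.ofReal (pk (m+1) (infDist z (g '' G)) ‖g s - z‖) ∂ω ≤ ENNReal.ofReal l') →
      (∀ S ⊆ G', MeasurableSet S → ∀ t > 0, |∫ s in S, ∫ z, k (g s - z) ∂ω| ≤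
        A * (t * volume.real S + ω.real univ / t)) ∧
      ∫ s in G', (∫ z, k (g s - z) ∂ω) ^ 2 ≤ 4 * A ^ 2 * ω.real univ := by
  obtain ⟨A, hA, hP⟩ := P4 m C c Λ l l' hl hl'
  refine ⟨A, hA, fun R0 η k g G G' ω _ hk hη hkη hg hG hGG hm hf h1 h2 => ?_⟩
  have hc := hk.cont; have hgc := hg.cont
  obtain ⟨M, hM⟩ := hk.bdd
  have Tm : StronglyMeasurable (fun s => ∫ z, k (g s - z) ∂ω) :=
    StronglyMeasurable.integral_prod_right' (f := fun p : EV (m+1) × EV (m+2) => k (g p.1 - p.2))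
      (Continuous.stronglyMeasurable (by fun_prop))
  have Tb : ∀ s, |∫ z, k (g s - z) ∂ω| ≤ M * ω.real univ := fun s => by
    rw [← Real.norm_eq_abs]; exact norm_integral_le_of_norm_le_const (Eventually.of_forall fun z => hM _)
  have key : ∀ (S : Set (EV (m+1))) (h : EV (m+1) → ℝ) (B : ℝ), S ⊆ G' → MeasurableSet S → StronglyMeasurable h →
      (∀ s, |h s| ≤ B) → |∫ s in S, h s * ∫ z, k (g s - z) ∂ω| ≤ A * ((∫ s in S, h s ^ 2) + ω.real univ) := by
    intro S h B hS hSm hh hB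
    have fS : IsFiniteMeasure (volume.restrict S) := ⟨by simpa using (measure_mono hS).trans_lt hf⟩
    have i1 : Integrable h (volume.restrict S) := Integrable.of_bound hh.aestronglyMeasurable B (Eventually.of_forall hB)
    have i2 : Integrable (fun s => h s ^ 2) (volume.restrict S) :=
      Integrable.of_bound (hh.pow 2).aestronglyMeasurable (B ^ 2) (Eventually.of_forall fun s => by
        rw [norm_pow]; exact pow_le_pow_left₀ (norm_nonneg _) (hB s) 2)
    have e : ∀ x, (S.indicator h x) ^ 2 = S.indicator (fun x => h x ^ 2) x := fun x => by
      by_cases h : x ∈ S <;> simp [h]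
    have := hP R0 η k g G G' ω (S.indicator h) hk hη hkη hg hG hGG h1 h2
      ⟨(integrable_indicator_iff hSm).2 i1, by simp only [e]; exact (integrable_indicator_iff hSm).2 i2⟩
      (fun s hs => indicator_of_notMem (fun h' => hs (hS h')) _)
    have e' : ∀ x, S.indicator h x * (∫ z, k (g x - z) ∂ω) = S.indicator (fun x => h x * ∫ z, k (g x - z) ∂ω) x := fun x => by
      by_cases h : x ∈ S <;> simp [h]
    simp only [e, e'] at this
    rwa [integral_indicator hSm, integral_indicator hSm] at this
  constructor
  · intro S hS hSm t ht
    have := key S (fun _ => t) |t| hS hSm stronglyMeasurable_const fun _ => le_rfl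
    rw [integral_const_mul, setIntegral_const, smul_eq_mul, abs_mul, abs_of_pos ht] at this
    generalize |∫ s in S, ∫ z, k (g s - z) ∂ω| = I at *
    generalize volume.real S = V at *
    generalize ω.real univ = W at *
    have h3 : A * (t * V + W / t) = (A * (V * t ^ 2 + W)) / t := by field_simp
    rw [h3, le_div_iff₀ ht]; linarith
  · have := key G' (fun s => (2 * A)⁻¹ * ∫ z, k (g s - z) ∂ω) (|(2 * A)⁻¹| * (M * ω.real univ)) le_rfl hm
      (Tm.const_mul _) (fun s => by rw [abs_mul]; gcongr; exact Tb s)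
    simp only [mul_pow, mul_assoc, ← sq] at this
    rw [integral_const_mul, integral_const_mul, abs_of_nonneg] at this
    · generalize ∫ s in G', (∫ z, k (g s - z) ∂ω) ^ 2 = I at *
      generalize ω.real univ = W at *
      have h3 := mul_le_mul_of_nonneg_left this (show 0 ≤ 4 * A by positivity)
      field_simp at h3
      linarith
    · exact mul_nonneg (by positivity) (integral_nonneg fun _ => sq_nonneg _)

end
end

section
section
variable {m : ℕ} {C c Λ : ℝ} {K : EV (m+2) → ℝ} {g : EV (m+1) → EV (m+2)}

theorem vr_ball (s : EV (m+1)) {r : ℝ} (hr : 0 ≤ r) : volume.real (ball s r) = vb m * r ^ (m+1) := by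
  rw [Measure.real, vol_ball s hr, ENNReal.toReal_ofReal (mul_nonneg (vb_pos m).le (by positivity))]

theorem refl_zero (s : EV m) {S : Set (EV m × EV m)} (hS : MeasurableSet S) {q : EV m × EV m → ℝ}
    (h : ∀ p, (s, s) - p ∈ S ↔ p ∈ S) (hq : ∀ p, q ((s, s) - p) = - q p) : ∫ p in S, q p ∂(volume.prod volume) = 0 := by
  have : ((volume : Measure (EV m)).prod (volume : Measure (EV m))).IsNegInvariant :=
    Measure.IsAddHaarMeasure.isNegInvariant_of_regular _
  have e := integral_sub_left_eq_self (S.indicator q) (volume.prod volume) (s, s)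
  rw [← integral_indicator hS]
  have e2 : ∀ p, S.indicator q ((s, s) - p) = - S.indicator q p := fun p => by
    by_cases hp : p ∈ S
    · rw [indicator_of_mem hp, indicator_of_mem ((h p).2 hp), hq]
    · rw [indicator_of_notMem hp, indicator_of_notMem (fun h' => hp ((h p).1 h')), neg_zero]
  simp only [e2, integral_neg] at e
  linarith

theorem Kt_eq {η η' R : ℝ} (hη : 0 < η) (h : η ≤ η') {v : EV m} (hv : η' ≤ ‖v‖) {K : EV m → ℝ} : Kt K η R v = Kt K η' R v := by
  have h' := hη.trans_le h
  have : ∀ η : ℝ, 0 < η → η ≤ ‖v‖ → uc m (η⁻¹ • v) = 0 := fun η hη h => uc_zero <| by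
    rw [norm_smul, norm_inv, Real.norm_eq_abs, abs_of_pos hη, ← div_eq_inv_mul]; exact (one_le_div hη).2 h
  unfold Kt; rw [this η hη (h.trans hv), this η' h' hv]

theorem deriv_bd {L : EV (m+1) →L[ℝ] EV (m+2)} {s : EV (m+1)} (hL : HasFDerivAt g L s) {κ : ℝ} (hκ : 0 < κ) :
    ∃ r > 0, ∀ ρ ∈ Ioc 0 r, ∀ t ∈ ball s ρ, ‖g t - g s - L (t - s)‖ ≤ κ * ρ := by
  obtain ⟨r, hr, h⟩ := Metric.eventually_nhds_iff_ball.1 ((hasFDerivAt_iff_isLittleO.1 hL).def hκ)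
  refine ⟨r, hr, fun ρ hρ t ht => (h t (ball_subset_ball hρ.2 ht)).trans ?_⟩
  rw [mem_ball, dist_eq_norm] at ht
  gcongr

def Den (s : EV (m+1)) (G' : Set (EV (m+1))) : Prop :=
  ∀ κ > 0, ∃ r0 > 0, ∀ r ∈ Ioc 0 r0, volume (ball s r \ G') ≤ ENNReal.ofReal (κ * r ^ (m+1))

set_option maxHeartbeats 1600000 in
theorem mu_term (hK : CZ m C K) (hg : BLip c Λ g) {L : EV (m+1) →L[ℝ] EV (m+2)} {s : EV (m+1)} (hL : HasFDerivAt g L s)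
    {G' : Set (EV (m+1))} (hG : MeasurableSet G') (hd : Den s G') {δ : ℝ} (hδ : 0 < δ) (hδ1 : δ ≤ 1) {κ : ℝ} (hκ : 0 < κ) :
    ∃ ε0 > 0, ∀ ε ∈ Ioc 0 ε0, ∃ η0 > 0, ∀ η ∈ Ioc 0 η0,
      |∫ u in G' ∩ ball s (δ * ε), ∫ t, Kt K η ε (g u - g t)| ≤ κ * ε ^ (m+1) := by
  have hc := hg.cpos; have hC := hK.rb.nn; have hv := vb_pos m
  obtain ⟨A0, hA0, hN⟩ := near_term m (C * 2 ^ (m+1)) c Λ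
  obtain ⟨M, hM⟩ : ∃ M, M = 1 / c + 2 := ⟨_, rfl⟩
  have hM2 : 2 ≤ M := by rw [hM]; have := one_div_pos.2 hc; linarith
  have hcM : c * M = 1 + 2 * c := by rw [hM]; field_simp
  obtain ⟨t, ht, ht'⟩ : ∃ t > 0, A0 * (t * vb m) ≤ κ / 6 := ⟨κ / 6 / (A0 * vb m + 1), by positivity, by
    rw [show A0 * (κ / 6 / (A0 * vb m + 1) * vb m) = κ / 6 * (A0 * vb m / (A0 * vb m + 1)) by ring]
    exact mul_le_of_le_one_right (by positivity) ((div_le_one (by positivity)).2 (by linarith))⟩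
  obtain ⟨κ0, hκ0, hκ0'⟩ : ∃ κ0 > 0, A0 * (κ0 / t) ≤ κ / 6 := ⟨κ / 6 * t / (A0 + 1), by positivity, by
    rw [show A0 * (κ / 6 * t / (A0 + 1) / t) = κ / 6 * (A0 / (A0 + 1)) by field_simp]
    exact mul_le_of_le_one_right (by positivity) ((div_le_one (by positivity)).2 (by linarith))⟩
  obtain ⟨τ, hτ, hτ1, hτ'⟩ : ∃ τ > 0, τ ≤ 1 ∧ vb m * ((1 + τ) ^ (m+1) - 1) ≤ κ0 := by
    have : Tendsto (fun τ : ℝ => vb m * ((1 + τ) ^ (m+1) - 1)) (𝓝[>] 0) (𝓝 (vb m * ((1 + 0) ^ (m+1) - 1))) :=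
      ((by fun_prop : Continuous fun τ : ℝ => vb m * ((1 + τ) ^ (m+1) - 1)).tendsto 0).mono_left nhdsWithin_le_nhds
    simp only [add_zero, one_pow, sub_self, mul_zero] at this
    obtain ⟨τ, h1, h2⟩ := ((this.eventually_le_const hκ0).and (Ioc_mem_nhdsGT (one_pos (α := ℝ)))).exists
    exact ⟨τ, h2.1, h2.2, h1⟩
  obtain ⟨ξ, hξ⟩ : ∃ ξ, ξ = c * τ * δ := ⟨_, rfl⟩
  have hξ0 : 0 < ξ := by rw [hξ]; positivity
  obtain ⟨V, hV⟩ : ∃ V, V = vb m * M ^ (m+1) := ⟨_, rfl⟩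
  have hV0 : 0 < V := by rw [hV]; positivity
  obtain ⟨κ2, hκ2, hκ2a, hκ2b⟩ : ∃ κ2 > 0, κ2 * (2 * M) ≤ ξ / 8 ∧
      C * 10 ^ (m+2) * (κ2 * (2 * M)) / ξ ^ (m+2) * (vb m * V) ≤ κ / 6 := by
    refine ⟨min (ξ / 8) (κ / 6 * ξ ^ (m+2) / (C * 10 ^ (m+2) * (vb m * V) + 1)) / (2 * M), by positivity, ?_, ?_⟩
    · rw [div_mul_cancel₀ _ (by positivity)]; exact min_le_left _ _
    · rw [div_mul_cancel₀ _ (by positivity)]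
      have h := min_le_right (ξ / 8) (κ / 6 * ξ ^ (m+2) / (C * 10 ^ (m+2) * (vb m * V) + 1))
      generalize min (ξ / 8) (κ / 6 * ξ ^ (m+2) / (C * 10 ^ (m+2) * (vb m * V) + 1)) = x at *
      have h2 : C * 10 ^ (m+2) * x / ξ ^ (m+2) * (vb m * V) = C * 10 ^ (m+2) * (vb m * V) * x / ξ ^ (m+2) := by ring
      rw [h2, div_le_iff₀ (by positivity)]
      refine (mul_le_mul_of_nonneg_left h (by positivity)).trans ?_
      rw [mul_div_assoc', div_le_iff₀ (by positivity)]
      nlinarith [show 0 ≤ κ / 6 * ξ ^ (m+2) by positivity]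
  obtain ⟨B, hB⟩ : ∃ B, B = C * 2 ^ (m+1) / ξ ^ (m+1) := ⟨_, rfl⟩
  have hB0 : 0 ≤ B := by rw [hB]; positivity
  obtain ⟨κ1, hκ1, hκ1a, hκ1b⟩ : ∃ κ1 > 0, κ1 ≤ κ0 ∧ B * (κ1 * V) ≤ κ / 6 :=
    ⟨min κ0 (κ / 6 / (B * V + 1)), by positivity, min_le_left _ _, by
      refine (mul_le_mul_of_nonneg_left (mul_le_mul_of_nonneg_right (min_le_right _ _) hV0.le) hB0).trans ?_
      rw [show B * (κ / 6 / (B * V + 1) * V) = κ / 6 * (B * V / (B * V + 1)) by ring]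
      exact mul_le_of_le_one_right (by positivity) ((div_le_one (by positivity)).2 (by linarith))⟩
  obtain ⟨r1, hr1, h1⟩ := hd κ1 hκ1
  obtain ⟨r2, hr2, h2⟩ := deriv_bd hL hκ2
  refine ⟨min r1 (r2 / M), by positivity, fun ε hε => ?_⟩
  have e0 : 0 < ε := hε.1
  have e1 : ε ≤ r1 := hε.2.trans (min_le_left _ _)
  have e2 : M * ε ≤ r2 := by have := hε.2.trans (min_le_right _ _); rw [le_div_iff₀ (by positivity)] at this; linarith
  refine ⟨ξ * ε, by positivity, fun η hη => ?_⟩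
  have hη0 : 0 < η := hη.1
  obtain ⟨D, hD⟩ : ∃ D, D = ball s (δ * ε) := ⟨_, rfl⟩
  obtain ⟨A, hA⟩ : ∃ A, A = G' ∩ ball s (δ * ε) := ⟨_, rfl⟩
  obtain ⟨A1, hA1⟩ : ∃ A1, A1 = ball s ((1 + τ) * δ * ε) := ⟨_, rfl⟩
  obtain ⟨Q, hQ⟩ : ∃ Q, Q = ball s (M * ε) := ⟨_, rfl⟩
  have δε : δ * ε ≤ ε := mul_le_of_le_one_left e0.le hδ1
  have sAD : A ⊆ D := by rw [hA, hD]; exact inter_subset_right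
  have sDA : D ⊆ A1 := by rw [hA1, hD]; refine ball_subset_ball ?_; linarith [mul_pos hτ (mul_pos hδ e0)]
  have sAQ : A1 ⊆ Q := by
    rw [hA1, hQ]; refine ball_subset_ball ?_
    calc (1 + τ) * δ * ε = (1 + τ) * (δ * ε) := by ring
      _ ≤ 2 * ε := by gcongr; linarith
      _ ≤ M * ε := by gcongr
  have mA : MeasurableSet A := by rw [hA]; exact hG.inter measurableSet_ball
  have mA1 : MeasurableSet A1 := by rw [hA1]; exact measurableSet_ball
  have mD : MeasurableSet D := by rw [hD]; exact measurableSet_ball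
  have mQ : MeasurableSet Q := by rw [hQ]; exact measurableSet_ball
  have fQ : volume Q < ∞ := by rw [hQ]; exact measure_ball_lt_top
  have vD : volume.real D ≤ vb m * ε ^ (m+1) := by rw [hD, vr_ball _ (by positivity)]; gcongr
  have vA : volume.real A ≤ vb m * ε ^ (m+1) :=
    (measureReal_mono sAD ((measure_mono (sDA.trans sAQ)).trans_lt fQ).ne).trans vD
  have vQ : volume.real Q = V * ε ^ (m+1) := by rw [hQ, vr_ball _ (by positivity), hV, mul_pow]; ring
  have vY : volume.real (Q \ A1) ≤ V * ε ^ (m+1) := (measureReal_mono sdiff_subset fQ.ne).trans vQ.le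
  have vDA : volume.real (D \ A) ≤ κ1 * ε ^ (m+1) := by
    have : volume (D \ A) ≤ ENNReal.ofReal (κ1 * (δ * ε) ^ (m+1)) := by
      rw [hD, hA, sdiff_inter_self_eq_sdiff]; exact h1 _ ⟨by positivity, by linarith⟩
    refine (ENNReal.toReal_le_of_le_ofReal (by positivity) this).trans ?_
    gcongr
  have vN : volume.real (A1 \ A) ≤ (κ0 + κ0) * ε ^ (m+1) := by
    have h3 : A1 \ A ⊆ (A1 \ D) ∪ (D \ A) := fun x hx => by by_cases h : x ∈ D <;> simp [h, hx.1, hx.2]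
    have fin : ∀ S ⊆ Q, volume S ≠ ∞ := fun S hS => ((measure_mono hS).trans_lt fQ).ne
    refine (measureReal_mono h3 (fin _ (union_subset (sdiff_subset.trans sAQ) (sdiff_subset.trans (sDA.trans sAQ))))).trans ?_
    refine (measureReal_union_le _ _).trans ?_
    rw [add_mul]
    refine add_le_add ?_ (vDA.trans (by gcongr))
    rw [measureReal_sdiff sDA mD (fin _ sAQ), hA1, hD, vr_ball _ (by positivity), vr_ball _ (by positivity)]
    calc _ = vb m * ((1 + τ) ^ (m+1) - 1) * (δ * ε) ^ (m+1) := by rw [mul_assoc (1 + τ), mul_pow (1 + τ)]; ring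
      _ ≤ κ0 * ε ^ (m+1) := by gcongr
  have nD : ∀ u ∈ D, ‖u - s‖ < δ * ε := fun u hu => by rwa [hD, mem_ball, dist_eq_norm] at hu
  obtain ⟨f, hf⟩ : ∃ f : EV (m+1) × EV (m+1) → ℝ, f = fun p => Kt K η ε (g p.1 - g p.2) := ⟨_, rfl⟩
  obtain ⟨q, hq⟩ : ∃ q : EV (m+1) × EV (m+1) → ℝ, q = fun p => Kt K (ξ * ε) ε (L (p.1 - p.2)) := ⟨_, rfl⟩
  have hgc := hg.cont
  have hξε : 0 < ξ * ε := by positivity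
  have k1 := (hK.ker hη0 e0); have k2 := hK.ker hξε e0
  have c1 := k1.cont; have c2 := k2.cont
  have qb : ∀ p, ‖q p‖ ≤ B / ε ^ (m+1) := fun p => by
    rw [hq, hB, Real.norm_eq_abs]; refine (hK.bd hξε e0 _).trans (le_of_eq ?_)
    rw [mul_pow]; field_simp
  have fin : ∀ S ⊆ Q, ∀ T ⊆ Q, (volume.prod volume : Measure (EV (m+1) × EV (m+1))) (S ×ˢ T) < ∞ := fun S hS T hT => by
    rw [Measure.prod_prod]
    exact ENNReal.mul_lt_top ((measure_mono hS).trans_lt fQ) ((measure_mono hT).trans_lt fQ)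
  have If : ∀ S ⊆ Q, ∀ T ⊆ Q, IntegrableOn f (S ×ˢ T) (volume.prod volume) := fun S hS T hT =>
    Measure.integrableOn_of_bounded (fin S hS T hT).ne (by rw [hf]; exact (by fun_prop : Continuous _).aestronglyMeasurable)
      (Eventually.of_forall fun p => by rw [hf]; exact hK.bd hη0 e0 _)
  have Iq : ∀ S ⊆ Q, ∀ T ⊆ Q, IntegrableOn q (S ×ˢ T) (volume.prod volume) := fun S hS T hT =>
    Measure.integrableOn_of_bounded (fin S hS T hT).ne (by rw [hq]; exact (by fun_prop : Continuous _).aestronglyMeasurable)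
      (Eventually.of_forall qb)
  have sA : A ⊆ Q := sAD.trans (sDA.trans sAQ)
  have s1 : ∫ u in A, ∫ t, Kt K η ε (g u - g t) = ∫ p in A ×ˢ Q, f p ∂(volume.prod volume) := by
    rw [setIntegral_prod f (If A sA Q le_rfl)]
    refine setIntegral_congr_fun mA fun u hu => ?_
    rw [hf]
    refine (setIntegral_eq_integral_of_forall_compl_eq_zero fun t ht => Kt_far e0 ?_).symm
    have h3 := nD u (sAD hu)
    rw [hQ, mem_ball, not_lt, dist_eq_norm, ← sub_add_sub_cancel t u s] at ht
    have h4 := ht.trans (norm_add_le _ _)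
    have h5 := hg.lo u t
    rw [norm_sub_rev u t] at h5
    have h6 : c * ((M - 1) * ε) ≤ c * ‖t - u‖ := by gcongr; linarith
    have h7 : c * M * ε = (1 + 2 * c) * ε := by rw [hcM]
    linarith [mul_pos hc e0]
  have i1 : ∫ p in A ×ˢ A, f p ∂(volume.prod volume) = 0 := by
    have e := setIntegral_prod_swap (μ := volume) (ν := volume) A A f
    have e2 : ∀ p, f (Prod.swap p) = - f p := fun p => by
      rw [hf]; simp only [Prod.fst_swap, Prod.snd_swap]; rw [← neg_sub, k1.odd]
    simp only [e2, integral_neg] at e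
    linarith
  have i2 : |∫ p in A ×ˢ (A1 \ A), f p ∂(volume.prod volume)| ≤ κ / 2 * ε ^ (m+1) := by
    have h3 := hN ε _ g A (A1 \ A) k1 hg mA (mA1.diff mA) ((measure_mono sA).trans_lt fQ)
      ((measure_mono (sdiff_subset.trans sAQ)).trans_lt fQ) t ht
    rw [hf]
    calc _ ≤ A0 * (t * (vb m * ε ^ (m+1)) + (κ0 + κ0) * ε ^ (m+1) / t) := h3.trans (by gcongr)
      _ = (A0 * (t * vb m) + A0 * (κ0 / t) + A0 * (κ0 / t)) * ε ^ (m+1) := by ring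
      _ ≤ _ := by gcongr; linarith
  have sY : Q \ A1 ⊆ Q := sdiff_subset
  have i3 : |(∫ p in A ×ˢ (Q \ A1), f p ∂(volume.prod volume)) - ∫ p in A ×ˢ (Q \ A1), q p ∂(volume.prod volume)| ≤
      κ / 6 * ε ^ (m+1) := by
    rw [← integral_sub (If A sA _ sY) (Iq A sA _ sY), ← Real.norm_eq_abs]
    refine (norm_setIntegral_le_of_norm_le_const (fin A sA _ sY)
      (C := C * 10 ^ (m+2) * (κ2 * (2 * M)) / ξ ^ (m+2) / ε ^ (m+1)) ?_).trans ?_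
    · rintro ⟨u, t⟩ ⟨hu, ht, ht1⟩
      rw [hf, hq, Real.norm_eq_abs]
      simp only at *
      have h3 := nD u (sAD hu)
      rw [hA1, mem_ball, not_lt, dist_eq_norm, ← sub_add_sub_cancel t u s] at ht1
      have h4 := ht1.trans (norm_add_le _ _)
      have h5 := hg.lo u t
      rw [norm_sub_rev u t] at h5
      have h6 : ξ * ε ≤ ‖g u - g t‖ := by
        rw [hξ]
        have : c * (τ * δ * ε) ≤ c * ‖t - u‖ := by gcongr; linarith
        linarith
      rw [Kt_eq hη0 hη.2 h6]
      have h7 : ‖(g u - g t) - L (u - t)‖ ≤ κ2 * (2 * M) * ε := by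
        have a1 := h2 (M * ε) ⟨by positivity, e2⟩ u (by rw [← hQ]; exact sA hu)
        have a2 := h2 (M * ε) ⟨by positivity, e2⟩ t (by rw [← hQ]; exact ht)
        rw [show (g u - g t) - L (u - t) = (g u - g s - L (u - s)) - (g t - g s - L (t - s)) by
          rw [← sub_sub_sub_cancel_right u t s, map_sub]; abel]
        refine (norm_sub_le _ _).trans ?_
        linarith
      refine (hK.pk hξε e0 (h7.trans ?_)).trans ?_
      · linarith [mul_le_mul_of_nonneg_right hκ2a e0.le]
      · rw [div_div, show ξ ^ (m+2) * ε ^ (m+1) = (ξ * ε) ^ (m+2) / ε by rw [mul_pow]; field_simp; ring, div_div_eq_mul_div, mul_assoc _ _ ε]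
        gcongr
        linarith [norm_nonneg (g u - g t)]
    · rw [measureReal_prod_prod]
      calc _ ≤ C * 10 ^ (m+2) * (κ2 * (2 * M)) / ξ ^ (m+2) / ε ^ (m+1) * ((vb m * ε ^ (m+1)) * (V * ε ^ (m+1))) := by gcongr
        _ = C * 10 ^ (m+2) * (κ2 * (2 * M)) / ξ ^ (m+2) * (vb m * V) * ε ^ (m+1) := by field_simp
        _ ≤ _ := by gcongr
  have i4 : |∫ p in A ×ˢ (Q \ A1), q p ∂(volume.prod volume)| ≤ κ / 6 * ε ^ (m+1) := by
    have z : ∫ p in D ×ˢ (Q \ A1), q p ∂(volume.prod volume) = 0 := by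
      refine refl_zero (s + s) (mD.prod (mQ.diff mA1)) (fun p => ?_) (fun p => ?_)
      · have : ∀ (r : ℝ) (x : EV (m+1)), s + s - x ∈ ball s r ↔ x ∈ ball s r := fun r x => by
          rw [mem_ball, mem_ball, dist_eq_norm, dist_eq_norm, ← norm_neg]
          rw [show -(s + s - x - s) = x - s by abel]
        rw [hD, hQ, hA1]
        simp only [mem_prod, Prod.fst_sub, Prod.snd_sub, Set.mem_sdiff, this]
      · rw [hq]
        simp only [Prod.fst_sub, Prod.snd_sub]
        rw [sub_sub_sub_cancel_left, ← neg_sub, map_neg, k2.odd]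
    have h3 : D ×ˢ (Q \ A1) = A ×ˢ (Q \ A1) ∪ (D \ A) ×ˢ (Q \ A1) := by
      rw [← union_prod, union_sdiff_cancel sAD]
    have sDA' : D \ A ⊆ Q := sdiff_subset.trans (sDA.trans sAQ)
    rw [h3, setIntegral_union (Set.disjoint_prod.2 (Or.inl disjoint_sdiff_right)) ((mD.diff mA).prod (mQ.diff mA1))
      (Iq _ sA _ sY) (Iq _ sDA' _ sY)] at z
    rw [eq_neg_of_add_eq_zero_left z, abs_neg, ← Real.norm_eq_abs]
    refine (norm_setIntegral_le_of_norm_le_const (fin _ sDA' _ sY) fun p _ => qb p).trans ?_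
    rw [measureReal_prod_prod]
    calc _ ≤ B / ε ^ (m+1) * ((κ1 * ε ^ (m+1)) * (V * ε ^ (m+1))) := by gcongr
      _ = B * (κ1 * V) * ε ^ (m+1) := by field_simp
      _ ≤ _ := by gcongr
  have s2 : ∫ p in A ×ˢ Q, f p ∂(volume.prod volume) = (∫ p in A ×ˢ A, f p ∂(volume.prod volume)) +
      (∫ p in A ×ˢ (A1 \ A), f p ∂(volume.prod volume)) + ∫ p in A ×ˢ (Q \ A1), f p ∂(volume.prod volume) := by
    have sN : A1 \ A ⊆ Q := sdiff_subset.trans sAQ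
    rw [← setIntegral_union (Set.disjoint_prod.2 (Or.inr disjoint_sdiff_right)) (mA.prod (mA1.diff mA)) (If _ sA _ sA)
      (If _ sA _ sN), ← prod_union, union_sdiff_cancel (sAD.trans sDA),
      ← setIntegral_union (Set.disjoint_prod.2 (Or.inr disjoint_sdiff_right)) (mA.prod (mQ.diff mA1)) (If _ sA _ sAQ)
      (If _ sA _ sY), ← prod_union, union_sdiff_cancel sAQ]
  rw [← hA, s1, s2, i1, zero_add]
  have t1 := abs_add_le (∫ p in A ×ˢ (A1 \ A), f p ∂(volume.prod volume)) (∫ p in A ×ˢ (Q \ A1), f p ∂(volume.prod volume))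
  have t2 := abs_sub_abs_le_abs_sub (∫ p in A ×ˢ (Q \ A1), f p ∂(volume.prod volume))
    (∫ p in A ×ˢ (Q \ A1), q p ∂(volume.prod volume))
  have t3 : 0 < κ * ε ^ (m+1) := by positivity
  linarith

end
end

section
section
variable {m : ℕ} {C c Λ : ℝ} {K : EV (m+2) → ℝ} {g : EV (m+1) → EV (m+2)}

theorem leb {f : EV (m+1) → ℝ} (hf : LocallyIntegrable f) : ∀ᵐ s, ∀ κ > 0, ∃ r0 > 0, ∀ r ∈ Ioc 0 r0,
    ∫ y in ball s r, |f y - f s| ≤ κ * r ^ (m+1) := by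
  have hv := vb_pos m
  filter_upwards [IsUnifLocDoublingMeasure.ae_tendsto_average_norm_sub.{0,0,0} volume hf 1] with s hs κ hκ
  have h := (hs (fun _ => s) (id : ℝ → ℝ) (tendsto_id (x := 𝓝[>] 0)) (by
    filter_upwards [self_mem_nhdsWithin] with r hr
    rw [one_mul]; exact mem_closedBall_self (le_of_lt hr))).eventually_le_const (show 0 < κ / vb m by positivity)
  obtain ⟨r0, hr0, h⟩ := mem_nhdsGT_iff_exists_Ioc_subset.1 h
  refine ⟨r0, hr0, fun r hr => ?_⟩
  have h2 : ⨍ y in closedBall s r, ‖f y - f s‖ ≤ κ / vb m := h hr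
  have h3 : volume.real (closedBall s r) = vb m * r ^ (m+1) := by
    rw [Measure.real, Measure.addHaar_closedBall_eq_addHaar_ball]; exact vr_ball s hr.1.le
  have h4 : 0 < r ^ (m+1) := pow_pos hr.1 _
  rw [setAverage_eq, h3, smul_eq_mul, inv_mul_le_iff₀ (by positivity)] at h2
  have i : IntegrableOn (fun y => |f y - f s|) (closedBall s r) :=
    (((hf.integrableOn_isCompact (isCompact_closedBall s r)).sub
      (integrableOn_const measure_closedBall_lt_top.ne)).abs)
  refine (setIntegral_mono_set i (Eventually.of_forall fun y => abs_nonneg _) ball_subset_closedBall.eventuallyLE).trans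
    (h2.trans (le_of_eq ?_))
  field_simp

theorem den_ae {G' : Set (EV (m+1))} (hG : MeasurableSet G') : ∀ᵐ s, s ∈ G' → Den s G' := by
  have h1 : LocallyIntegrable (G'.indicator fun _ => (1:ℝ)) (volume : Measure (EV (m+1))) :=
    ((continuous_const).locallyIntegrable).indicator hG
  filter_upwards [leb h1] with s hs hsG κ hκ
  obtain ⟨r0, h0, h⟩ := hs κ hκ
  refine ⟨r0, h0, fun r hr => ?_⟩
  have e : ∀ y, |G'.indicator (fun _ => (1:ℝ)) y - G'.indicator (fun _ => 1) s| = (G'ᶜ).indicator (fun _ => 1) y := fun y => by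
    by_cases hy : y ∈ G' <;> simp [hy, hsG]
  have h2 := h r hr
  simp only [e] at h2
  rw [integral_indicator hG.compl, Measure.restrict_restrict hG.compl, setIntegral_const, smul_eq_mul, mul_one, inter_comm] at h2
  rw [sdiff_eq]
  exact (ENNReal.le_ofReal_iff_toReal_le ((measure_mono inter_subset_left).trans_lt measure_ball_lt_top).ne
    (mul_nonneg hκ.le (pow_nonneg hr.1.le _))).2 h2

theorem Kt_split {ε η : ℝ} (hη : 0 < η) (h : η ≤ ε / 2) (hε : ε ≤ 1 / 2) (v : EV m) {K : EV m → ℝ} :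
    Kt K η 1 v = Kt K ε 1 v + Kt K η ε v := by
  have h0 : 0 < ε := by linarith
  have n : ∀ a : ℝ, 0 < a → ‖a⁻¹ • v‖ = ‖v‖ / a := fun a ha => by
    rw [norm_smul, norm_inv, Real.norm_eq_abs, abs_of_pos ha, ← div_eq_inv_mul]
  unfold Kt
  rw [inv_one, one_smul]
  rcases le_total ε ‖v‖ with h1 | h1
  · rw [uc_zero (v := ε⁻¹ • v) (by rw [n _ h0]; exact (one_le_div h0).2 h1),
      uc_zero (v := η⁻¹ • v) (by rw [n _ hη]; exact (one_le_div hη).2 (by linarith))]; ring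
  · rw [uc_one (v := v) (h1.trans hε)]
    rcases le_total η ‖v‖ with h2 | h2
    · rw [uc_zero (v := η⁻¹ • v) (by rw [n _ hη]; exact (one_le_div hη).2 h2)]; ring
    · rw [uc_one (v := ε⁻¹ • v) (by rw [n _ h0, div_le_iff₀ h0]; linarith)]; ring

structure Good (g : EV (m+1) → EV (m+2)) (ν : Measure (EV (m+2))) (l l' : ℝ) (G G' : Set (EV (m+1))) : Prop where
  l0 : 0 ≤ l
  l1 : 0 ≤ l'
  sub : G' ⊆ G
  meas : MeasurableSet G'
  fin : volume G' < ∞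
  gr : ∀ s ∈ G, ∀ r > 0, ν (ball (g s) r) ≤ ENNReal.ofReal (l * r ^ (m+1))
  pk : ∀ s ∈ G', ∫⁻ z, ENNReal.ofReal (pk (m+1) (infDist z (g '' G)) ‖g s - z‖) ∂ν ≤ ENNReal.ofReal l'

theorem Good.sing {ν : Measure (EV (m+2))} {l l' G G'} (h : Good g ν l l' G G') (hg : BLip c Λ g) (hK : CZ m C K)
    (hG : G.Nonempty) : ∃ A > 0, ∀ ω ≤ ν, ∀ B, ω B < ∞ → ∀ ε > 0, ∀ η > 0,
      (∀ S ⊆ G', MeasurableSet S → ∀ t > 0, |∫ s in S, ∫ z in B, Kt K η ε (g s - z) ∂ω| ≤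
        A * (t * volume.real S + ω.real B / t)) ∧
      ∫ s in G', (∫ z in B, Kt K η ε (g s - z) ∂ω) ^ 2 ≤ 4 * A ^ 2 * ω.real B := by
  obtain ⟨A, hA, H⟩ := sing_term m (C * 2 ^ (m+1)) c Λ l l' h.l0 h.l1
  refine ⟨A, hA, fun ω hω B hB ε hε η hη => ?_⟩
  have : IsFiniteMeasure (ω.restrict B) := ⟨by simpa using hB⟩
  have hle : ω.restrict B ≤ ν := Measure.restrict_le_self.trans hω
  have := H ε η _ g G G' (ω.restrict B) (hK.ker hη hε) hη (hK.bd hη hε) hg hG h.sub h.meas h.fin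
    (fun s hs r hr => (hle _).trans (h.gr s hs r hr)) (fun s hs => (lintegral_mono' hle le_rfl).trans (h.pk s hs))
  rwa [measureReal_restrict_apply_univ] at this

theorem good_mu (hg : BLip c Λ g) (θ : ℝ≥0) {G' : Set (EV (m+1))} (hG : MeasurableSet G') (hf : volume G' < ∞) :
    Good g (θ • pm g) (θ * gl m c) 0 univ G' := by
  have h0 := gl_nn hg
  refine ⟨by positivity, le_rfl, subset_univ _, hG, hf, fun s _ r hr => ?_, fun s _ => ?_⟩
  · rw [Measure.smul_apply, ENNReal.smul_def, smul_eq_mul, mul_assoc, ENNReal.ofReal_mul (NNReal.coe_nonneg θ), ENNReal.ofReal_coe_nnreal]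
    have : ball (g s) r = {y | ‖y - g s‖ < r} := by ext; simp [dist_eq_norm]
    rw [this]
    gcongr; exact pm_growth hg _ hr
  · have hgc := hg.cont
    rw [ENNReal.ofReal_zero, nonpos_iff_eq_zero]
    rw [lintegral_smul_measure, pm, lintegral_map (by unfold pk; fun_prop) hgc.measurable]
    have : ∀ t, pk (m+1) (infDist (g t) (g '' univ)) ‖g s - g t‖ = 0 := fun t => by
      rw [infDist_zero_of_mem (mem_image_of_mem _ (mem_univ _))]; simp [pk]
    simp only [this]; simp

end
end

section
section
variable {m : ℕ} {C c Λ : ℝ} {K : EV (m+2) → ℝ} {g : EV (m+1) → EV (m+2)}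

theorem int_pk {α : Type*} [MeasurableSpace α] {τ : Measure α} {F p : α → ℝ} {B l : ℝ} (hB : 0 ≤ B) (hl : 0 ≤ l)
    (hF : ∀ z, |F z| ≤ B * p z) (h : ∫⁻ z, ENNReal.ofReal (p z) ∂τ ≤ ENNReal.ofReal l) : |∫ z, F z ∂τ| ≤ B * l := by
  have h1 : ‖∫ z, F z ∂τ‖ₑ ≤ ENNReal.ofReal (B * l) := by
    refine (enorm_integral_le_lintegral_enorm _).trans ?_
    calc ∫⁻ z, ‖F z‖ₑ ∂τ ≤ ∫⁻ z, ENNReal.ofReal B * ENNReal.ofReal (p z) ∂τ := lintegral_mono fun z => by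
          rw [← ENNReal.ofReal_mul hB, Real.enorm_eq_ofReal_abs]; exact ENNReal.ofReal_le_ofReal (hF z)
      _ = ENNReal.ofReal B * ∫⁻ z, ENNReal.ofReal (p z) ∂τ := lintegral_const_mul' _ _ ENNReal.ofReal_ne_top
      _ ≤ _ := by rw [ENNReal.ofReal_mul hB]; gcongr
  rw [Real.enorm_eq_ofReal_abs] at h1
  exact (ENNReal.ofReal_le_ofReal_iff (by positivity)).1 h1

theorem CZ.int_z (hK : CZ m C K) (τ : Measure (EV (m+2))) [IsFiniteMeasure τ] {ε η : ℝ} (hη : 0 < η) (hε : 0 < ε)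
    (x : EV (m+2)) : Integrable (fun z => Kt K η ε (x - z)) τ :=
  have hc := Kt_cont (R := ε) hK.co hη
  Integrable.of_bound (by fun_prop : Continuous _).aestronglyMeasurable _ (Eventually.of_forall fun z => hK.bd hη hε _)

theorem CZ.int_u (hK : CZ m C K) (hg : BLip c Λ g) (τ : Measure (EV (m+2))) [IsFiniteMeasure τ] {ε η : ℝ} (hη : 0 < η) (hε : 0 < ε) :
    StronglyMeasurable (fun u => ∫ z, Kt K η ε (g u - z) ∂τ) ∧
    ∀ u, ‖∫ z, Kt K η ε (g u - z) ∂τ‖ ≤ C * 2 ^ (m+1) / η ^ (m+1) * τ.real univ := by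
  have hc := Kt_cont (R := ε) hK.co hη; have hgc := hg.cont
  exact ⟨StronglyMeasurable.integral_prod_right' (f := fun p : EV (m+1) × EV (m+2) => Kt K η ε (g p.1 - p.2))
    (Continuous.stronglyMeasurable (by fun_prop)), fun u =>
    norm_integral_le_of_norm_le_const (Eventually.of_forall fun z => hK.bd hη hε _)⟩

theorem CZ.int_A (hK : CZ m C K) (hg : BLip c Λ g) (τ : Measure (EV (m+2))) [IsFiniteMeasure τ] {ε η : ℝ} (hη : 0 < η) (hε : 0 < ε)
    {A : Set (EV (m+1))} (hA : volume A < ∞) : IntegrableOn (fun u => ∫ z, Kt K η ε (g u - z) ∂τ) A :=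
  Measure.integrableOn_of_bounded hA.ne (hK.int_u hg τ hη hε).1.aestronglyMeasurable
    (Eventually.of_forall (hK.int_u hg τ hη hε).2)

set_option maxHeartbeats 1000000 in
theorem loc_est (hK : CZ m C K) (hg : BLip c Λ g) {ν : Measure (EV (m+2))} [IsFiniteMeasure ν] {l l' G G'}
    (h : Good g ν l l' G G') {s : EV (m+1)} (hs : s ∈ G') {L : EV (m+1) →L[ℝ] EV (m+2)} (hL : HasFDerivAt g L s)
    (hd : Den s G') {θ ωp ωm} (D : Dec g ν (g s) θ ωp ωm) {κ : ℝ} (hκ : 0 < κ) :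
    ∃ δ > 0, ∃ ε0 > 0, ∀ ε ∈ Ioc 0 ε0, ∃ η0 > 0, ∀ η ∈ Ioc 0 η0,
      |∫ u in G' ∩ ball s (δ * ε), ((∫ z, Kt K η 1 (g u - z) ∂ν) - ∫ z, Kt K ε 1 (g s - z) ∂ν)| ≤
        κ * (δ * ε) ^ (m+1) := by
  have hC := hK.rb.nn; have hv := vb_pos m; have hΛ := hg.Lpos; have l0 := h.l0
  obtain ⟨δ, hδ, hδ1, hδ2, hδ3⟩ : ∃ δ > 0, δ ≤ 1 ∧ Λ * δ ≤ 1 / 8 ∧ C * 10 ^ (m+2) * (Λ * δ) * (2 ^ (m+3) * l) * vb m ≤ κ / 5 := by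
    obtain ⟨X, hX⟩ : ∃ X, X = C * 10 ^ (m+2) * Λ * (2 ^ (m+3) * l) * vb m := ⟨_, rfl⟩
    have hX0 : 0 ≤ X := by rw [hX]; positivity
    refine ⟨min 1 (min (1 / 8 / Λ) (κ / 5 / (X + 1))), by positivity, min_le_left _ _, ?_, ?_⟩
    · rw [mul_comm, ← le_div_iff₀ hΛ]; exact (min_le_right _ _).trans (min_le_left _ _)
    · have h1 := (min_le_right 1 (min (1 / 8 / Λ) (κ / 5 / (X + 1)))).trans (min_le_right _ _)
      generalize min 1 (min (1 / 8 / Λ) (κ / 5 / (X + 1))) = δ at *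
      rw [le_div_iff₀ (by positivity)] at h1
      rw [show C * 10 ^ (m+2) * (Λ * δ) * (2 ^ (m+3) * l) * vb m = X * δ by rw [hX]; ring]
      rcases le_total 0 δ with h2 | h2 <;> nlinarith
  obtain ⟨q, hq⟩ : ∃ q, q = κ / 5 * δ ^ (m+1) := ⟨_, rfl⟩
  have hq0 : 0 < q := by rw [hq]; positivity
  obtain ⟨A1, hA1, H1⟩ := h.sing hg hK ⟨s, h.sub hs⟩
  obtain ⟨A2, hA2, H2⟩ := (good_mu hg θ h.meas h.fin).sing hg hK ⟨s, mem_univ _⟩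
  obtain ⟨A, hA⟩ : ∃ A, A = A1 + A2 := ⟨_, rfl⟩
  have hA0 : 0 < A := by rw [hA]; positivity
  obtain ⟨t, ht, ht'⟩ : ∃ t > 0, A * (t * vb m) = q / 2 := ⟨q / (2 * A * vb m), by positivity, by field_simp⟩
  obtain ⟨κ1, hκ1, hκ1'⟩ : ∃ κ1 > 0, A * (κ1 * 2 ^ (m+1) / t) = q / 2 := ⟨q * t / (2 * A * 2 ^ (m+1)), by positivity, by field_simp⟩
  obtain ⟨r1, hr1, h1⟩ := D.o κ1 hκ1
  obtain ⟨r2, hr2, h2⟩ := mu_term hK hg hL h.meas hd hδ hδ1 (κ := q / (θ + 1)) (by positivity)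
  refine ⟨δ, hδ, min (1 / 2) (min (r1 / 2) r2), by positivity, fun ε hε => ?_⟩
  have e0 : 0 < ε := hε.1
  have e1 : ε ≤ 1 / 2 := hε.2.trans (min_le_left _ _)
  have e2 : 2 * ε ≤ r1 := by have := hε.2.trans ((min_le_right _ _).trans (min_le_left _ _)); linarith
  obtain ⟨η0, hη0, h3⟩ := h2 ε ⟨e0, hε.2.trans ((min_le_right _ _).trans (min_le_right _ _))⟩
  refine ⟨min η0 (ε / 2), by positivity, fun η hη => ?_⟩
  have h4 := h3 η ⟨hη.1, hη.2.trans (min_le_left _ _)⟩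
  have n0 : 0 < η := hη.1
  have n1 : η ≤ ε / 2 := hη.2.trans (min_le_right _ _)
  clear h3 h2 hη hε
  obtain ⟨S, hS⟩ : ∃ S, S = G' ∩ ball s (δ * ε) := ⟨_, rfl⟩
  rw [← hS] at h4 ⊢
  have mS : MeasurableSet S := by rw [hS]; exact h.meas.inter measurableSet_ball
  have sG : S ⊆ G' := by rw [hS]; exact inter_subset_left
  have fS : volume S < ∞ := (measure_mono sG).trans_lt h.fin
  have vS : volume.real S ≤ vb m * (δ * ε) ^ (m+1) := by
    rw [← vr_ball s (by positivity), hS]; exact measureReal_mono inter_subset_right measure_ball_lt_top.ne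
  have vS' : volume.real S ≤ vb m * ε ^ (m+1) := vS.trans (by gcongr; exact mul_le_of_le_one_left e0.le hδ1)
  have nS : ∀ u ∈ S, ‖g s - g u‖ ≤ Λ * δ * ε := fun u hu => by
    have : ‖s - u‖ ≤ δ * ε := by rw [hS] at hu; rw [← dist_eq_norm, dist_comm]; exact (mem_ball.1 hu.2).le
    rw [mul_assoc]; exact (hg.hi s u).trans (by gcongr)
  obtain ⟨B, hB⟩ : ∃ B, B = closedBall (g s) (2 * ε) := ⟨_, rfl⟩
  have oB : (ωp + ωm) B ≤ ENNReal.ofReal (κ1 * (2 * ε) ^ (m+1)) := by rw [hB]; exact h1 _ ⟨by positivity, e2⟩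
  have mB : MeasurableSet B := by rw [hB]; exact measurableSet_closedBall
  have pB : ωp B ≤ ENNReal.ofReal (κ1 * (2 * ε) ^ (m+1)) := le_trans (by simp) oB
  have qB : ωm B ≤ ENNReal.ofReal (κ1 * (2 * ε) ^ (m+1)) := le_trans (by simp) oB
  have bd : ∀ ω : Measure (EV (m+2)), ω B ≤ ENNReal.ofReal (κ1 * (2 * ε) ^ (m+1)) →
      ∀ A' ≤ A, 0 < A' → |∫ s in S, ∫ z in B, Kt K η ε (g s - z) ∂ω| ≤ A' * (t * volume.real S + ω.real B / t) →
      |∫ s in S, ∫ z in B, Kt K η ε (g s - z) ∂ω| ≤ q * ε ^ (m+1) := by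
    intro ω hω A' hA' hA0' h5
    have h6 : ω.real B ≤ κ1 * (2 * ε) ^ (m+1) := ENNReal.toReal_le_of_le_ofReal (by positivity) hω
    calc _ ≤ A * (t * (vb m * ε ^ (m+1)) + κ1 * (2 * ε) ^ (m+1) / t) := h5.trans (by gcongr)
      _ = (A * (t * vb m) + A * (κ1 * 2 ^ (m+1) / t)) * ε ^ (m+1) := by rw [mul_pow]; ring
      _ = _ := by rw [ht', hκ1']; ring
  have b1 := bd ωp pB A1 (by linarith) hA1 ((H1 ωp D.hp B (pB.trans_lt ENNReal.ofReal_lt_top) ε e0 η n0).1 S sG mS t ht)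
  have b2 := bd ωm qB A2 (by linarith) hA2 ((H2 ωm D.hm B (qB.trans_lt ENNReal.ofReal_lt_top) ε e0 η n0).1 S sG mS t ht)
  have F1 : IsFiniteMeasure (ωp.restrict B) := ⟨by simpa using pB.trans_lt ENNReal.ofReal_lt_top⟩
  have F2 : IsFiniteMeasure (ωm.restrict B) := ⟨by simpa using qB.trans_lt ENNReal.ofReal_lt_top⟩
  have F3 : IsFiniteMeasure ((θ • pm g).restrict B) := by
    have := pm_lf hg
    refine ⟨?_⟩
    rw [Measure.restrict_apply_univ, Measure.smul_apply, ENNReal.smul_def, smul_eq_mul, hB]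
    exact ENNReal.mul_lt_top ENNReal.coe_lt_top (isCompact_closedBall _ _).measure_lt_top
  have far : ∀ u ∈ S, ∀ z ∉ B, Kt K η ε (g u - z) = 0 := fun u hu z hz => Kt_far e0 (by
    rw [hB, mem_closedBall, not_le, dist_comm, dist_eq_norm, ← sub_add_sub_cancel (g s) (g u) z] at hz
    have h5 := norm_add_le (g s - g u) (g u - z)
    have h6 := nS u hu
    have h7 := mul_le_mul_of_nonneg_right hδ2 e0.le
    linarith)
  have id1 : ∀ u ∈ S, (∫ z in B, Kt K η ε (g u - z) ∂ν) + (∫ z in B, Kt K η ε (g u - z) ∂ωm) -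
      (∫ z in B, Kt K η ε (g u - z) ∂ωp) = θ * ∫ t, Kt K η ε (g u - g t) := fun u hu => by
    have hc := Kt_cont (R := ε) hK.co n0
    have e : ν.restrict B + ωm.restrict B = (θ • pm g).restrict B + ωp.restrict B := by
      rw [← Measure.restrict_add, ← Measure.restrict_add, D.eq]
    have e2 := congrArg (fun τ => ∫ z, Kt K η ε (g u - z) ∂τ) e
    beta_reduce at e2
    rw [integral_add_measure (hK.int_z _ n0 e0 _) (hK.int_z _ n0 e0 _),
      integral_add_measure (hK.int_z _ n0 e0 _) (hK.int_z _ n0 e0 _),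
      setIntegral_eq_integral_of_forall_compl_eq_zero (μ := θ • pm g) (far u hu), integral_smul_nnreal_measure, pm,
      integral_map hg.cont.measurable.aemeasurable (by fun_prop : Continuous _).aestronglyMeasurable, NNReal.smul_def, smul_eq_mul] at e2
    linarith
  have b3 : |(∫ u in S, ∫ z in B, Kt K η ε (g u - z) ∂ν) + (∫ u in S, ∫ z in B, Kt K η ε (g u - z) ∂ωm) -
      ∫ u in S, ∫ z in B, Kt K η ε (g u - z) ∂ωp| ≤ q * ε ^ (m+1) := by
    have i1 := hK.int_A hg (ν.restrict B) n0 e0 fS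
    have i2 := hK.int_A hg (ωm.restrict B) n0 e0 fS
    have i3 := hK.int_A hg (ωp.restrict B) n0 e0 fS
    have e := integral_sub (i1.add i2) i3
    simp only [Pi.add_apply] at e
    rw [integral_add i1 i2] at e
    rw [← e, setIntegral_congr_fun mS id1, integral_const_mul, abs_mul, NNReal.abs_eq]
    calc _ ≤ θ * (q / (θ + 1) * ε ^ (m+1)) := by gcongr
      _ = q * ε ^ (m+1) * (θ / (θ + 1)) := by ring
      _ ≤ _ := mul_le_of_le_one_right (by positivity) ((div_le_one (by positivity)).2 (by simp))
  have id2 : ∀ u ∈ S, (∫ z, Kt K η 1 (g u - z) ∂ν) - ∫ z, Kt K ε 1 (g s - z) ∂ν =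
      (∫ z in B, Kt K η ε (g u - z) ∂ν) + ((∫ z, Kt K ε 1 (g u - z) ∂ν) - ∫ z, Kt K ε 1 (g s - z) ∂ν) := fun u hu => by
    rw [setIntegral_eq_integral_of_forall_compl_eq_zero (μ := ν) (far u hu)]
    simp only [Kt_split n0 n1 e1]
    rw [integral_add (hK.int_z ν e0 one_pos _) (hK.int_z ν n0 e0 _)]
    ring
  have b4 : ∀ u ∈ S, ‖(∫ z, Kt K ε 1 (g u - z) ∂ν) - ∫ z, Kt K ε 1 (g s - z) ∂ν‖ ≤ C * 10 ^ (m+2) * (Λ * δ) * (2 ^ (m+3) * l) := by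
    intro u hu
    rw [norm_sub_rev, ← integral_sub (hK.int_z ν e0 one_pos _) (hK.int_z ν e0 one_pos _), Real.norm_eq_abs]
    refine int_pk (p := fun z => pk (m+1) ε ‖g s - z‖) (by positivity) (by positivity) (fun z => ?_) ?_
    · have h6 := nS u hu
      have h5 : ‖(g s - z) - (g u - z)‖ ≤ Λ * δ * ε := by rwa [sub_sub_sub_cancel_right]
      refine (hK.pk e0 one_pos (h5.trans ?_)).trans ?_
      · linarith [mul_le_mul_of_nonneg_right hδ2 e0.le]
      · rw [pk, mul_div_assoc', mul_assoc (C * 10 ^ (m+2))]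
        gcongr
    · refine growth (D := fun z => ‖g s - z‖) (by fun_prop) (fun _ => norm_nonneg _) l0 (fun r hr => ?_) e0
      have : {y | ‖g s - y‖ < r} = ball (g s) r := by ext; simp [dist_eq_norm, norm_sub_rev]
      rw [this]; exact h.gr s (h.sub hs) r hr
  have i5 : IntegrableOn (fun u => (∫ z, Kt K ε 1 (g u - z) ∂ν) - ∫ z, Kt K ε 1 (g s - z) ∂ν) S :=
    (hK.int_A hg ν e0 one_pos fS).sub (integrableOn_const fS.ne)
  rw [setIntegral_congr_fun mS id2, integral_add (hK.int_A hg (ν.restrict B) n0 e0 fS) i5]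
  have b5 := norm_setIntegral_le_of_norm_le_const fS b4
  rw [Real.norm_eq_abs] at b5
  have b6 : C * 10 ^ (m+2) * (Λ * δ) * (2 ^ (m+3) * l) * volume.real S ≤ κ / 5 * (δ * ε) ^ (m+1) :=
    calc _ ≤ C * 10 ^ (m+2) * (Λ * δ) * (2 ^ (m+3) * l) * (vb m * (δ * ε) ^ (m+1)) := by gcongr
      _ = C * 10 ^ (m+2) * (Λ * δ) * (2 ^ (m+3) * l) * vb m * (δ * ε) ^ (m+1) := by ring
      _ ≤ _ := by gcongr
  have b7 : q * ε ^ (m+1) = κ / 5 * (δ * ε) ^ (m+1) := by rw [hq, mul_pow]; ring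
  have b8 : 0 < κ * (δ * ε) ^ (m+1) := by positivity
  rw [b7] at b1 b2 b3
  clear id1 id2 bd H1 H2 h4 far
  generalize (∫ u in S, ∫ z in B, Kt K η ε (g u - z) ∂ν) = x1 at *
  generalize (∫ u in S, ∫ z in B, Kt K η ε (g u - z) ∂ωm) = x2 at *
  generalize (∫ u in S, ∫ z in B, Kt K η ε (g u - z) ∂ωp) = x3 at *
  generalize (∫ u in S, ((∫ z, Kt K ε 1 (g u - z) ∂ν) - ∫ z, Kt K ε 1 (g s - z) ∂ν)) = x4 at *
  rw [abs_le] at *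
  constructor <;> linarith

end
end

section
theorem weak_lim {X : Type*} [MeasurableSpace X] {μ : Measure X} [IsFiniteMeasure μ] (F : ℕ → X → ℝ)
    (hF : ∀ k, MemLp (F k) 2 μ) {R : ℝ} (hR : ∀ k, ∫ x, F k x ^ 2 ∂μ ≤ R) : ∃ H, Integrable H μ ∧
    ∃ U : Ultrafilter ℕ, ↑U ≤ (atTop : Filter ℕ) ∧ ∀ S, MeasurableSet S →
      Tendsto (fun k => ∫ x in S, F k x ∂μ) U (𝓝 (∫ x in S, H x ∂μ)) := by
  obtain ⟨f, hf⟩ : ∃ f : ℕ → Lp ℝ 2 μ, f = fun k => (hF k).toLp := ⟨_, rfl⟩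
  have fe : ∀ k, f k =ᵐ[μ] F k := fun k => by rw [hf]; exact (hF k).coeFn_toLp
  have hn : ∀ k, ‖f k‖ ≤ √R := fun k => Real.le_sqrt_of_sq_le <| by
    rw [← real_inner_self_eq_norm_sq, L2.inner_def]
    refine le_trans (le_of_eq (integral_congr_ae ?_)) (hR k)
    filter_upwards [fe k] with x hx
    rw [hx, real_inner_self_eq_norm_sq, Real.norm_eq_abs, sq_abs]
  obtain ⟨U, hU⟩ := exists_ultrafilter_le (atTop : Filter ℕ)
  obtain ⟨G, hG⟩ : ∃ G : ℕ → WeakDual ℝ (Lp ℝ 2 μ), G = fun k => StrongDual.toWeakDual (InnerProductSpace.toDual ℝ _ (f k)) := ⟨_, rfl⟩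
  obtain ⟨x, -, hx⟩ := (WeakDual.isCompact_closedBall (𝕜 := ℝ) (E := Lp ℝ 2 μ) 0 (√R)).ultrafilter_le_nhds (U.map G) (by
    rw [le_principal_iff]
    refine mem_map.2 (Eventually.of_forall fun k => ?_)
    rw [hG]
    simp only [mem_preimage, mem_closedBall_zero_iff]
    refine le_trans (le_of_eq ?_) (hn k)
    exact (InnerProductSpace.toDual ℝ _).norm_map (f k))
  obtain ⟨H, hH⟩ := (InnerProductSpace.toDual ℝ (Lp ℝ 2 μ)).surjective (WeakDual.toStrongDual x)
  refine ⟨H, (Lp.memLp H).integrable one_le_two, U, hU, fun S hS => ?_⟩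
  have h1 : Tendsto G U (𝓝 x) := hx
  have h2 := ((WeakDual.eval_continuous (indicatorConstLp 2 hS (measure_ne_top μ S) (1:ℝ))).tendsto x).comp h1
  have e1 : ∀ p : Lp ℝ 2 μ, InnerProductSpace.toDual ℝ _ p (indicatorConstLp 2 hS (measure_ne_top μ S) (1:ℝ)) = ∫ y in S, p y ∂μ := fun p => by
    rw [InnerProductSpace.toDual_apply_apply, real_inner_comm, L2.inner_indicatorConstLp_one]
  have e2 : x (indicatorConstLp 2 hS (measure_ne_top μ S) (1:ℝ)) = ∫ y in S, H y ∂μ := by rw [← e1, hH]; rfl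
  rw [e2] at h2
  refine h2.congr fun k => ?_
  rw [Function.comp_apply, hG]
  refine (e1 (f k)).trans (integral_congr_ae (ae_restrict_of_ae (fe k)))

section
variable {m : ℕ} {C c Λ : ℝ} {K : EV (m+2) → ℝ} {g : EV (m+1) → EV (m+2)}

theorem BLip.diff (hg : BLip c Λ g) : ∀ᵐ s, DifferentiableAt ℝ g s :=
  (LipschitzWith.of_dist_le_mul (K := Λ.toNNReal) fun x y => by
    rw [dist_eq_norm, dist_eq_norm, Real.coe_toNNReal _ hg.Lpos.le]; exact hg.hi x y).ae_differentiableAt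

theorem good_lim (hK : CZ m C K) (hg : BLip c Λ g) {ν : Measure (EV (m+2))} [IsFiniteMeasure ν] {l l' G G'}
    (h : Good g ν l l' G G') : ∀ᵐ s, s ∈ G' →
      ∃ H, Tendsto (fun ε => ∫ z, Kt K ε 1 (g s - z) ∂ν) (𝓝[>] 0) (𝓝 H) := by
  rcases G'.eq_empty_or_nonempty with h0 | ⟨s0, hs0⟩
  · exact Eventually.of_forall fun s hs => by simp [h0] at hs
  have hv := vb_pos m
  obtain ⟨A, hA, HA⟩ := h.sing hg hK ⟨s0, h.sub hs0⟩
  obtain ⟨e, he⟩ : ∃ e : ℕ → ℝ, e = fun k : ℕ => 1 / ((k:ℝ) + 1) := ⟨_, rfl⟩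
  have e0 : ∀ k, 0 < e k := fun k => by rw [he]; positivity
  have et : Tendsto e atTop (𝓝 0) := by rw [he]; exact tendsto_one_div_add_atTop_nhds_zero_nat
  have fG : IsFiniteMeasure (volume.restrict G') := ⟨by simpa using h.fin⟩
  obtain ⟨H, hH, U, hU, hW⟩ := weak_lim (μ := volume.restrict G') (fun k u => ∫ z, Kt K (e k) 1 (g u - z) ∂ν)
    (fun k => MemLp.of_bound (hK.int_u hg ν (e0 k) one_pos).1.aestronglyMeasurable _
      (Eventually.of_forall (hK.int_u hg ν (e0 k) one_pos).2)) (R := 4 * A ^ 2 * ν.real univ)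
    (fun k => by
      have := (HA ν le_rfl univ (measure_lt_top _ _) 1 one_pos (e k) (e0 k)).2
      rwa [Measure.restrict_univ] at this)
  have hloc : LocallyIntegrable (G'.indicator H) volume := (IntegrableOn.integrable_indicator hH h.meas).locallyIntegrable
  filter_upwards [leb hloc, den_ae h.meas, dec_ae hg ν, hg.diff] with s q1 q2 q3 q4 hs
  obtain ⟨θ, ωp, ωm, D⟩ := q3
  refine ⟨H s, ?_⟩
  rw [Metric.tendsto_nhds]
  intro κ hκ
  obtain ⟨δ, hδ, ε0, hε0, h1⟩ := loc_est hK hg h hs q4.hasFDerivAt (q2 hs) D (κ := κ * vb m / 8) (by positivity)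
  obtain ⟨r1, hr1, h2⟩ := q1 (κ * vb m / 8) (by positivity)
  obtain ⟨r2, hr2, h3⟩ := q2 hs (vb m / 2) (by positivity)
  filter_upwards [Ioc_mem_nhdsGT (show 0 < min ε0 (min (r1 / δ) (r2 / δ)) by positivity)] with ε hε
  have hε0' : 0 < ε := hε.1
  obtain ⟨η0, hη0, h4⟩ := h1 ε ⟨hε.1, hε.2.trans (min_le_left _ _)⟩
  have a1 : δ * ε ∈ Ioc 0 r1 := ⟨by positivity, by
    have := hε.2.trans ((min_le_right _ _).trans (min_le_left _ _)); rw [le_div_iff₀ hδ] at this; linarith⟩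
  have a2 : δ * ε ∈ Ioc 0 r2 := ⟨by positivity, by
    have := hε.2.trans ((min_le_right _ _).trans (min_le_right _ _)); rw [le_div_iff₀ hδ] at this; linarith⟩
  have h2 := h2 _ a1
  have h3 := h3 _ a2
  obtain ⟨w, hw⟩ : ∃ w, w = (δ * ε) ^ (m+1) := ⟨_, rfl⟩
  have hw0 : 0 < w := by rw [hw]; positivity
  have vr := vr_ball s a1.1.le
  obtain ⟨B, hB⟩ : ∃ B, B = ball s (δ * ε) := ⟨_, rfl⟩
  have mB : MeasurableSet B := by rw [hB]; exact measurableSet_ball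
  have fB : volume B < ∞ := by rw [hB]; exact measure_ball_lt_top
  rw [← hw, ← hB] at h2 h3 vr
  rw [← hB] at h4
  have mS := h.meas.inter mB
  have fS : volume (G' ∩ B) < ∞ := (measure_mono inter_subset_left).trans_lt h.fin
  have lo : vb m / 2 * w ≤ volume.real (G' ∩ B) := by
    have e := measureReal_sdiff_add_inter (μ := volume) (s := B) (t := G') h.meas fB.ne
    have e2 : volume.real (B \ G') ≤ vb m / 2 * w := ENNReal.toReal_le_of_le_ofReal (by positivity) h3
    rw [inter_comm]; linarith
  have b1 : |(∫ u in G' ∩ B, H u) - volume.real (G' ∩ B) * ∫ z, Kt K ε 1 (g s - z) ∂ν| ≤ κ * vb m / 8 * w := by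
    have t1 := hW B mB
    rw [Measure.restrict_restrict mB, inter_comm B] at t1
    refine le_of_tendsto ((t1.sub_const _).abs) ?_
    filter_upwards [hU (et.eventually (gt_mem_nhds hη0))] with k hk
    have := h4 (e k) ⟨e0 k, le_of_lt hk⟩
    rwa [integral_sub (hK.int_A hg ν (e0 k) one_pos fS) (integrableOn_const fS.ne), setIntegral_const, smul_eq_mul, ← hw] at this
  have b2 : |(∫ u in G' ∩ B, H u) - volume.real (G' ∩ B) * H s| ≤ κ * vb m / 8 * w := by
    have i : IntegrableOn H (G' ∩ B) := IntegrableOn.mono_set hH inter_subset_left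
    rw [← smul_eq_mul, ← setIntegral_const, ← integral_sub i (integrableOn_const fS.ne)]
    refine (abs_integral_le_integral_abs).trans (le_trans ?_ h2)
    have e : ∫ u in G' ∩ B, |H u - H s| = ∫ u in G' ∩ B, |G'.indicator H u - G'.indicator H s| :=
      setIntegral_congr_fun mS fun u hu => by rw [indicator_of_mem hu.1, indicator_of_mem hs]
    rw [e]
    refine setIntegral_mono_set ?_ (Eventually.of_forall fun _ => abs_nonneg _) inter_subset_right.eventuallyLE
    have i2 : Integrable (G'.indicator H) volume := IntegrableOn.integrable_indicator hH h.meas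
    exact ((i2.integrableOn).sub (integrableOn_const fB.ne)).abs
  rw [Real.dist_eq]
  have b3 : volume.real (G' ∩ B) * |(∫ z, Kt K ε 1 (g s - z) ∂ν) - H s| ≤ κ * vb m / 4 * w := by
    rw [← abs_of_nonneg (measureReal_nonneg : 0 ≤ volume.real (G' ∩ B)), ← abs_mul]
    rw [abs_le] at b1 b2 ⊢
    constructor <;> linarith
  have b4 := (mul_le_mul_of_nonneg_right lo (abs_nonneg ((∫ z, Kt K ε 1 (g s - z) ∂ν) - H s))).trans b3
  generalize |(∫ z, Kt K ε 1 (g s - z) ∂ν) - H s| = y at *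
  have b5 : vb m * w * (y / 2) ≤ vb m * w * (κ / 4) := by linarith
  have := le_of_mul_le_mul_left b5 (by positivity)
  linarith

theorem P5 (hK : CZ m C K) (hg : BLip c Λ g) (ν : Measure (EV (m+2))) [IsFiniteMeasure ν] :
    ∀ᵐ s, ∃ H, Tendsto (fun ε => ∫ z, Kt K ε 1 (g s - z) ∂ν) (𝓝[>] 0) (𝓝 H) := by
  have hgc := hg.cont
  obtain ⟨G, hG⟩ : ∃ G : ℕ → Set (EV (m+1)), G = fun N : ℕ => ⋂ q : {q : ℚ // 0 < q},
    {s | ν (ball (g s) q) ≤ ENNReal.ofReal ((N:ℝ) * (q:ℝ) ^ (m+1))} := ⟨_, rfl⟩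
  have hGm : ∀ N, MeasurableSet (G N) := fun N => by
    rw [hG]
    refine MeasurableSet.iInter fun q => measurableSet_le ?_ measurable_const
    have : MeasurableSet {p : EV (m+1) × EV (m+2) | dist p.2 (g p.1) < q} :=
      (isOpen_lt (by fun_prop) continuous_const).measurableSet
    exact measurable_measure_prodMk_left this
  obtain ⟨Φ, hΦ⟩ : ∃ Φ : ℕ → EV (m+1) → ℝ≥0∞, Φ = fun N s =>
    ∫⁻ z, ENNReal.ofReal (pk (m+1) (infDist z (g '' G N)) ‖g s - z‖) ∂ν := ⟨_, rfl⟩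
  have jm : ∀ N, Measurable fun p : EV (m+1) × EV (m+2) => ENNReal.ofReal (pk (m+1) (infDist p.2 (g '' G N)) ‖g p.1 - p.2‖) := fun N => by
    have : Continuous fun p : EV (m+1) × EV (m+2) => infDist p.2 (g '' G N) := (continuous_infDist_pt _).comp continuous_snd
    have h2 : Continuous fun p : EV (m+1) × EV (m+2) => ‖g p.1 - p.2‖ := by fun_prop
    unfold pk
    exact (this.measurable.div ((this.measurable.add h2.measurable).pow_const _)).ennreal_ofReal
  have hΦm : ∀ N, Measurable (Φ N) := fun N => by rw [hΦ]; exact (jm N).lintegral_prod_right'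
  have good : ∀ N M : ℕ, Good g ν (N * 2 ^ (m+1)) M (G N) (G N ∩ closedBall 0 M ∩ {s | Φ N s ≤ ENNReal.ofReal M}) := fun N M => by
    refine ⟨by positivity, by positivity, fun s hs => hs.1.1, ((hGm N).inter measurableSet_closedBall).inter
      (measurableSet_le (hΦm N) measurable_const), (measure_mono fun s hs => hs.1.2).trans_lt measure_closedBall_lt_top,
      fun s hs r hr => ?_, fun s hs => by have := hs.2; rwa [hΦ] at this⟩
    obtain ⟨q, q1, q2⟩ := exists_rat_btwn (show r < 2 * r by linarith)
    have q0 : (0:ℚ) < q := by exact_mod_cast hr.trans q1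
    rw [hG] at hs
    refine (measure_mono (ball_subset_ball q1.le)).trans ((mem_iInter.1 hs ⟨q, q0⟩).trans (ENNReal.ofReal_le_ofReal ?_))
    have := hr.trans q1
    calc (N:ℝ) * (q:ℝ) ^ (m+1) ≤ N * (2 * r) ^ (m+1) := by gcongr
      _ = _ := by rw [mul_pow]; ring
  have h1 : ∀ᵐ s, ∀ N, Φ N s < ∞ := ae_all_iff.2 fun N => by
    refine ae_lt_top (hΦm N) (ne_of_lt ?_)
    rw [hΦ]
    rw [lintegral_lintegral_swap (jm N).aemeasurable]
    refine (lintegral_mono (g := fun _ => ENNReal.ofReal (2 ^ (m+3) * (vb m * (3 / c) ^ (m+1)))) fun z => ?_).trans_lt ?_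
    · rcases (infDist_nonneg (x := z) (s := g '' G N)).eq_or_lt with h0 | h0
      · simp [← h0, pk]
      · exact mu_pk hg z h0
    · rw [lintegral_const]; exact ENNReal.mul_lt_top ENNReal.ofReal_lt_top (measure_lt_top _ _)
  have h2 : ∀ᵐ s, ∃ N, s ∈ G N := by
    filter_upwards [dec_ae hg ν] with s ⟨θ, ωp, ωm, D⟩
    obtain ⟨l, hl, h3⟩ := D.lp hg
    obtain ⟨N, hN⟩ := exists_nat_ge (θ * gl m c + l)
    refine ⟨N, ?_⟩
    rw [hG]
    refine mem_iInter.2 fun ⟨q, q0⟩ => ?_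
    have q0' : (0:ℝ) < q := by exact_mod_cast q0
    have e1 : ball (g s) (q:ℝ) = {y | ‖g s - y‖ < q} := by ext; simp [dist_eq_norm, norm_sub_rev]
    have e2 : {y | ‖g s - y‖ < q} = {y | ‖y - g s‖ < (q:ℝ)} := by ext; simp [norm_sub_rev]
    have e3 : ν ≤ θ • pm g + (ωp + ωm) := by
      refine (Measure.le_add_right le_rfl : ν ≤ ν + ωm).trans ?_
      rw [D.eq]
      exact add_le_add le_rfl (Measure.le_add_right le_rfl)
    rw [mem_ofPred_eq, e1]
    refine (e3 _).trans ?_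
    rw [Measure.add_apply, Measure.smul_apply, ENNReal.smul_def, smul_eq_mul]
    refine (add_le_add (mul_le_mul_right (e2 ▸ pm_growth hg (g s) q0') _) (h3 q q0')).trans ?_
    have g0 := gl_nn hg
    rw [← ENNReal.ofReal_coe_nnreal, ← ENNReal.ofReal_mul (by positivity), ← ENNReal.ofReal_add (by positivity) (by positivity)]
    refine ENNReal.ofReal_le_ofReal ?_
    calc _ = (θ * gl m c + l) * (q:ℝ) ^ (m+1) := by ring
      _ ≤ _ := by gcongr
  have h3 : ∀ᵐ s, ∀ N M : ℕ, s ∈ G N ∩ closedBall 0 M ∩ {s | Φ N s ≤ ENNReal.ofReal M} →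
      ∃ H, Tendsto (fun ε => ∫ z, Kt K ε 1 (g s - z) ∂ν) (𝓝[>] 0) (𝓝 H) :=
    ae_all_iff.2 fun N => ae_all_iff.2 fun M => good_lim hK hg (good N M)
  filter_upwards [h1, h2, h3] with s a1 ⟨N, hN⟩ a3
  obtain ⟨M, hM⟩ := exists_nat_ge (max ‖s‖ (Φ N s).toReal)
  refine a3 N M ⟨⟨hN, by simpa using (le_max_left _ _).trans hM⟩, ?_⟩
  exact (ENNReal.le_ofReal_iff_toReal_le (a1 N).ne (by positivity)).2 ((le_max_right _ _).trans hM)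

end
end

section
section
variable {m : ℕ} {C c Λ : ℝ} {K : EV (m+2) → ℝ} {g : EV (m+1) → EV (m+2)} {L : EV (m+1) →L[ℝ] EV (m+2)} {s : EV (m+1)}

theorem q_lim (hL : HasFDerivAt g L s) (w : EV (m+1)) :
    Tendsto (fun ρ : ℝ => ρ⁻¹ • (g (s + ρ • w) - g s)) (𝓝[>] 0) (𝓝 (L w)) := by
  have := HasDerivAt.tendsto_slope_zero_right (hL.hasLineDerivAt w)
  simpa using this

theorem q_lo (hg : BLip c Λ g) {ρ : ℝ} (hρ : 0 < ρ) (w : EV (m+1)) : c * ‖w‖ ≤ ‖ρ⁻¹ • (g (s + ρ • w) - g s)‖ := by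
  have := hg.lo (s + ρ • w) s
  rw [add_sub_cancel_left, norm_smul, Real.norm_of_nonneg hρ.le] at this
  rw [norm_smul, Real.norm_of_nonneg (inv_nonneg.2 hρ.le), le_inv_mul_iff₀ hρ]
  linarith

theorem L_lo (hg : BLip c Λ g) (hL : HasFDerivAt g L s) (w : EV (m+1)) : c * ‖w‖ ≤ ‖L w‖ :=
  ge_of_tendsto (q_lim hL w).norm (by filter_upwards [self_mem_nhdsWithin] with ρ hρ using q_lo hg hρ w)

theorem pk_int (hc : 0 < c) {ρ : ℝ} (hρ : 0 < ρ) : Integrable (fun w : EV (m+1) => pk (m+1) ρ (c * ‖w‖)) := by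
  have hm : Measurable fun w : EV (m+1) => pk (m+1) ρ (c * ‖w‖) := by unfold pk; fun_prop
  refine ⟨hm.aestronglyMeasurable, ?_⟩
  rw [hasFiniteIntegral_iff_ofReal (Eventually.of_forall fun w => pk_nonneg hρ.le (by positivity))]
  have := vb_pos m
  refine (growth (by fun_prop) (fun w => by positivity) (l := vb m / c ^ (m+1)) (by positivity) (fun r hr => ?_) hρ).trans_lt ENNReal.ofReal_lt_top
  have : {y : EV (m+1) | c * ‖y‖ < r} = ball 0 (r / c) := by ext; simp [lt_div_iff₀ hc, mul_comm]
  rw [this, vol_ball _ (by positivity)]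
  refine le_of_eq ?_
  congr 1
  rw [div_pow]; field_simp

theorem pk_anti {n : ℕ} {ρ d d' : ℝ} (hρ : 0 < ρ) (hd : 0 ≤ d) (h : d ≤ d') : pk n ρ d' ≤ pk n ρ d := by
  unfold pk; gcongr

theorem pk_scale {n : ℕ} {ρ d : ℝ} (hρ : 0 < ρ) (hd : 0 ≤ d) : pk n ρ d = (ρ ^ n)⁻¹ * pk n 1 (ρ⁻¹ * d) := by
  unfold pk
  have : 1 + ρ⁻¹ * d = (ρ + d) / ρ := by field_simp
  rw [this, div_pow, pow_succ ρ]; field_simp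

theorem blow (hg : BLip c Λ g) (hL : HasFDerivAt g L s) {ν : Measure (EV (m+2))} [IsFiniteMeasure ν] {θ ωp ωm}
    (D : Dec g ν (g s) θ ωp ωm) {ι : Type*} {l : Filter ι} [l.IsCountablyGenerated] {ρ : ι → ℝ} (hρ : Tendsto ρ l (𝓝[>] 0))
    {f : ι → EV (m+2) → ℝ} (hm : ∀ i, Measurable (f i)) {B : ℝ} (hB : 0 ≤ B)
    (hb : ∀ᶠ i in l, ∀ v, |f i v| ≤ B * pk (m+1) 1 ‖v‖)
    (hc : ∀ᵐ w, Tendsto (fun i => f i ((ρ i)⁻¹ • (g (s + ρ i • w) - g s)) - f i (L w)) l (𝓝 0)) :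
    Tendsto (fun i => (∫ z, ((ρ i) ^ (m+1))⁻¹ * f i ((ρ i)⁻¹ • (z - g s)) ∂ν) - θ * ∫ w, f i (L w)) l (𝓝 0) := by
  have hcp := hg.cpos
  have hgc := hg.cont
  have hρ0 : ∀ᶠ i in l, 0 < ρ i := hρ self_mem_nhdsWithin
  have A : Tendsto (fun i => (∫ z, ((ρ i) ^ (m+1))⁻¹ * f i ((ρ i)⁻¹ • (z - g s)) ∂ν) -
      θ * ∫ t, ((ρ i) ^ (m+1))⁻¹ * f i ((ρ i)⁻¹ • (g t - g s))) l (𝓝 0) := by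
    rw [Metric.tendsto_nhds]
    intro κ hκ
    obtain ⟨r, hr, h⟩ := reduce_mu D hg hB (half_pos hκ)
    filter_upwards [hb, hρ (Ioc_mem_nhdsGT hr)] with i h1 h2
    rw [Real.dist_eq, sub_zero]
    refine (h _ h2 _ (by have := hm i; fun_prop) fun z => ?_).trans_lt (half_lt_self hκ)
    have hp : 0 < ρ i := h2.1
    rw [abs_mul, abs_of_pos (by positivity), pk_scale hp (norm_nonneg _), mul_left_comm]
    refine mul_le_mul_of_nonneg_left ((h1 _).trans (le_of_eq ?_)) (by positivity)
    rw [norm_smul, Real.norm_of_nonneg (inv_nonneg.2 hp.le), norm_sub_rev]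
  have qm : ∀ i, Measurable fun w => f i ((ρ i)⁻¹ • (g (s + ρ i • w) - g s)) := fun i => (hm i).comp (by fun_prop)
  have Lm : ∀ i, Measurable fun w => f i (L w) := fun i => (hm i).comp (by fun_prop)
  have bi := (pk_int (m := m) hcp one_pos).const_mul B
  have bd : ∀ᶠ i in l, ∀ w, |f i ((ρ i)⁻¹ • (g (s + ρ i • w) - g s))| ≤ B * pk (m+1) 1 (c * ‖w‖) ∧
      |f i (L w)| ≤ B * pk (m+1) 1 (c * ‖w‖) := by
    filter_upwards [hb, hρ0] with i h1 h2 w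
    constructor
    · exact (h1 _).trans (mul_le_mul_of_nonneg_left (pk_anti one_pos (by positivity) (q_lo hg h2 w)) hB)
    · exact (h1 _).trans (mul_le_mul_of_nonneg_left (pk_anti one_pos (by positivity) (L_lo hg hL w)) hB)
  have B2 : Tendsto (fun i => ∫ w, (f i ((ρ i)⁻¹ • (g (s + ρ i • w) - g s)) - f i (L w))) l (𝓝 0) := by
    have := tendsto_integral_filter_of_dominated_convergence (f := fun _ : EV (m+1) => (0:ℝ)) (l := l)
      (F := fun i w => f i ((ρ i)⁻¹ • (g (s + ρ i • w) - g s)) - f i (L w))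
      (fun w => B * pk (m+1) 1 (c * ‖w‖) + B * pk (m+1) 1 (c * ‖w‖)) (Eventually.of_forall fun i => ((qm i).sub (Lm i)).aestronglyMeasurable)
      (by filter_upwards [bd] with i h
          exact Eventually.of_forall fun w => (abs_sub _ _).trans (add_le_add (h w).1 (h w).2)) (bi.add bi) hc
    simpa using this
  have := A.add (B2.const_mul (θ:ℝ))
  rw [mul_zero, add_zero] at this
  refine this.congr' ?_
  filter_upwards [bd, hρ0] with i h1 h2
  have i1 : Integrable fun w => f i ((ρ i)⁻¹ • (g (s + ρ i • w) - g s)) :=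
    bi.mono' (qm i).aestronglyMeasurable (Eventually.of_forall fun w => (h1 w).1)
  have i2 : Integrable fun w => f i (L w) := bi.mono' (Lm i).aestronglyMeasurable (Eventually.of_forall fun w => (h1 w).2)
  have e1 := Measure.integral_comp_smul (volume : Measure (EV (m+1))) (fun t => f i ((ρ i)⁻¹ • (g (s + t) - g s))) (ρ i)
  have e2 := integral_add_left_eq_self (μ := (volume : Measure (EV (m+1)))) (fun t => f i ((ρ i)⁻¹ • (g t - g s))) s
  rw [e2, finrank_euclideanSpace_fin, abs_of_pos (by positivity), smul_eq_mul] at e1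
  rw [integral_sub i1 i2, e1]; simp only [integral_const_mul]
  ring
end
end

section
section
variable {m : ℕ} {C c Λ : ℝ} {K : EV (m+2) → ℝ} {g : EV (m+1) → EV (m+2)} {L : EV (m+1) →L[ℝ] EV (m+2)} {s : EV (m+1)}

def Ks {n : ℕ} (K : EV n → ℝ) (b : ℝ) (v : EV n) : ℝ := if b < ‖v‖ then K v else 0

theorem CZ.meas (hK : CZ m C K) : Measurable K := measurable_of_continuousOn_compl_singleton 0 hK.co

theorem CZ.ks_meas (hK : CZ m C K) (b : ℝ) : Measurable (Ks K b) :=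
  Measurable.ite (measurableSet_lt measurable_const measurable_norm) hK.meas measurable_const

theorem CZ.ks_bd (hK : CZ m C K) {b : ℝ} (hb : 0 < b) (v) : |Ks K b v| ≤ C / b ^ (m+1) := by
  unfold Ks; split_ifs with h
  · exact hK.rb.b0 b hb v h.le
  · have := hK.rb.nn; rw [abs_zero]; positivity

theorem CZ.ks_neg (hK : CZ m C K) (b : ℝ) (v) : Ks K b (-v) = -Ks K b v := by
  unfold Ks; rw [norm_neg, hK.odd]; split_ifs <;> simp

theorem CZ.ks_hom (hK : CZ m C K) (b : ℝ) {ρ : ℝ} (hρ : 0 < ρ) (v) : Ks K (b * ρ) v = (ρ ^ (m+1))⁻¹ * Ks K b (ρ⁻¹ • v) := by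
  have h := hK.hom (ρ⁻¹ • v) ρ hρ
  rw [smul_inv_smul₀ hρ.ne'] at h
  unfold Ks
  rw [norm_smul, Real.norm_of_nonneg (inv_nonneg.2 hρ.le)]
  by_cases hh : b * ρ < ‖v‖
  · rw [if_pos hh, if_pos ((lt_inv_mul_iff₀' hρ).2 hh), h]
  · rw [if_neg hh, if_neg (mt (lt_inv_mul_iff₀' hρ).1 hh), mul_zero]

theorem CZ.ks_cont (hK : CZ m C K) {b : ℝ} (hb : 0 < b) {v : EV (m+2)} (hv : ‖v‖ ≠ b) : ContinuousAt (Ks K b) v := by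
  rcases lt_or_gt_of_ne hv with h | h
  · have : Ks K b =ᶠ[𝓝 v] fun _ => 0 := by
      filter_upwards [continuous_norm.continuousAt.eventually (gt_mem_nhds h)] with u hu
      simp [Ks, not_lt.2 hu.le]
    exact continuousAt_const.congr this.symm
  · have : Ks K b =ᶠ[𝓝 v] K := by
      filter_upwards [continuous_norm.continuousAt.eventually (lt_mem_nhds h)] with u hu
      simp only [Ks, if_pos hu]
    have h0 : v ≠ 0 := norm_pos_iff.1 (hb.trans h)
    exact (hK.co.continuousAt (isOpen_compl_singleton.mem_nhds h0)).congr this.symm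

def cbd (m : ℕ) (C b M : ℝ) : ℝ := C * (1 / b ^ (m+1) + 1 + M) * (1 + 2 * M) ^ (m+2)

theorem cz_cb (hK : CZ m C K) {b M : ℝ} (hb : 0 < b) (hb1 : b ≤ 1) (hM : 1 ≤ M) {e : EV (m+2)} (he : ‖e‖ ≤ M) (v) :
    |Ks K b (e - v) - Ks K 1 (-v)| ≤ cbd m C b M * pk (m+1) 1 ‖v‖ := by
  have hC := hK.rb.nn
  unfold cbd
  have hp := pk_nonneg (n := m+1) zero_le_one (norm_nonneg v)
  rcases le_or_gt ‖v‖ (2 * M) with h | h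
  · have h1 := hK.ks_bd hb (e - v)
    have h2 := hK.ks_bd one_pos (-v)
    have h3 := pk_ge (n := m+1) (2 * M) one_pos (norm_nonneg v) (by linarith)
    rw [one_pow, inv_one] at h3
    rw [one_pow, div_one] at h2
    calc _ ≤ C / b ^ (m+1) + C := (abs_sub _ _).trans (add_le_add h1 h2)
      _ ≤ C * (1 / b ^ (m+1) + 1 + M) * 1 := by rw [mul_one, mul_add, mul_add, mul_one_div, mul_one]; have := mul_nonneg hC (zero_le_one.trans hM); linarith
      _ ≤ _ := by rw [mul_assoc _ _ (pk _ _ _)]; gcongr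
  · have n1 : ‖v‖ / 2 ≤ ‖e - v‖ := by have := norm_sub_norm_le v e; rw [norm_sub_rev] at this; linarith
    have n2 : ‖v‖ / 2 ≤ ‖-v‖ := by rw [norm_neg]; linarith [norm_nonneg v]
    have h1 := hK.rb.b1 (‖v‖ / 2) (by linarith) _ _ n1 n2
    rw [Ks, Ks, if_pos (by linarith), if_pos (by linarith)]
    rw [sub_neg_eq_add, sub_add_cancel] at h1
    have n3 : (1 + ‖v‖) / 3 ≤ ‖v‖ / 2 := by linarith
    have n4 : (3:ℝ) ^ (m+2) ≤ (1 + 2 * M) ^ (m+2) := by gcongr; linarith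
    calc _ ≤ _ := h1
      _ ≤ C * M / ((1 + ‖v‖) / 3) ^ (m+2) := by gcongr
      _ = C * M * 3 ^ (m+2) * pk (m+1) 1 ‖v‖ := by unfold pk; rw [div_pow]; field_simp
      _ ≤ _ := by
        gcongr
        have : 0 ≤ 1 / b ^ (m+1) := by positivity
        linarith

theorem CZ.cbd_nn (hK : CZ m C K) {b M : ℝ} (hb : 0 < b) (hM : 1 ≤ M) : 0 ≤ cbd m C b M := by
  have hC := hK.rb.nn; unfold cbd; positivity

/-- linear data -/
structure LN (c : ℝ) (L : EV (m+1) →L[ℝ] EV (m+2)) (N : EV (m+2)) : Prop where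
  cp : 0 < c
  lo : ∀ w, c * ‖w‖ ≤ ‖L w‖
  n1 : ‖N‖ = 1
  pp : ∀ w, ⟪L w, N⟫ = 0

theorem LN.ge {N} (h : LN c L N) (e : EV (m+2)) (w) : ⟪e, N⟫ ≤ ‖e - L w‖ := by
  have := real_inner_le_norm (e - L w) N
  rwa [inner_sub_left, h.pp, sub_zero, h.n1, mul_one] at this

theorem LN.decomp {N} (h : LN c L N) (e : EV (m+2)) : ∃ w, e = ⟪e, N⟫ • N + L w := by
  let f : (EV (m+1) × ℝ) →ₗ[ℝ] EV (m+2) := (L : EV (m+1) →ₗ[ℝ] EV (m+2)).coprod (LinearMap.toSpanSingleton ℝ _ N)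
  have hN : ⟪N, N⟫ = 1 := by rw [real_inner_self_eq_norm_sq, h.n1, one_pow]
  have ap : ∀ p, f p = L p.1 + p.2 • N := fun p => by simp [f]
  have ht : ∀ p, ⟪f p, N⟫ = p.2 := fun p => by rw [ap, inner_add_left, h.pp, inner_smul_left, hN]; simp
  have inj : Function.Injective f := by
    rw [← LinearMap.ker_eq_bot, LinearMap.ker_eq_bot']
    intro p hp
    have h2 := ht p
    rw [hp, inner_zero_left] at h2
    have h3 := h.lo p.1
    rw [ap, ← h2, zero_smul, add_zero] at hp
    rw [hp, norm_zero] at h3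
    have : ‖p.1‖ ≤ 0 := by by_contra hh; push Not at hh; have := mul_pos h.cp hh; linarith
    exact Prod.ext (norm_le_zero_iff.1 this) h2.symm
  have sur := (LinearMap.injective_iff_surjective_of_finrank_eq_finrank (f := f) (by simp)).1 inj
  obtain ⟨p, rfl⟩ := sur e
  exact ⟨p.1, by rw [ht, ap]; exact add_comm _ _⟩

theorem LN.sphere {N} (h : LN c L N) : ∀ᵐ w, ‖L w‖ ≠ 1 := by
  have cv : Convex ℝ {w | ‖L w‖ ≤ 1} := by
    have e : {w | ‖L w‖ ≤ 1} = (L : EV (m+1) →ₗ[ℝ] EV (m+2)) ⁻¹' closedBall 0 1 := by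
      ext w; rw [mem_preimage, mem_closedBall_zero_iff]; rfl
    rw [e]
    exact (convex_closedBall (0 : EV (m+2)) 1).linear_preimage _
  refine measure_mono_null (fun w hw => ?_) (cv.addHaar_frontier volume)
  simp only [mem_compl_iff, mem_ofPred_eq, not_not] at hw
  refine ⟨subset_closure hw.le, fun hi => ?_⟩
  have t : Tendsto (fun r : ℝ => (1 + r) • w) (𝓝[>] 0) (𝓝 w) := by
    have : Continuous fun r : ℝ => (1 + r) • w := by fun_prop
    have := this.tendsto 0
    simp only [add_zero, one_smul] at this
    exact this.mono_left nhdsWithin_le_nhds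
  obtain ⟨r, h1, h2⟩ := ((t.eventually (isOpen_interior.mem_nhds hi)).and self_mem_nhdsWithin).exists
  have h3 : ‖L ((1 + r) • w)‖ ≤ 1 := (interior_subset : interior {w | ‖L w‖ ≤ 1} ⊆ _) h1
  have h2 : 0 < r := h2
  rw [map_smul, norm_smul, hw, Real.norm_of_nonneg (by linarith)] at h3
  linarith

def Ph (K : EV (m+2) → ℝ) (L : EV (m+1) →L[ℝ] EV (m+2)) (e : EV (m+2)) : ℝ := ∫ w, (K (e - L w) - Ks K 1 (-L w))

theorem Ph_neg (hK : CZ m C K) (e) : Ph K L (-e) = -Ph K L e := by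
  unfold Ph
  rw [← integral_neg_eq_self, ← integral_neg]
  congr 1; ext w
  rw [map_neg, show -e - -L w = -(e - L w) by abel, hK.odd, hK.ks_neg]; ring

theorem Ph_int (hK : CZ m C K) {N} (h : LN c L N) {e : EV (m+2)} (he : 0 < ⟪e, N⟫) :
    Integrable fun w => K (e - L w) - Ks K 1 (-L w) := by
  have hb : 0 < min 1 (⟪e, N⟫ / 2) := by positivity
  have hcp := h.cp
  refine ((pk_int (m := m) hcp one_pos).const_mul (cbd m C (min 1 (⟪e, N⟫ / 2)) (max 1 ‖e‖))).mono' ?_ (Eventually.of_forall fun w => ?_)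
  · have := hK.meas; have := hK.ks_meas 1
    exact Measurable.aestronglyMeasurable (by fun_prop)
  · have := cz_cb hK hb (min_le_left _ _) (le_max_left 1 ‖e‖) (le_max_right _ _) (L w)
    rw [Ks, if_pos ((min_le_right _ _).trans_lt ((half_lt_self he).trans_le (h.ge e w)))] at this
    exact this.trans (mul_le_mul_of_nonneg_left (pk_anti one_pos (by positivity) (h.lo w)) (hK.cbd_nn hb (le_max_left _ _)))

theorem Ph_smul (hK : CZ m C K) {N} (h : LN c L N) {e : EV (m+2)} (he : 0 < ⟪e, N⟫) {r : ℝ} (hr : 0 < r) :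
    Ph K L (r • e) = Ph K L e := by
  have i1 := Ph_int hK h he
  have i2 := Ph_int hK h (e := r • e) (by rw [inner_smul_left]; exact mul_pos hr he)
  have e1 := Measure.integral_comp_smul (volume : Measure (EV (m+1))) (fun w => K (r • e - L w) - Ks K 1 (-L w)) r
  rw [finrank_euclideanSpace_fin, abs_of_pos (by positivity), smul_eq_mul] at e1
  have e2 : ∀ w, K (r • e - L (r • w)) - Ks K 1 (-L (r • w)) = (r ^ (m+1))⁻¹ * (K (e - L w) - Ks K r⁻¹ (-L w)) := fun w => by
    have h2 := hK.ks_hom r⁻¹ hr (r • (-L w))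
    rw [inv_mul_cancel₀ hr.ne', inv_smul_smul₀ hr.ne'] at h2
    rw [map_smul, ← smul_sub, hK.hom _ _ hr, ← smul_neg, h2]; ring
  have i3 := i2.comp_smul hr.ne'
  simp only [e2] at i3 e1
  rw [integral_const_mul] at e1
  have e3 : Ph K L (r • e) = ∫ w, (K (e - L w) - Ks K r⁻¹ (-L w)) := (mul_left_cancel₀ (by positivity) e1).symm
  have i4 : Integrable fun w => K (e - L w) - Ks K r⁻¹ (-L w) := (i3.const_mul (r ^ (m+1))).congr
    (Eventually.of_forall fun w => by simp only; rw [mul_inv_cancel_left₀ (by positivity)])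
  rw [e3, ← sub_eq_zero, Ph, ← integral_sub i4 i1]
  have : ∀ q : EV (m+1) → ℝ, (∀ w, q (-w) = - q w) → ∫ w, q w = 0 := fun q hq => by
    have h := integral_neg_eq_self q volume
    simp only [hq, integral_neg] at h; linarith
  refine this _ fun w => ?_
  simp only [map_neg, hK.ks_neg]; ring
end
end

section
section
variable {m : ℕ} {C c Λ : ℝ} {K : EV (m+2) → ℝ} {g : EV (m+1) → EV (m+2)} {L : EV (m+1) →L[ℝ] EV (m+2)} {s : EV (m+1)}

theorem a_bd (hK : CZ m C K) {N} (h : LN c L N) {e : EV (m+2)} (he : 0 < ⟪e, N⟫) :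
    ∃ A, 0 ≤ A ∧ ∀ w, |K (e - L w)| ≤ A * ((1 + c * ‖w‖) * pk (m+1) 1 (c * ‖w‖)) := by
  have hb : 0 < min 1 (⟪e, N⟫ / 2) := by positivity
  have hcp := h.cp; have hC := hK.rb.nn
  have hB := hK.cbd_nn hb (le_max_left 1 ‖e‖)
  obtain ⟨B, hB'⟩ : ∃ B, B = cbd m C (min 1 (⟪e, N⟫ / 2)) (max 1 ‖e‖) := ⟨_, rfl⟩
  refine ⟨B + C * 2 ^ (m+1), by rw [hB']; positivity, fun w => ?_⟩
  have h1 := cz_cb hK hb (min_le_left _ _) (le_max_left 1 ‖e‖) (le_max_right _ _) (L w)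
  rw [Ks, if_pos ((min_le_right _ _).trans_lt ((half_lt_self he).trans_le (h.ge e w))), ← hB'] at h1
  rw [← hB'] at hB
  have hl := h.lo w
  have h0 : 0 ≤ c * ‖w‖ := by positivity
  generalize c * ‖w‖ = d at *
  have hp := pk_nonneg (n := m+1) zero_le_one h0
  have h2 : |Ks K 1 (-L w)| ≤ C * 2 ^ (m+1) * ((1 + d) * pk (m+1) 1 d) := by
    have e1 : C * 2 ^ (m+1) * ((1 + d) * pk (m+1) 1 d) = C / ((1 + d) / 2) ^ (m+1) := by
      unfold pk; rw [div_pow, pow_succ (1 + d) (m+1)]; field_simp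
    rw [e1]; unfold Ks; split_ifs with hh
    · exact hK.rb.b0 _ (by positivity) _ (by rw [norm_neg] at hh ⊢; linarith)
    · rw [abs_zero]; positivity
  have h3 : B * pk (m+1) 1 ‖L w‖ ≤ B * ((1 + d) * pk (m+1) 1 d) :=
    mul_le_mul_of_nonneg_left ((pk_anti one_pos h0 hl).trans (le_mul_of_one_le_left hp (by linarith))) hB
  have h4 := abs_sub_abs_le_abs_sub (K (e - L w)) (Ks K 1 (-L w))
  rw [add_mul]; linarith

set_option maxHeartbeats 800000 in
theorem Ph_add (hK : CZ m C K) {N} (h : LN c L N) {e : EV (m+2)} (he : 0 < ⟪e, N⟫) (u : EV (m+1)) :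
    Ph K L (e + L u) = Ph K L e := by
  have he' : 0 < ⟪e + L u, N⟫ := by rwa [inner_add_left, h.pp, add_zero]
  have hcp := h.cp
  have i1 := Ph_int hK h he
  have i2 := Ph_int hK h he'
  obtain ⟨A, hA, hb⟩ := a_bd hK h he
  obtain ⟨a, ha⟩ : ∃ a : EV (m+1) → ℝ, a = fun w => K (e - L w) := ⟨_, rfl⟩
  have ha1 : ∀ w, K (e + L u - L w) = a (w - u) := fun w => by rw [ha]; simp only [map_sub]; congr 1; abel
  have ha2 : ∀ w, K (e - L w) = a w := fun w => by rw [ha]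
  have ac : Continuous a := by
    rw [ha]
    refine hK.co.comp_continuous (by fun_prop) fun w => ?_
    have := he.trans_le (h.ge e w)
    exact norm_pos_iff.1 this
  have i3 := i2.sub i1
  rw [← sub_eq_zero, Ph, Ph, ← integral_sub i2 i1]
  simp only [Pi.sub_def, ha1, ha2, sub_sub_sub_cancel_right] at i3 hb ⊢
  obtain ⟨χ, hχ⟩ : ∃ χ : ℕ → EV (m+1) → ℝ, χ = fun (k : ℕ) w => max 0 (1 - ‖w‖ / ((k:ℝ) + 1)) := ⟨_, rfl⟩
  have χ0 : ∀ k w, 0 ≤ χ k w := fun k w => by rw [hχ]; exact le_max_left _ _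
  have χ1 : ∀ k w, χ k w ≤ 1 := fun k w => by
    rw [hχ]; refine max_le zero_le_one ?_
    have : 0 ≤ ‖w‖ / ((k:ℝ) + 1) := by positivity
    linarith
  have χc : ∀ k, Continuous (χ k) := fun k => by rw [hχ]; fun_prop
  have χz : ∀ (k : ℕ) w, (k:ℝ) + 1 ≤ ‖w‖ → χ k w = 0 := fun k w hw => by
    rw [hχ]; refine max_eq_left ?_
    have : 1 ≤ ‖w‖ / ((k:ℝ) + 1) := (one_le_div (by positivity)).2 hw
    linarith
  have χl : ∀ (k : ℕ) w, |χ k (w + u) - χ k w| ≤ ‖u‖ / (k + 1) := fun k w => by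
    rw [hχ]
    refine (abs_max_sub_max_le_max _ _ _ _).trans (max_le (by rw [sub_zero, abs_zero]; positivity) ?_)
    rw [show 1 - ‖w + u‖ / ((k:ℝ) + 1) - (1 - ‖w‖ / (k + 1)) = (‖w‖ - ‖w + u‖) / (k + 1) by ring, abs_div, abs_of_pos (by positivity : 0 < (k:ℝ) + 1)]
    gcongr
    have := abs_norm_sub_norm_le w (w + u)
    rwa [sub_add_cancel_left, norm_neg] at this
  have cs : ∀ k u', Integrable fun w => a w * χ k (w + u') := fun k u' => by
    refine (ac.mul ((χc k).comp (continuous_id.add continuous_const))).integrable_of_hasCompactSupport ?_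
    refine HasCompactSupport.intro (isCompact_closedBall 0 ((k:ℝ) + 1 + ‖u'‖)) fun w hw => ?_
    rw [mem_closedBall_zero_iff, not_le] at hw
    have := norm_sub_norm_le w (-u')
    rw [sub_neg_eq_add, norm_neg] at this
    change a w * χ k (w + u') = 0
    rw [χz k (w + u') (by linarith), mul_zero]
  have t1 : Tendsto (fun k => ∫ w, (a (w - u) - a w) * χ k w) atTop (𝓝 (∫ w, (a (w - u) - a w))) := by
    refine tendsto_integral_of_dominated_convergence (fun w => |a (w - u) - a w|)
      (fun k => Continuous.aestronglyMeasurable (by have := χc k; fun_prop)) i3.abs (fun k => Eventually.of_forall fun w => ?_)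
      (Eventually.of_forall fun w => ?_)
    · rw [Real.norm_eq_abs, abs_mul, abs_of_nonneg (χ0 k w)]
      exact mul_le_of_le_one_right (abs_nonneg _) (χ1 k w)
    · have : Tendsto (fun k => χ k w) atTop (𝓝 1) := by
        have h1 : Tendsto (fun k : ℕ => max 0 (1 - ‖w‖ * (1 / ((k:ℝ) + 1)))) atTop (𝓝 (max 0 (1 - ‖w‖ * 0))) :=
          tendsto_const_nhds.max (tendsto_const_nhds.sub (tendsto_one_div_add_atTop_nhds_zero_nat.const_mul _))
        simpa [hχ, div_eq_mul_inv] using h1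
      simpa using this.const_mul (a (w - u) - a w)
  have e1 : ∀ k, ∫ w, (a (w - u) - a w) * χ k w = ∫ w, a w * (χ k (w + u) - χ k w) := fun k => by
    have j1 := (cs k u).comp_sub_right u
    have j2 := cs k 0
    have j3 := integral_sub_right_eq_self (μ := volume) (fun w => a w * χ k (w + u)) u
    simp only [sub_add_cancel, add_zero] at j1 j2 j3
    simp only [sub_mul, mul_sub]
    rw [integral_sub j1 j2, integral_sub (cs k u) j2, j3]
  have t2 : Tendsto (fun k => ∫ w, a w * (χ k (w + u) - χ k w)) atTop (𝓝 (∫ w : EV (m+1), (0:ℝ))) := by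
    refine tendsto_integral_of_dominated_convergence (fun w => A * ((1 + c * (1 + ‖u‖)) * ‖u‖) * pk (m+1) 1 (c * ‖w‖))
      (fun k => Continuous.aestronglyMeasurable (by have := χc k; fun_prop)) ((pk_int hcp one_pos).const_mul _)
      (fun k => Eventually.of_forall fun w => ?_) (Eventually.of_forall fun w => ?_)
    · have hp := pk_nonneg (n := m+1) zero_le_one (show 0 ≤ c * ‖w‖ by positivity)
      rcases le_or_gt ((k:ℝ) + 1 + ‖u‖) ‖w‖ with hw | hw
      · have := norm_sub_norm_le w (-u)
        rw [sub_neg_eq_add, norm_neg] at this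
        rw [χz k _ (by linarith), χz k w (by linarith [norm_nonneg u]), sub_self, mul_zero, norm_zero]; positivity
      · rw [Real.norm_eq_abs, abs_mul]
        have k0 : 0 < (k:ℝ) + 1 := by positivity
        have k1 : 1 ≤ (k:ℝ) + 1 := by have := Nat.cast_nonneg (α := ℝ) k; linarith
        have q : (1 + c * ‖w‖) / (k + 1) ≤ 1 + c * (1 + ‖u‖) := by
          rw [div_le_iff₀ k0]
          have h1 : ‖w‖ ≤ (1 + ‖u‖) * (k + 1) := by
            have := mul_le_mul_of_nonneg_left k1 (norm_nonneg u); linarith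
          have := mul_le_mul_of_nonneg_left h1 hcp.le
          linarith
        calc _ ≤ A * ((1 + c * ‖w‖) * pk (m+1) 1 (c * ‖w‖)) * (‖u‖ / (k + 1)) :=
              mul_le_mul (hb w) (χl k w) (abs_nonneg _) (by positivity)
          _ = A * ((1 + c * ‖w‖) / (k + 1) * ‖u‖) * pk (m+1) 1 (c * ‖w‖) := by ring
          _ ≤ _ := by gcongr
    · refine squeeze_zero_norm (a := fun k : ℕ => |a w| * ‖u‖ * (1 / ((k:ℝ) + 1))) (fun k => ?_) ?_
      · rw [Real.norm_eq_abs, abs_mul, mul_assoc, mul_one_div]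
        exact mul_le_mul_of_nonneg_left (χl k w) (abs_nonneg _)
      · simpa using tendsto_one_div_add_atTop_nhds_zero_nat.const_mul (|a w| * ‖u‖)
  simp only [e1] at t1
  rw [integral_zero] at t2
  exact tendsto_nhds_unique t1 t2

theorem Ph_const (hK : CZ m C K) {N} (h : LN c L N) {e : EV (m+2)} (he : 0 < ⟪e, N⟫) : Ph K L e = Ph K L N := by
  have hN : ⟪N, N⟫ = 1 := by rw [real_inner_self_eq_norm_sq, h.n1, one_pow]
  obtain ⟨w, hw⟩ := h.decomp e
  rw [hw, Ph_add hK h (by rw [inner_smul_left, hN]; simpa using he), Ph_smul hK h (by rw [hN]; exact one_pos) he]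

theorem CZ.ks_int (hK : CZ m C K) {b : ℝ} (hb : 0 < b) (y) (ν : Measure (EV (m+2))) [IsFiniteMeasure ν] :
    Integrable (fun z => Ks K b (y - z)) ν :=
  Integrable.of_bound ((hK.ks_meas b).comp (measurable_const.sub measurable_id)).aestronglyMeasurable _
    (Eventually.of_forall fun z => hK.ks_bd hb _)

set_option maxHeartbeats 800000 in
theorem cone_lim (hK : CZ m C K) (hg : BLip c Λ g) (hL : HasFDerivAt g L s) {ν : Measure (EV (m+2))} [IsFiniteMeasure ν] {θ ωp ωm}
    (D : Dec g ν (g s) θ ωp ωm) {N} (h : LN c L N) {a b : ℝ} (hb : 0 < b) (hab : b < a) (ha : a < 1) :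
    Tendsto (fun y => (∫ z, Ks K (b * ‖g s - y‖) (y - z) ∂ν) - ∫ z, Ks K ‖g s - y‖ (g s - z) ∂ν)
      (𝓝[{y | a * ‖y - g s‖ < ⟪y - g s, N⟫}] (g s)) (𝓝 (θ * Ph K L N)) := by
  obtain ⟨l, hl⟩ : ∃ l, l = 𝓝[{y | a * ‖y - g s‖ < ⟪y - g s, N⟫}] (g s) := ⟨_, rfl⟩
  have lc : l.IsCountablyGenerated := by rw [hl]; infer_instance
  rw [← hl]
  have mem : ∀ᶠ y in l, 0 < ‖g s - y‖ ∧ a * ‖g s - y‖ < ⟪y - g s, N⟫ := by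
    rw [hl]; filter_upwards [self_mem_nhdsWithin] with y hy
    rw [norm_sub_rev]
    refine ⟨norm_pos_iff.2 fun h0 => ?_, hy⟩
    have hy : a * ‖y - g s‖ < ⟪y - g s, N⟫ := hy
    rw [h0] at hy; simp at hy
  have hρ : Tendsto (fun y => ‖g s - y‖) l (𝓝[>] 0) := by
    refine tendsto_nhdsWithin_iff.2 ⟨?_, mem.mono fun y hy => hy.1⟩
    have : Continuous fun y => ‖g s - y‖ := by fun_prop
    have := (this.tendsto (g s)).mono_left (nhdsWithin_le_nhds (s := {y | a * ‖y - g s‖ < ⟪y - g s, N⟫}))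
    rwa [sub_self, norm_zero, ← hl] at this
  obtain ⟨ε, hε⟩ : ∃ ε : EV (m+2) → EV (m+2), ε = fun y => ‖g s - y‖⁻¹ • (y - g s) := ⟨_, rfl⟩
  have emem : ∀ᶠ y in l, ‖ε y‖ = 1 ∧ a < ⟪ε y, N⟫ := by
    filter_upwards [mem] with y ⟨h1, h2⟩
    rw [hε]; simp only
    rw [norm_smul, norm_inv, norm_norm, norm_sub_rev y, inv_mul_cancel₀ h1.ne', real_inner_smul_left, lt_inv_mul_iff₀' h1]
    exact ⟨rfl, h2⟩
  have km := hK.ks_meas b; have km1 := hK.ks_meas 1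
  have main := blow hg hL D hρ (f := fun y v => Ks K b (ε y - v) - Ks K 1 (-v)) (fun y => by fun_prop)
    (hK.cbd_nn hb le_rfl) (by filter_upwards [emem] with y hy v using cz_cb hK hb (by linarith) le_rfl hy.1.le v) (by
    filter_upwards [h.sphere] with w hw
    have q := (q_lim hL w).comp hρ
    obtain ⟨Q, hQ⟩ : ∃ Q : EV (m+2) → EV (m+2), Q = fun y => ‖g s - y‖⁻¹ • (g (s + ‖g s - y‖ • w) - g s) := ⟨_, rfl⟩
    have q : Tendsto Q l (𝓝 (L w)) := by rw [hQ]; exact q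
    have q0 : Tendsto (fun y => ‖Q y - L w‖) l (𝓝 0) := by simpa using (q.sub_const (L w)).norm
    have t2 : Tendsto (fun y => Ks K 1 (- Q y) - Ks K 1 (-L w)) l (𝓝 0) := by
      have := ((hK.ks_cont one_pos (v := -L w) (by rwa [norm_neg])).tendsto.comp q.neg).sub_const (Ks K 1 (-L w))
      simpa using this
    have t1 : Tendsto (fun y => Ks K b (ε y - Q y) - Ks K b (ε y - L w)) l (𝓝 0) := by
      refine squeeze_zero_norm' (a := fun y => C / b ^ (m+2) * ‖Q y - L w‖) ?_ (by simpa using q0.const_mul (C / b ^ (m+2)))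
      filter_upwards [emem, q0.eventually (gt_mem_nhds (sub_pos.2 hab))] with y h1 h2
      have h3 := h1.2.trans_le (h.ge (ε y) w)
      have h4 := norm_sub_norm_le (ε y - L w) (Q y - L w)
      rw [sub_sub_sub_cancel_right] at h4
      rw [Ks, Ks, if_pos (by linarith), if_pos (by linarith), Real.norm_eq_abs]
      refine (hK.rb.b1 b hb _ _ (by linarith) (by linarith)).trans (le_of_eq ?_)
      rw [sub_sub_sub_cancel_left, norm_sub_rev]; ring
    have := t1.sub t2
    rw [sub_zero] at this
    refine this.congr fun y => ?_
    simp only [hQ]; ring)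
  have := main.add_const (θ * Ph K L N)
  rw [zero_add] at this
  refine this.congr' ?_
  filter_upwards [mem, emem] with y h1 h2
  have hp := h1.1
  have e1 : ∫ w, (Ks K b (ε y - L w) - Ks K 1 (-L w)) = Ph K L N := by
    rw [← Ph_const hK h (hb.trans (hab.trans h2.2)), Ph]
    congr 1; ext w
    rw [Ks, if_pos ((hab.trans h2.2).trans_le (h.ge _ w))]
  rw [e1, sub_add_cancel, ← integral_sub (hK.ks_int (by positivity) y ν) (hK.ks_int hp _ ν)]
  congr 1; ext z
  have e2 := hK.ks_hom 1 hp (g s - z)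
  rw [one_mul] at e2
  rw [hK.ks_hom b hp, e2, mul_sub, hε]
  simp only [smul_sub]
  congr 3 <;> abel
end
end

section
section
variable {m : ℕ} {C c Λ : ℝ} {K : EV (m+2) → ℝ} {g : EV (m+1) → EV (m+2)} {L : EV (m+1) →L[ℝ] EV (m+2)} {s : EV (m+1)}

theorem uc_bd (hK : CZ m C K) (v) : |K v * (1 - uc (m+2) v)| ≤ C * 2 ^ (m+1) := by
  have hC := hK.rb.nn
  rcases le_total ‖v‖ (1/2) with h | h
  · rw [uc_one h]; simp; positivity
  · have := hK.rb.b0 (1/2) (by norm_num) v h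
    have u0 := uc_nonneg v; have u1 := uc_le_one v
    rw [abs_mul, abs_of_nonneg (by linarith : 0 ≤ 1 - uc (m+2) v)]
    refine (mul_le_of_le_one_right (abs_nonneg _) (by linarith)).trans (this.trans (le_of_eq ?_))
    rw [div_pow, one_pow]; field_simp

set_option maxHeartbeats 800000 in
theorem pv_lim (hK : CZ m C K) (hg : BLip c Λ g) (hL : HasFDerivAt g L s) {ν : Measure (EV (m+2))} [IsFiniteMeasure ν] {θ ωp ωm}
    (D : Dec g ν (g s) θ ωp ωm) {H : ℝ} (hH : Tendsto (fun ε => ∫ z, Kt K ε 1 (g s - z) ∂ν) (𝓝[>] 0) (𝓝 H)) :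
    ∃ p, Tendsto (fun ε => ∫ z, Ks K ε (g s - z) ∂ν) (𝓝[>] 0) (𝓝 p) := by
  have hC := hK.rb.nn; have hcp := hg.cpos
  have um := (uc_cont (n := m+2)).measurable
  obtain ⟨ψ, hψ⟩ : ∃ ψ : EV (m+2) → ℝ, ψ = fun v => Ks K 1 v - K v * (1 - uc (m+2) v) := ⟨_, rfl⟩
  have ψm : Measurable ψ := by rw [hψ]; have := hK.ks_meas 1; have := hK.meas; fun_prop
  have ψo : ∀ v, ψ (-v) = - ψ v := fun v => by simp only [hψ, hK.ks_neg, hK.odd, uc_neg]; ring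
  have ψf : ∀ v, 1 < ‖v‖ → ψ v = 0 := fun v hv => by simp only [hψ, Ks, if_pos hv, uc_zero hv.le]; ring
  have ψb : ∀ v, |ψ v| ≤ C * 2 ^ (m+1) * 2 ^ (m+2) * pk (m+1) 1 ‖v‖ := fun v => by
    have hp := pk_nonneg (n := m+1) zero_le_one (norm_nonneg v)
    rcases lt_or_ge 1 ‖v‖ with h | h
    · rw [ψf v h, abs_zero]; positivity
    · have h3 := pk_ge (n := m+1) 1 one_pos (norm_nonneg v) (by linarith)
      rw [one_pow, inv_one, one_add_one_eq_two] at h3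
      simp only [hψ, Ks, if_neg (not_lt.2 h), zero_sub, abs_neg]
      refine (uc_bd hK v).trans ?_
      rw [mul_assoc _ ((2:ℝ) ^ (m+2))]
      exact le_mul_of_one_le_right (by positivity) h3
  have ψc : ∀ v, v ≠ 0 → ‖v‖ ≠ 1 → ContinuousAt ψ v := fun v h0 h1 => by
    rw [hψ]
    exact (hK.ks_cont one_pos h1).sub ((hK.co.continuousAt (isOpen_compl_singleton.mem_nhds h0)).mul
      (continuousAt_const.sub uc_cont.continuousAt))
  have sph : ∀ᵐ w, ‖L w‖ ≠ 1 := by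
    by_cases h : ∃ N, LN c L N
    · exact h.choose_spec.sphere
    · exfalso; apply h
      have hr : (LinearMap.range (L : EV (m+1) →ₗ[ℝ] EV (m+2))) ≠ ⊤ := fun ht => by
        have h1 := LinearMap.finrank_range_le (L : EV (m+1) →ₗ[ℝ] EV (m+2))
        rw [ht, finrank_top] at h1
        simp at h1
      have h2 := (Submodule.orthogonal_eq_bot_iff.not).2 hr
      obtain ⟨x, hx, x0⟩ := Submodule.exists_mem_ne_zero_of_ne_bot h2
      refine ⟨‖x‖⁻¹ • x, hcp, L_lo hg hL, norm_smul_inv_norm x0, fun w => ?_⟩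
      rw [inner_smul_right, (Submodule.mem_orthogonal _ x).1 hx (L w) ⟨w, rfl⟩, mul_zero]
  have main := blow hg hL D (l := 𝓝[>] (0:ℝ)) tendsto_id (f := fun _ v => ψ (-v)) (fun _ => by fun_prop)
    (B := C * 2 ^ (m+1) * 2 ^ (m+2)) (by positivity) (Eventually.of_forall fun _ v => by have := ψb (-v); rwa [norm_neg] at this) (by
    filter_upwards [sph, Measure.ae_ne volume 0] with w hw h0
    have : L w ≠ 0 := norm_pos_iff.1 ((mul_pos hcp (norm_pos_iff.2 h0)).trans_le (L_lo hg hL w))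
    have := ((ψc (-L w) (neg_ne_zero.2 this) (by rwa [norm_neg])).tendsto.comp (q_lim hL w).neg).sub_const (ψ (-L w))
    simpa using this)
  have e0 : ∫ w, ψ (-L w) = 0 := by
    have := integral_neg_eq_self (fun w => ψ (-L w)) volume
    simp only [map_neg, ψo, integral_neg] at this ⊢; linarith
  simp only [e0, mul_zero, sub_zero, id] at main
  refine ⟨0 + H + ∫ z, K (g s - z) * (1 - uc (m+2) (g s - z)) ∂ν, ((main.add hH).add_const _).congr' ?_⟩
  filter_upwards [Ioc_mem_nhdsGT (show (0:ℝ) < 1/2 by norm_num)] with ε hε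
  have hp := hε.1
  have Km := hK.meas
  have i1 : Integrable (fun z => (ε ^ (m+1))⁻¹ * ψ (-(ε⁻¹ • (z - g s)))) ν := by
    refine Integrable.const_mul (Integrable.of_bound (Measurable.aestronglyMeasurable (by fun_prop)) (C * 2 ^ (m+1) * 2 ^ (m+2) * 1)
      (Eventually.of_forall fun z => (ψb _).trans ?_)) _
    gcongr
    have := pk_le (n := m+1) one_pos le_rfl (norm_nonneg (-(ε⁻¹ • (z - g s))))
    simpa using this
  have i2 : Integrable (fun z => Kt K ε 1 (g s - z)) ν :=
    Integrable.of_bound ((Kt_cont hK.co hp).comp (continuous_const.sub continuous_id)).aestronglyMeasurable _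
      (Eventually.of_forall fun z => hK.bd hp one_pos _)
  have i3 : Integrable (fun z => K (g s - z) * (1 - uc (m+2) (g s - z))) ν :=
    Integrable.of_bound (Measurable.aestronglyMeasurable (by fun_prop)) _ (Eventually.of_forall fun z => uc_bd hK _)
  have i12 := i1.add i2
  simp only [Pi.add_def] at i12
  rw [← integral_add i1 i2, ← integral_add i12 i3]
  congr 1; ext z
  rw [← smul_neg, neg_sub]
  generalize g s - z = v
  have e2 := hK.ks_hom 1 hp v
  have e3 := hK.hom (ε⁻¹ • v) ε hp
  rw [one_mul] at e2
  rw [smul_inv_smul₀ hp.ne'] at e3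
  have e4 : uc (m+2) (ε⁻¹ • v) * (1 - uc (m+2) v) = 0 := by
    rcases le_total ‖v‖ ε with h | h
    · rw [uc_one (v := v) (h.trans hε.2)]; ring
    · rw [uc_zero (v := ε⁻¹ • v), zero_mul]
      rw [norm_smul, Real.norm_of_nonneg (inv_nonneg.2 hp.le), le_inv_mul_iff₀ hp]; linarith
  rw [e2, hψ]; simp only [Kt, inv_one, one_smul]
  rw [mul_sub, ← mul_assoc _ (K _), ← e3]
  linear_combination K v * e4

theorem PF (hK : CZ m C K) (hg : BLip c Λ g) (ν : Measure (EV (m+2))) [IsFiniteMeasure ν] :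
    ∀ᵐ s, ∀ L : EV (m+1) →L[ℝ] EV (m+2), HasFDerivAt g L s → ∃ p, Tendsto (fun ε => ∫ z, Ks K ε (g s - z) ∂ν) (𝓝[>] 0) (𝓝 p) ∧
      ∀ N, ‖N‖ = 1 → (∀ w, ⟪L w, N⟫ = 0) → ∃ J, ∀ a b, 0 < b → b < a → a < 1 →
      Tendsto (fun y => ∫ z, Ks K (b * ‖g s - y‖) (y - z) ∂ν) (𝓝[{y | a * ‖y - g s‖ < ⟪y - g s, N⟫}] (g s)) (𝓝 (p + J)) ∧
      Tendsto (fun y => ∫ z, Ks K (b * ‖g s - y‖) (y - z) ∂ν) (𝓝[{y | a * ‖y - g s‖ < ⟪y - g s, -N⟫}] (g s)) (𝓝 (p - J)) := by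
  filter_upwards [P5 hK hg ν, dec_ae hg ν] with s ⟨H, hH⟩ ⟨θ, ωp, ωm, D⟩ L hL
  obtain ⟨p, hp⟩ := pv_lim hK hg hL D hH
  refine ⟨p, hp, fun N n1 pp => ⟨θ * Ph K L N, fun a b hb hab ha => ?_⟩⟩
  have key : ∀ N, ‖N‖ = 1 → (∀ w, ⟪L w, N⟫ = 0) → Tendsto (fun y => ∫ z, Ks K (b * ‖g s - y‖) (y - z) ∂ν)
      (𝓝[{y | a * ‖y - g s‖ < ⟪y - g s, N⟫}] (g s)) (𝓝 (p + θ * Ph K L N)) := fun N n1 pp => by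
    have h : LN c L N := ⟨hg.cpos, L_lo hg hL, n1, pp⟩
    have t1 := cone_lim hK hg hL D h hb hab ha
    have hρ : Tendsto (fun y => ‖g s - y‖) (𝓝[{y | a * ‖y - g s‖ < ⟪y - g s, N⟫}] (g s)) (𝓝[>] 0) := by
      refine tendsto_nhdsWithin_iff.2 ⟨?_, ?_⟩
      · have : Continuous fun y => ‖g s - y‖ := by fun_prop
        have := (this.tendsto (g s)).mono_left (nhdsWithin_le_nhds (s := {y | a * ‖y - g s‖ < ⟪y - g s, N⟫}))
        rwa [sub_self, norm_zero] at this
      · filter_upwards [self_mem_nhdsWithin] with y hy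
        have hy : a * ‖y - g s‖ < ⟪y - g s, N⟫ := hy
        rw [mem_Ioi, norm_sub_rev]
        refine norm_pos_iff.2 fun h0 => ?_
        rw [h0] at hy; simp at hy
    refine ((hp.comp hρ).add t1).congr fun y => ?_
    simp only [Function.comp]; ring
  refine ⟨key N n1 pp, ?_⟩
  have := key (-N) (by rwa [norm_neg]) (fun w => by rw [inner_neg_right, pp, neg_zero])
  rwa [Ph_neg hK, mul_neg, ← sub_eq_add_neg] at this
end
end

section
section
variable {n : ℕ} {Λ δ : ℝ≥0} {f : EV n → EV (n+1)}

theorem sing_step {A : EV n →L[ℝ] EV (n+1)} {v : EV n} (hv : ‖v‖ = 1) (hA : A v = 0) (hA' : ‖A‖ ≤ Λ)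
    (h0 : 0 < δ) (h1 : δ ≤ 1) {s : Set (EV n)} (hf : ApproximatesLinearOn f A s δ) :
    μH[(n:ℝ)] (f '' s) ≤ ((Λ + 1 : ℝ≥0) : ℝ≥0∞) ^ (n:ℝ) * (δ * μH[(n:ℝ)] s) := by
  obtain ⟨φ, hφ⟩ : ∃ φ : Module.Dual ℝ (EV n), φ = ((δ:ℝ) - 1) • (innerSL ℝ v : EV n →L[ℝ] ℝ).toLinearMap := ⟨_, rfl⟩
  obtain ⟨T, hT⟩ : ∃ T, T = LinearMap.transvection φ v := ⟨_, rfl⟩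
  have hdet : LinearMap.det T = δ := by
    rw [hT, LinearMap.transvection.det, hφ]; simp [hv]
  have hTw : ∀ w, T w = w + (((δ:ℝ)-1) * ⟪v, w⟫) • v := by
    intro w; rw [hT, LinearMap.transvection.apply, hφ]; simp
  have d0 : (0:ℝ) < δ := h0
  have d1 : (δ:ℝ) ≤ 1 := h1
  have hlow : ∀ w, δ * ‖w‖ ≤ ‖T w‖ := by
    intro w
    refine abs_le_of_sq_le_sq' ?_ (norm_nonneg _) |>.2
    have hp : ⟪v, w⟫ ^ 2 ≤ ‖w‖ ^ 2 := by
      rw [sq_le_sq, abs_norm]; simpa [hv] using abs_real_inner_le_norm v w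
    have : ‖T w‖^2 = ‖w‖^2 + ((δ:ℝ)^2 - 1) * ⟪v, w⟫^2 := by
      rw [hTw, norm_add_sq_real, inner_smul_right, norm_smul, hv, mul_one, real_inner_comm, Real.norm_eq_abs, sq_abs]
      ring
    rw [this]; nlinarith [mul_nonneg (by nlinarith : (0:ℝ) ≤ 1 - (δ:ℝ)^2) (sub_nonneg.2 hp)]
  have hinj : Function.Injective T := by
    refine (injective_iff_map_eq_zero T).2 fun w hw => ?_
    have := hlow w; rw [hw, norm_zero] at this
    exact norm_eq_zero.1 (by nlinarith [norm_nonneg w])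
  have hlip : LipschitzOnWith (Λ+1) (f ∘ Function.invFun T) (T '' s) := by
    refine LipschitzOnWith.of_dist_le_mul ?_
    rintro _ ⟨x, hx, rfl⟩ _ ⟨y, hy, rfl⟩
    simp only [Function.comp, Function.leftInverse_invFun hinj _, dist_eq_norm, ← map_sub]
    have e1 := hf x hx y hy
    have e2 : A (x - y) = A (T (x-y)) := by rw [hTw]; simp [hA]
    have e3 := (A.le_opNorm (T (x-y))).trans (mul_le_mul_of_nonneg_right hA' (norm_nonneg _))
    have e4 := hlow (x-y)
    have e5 := norm_add_le (f x - f y - A (x-y)) (A (x-y))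
    rw [sub_add_cancel] at e5; rw [← e2] at e3
    push_cast; linarith
  have := hlip.hausdorffMeasure_image_le (d := n) (by positivity)
  rw [image_comp, ← image_comp (Function.invFun T), Function.invFun_comp hinj, image_id] at this
  rwa [Measure.addHaar_image_linearMap, hdet, abs_of_pos d0, ENNReal.ofReal_coe_nnreal] at this

theorem sing_null (hf : LipschitzWith Λ f) :
    μH[(n:ℝ)] (f '' {x | DifferentiableAt ℝ f x ∧ ∃ v, ‖v‖ = 1 ∧ fderiv ℝ f x v = 0}) = 0 := by
  obtain ⟨S, hS⟩ : ∃ S, S = {x | DifferentiableAt ℝ f x ∧ ∃ v, ‖v‖ = 1 ∧ fderiv ℝ f x v = 0} := ⟨_, rfl⟩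
  rw [← hS]
  have key : ∀ k : ℕ, μH[(n:ℝ)] (f '' (S ∩ ball 0 k)) = 0 := by
    intro k
    rcases (S ∩ ball 0 k).eq_empty_or_nonempty with he | hne
    · simp [he]
    obtain ⟨M, hM⟩ : ∃ M, M = ((Λ + 1 : ℝ≥0) : ℝ≥0∞) ^ (n:ℝ) := ⟨_, rfl⟩
    have hMt : M ≠ ∞ := by rw [hM]; exact ENNReal.rpow_ne_top_of_nonneg (by positivity) ENNReal.coe_ne_top
    have st : ∀ δ : ℝ≥0, 0 < δ → δ ≤ 1 → μH[(n:ℝ)] (f '' (S ∩ ball 0 k)) ≤ δ * (M * μH[(n:ℝ)] (ball (0:EV n) k)) := by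
      intro δ h0 h1
      obtain ⟨t, A, td, tm, ts, ta, ty⟩ := exists_partition_approximatesLinearOn_of_hasFDerivWithinAt f (S ∩ ball 0 k)
        (fderiv ℝ f) (fun x hx => by
          have : x ∈ S := hx.1
          rw [hS] at this; exact this.1.hasFDerivAt.hasFDerivWithinAt) (fun _ => δ) (fun _ => h0.ne')
      have hk : ∀ i, μH[(n:ℝ)] (f '' (S ∩ ball 0 k ∩ t i)) ≤ M * δ * (μH[(n:ℝ)].restrict (S ∩ ball 0 k)) (t i) := by
        intro i
        obtain ⟨y, hy, hAy⟩ := ty hne i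
        have hy1 : y ∈ S := hy.1
        rw [hS] at hy1
        obtain ⟨v, hv, hv0⟩ := hy1.2
        rw [Measure.restrict_apply (tm i), inter_comm (t i), hM, mul_assoc]
        exact sing_step hv (by rw [hAy, hv0]) (by rw [hAy]; exact norm_fderiv_le_of_lipschitz ℝ hf) h0 h1 (ta i)
      calc μH[(n:ℝ)] (f '' (S ∩ ball 0 k)) ≤ μH[(n:ℝ)] (⋃ i, f '' (S ∩ ball 0 k ∩ t i)) := by
            refine measure_mono ?_
            rw [← image_iUnion, ← inter_iUnion]; exact image_mono (subset_inter le_rfl ts)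
        _ ≤ ∑' i, M * δ * (μH[(n:ℝ)].restrict (S ∩ ball 0 k)) (t i) := (measure_iUnion_le _).trans (ENNReal.tsum_le_tsum hk)
        _ = M * δ * (μH[(n:ℝ)].restrict (S ∩ ball 0 k)) (⋃ i, t i) := by
            rw [ENNReal.tsum_mul_left, measure_iUnion td tm]
        _ ≤ M * δ * μH[(n:ℝ)] (ball (0:EV n) k) := by
            refine mul_le_mul' le_rfl ?_
            rw [Measure.restrict_apply (MeasurableSet.iUnion tm)]; exact measure_mono (inter_subset_right.trans inter_subset_right)
        _ = _ := by ring
    have hX : M * μH[(n:ℝ)] (ball (0:EV n) k) ≠ ∞ := ENNReal.mul_ne_top hMt measure_ball_lt_top.ne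
    have lim : Tendsto (fun δ : ℝ≥0 => (δ:ℝ≥0∞) * (M * μH[(n:ℝ)] (ball (0:EV n) k))) (𝓝[>] 0) (𝓝 0) := by
      have : Tendsto (fun δ : ℝ≥0 => (δ:ℝ≥0∞) * (M * μH[(n:ℝ)] (ball (0:EV n) k))) (𝓝 0) (𝓝 ((0:ℝ≥0) * (M * μH[(n:ℝ)] (ball (0:EV n) k)))) :=
        ENNReal.Tendsto.mul_const (ENNReal.tendsto_coe.2 tendsto_id) (Or.inr hX)
      simpa using this.mono_left nhdsWithin_le_nhds
    refine le_antisymm (ge_of_tendsto lim ?_) bot_le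
    filter_upwards [Ioc_mem_nhdsGT (zero_lt_one : (0:ℝ≥0) < 1)] with δ hδ using st δ hδ.1 hδ.2
  have : f '' S ⊆ ⋃ k : ℕ, f '' (S ∩ ball 0 k) := by
    rw [← image_iUnion, ← inter_iUnion, iUnion_ball_nat, inter_univ]
  exact measure_mono_null this (measure_iUnion_null key)

theorem cover (hf : LipschitzWith Λ f) : ∃ G : Set (EV n → EV (n+1)), G.Countable ∧ (∀ g ∈ G, ∃ c Λ, BLip c Λ g) ∧
    μH[(n:ℝ)] (range f \ ⋃ g ∈ G, range g) = 0 := by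
  classical
  obtain ⟨S, hS⟩ : ∃ S, S = {x | DifferentiableAt ℝ f x ∧ ∃ v, ‖v‖ = 1 ∧ fderiv ℝ f x v = 0} := ⟨_, rfl⟩
  obtain ⟨D, hD⟩ : ∃ D, D = {x | ¬ DifferentiableAt ℝ f x} := ⟨_, rfl⟩
  obtain ⟨I, hI⟩ : ∃ I, I = {x | DifferentiableAt ℝ f x ∧ ¬ ∃ v, ‖v‖ = 1 ∧ fderiv ℝ f x v = 0} := ⟨_, rfl⟩
  have nS : μH[(n:ℝ)] (f '' S) = 0 := by rw [hS]; exact sing_null hf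
  have nD : μH[(n:ℝ)] (f '' D) = 0 := by
    have h1 : μH[(n:ℝ)] D = 0 := by rw [hD]; exact ae_iff.1 (hf.ae_differentiableAt (μ := μH[(n:ℝ)]))
    have := hf.hausdorffMeasure_image_le (d := n) (by positivity) D
    rw [h1, mul_zero] at this; exact le_antisymm this bot_le
  obtain ⟨q, hq⟩ : ∃ q, q = lipschitzExtensionConstant (EV (n+1)) := ⟨_, rfl⟩
  have hr : ∀ A : EV n →L[ℝ] EV (n+1), ∃ r : ℝ≥0, r ≠ 0 ∧ ((∀ v, ‖v‖ = 1 → A v ≠ 0) →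
      ∃ c : ℝ, 0 < c ∧ (∀ w, c * ‖w‖ ≤ ‖A w‖) ∧ q * r ≤ c / 2) := by
    intro A
    by_cases hA : ∀ v, ‖v‖ = 1 → A v ≠ 0
    · obtain ⟨k, k0, hk⟩ := LinearMap.exists_antilipschitzWith (A : EV n →ₗ[ℝ] EV (n+1)) (by
        refine (Submodule.eq_bot_iff _).2 fun w hw => ?_
        by_contra h
        refine hA (‖w‖⁻¹ • w) (norm_smul_inv_norm h) ?_
        have : A w = 0 := hw
        rw [map_smul, this, smul_zero])
      have k0' : (0:ℝ) < k := k0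
      refine ⟨k⁻¹ / (2 * (q + 1)), by positivity, fun _ => ⟨(k:ℝ)⁻¹, by positivity, fun w => ?_, ?_⟩⟩
      · have := hk.le_mul_dist w 0
        rw [map_zero, dist_zero_right, dist_zero_right] at this
        rw [inv_mul_le_iff₀ k0']; exact this
      · push_cast
        rw [mul_div_assoc', div_le_div_iff₀ (by positivity) (by norm_num)]
        have : (0:ℝ) ≤ (k:ℝ)⁻¹ := by positivity
        nlinarith
    · exact ⟨1, one_ne_zero, fun h => absurd h hA⟩
  choose r r0 hr using hr
  obtain ⟨t, A, -, -, ts, ta, ty⟩ := exists_partition_approximatesLinearOn_of_hasFDerivWithinAt f I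
    (fderiv ℝ f) (fun x hx => by rw [hI] at hx; exact hx.1.hasFDerivAt.hasFDerivWithinAt) r r0
  have hg : I.Nonempty → ∀ i, ∃ g : EV n → EV (n+1), (∃ c Λ, BLip c Λ g) ∧ EqOn f g (I ∩ t i) := by
    intro hne i
    obtain ⟨y, hy, hAy⟩ := ty hne i
    rw [hI] at hy
    obtain ⟨c, c0, hc, hcr⟩ := hr (A i) (fun v hv h => hy.2 ⟨v, hv, by rw [← hAy, h]⟩)
    obtain ⟨u, hu, he⟩ := (ta i).lipschitzOnWith.extend_finite_dimension
    rw [← hq] at hu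
    have hu' : ∀ x y, ‖u x - u y‖ ≤ c / 2 * ‖x - y‖ := fun x y => by
      have := hu.dist_le_mul x y
      rw [dist_eq_norm, dist_eq_norm] at this; push_cast at this
      exact this.trans (mul_le_mul_of_nonneg_right hcr (norm_nonneg _))
    have e : ∀ x y, (A i x + u x) - (A i y + u y) = A i (x - y) + (u x - u y) := fun x y => by rw [map_sub]; abel
    refine ⟨fun x => A i x + u x, ⟨c / 2, ‖A i‖ + c, by positivity, by positivity, fun x y => ?_, fun x y => ?_⟩, fun x hx => ?_⟩
    · rw [e]
      have := norm_sub_norm_le (A i (x-y)) (-(u x - u y))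
      rw [norm_neg, sub_neg_eq_add] at this
      linarith [hc (x-y), hu' x y]
    · rw [e]
      have := norm_add_le (A i (x-y)) (u x - u y)
      nlinarith [(A i).le_opNorm (x-y), hu' x y, norm_nonneg (x-y)]
    · have := he hx
      simp only [Pi.sub_apply] at this
      simp only [← this]; abel
  have hz : ∀ U : Set (EV (n+1)), f '' I ⊆ U → μH[(n:ℝ)] (range f \ U) = 0 := fun U hU => by
    refine measure_mono_null (t := f '' S ∪ f '' D) ?_ (measure_union_null nS nD)
    rintro _ ⟨⟨x, rfl⟩, hx⟩
    by_cases h1 : DifferentiableAt ℝ f x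
    · by_cases h2 : ∃ v, ‖v‖ = 1 ∧ fderiv ℝ f x v = 0
      · exact Or.inl ⟨x, by rw [hS]; exact ⟨h1, h2⟩, rfl⟩
      · exact absurd (hU ⟨x, by rw [hI]; exact ⟨h1, h2⟩, rfl⟩) hx
    · exact Or.inr ⟨x, by rw [hD]; exact h1, rfl⟩
  rcases I.eq_empty_or_nonempty with hi | hi
  · exact ⟨∅, countable_empty, by simp, hz _ (by simp [hi])⟩
  · choose g hg hgE using hg hi
    refine ⟨range g, countable_range g, by rintro _ ⟨i, rfl⟩; exact hg i, hz _ ?_⟩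
    rintro _ ⟨x, hx, rfl⟩
    obtain ⟨i, hi⟩ := mem_iUnion.1 (ts hx)
    rw [biUnion_range]
    exact mem_iUnion.2 ⟨i, x, (hgE i ⟨hx, hi⟩).symm⟩
end
end

section
section
variable {m : ℕ} {c Λ : ℝ} {g : EV (m+1) → EV (m+2)} {L : EV (m+1) →L[ℝ] EV (m+2)} {s : EV (m+1)}

set_option maxHeartbeats 1600000 in
theorem normal_lem (hg : BLip c Λ g) (hL : HasFDerivAt g L s) {E' : Set (EV (m+2))} (hD : Den s (g ⁻¹' E')) {u : EV (m+2)}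
    (hu : HasApproxTangentNormal (m+1) E' (g s) u) (w : EV (m+1)) : ⟪L w, u⟫ = 0 := by
  by_contra hne
  obtain ⟨ℓ, hℓ⟩ : ∃ ℓ, ℓ = ⟪L w, u⟫ := ⟨_, rfl⟩
  rw [← hℓ] at hne
  have l0 : 0 < |ℓ| := abs_pos.2 hne
  have lL : |ℓ| ≤ ‖L w‖ := by rw [hℓ]; simpa [hu.1] using abs_real_inner_le_norm (L w) u
  obtain ⟨R, hR⟩ : ∃ R, R = ‖w‖ + 1 := ⟨_, rfl⟩
  have R0 : 0 < R := by rw [hR]; positivity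
  obtain ⟨M, hM⟩ : ∃ M, M = ‖L w‖ + |ℓ| := ⟨_, rfl⟩
  have M0 : 0 < M := by rw [hM]; positivity
  obtain ⟨δ, hδ⟩ : ∃ δ, δ = min 1 (|ℓ| / (8 * (‖L‖ + 1))) := ⟨_, rfl⟩
  have d0 : 0 < δ := by rw [hδ]; positivity
  have d1 : δ ≤ 1 := by rw [hδ]; exact min_le_left _ _
  have dL : ‖L‖ * δ ≤ |ℓ| / 8 := by
    have : δ ≤ |ℓ| / (8 * (‖L‖ + 1)) := by rw [hδ]; exact min_le_right _ _
    rw [le_div_iff₀ (by positivity)] at this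
    nlinarith
  obtain ⟨r1, r10, h1⟩ := deriv_bd hL (κ := |ℓ| / (8 * R)) (by positivity)
  have v0 := vb_pos m
  obtain ⟨A, hA⟩ : ∃ A, A = vb m * δ ^ (m+1) / 2 := ⟨_, rfl⟩
  have A0 : 0 < A := by rw [hA]; positivity
  obtain ⟨r2, r20, h2⟩ := hD (A / R ^ (m+1)) (by positivity)
  obtain ⟨F, hF⟩ : ∃ F : ℝ → ℝ≥0∞, F = fun r => μH[((m+1:ℕ):ℝ)] (E' ∩ (cone (|ℓ| / (2 * M)) (g s) u ∪ cone (|ℓ| / (2 * M)) (g s) (-u)) ∩ ball (g s) r) := ⟨_, rfl⟩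
  have hT := hu.2 (|ℓ| / (2 * M)) ⟨by positivity, by rw [div_lt_one (by positivity)]; linarith⟩
  obtain ⟨h, hh⟩ : ∃ h : ℝ≥0, (volume : Measure (EV (m+1))) = h • μH[((m+1:ℕ):ℝ)] := ⟨_, Measure.isAddLeftInvariant_eq_smul _ _⟩
  have c0 := hg.cpos
  have anti : AntilipschitzWith (c⁻¹).toNNReal g := AntilipschitzWith.of_le_mul_dist fun x y => by
    rw [dist_eq_norm, dist_eq_norm, Real.coe_toNNReal _ (by positivity), ← div_eq_inv_mul, le_div_iff₀ c0, mul_comm]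
    exact hg.lo x y
  obtain ⟨B, hB⟩ : ∃ B : ℝ≥0∞, B = h * ((c⁻¹).toNNReal : ℝ≥0∞) ^ (((m+1:ℕ)):ℝ) := ⟨_, rfl⟩
  have Bt : B ≠ ∞ := by
    rw [hB]; exact ENNReal.mul_ne_top ENNReal.coe_ne_top (ENNReal.rpow_ne_top_of_nonneg (by positivity) ENNReal.coe_ne_top)
  have key : ∀ r, 0 < r → R * r ≤ r1 → R * r ≤ r2 → ENNReal.ofReal (A * r ^ (m+1)) ≤ B * F (M * r) := by
    intro r r0 hr1 hr2
    obtain ⟨Q, hQ⟩ : ∃ Q, Q = ball (s + r • w) (δ * r) := ⟨_, rfl⟩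
    have nQ : ∀ t ∈ Q, ‖t - s - r • w‖ < δ * r := fun t ht => by
      rw [hQ, mem_ball, dist_eq_norm, ← sub_sub] at ht; exact ht
    have sQ : Q ⊆ ball s (R * r) := fun t ht => by
      rw [mem_ball, dist_eq_norm]
      have e1 := norm_add_le (t - s - r • w) (r • w)
      rw [sub_add_cancel, norm_smul, Real.norm_of_nonneg r0.le] at e1
      have := nQ t ht; rw [hR]; nlinarith
    have im : g '' (Q ∩ g ⁻¹' E') ⊆ E' ∩ (cone (|ℓ| / (2 * M)) (g s) u ∪ cone (|ℓ| / (2 * M)) (g s) (-u)) ∩ ball (g s) (M * r) := by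
      rintro _ ⟨t, ⟨ht, htE⟩, rfl⟩
      have e1 := h1 (R * r) ⟨by positivity, hr1⟩ t (sQ ht)
      have e2 : |ℓ| / (8 * R) * (R * r) = |ℓ| / 8 * r := by field_simp
      have e3 := (L.le_opNorm (t - s - r • w)).trans (mul_le_mul_of_nonneg_left (nQ t ht).le (norm_nonneg _))
      have e4 : g t - g s = r • L w + ((g t - g s - L (t - s)) + L (t - s - r • w)) := by
        simp only [map_sub, map_smul]; abel
      obtain ⟨e, he⟩ : ∃ e, e = (g t - g s - L (t - s)) + L (t - s - r • w) := ⟨_, rfl⟩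
      rw [← he] at e4
      have e5 : ‖e‖ ≤ |ℓ| / 4 * r := by
        rw [he]; refine (norm_add_le _ _).trans ?_
        rw [e2] at e1; nlinarith
      have e6 : ‖g t - g s‖ < M * r := by
        rw [e4]; refine (norm_add_le _ _).trans_lt ?_
        rw [norm_smul, Real.norm_of_nonneg r0.le, hM]; nlinarith [mul_pos l0 r0]
      have e7 : ⟪g t - g s, u⟫ = r * ℓ + ⟪e, u⟫ := by rw [e4, inner_add_left, real_inner_smul_left, hℓ]
      have e8 : |⟪e, u⟫| ≤ |ℓ| / 4 * r := (abs_real_inner_le_norm e u).trans (by rw [hu.1, mul_one]; exact e5)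
      have e9 : |ℓ| / (2 * M) * ‖g t - g s‖ < |ℓ| / 2 * r := by
        calc _ < |ℓ| / (2 * M) * (M * r) := mul_lt_mul_of_pos_left e6 (by positivity)
          _ = _ := by field_simp
      have := abs_le.1 e8
      refine ⟨⟨htE, ?_⟩, by rw [mem_ball, dist_eq_norm]; exact e6⟩
      rcases lt_or_gt_of_ne hne with hn | hp
      · right
        change _ < ⟪g t - g s, -u⟫
        rw [inner_neg_right, e7]; rw [abs_of_neg hn] at *; nlinarith
      · left
        change _ < ⟪g t - g s, u⟫
        rw [e7]; rw [abs_of_pos hp] at *; nlinarith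
    have b1 : volume (Q ∩ g ⁻¹' E') ≤ B * F (M * r) := by
      rw [hh, Measure.smul_apply, ENNReal.smul_def, smul_eq_mul, hB, mul_assoc, hF]
      gcongr
      exact (anti.le_hausdorffMeasure_image (by positivity) _).trans (mul_le_mul' le_rfl (measure_mono im))
    refine le_trans ?_ b1
    have b2 : volume Q = ENNReal.ofReal (A * r ^ (m+1)) + ENNReal.ofReal (A * r ^ (m+1)) := by
      rw [hQ, vol_ball _ (by positivity), ← ENNReal.ofReal_add (by positivity) (by positivity), hA, mul_pow]; congr 1; ring
    have b3 : volume (Q \ g ⁻¹' E') ≤ ENNReal.ofReal (A * r ^ (m+1)) := by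
      refine (measure_mono (sdiff_subset_sdiff_left sQ)).trans ((h2 (R * r) ⟨by positivity, hr2⟩).trans (le_of_eq ?_))
      congr 1; rw [mul_pow]; field_simp
    have b4 : volume Q ≤ volume (Q ∩ g ⁻¹' E') + volume (Q \ g ⁻¹' E') := measure_le_inter_add_sdiff _ _ _
    rw [b2] at b4
    exact (ENNReal.add_le_add_iff_right ENNReal.ofReal_ne_top).1 (b4.trans (add_le_add le_rfl b3))
  have hT2 : Tendsto (fun r => B * (F (M * r) / ENNReal.ofReal ((M * r) ^ (m+1)))) (𝓝[>] 0) (𝓝 (B * 0)) := by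
    refine ENNReal.Tendsto.const_mul ?_ (Or.inr Bt)
    have : Tendsto (fun r => M * r) (𝓝[>] 0) (𝓝[>] 0) := by
      refine tendsto_nhdsWithin_iff.2 ⟨?_, ?_⟩
      · exact (by simpa using (continuous_const_mul M).tendsto (0:ℝ) : Tendsto (fun r => M * r) (𝓝 0) (𝓝 0)).mono_left nhdsWithin_le_nhds
      · filter_upwards [self_mem_nhdsWithin] with r hr
        exact mul_pos M0 hr
    rw [hF]; exact hT.comp this
  rw [mul_zero] at hT2
  have : ENNReal.ofReal (A / M ^ (m+1)) ≤ 0 := by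
    refine ge_of_tendsto hT2 ?_
    filter_upwards [Ioc_mem_nhdsGT (show 0 < min (r1 / R) (r2 / R) by positivity)] with r hr
    have k := key r hr.1 (by have := hr.2.trans (min_le_left _ _); rwa [le_div_iff₀' R0] at this)
      (by have := hr.2.trans (min_le_right _ _); rwa [le_div_iff₀' R0] at this)
    have rp : 0 < r := hr.1
    rw [← mul_div_assoc, ENNReal.le_div_iff_mul_le (Or.inl (by simp; positivity)) (Or.inl ENNReal.ofReal_ne_top), ← ENNReal.ofReal_mul (by positivity)]
    convert k using 2
    rw [mul_pow]; field_simp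
  exact absurd this (by simp; positivity)
end
end

section
variable {m : ℕ} {C c Λ : ℝ} {K : EV (m+2) → ℝ} {g : EV (m+1) → EV (m+2)}

theorem hatn_congr {E E' : Set (EV (m+2))} (h : (μH[((m+1:ℕ):ℝ)]).restrict E' = (μH[((m+1:ℕ):ℝ)]).restrict E) {x u : EV (m+2)}
    (hu : HasApproxTangentNormal (m+1) E x u) : HasApproxTangentNormal (m+1) E' x u := by
  refine ⟨hu.1, fun a ha => ?_⟩
  have mc : ∀ v : EV (m+2), MeasurableSet (cone a x v) := fun v =>
    (isOpen_lt (by fun_prop) (by fun_prop) : IsOpen {y | a * ‖y - x‖ < ⟪y - x, v⟫}).measurableSet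
  convert hu.2 a ha using 3 with r
  have mS := ((mc u).union (mc (-u))).inter (measurableSet_ball (x := x) (ε := r))
  rw [inter_assoc, inter_assoc, inter_comm, inter_comm E, ← Measure.restrict_apply mS, h, Measure.restrict_apply mS]

theorem BLip.null (hg : BLip c Λ g) {Z : Set (EV (m+1))} (hZ : volume Z = 0) : μH[((m+1:ℕ):ℝ)] (g '' Z) = 0 := by
  have hl : LipschitzWith Λ.toNNReal g := LipschitzWith.of_dist_le_mul fun x y => by
    rw [dist_eq_norm, dist_eq_norm, Real.coe_toNNReal _ hg.Lpos.le]; exact hg.hi x y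
  have := hl.hausdorffMeasure_image_le (d := ((m+1:ℕ):ℝ)) (by positivity) Z
  rw [Measure.isAddLeftInvariant_eq_smul (μH[((m+1:ℕ):ℝ)] : Measure (EV (m+1))) volume, Measure.smul_apply, hZ, smul_zero, mul_zero] at this
  exact le_antisymm this bot_le

theorem BLip.closed (hg : BLip c Λ g) : MeasurableSet (range g) := by
  have c0 := hg.cpos
  have anti : AntilipschitzWith (c⁻¹).toNNReal g := AntilipschitzWith.of_le_mul_dist fun x y => by
    rw [dist_eq_norm, dist_eq_norm, Real.coe_toNNReal _ (by positivity), ← div_eq_inv_mul, le_div_iff₀ c0, mul_comm]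
    exact hg.lo x y
  have hl : LipschitzWith Λ.toNNReal g := LipschitzWith.of_dist_le_mul fun x y => by
    rw [dist_eq_norm, dist_eq_norm, Real.coe_toNNReal _ hg.Lpos.le]; exact hg.hi x y
  exact (anti.isClosed_range hl.uniformContinuous).measurableSet

theorem chart (hK : CZ m C K) (hg : BLip c Λ g) {E E' : Set (EV (m+2))} (mE : MeasurableSet E')
    (h : (μH[((m+1:ℕ):ℝ)]).restrict E' = (μH[((m+1:ℕ):ℝ)]).restrict E) (ν : SignedMeasure (EV (m+2)))
    {a b : ℝ} (ha : a ∈ Ioo 0 1) (hb : b ∈ Ioo 0 a) (N : EV (m+2) → EV (m+2)) :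
    ∀ᵐ x ∂(μH[((m+1:ℕ):ℝ)]).restrict E', x ∈ range g → HasApproxTangentNormal (m+1) E x (N x) → ∃ Tp Tm Tpv : ℝ,
      Tendsto (fun y => Teps K ν (b * dist x y) y) (𝓝[cone a x (N x)] x) (𝓝 Tp) ∧
      Tendsto (fun y => Teps K ν (b * dist x y) y) (𝓝[cone a x (-N x)] x) (𝓝 Tm) ∧
      Tendsto (fun ε => Teps K ν ε x) (𝓝[>] (0 : ℝ)) (𝓝 Tpv) ∧
      (Tp + Tm) / 2 = Tpv := by
  have all := ((PF hK hg ν.toJordanDecomposition.posPart).and (PF hK hg ν.toJordanDecomposition.negPart)).and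
    (hg.diff.and (den_ae (hg.cont.measurable mE)))
  rw [ae_restrict_iff' mE]
  refine measure_mono_null ?_ (hg.null (ae_iff.1 all))
  intro x hx
  have hx : ¬ _ := hx
  by_contra hxZ
  refine hx ?_
  rintro hxE ⟨s, rfl⟩ hT
  have hs := by_contra fun hs => hxZ ⟨s, hs, rfl⟩
  obtain ⟨⟨h1, h2⟩, hd, hD⟩ := hs
  have nl := normal_lem hg hd.hasFDerivAt (hD hxE) (hatn_congr h hT)
  obtain ⟨p1, t1, J1⟩ := h1 _ hd.hasFDerivAt
  obtain ⟨p2, t2, J2⟩ := h2 _ hd.hasFDerivAt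
  obtain ⟨J1, j1⟩ := J1 _ hT.1 nl
  obtain ⟨J2, j2⟩ := J2 _ hT.1 nl
  have j1 := j1 a b hb.1 hb.2 ha.2
  have j2 := j2 a b hb.1 hb.2 ha.2
  have e : ∀ ε y, Teps K ν ε y = ∫ z, Ks K ε (y - z) ∂ν.toJordanDecomposition.posPart
      - ∫ z, Ks K ε (y - z) ∂ν.toJordanDecomposition.negPart := fun ε y => by
    simp only [Teps, sintegral, Ks, dist_eq_norm]
  simp only [e, dist_eq_norm]
  exact ⟨_, _, _, j1.1.sub j2.1, j1.2.sub j2.2, t1.sub t2, by ring⟩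
end

theorem jump_formula_sum
    (n : ℕ) (hn : 1 ≤ n)
    (K Ω : EuclideanSpace ℝ (Fin (n + 1)) → ℝ) (C : ℝ)
    (hΩhom : ∀ x : EuclideanSpace ℝ (Fin (n + 1)), x ≠ 0 → ∀ t : ℝ, 0 < t → Ω (t • x) = Ω x)
    (hKform : ∀ x : EuclideanSpace ℝ (Fin (n + 1)), x ≠ 0 → K x = Ω x / ‖x‖ ^ n)
    (hKodd : ∀ x : EuclideanSpace ℝ (Fin (n + 1)), K (-x) = -K x)
    (hKsmooth : ContDiffOn ℝ 2 K {(0 : EuclideanSpace ℝ (Fin (n + 1)))}ᶜ)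
    (hKbound : ∀ j ≤ 2, ∀ x : EuclideanSpace ℝ (Fin (n + 1)), x ≠ 0 →
      ‖iteratedFDerivWithin ℝ j K {(0 : EuclideanSpace ℝ (Fin (n + 1)))}ᶜ x‖ ≤ C / ‖x‖ ^ (n + j))
    (E : Set (EuclideanSpace ℝ (Fin (n + 1)))) (hE : Rectifiable n E)
    (hEloc : ∀ x : EuclideanSpace ℝ (Fin (n + 1)), ∃ r > 0, μH[n] (E ∩ ball x r) < ∞)
    (ν : MeasureTheory.SignedMeasure (EuclideanSpace ℝ (Fin (n + 1))))
    (a b : ℝ) (ha : a ∈ Set.Ioo (0 : ℝ) 1) (hb : b ∈ Set.Ioo 0 a)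
    (N : EuclideanSpace ℝ (Fin (n + 1)) → EuclideanSpace ℝ (Fin (n + 1)))
    (hNmeas : Measurable N)
    (hN : ∀ᵐ x ∂(μH[n].restrict E), HasApproxTangentNormal n E x (N x)) :
    ∀ᵐ x ∂(μH[n].restrict E), ∃ Tp Tm Tpv : ℝ,
      Tendsto (fun y => Teps K ν (b * dist x y) y) (𝓝[cone a x (N x)] x) (𝓝 Tp) ∧
      Tendsto (fun y => Teps K ν (b * dist x y) y) (𝓝[cone a x (-N x)] x) (𝓝 Tm) ∧
      Tendsto (fun ε => Teps K ν ε x) (𝓝[>] (0 : ℝ)) (𝓝 Tpv) ∧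
      (Tp + Tm) / 2 = Tpv := by
  obtain ⟨m, rfl⟩ : ∃ m, n = m + 1 := ⟨n - 1, by omega⟩
  obtain ⟨C1, h1⟩ := K_RB hKsmooth hKbound
  obtain ⟨C2, h2⟩ := Kt_RB h1
  have K0 : K 0 = 0 := by have := hKodd 0; rw [neg_zero] at this; linarith
  have hK : CZ m (max C1 C2) K := by
    refine ⟨h1.mono (le_max_left _ _), fun η hη R hR => (h2 η hη R hR).mono (le_max_right _ _), hKodd,
      hKsmooth.continuousOn, fun x t ht => ?_⟩
    rcases eq_or_ne x 0 with rfl | hx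
    · rw [smul_zero, K0, mul_zero]
    · rw [hKform _ (smul_ne_zero ht.ne' hx), hKform _ hx, hΩhom x hx t ht, norm_smul, Real.norm_of_nonneg ht.le, mul_pow]
      field_simp
  choose ρ ρ0 hρ using hEloc
  obtain ⟨T, hTc, hTu⟩ := TopologicalSpace.isOpen_iUnion_countable (fun x => ball x (ρ x)) fun _ => isOpen_ball
  have hTu' : ⋃ x ∈ T, ball x (ρ x) = univ := by
    rw [hTu]; exact eq_univ_of_forall fun x => mem_iUnion.2 ⟨x, mem_ball_self (ρ0 x)⟩
  have hTn : T.Nonempty := by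
    rcases T.eq_empty_or_nonempty with h | h
    · exact absurd (mem_univ (0 : EV (m+2))) (by rw [← hTu', h]; simp)
    · exact h
  obtain ⟨q, hq⟩ := hTc.exists_eq_range hTn
  have hR : (μH[((m+1:ℕ):ℝ)]).restrict (toMeasurable μH[((m+1:ℕ):ℝ)] E) = (μH[((m+1:ℕ):ℝ)]).restrict E :=
    Measure.restrict_toMeasurable_of_cover (v := fun k => ball (q k) (ρ (q k)))
      (by rw [← biUnion_range (f := q) (g := fun x => ball x (ρ x)), ← hq, hTu']; exact subset_univ _) fun k => (hρ (q k)).ne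
  obtain ⟨f, hf, hf0⟩ := hE
  choose Λ hf using hf
  choose G Gc Gb G0 using fun k => cover (hf k)
  obtain ⟨H, hH⟩ : ∃ H, H = ⋃ k, G k := ⟨_, rfl⟩
  have Hc : H.Countable := by rw [hH]; exact countable_iUnion Gc
  have Hb : ∀ g ∈ H, ∃ c Λ, BLip c Λ g := by rw [hH]; intro g hg; obtain ⟨k, hk⟩ := mem_iUnion.1 hg; exact Gb k g hk
  have mU : MeasurableSet (⋃ g ∈ H, range g) := MeasurableSet.biUnion Hc fun g hg => by
    obtain ⟨c, Λ, h⟩ := Hb g hg; exact h.closed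
  have hU : ∀ᵐ x ∂(μH[((m+1:ℕ):ℝ)]).restrict E, x ∈ ⋃ g ∈ H, range g := by
    refine (ae_restrict_iff mU).2 (measure_mono_null ?_ (measure_union_null hf0 (measure_iUnion_null G0)))
    intro x hx
    have hx : ¬ (x ∈ E → _) := hx
    rw [Classical.not_imp] at hx
    by_cases hxf : x ∈ ⋃ k, range (f k)
    · obtain ⟨k, hk⟩ := mem_iUnion.1 hxf
      refine Or.inr (mem_iUnion.2 ⟨k, hk, fun h => hx.2 ?_⟩)
      refine biUnion_subset_biUnion_left ?_ h
      rw [hH]; exact subset_iUnion G k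
    · exact Or.inl ⟨hx.1, hxf⟩
  have hc : ∀ᵐ x ∂(μH[((m+1:ℕ):ℝ)]).restrict E, ∀ g ∈ H, x ∈ range g → _ := (ae_ball_iff Hc).2 fun g hg => by
    obtain ⟨c, Λ, h⟩ := Hb g hg
    rw [← hR]
    exact chart hK h (measurableSet_toMeasurable _ _) hR ν ha hb N
  filter_upwards [hN, hU, hc] with x h1 h2 h3
  obtain ⟨g, hg, hx⟩ := mem_iUnion₂.1 h2
  exact h3 g hg hx h1
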